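/- Let 2 < α ≤ 3 and let u ∈ C^∞(S²) be a solution of −Δu + α = e^{2u} on S². If there exists a point p ∈ S² such that ∇u(p) = 0 and the Hessian D²u(p) has two equal eigenvalues (i.e. p is an umbilical critical point of u), then u is axially symmetric with respect to p. -/

import Mathlib

open MeasureTheory Real
open scoped RealInnerProductSpace ContDiff

noncomputable section

abbrev E3 : Type := EuclideanSpace ℝ (Fin 3)

/-- The unit sphere `S²` as a subset of `ℝ³`. -/
def S2 : Set E3 := Metric.sphere 0 1

/-- The Euclidean Laplacian of `u : ℝ³ → ℝ`.  For a `0`-homogeneous function it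
coincides on `S²` with the Laplace–Beltrami operator of the round metric applied
to the restriction of `u` to `S²`. -/
def lap (u : E3 → ℝ) (x : E3) : ℝ :=
  ∑ i : Fin 3, iteratedFDeriv ℝ 2 u x ![EuclideanSpace.single i 1, EuclideanSpace.single i 1]

/-- `u : ℝ³ → ℝ` is positively homogeneous of degree `0`, i.e. it is the radial
extension of a function on `S²`. -/
def Hom0 (u : E3 → ℝ) : Prop := ∀ (x : E3) (r : ℝ), 0 < r → u (r • x) = u x

/-- `u` represents a smooth solution of the mean field equation `-Δ_{S²} u + α = e^{2u}`
on `S²`, encoded through its degree-zero homogeneous extension to `ℝ³ \ {0}`. -/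
def MFE (u : E3 → ℝ) (α : ℝ) : Prop :=
  ContDiffOn ℝ ∞ u {(0 : E3)}ᶜ ∧ Hom0 u ∧
    ∀ x ∈ S2, -lap u x + α = Real.exp (2 * u x)

/-- Reflection of `ℝ³` across the plane `{x · y = 0}`. -/
def Refl (y x : E3) : E3 := x - (2 * ⟪x, y⟫) • y

/-- The closed half-sphere `H_y`. -/
def halfSphere (y : E3) : Set E3 := {x ∈ S2 | 0 ≤ ⟪x, y⟫}

/-- The great circle `C_y`. -/
def circleOf (y : E3) : Set E3 := {x ∈ S2 | ⟪x, y⟫ = 0}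

/-- `u` is axially symmetric with respect to `p`: on the sphere it depends only on `x · p`. -/
def AxiallySymmetric (u : E3 → ℝ) (p : E3) : Prop :=
  ∀ x ∈ S2, ∀ y ∈ S2, ⟪x, p⟫ = ⟪y, p⟫ → u x = u y

/-- `p` is an umbilical critical point of `u` (viewed as a function on `S²`):
the (intrinsic) gradient vanishes and the Hessian, as a quadratic form on the
tangent plane `p^⊥`, is a multiple of the metric. -/
def UmbilicalCritical (u : E3 → ℝ) (p : E3) : Prop :=
  fderiv ℝ u p = 0 ∧
    ∃ c : ℝ, ∀ v : E3, ⟪v, p⟫ = 0 → iteratedFDeriv ℝ 2 u p ![v, v] = c * ‖v‖ ^ 2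

/-- `z` is an eigenvector of the Hessian `D²u(q)` viewed as a symmetric bilinear
form on the tangent plane `q^⊥`. -/
def HessEigen (u : E3 → ℝ) (q z : E3) : Prop :=
  ∃ lam : ℝ, ∀ v : E3, ⟪v, q⟫ = 0 → iteratedFDeriv ℝ 2 u q ![z, v] = lam * ⟪z, v⟫

/-- Cross product on `ℝ³`. -/
def cross (a b : E3) : E3 :=
  (WithLp.equiv 2 (Fin 3 → ℝ)).symm
    (crossProduct ((WithLp.equiv 2 (Fin 3 → ℝ)) a) ((WithLp.equiv 2 (Fin 3 → ℝ)) b))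

/-- `Ω` is a nodal domain of `w` on the sphere: a connected component of
`S² \ w⁻¹(0)` (in the subspace topology of `S²`). -/
def IsNodalDomain (w : E3 → ℝ) (Ω : Set E3) : Prop :=
  ∃ x ∈ S2, w x ≠ 0 ∧ Ω = connectedComponentIn {z ∈ S2 | w z ≠ 0} x

end

section PlaneCalculus

open Topology Filter Set

variable {F : Type*} [NormedAddCommGroup F] [NormedSpace ℝ F]

/-- Directional derivative of a function on the plane. -/
noncomputable def dir (e : ℂ) (f : ℂ → F) (z : ℂ) : F := fderiv ℝ f z e

/-- The flat Laplacian on the plane. -/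
noncomputable def flatLap (f : ℂ → F) (z : ℂ) : F :=
  dir 1 (dir 1 f) z + dir Complex.I (dir Complex.I f) z

/-- The gradient of a function on the plane, as a complex number. -/
noncomputable def gr (f : ℂ → ℝ) (z : ℂ) : ℂ := ⟨dir 1 f z, dir Complex.I f z⟩

theorem ContDiff.dir {f : ℂ → F} (hf : ContDiff ℝ ∞ f) (e : ℂ) : ContDiff ℝ ∞ (dir e f) :=
  (hf.fderiv_right (m := ∞) (by simp)).clm_apply contDiff_const

theorem ContDiff.flatLap {f : ℂ → F} (hf : ContDiff ℝ ∞ f) : ContDiff ℝ ∞ (flatLap f) :=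
  ((hf.dir 1).dir 1).add ((hf.dir _).dir _)

theorem ContDiff.diffAt {f : ℂ → F} (hf : ContDiff ℝ ∞ f) (z : ℂ) : DifferentiableAt ℝ f z :=
  (hf.differentiable (by simp)).differentiableAt

theorem ContDiff.gr {f : ℂ → ℝ} (hf : ContDiff ℝ ∞ f) : ContDiff ℝ ∞ (gr f) := by
  have : _root_.gr f = fun z =>
      ((_root_.dir 1 f z : ℝ) : ℂ) + ((_root_.dir Complex.I f z : ℝ) : ℂ) * Complex.I := by
    ext z; exact Complex.mk_eq_add_mul_I _ _
  rw [this]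
  exact (Complex.ofRealCLM.contDiff.comp (hf.dir 1)).add
    ((Complex.ofRealCLM.contDiff.comp (hf.dir Complex.I)).mul contDiff_const)

theorem dir_add {f g : ℂ → F} (e z : ℂ) (hf : DifferentiableAt ℝ f z)
    (hg : DifferentiableAt ℝ g z) : dir e (fun x => f x + g x) z = dir e f z + dir e g z := by
  have := (hf.hasFDerivAt.add hg.hasFDerivAt).fderiv
  simp only [dir]
  erw [this]; rfl

theorem dir_sub {f g : ℂ → F} (e z : ℂ) (hf : DifferentiableAt ℝ f z)
    (hg : DifferentiableAt ℝ g z) : dir e (fun x => f x - g x) z = dir e f z - dir e g z := by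
  have := (hf.hasFDerivAt.sub hg.hasFDerivAt).fderiv
  simp only [dir]
  erw [this]; rfl

theorem dir_neg {f : ℂ → F} (e z : ℂ) : dir e (fun x => -f x) z = - dir e f z := by
  simp only [dir]
  erw [fderiv_fun_neg]; rfl

theorem dir_const (c : F) (e z : ℂ) : dir e (fun _ => c) z = 0 := by
  simp [dir]

theorem dir_mul {A : Type*} [NormedCommRing A] [NormedAlgebra ℝ A] {f g : ℂ → A} (e z : ℂ)
    (hf : DifferentiableAt ℝ f z) (hg : DifferentiableAt ℝ g z) :
    dir e (fun x => f x * g x) z = dir e f z * g z + f z * dir e g z := by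
  simp only [dir]
  rw [fderiv_fun_mul hf hg]
  simp [smul_eq_mul]; ring

theorem dir_comp {j : ℝ → ℝ} {f : ℂ → ℝ} (e z : ℂ) (hj : DifferentiableAt ℝ j (f z))
    (hf : DifferentiableAt ℝ f z) : dir e (fun x => j (f x)) z = deriv j (f z) * dir e f z := by
  have := (hj.hasDerivAt.comp_hasFDerivAt z hf.hasFDerivAt).fderiv
  simp only [dir]
  erw [this]; simp

theorem dir_congr {f g : ℂ → F} {z : ℂ} (h : f =ᶠ[𝓝 z] g) (e : ℂ) : dir e f z = dir e g z := by
  simp only [dir, h.fderiv_eq]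

theorem dir_congr_nhds {f g : ℂ → F} {z : ℂ} (h : f =ᶠ[𝓝 z] g) (e : ℂ) :
    dir e f =ᶠ[𝓝 z] dir e g := by
  filter_upwards [h.eventuallyEq_nhds] with x hx using dir_congr hx e

theorem flatLap_congr {f g : ℂ → F} {z : ℂ} (h : f =ᶠ[𝓝 z] g) : flatLap f z = flatLap g z := by
  simp only [flatLap, dir_congr (dir_congr_nhds h _) _]

theorem gr_congr {f g : ℂ → ℝ} {z : ℂ} (h : f =ᶠ[𝓝 z] g) : gr f z = gr g z := by
  simp only [gr, dir_congr h]

theorem dir_dir {f : ℂ → F} (hf : ContDiff ℝ ∞ f) (e e' z : ℂ) :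
    dir e (dir e' f) z = fderiv ℝ (fderiv ℝ f) z e e' := by
  have hd : DifferentiableAt ℝ (fderiv ℝ f) z :=
    (hf.fderiv_right (m := ∞) (by simp)).differentiable (by simp) z
  have := (hd.hasFDerivAt.clm_apply (hasFDerivAt_const e' z)).fderiv
  simp only [dir]
  erw [this]
  simp

theorem dir_comm {f : ℂ → F} (hf : ContDiff ℝ ∞ f) (e e' z : ℂ) :
    dir e (dir e' f) z = dir e' (dir e f) z := by
  rw [dir_dir hf, dir_dir hf]
  exact (hf.contDiffAt.isSymmSndFDerivAt (by simpa using ENat.LEInfty.out)).eq e e'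

theorem flatLap_eq_laplacian {f : ℂ → F} (hf : ContDiff ℝ ∞ f) :
    flatLap f = Laplacian.laplacian f := by
  rw [InnerProductSpace.laplacian_eq_iteratedFDeriv_complexPlane]
  ext z
  simp [flatLap, dir_dir hf, iteratedFDeriv_two_apply]

theorem dir_eq_gr (f : ℂ → ℝ) (z e : ℂ) : dir e f z = e.re * (gr f z).re + e.im * (gr f z).im := by
  simp only [dir, gr]
  conv_lhs => rw [show e = e.re • (1:ℂ) + e.im • Complex.I by
    simp [Complex.re_add_im]]
  rw [map_add, map_smul, map_smul]; simp

theorem hasCompactSupport_dir {f : ℂ → F} (hf : HasCompactSupport f) (e : ℂ) :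
    HasCompactSupport (dir e f) :=
  hf.fderiv_apply ℝ e

theorem hasCompactSupport_flatLap {f : ℂ → F} (hf : HasCompactSupport f) :
    HasCompactSupport (flatLap f) :=
  (hasCompactSupport_dir (hasCompactSupport_dir hf 1) 1).add
    (hasCompactSupport_dir (hasCompactSupport_dir hf _) _)

theorem hasCompactSupport_gr {f : ℂ → ℝ} (hf : HasCompactSupport f) :
    HasCompactSupport (gr f) := by
  refine HasCompactSupport.of_support_subset_isCompact hf ?_
  intro z hz
  by_contra h
  apply hz
  have : f =ᶠ[𝓝 z] fun _ => 0 := notMem_tsupport_iff_eventuallyEq.mp h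
  rw [gr_congr this]
  simp only [gr, dir_const]; rfl

theorem integral_mul_dir {A : Type*} [RCLike A] {f g : ℂ → A}
    (hf : ContDiff ℝ ∞ f) (hg : ContDiff ℝ ∞ g) (h : HasCompactSupport f ∨ HasCompactSupport g)
    (e : ℂ) : ∫ z, f z * dir e g z = - ∫ z, dir e f z * g z := by
  have hInt : ∀ a b : ℂ → A, ContDiff ℝ ∞ a → ContDiff ℝ ∞ b →
      (HasCompactSupport a ∨ HasCompactSupport b) → Integrable (fun z => a z * b z) := by
    intro a b ha hb hab
    apply Continuous.integrable_of_hasCompactSupport (ha.continuous.mul hb.continuous)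
    rcases hab with hab | hab
    · exact hab.mul_right
    · exact hab.mul_left
  apply integral_mul_fderiv_eq_neg_fderiv_mul_of_integrable
  · exact hInt _ _ (hf.dir e) hg (h.imp (hasCompactSupport_dir · e) id)
  · exact hInt _ _ hf (hg.dir e) (h.imp id (hasCompactSupport_dir · e))
  · exact hInt _ _ hf hg h
  · exact fun x _ => hf.diffAt x
  · exact fun x _ => hg.diffAt x

theorem integrable_mul_of_hasCompactSupport {A : Type*} [NormedRing A] {a b : ℂ → A}
    (ha : Continuous a) (hb : Continuous b)
    (h : HasCompactSupport a ∨ HasCompactSupport b) : Integrable (fun z => a z * b z) := by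
  apply Continuous.integrable_of_hasCompactSupport (ha.mul hb)
  rcases h with hab | hab
  · exact hab.mul_right
  · exact hab.mul_left

/-- Green's first identity. -/
theorem integral_mul_flatLap {f g : ℂ → ℝ} (hf : ContDiff ℝ ∞ f) (hg : ContDiff ℝ ∞ g)
    (h : HasCompactSupport f ∨ HasCompactSupport g) :
    ∫ z, f z * flatLap g z =
      - ∫ z, ((gr f z).re * (gr g z).re + (gr f z).im * (gr g z).im) := by
  have h' : ∀ e, HasCompactSupport (dir e f) ∨ HasCompactSupport (dir e g) := fun e =>
    h.imp (hasCompactSupport_dir · e) (hasCompactSupport_dir · e)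
  have h'' : ∀ e, HasCompactSupport f ∨ HasCompactSupport (dir e g) := fun e =>
    h.imp id (hasCompactSupport_dir · e)
  have h''' : ∀ e, HasCompactSupport f ∨ HasCompactSupport (dir e (dir e g)) := fun e =>
    h.imp id fun h => hasCompactSupport_dir (hasCompactSupport_dir h e) e
  simp only [flatLap, mul_add, gr]
  rw [integral_add
      (integrable_mul_of_hasCompactSupport hf.continuous ((hg.dir _).dir _).continuous (h''' _))
      (integrable_mul_of_hasCompactSupport hf.continuous ((hg.dir _).dir _).continuous (h''' _)),
    integral_add
      (integrable_mul_of_hasCompactSupport (hf.dir _).continuous (hg.dir _).continuous (h' _))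
      (integrable_mul_of_hasCompactSupport (hf.dir _).continuous (hg.dir _).continuous (h' _)),
    integral_mul_dir hf (hg.dir _) (h'' _), integral_mul_dir hf (hg.dir _) (h'' _)]
  ring

/-- Green's second identity. -/
theorem integral_mul_flatLap_comm {f g : ℂ → ℝ} (hf : ContDiff ℝ ∞ f) (hg : ContDiff ℝ ∞ g)
    (h : HasCompactSupport f ∨ HasCompactSupport g) :
    ∫ z, f z * flatLap g z = ∫ z, flatLap f z * g z := by
  rw [integral_mul_flatLap hf hg h]
  simp_rw [mul_comm (flatLap f _)]
  rw [integral_mul_flatLap hg hf h.symm]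
  simp_rw [mul_comm]

theorem flatLap_add {f g : ℂ → F} (hf : ContDiff ℝ ∞ f) (hg : ContDiff ℝ ∞ g) (z : ℂ) :
    flatLap (fun x => f x + g x) z = flatLap f z + flatLap g z := by
  have h : ∀ e, dir e (fun x => f x + g x) = fun x => dir e f x + dir e g x := fun e =>
    funext fun x => dir_add e x (hf.diffAt x) (hg.diffAt x)
  simp only [flatLap, h]
  rw [dir_add _ _ ((hf.dir _).diffAt z) ((hg.dir _).diffAt z),
    dir_add _ _ ((hf.dir _).diffAt z) ((hg.dir _).diffAt z)]
  abel

theorem flatLap_neg {f : ℂ → F} (z : ℂ) :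
    flatLap (fun x => -f x) z = - flatLap f z := by
  have h : ∀ e, dir e (fun x => -f x) = fun x => -dir e f x := fun e =>
    funext fun x => dir_neg e x
  simp only [flatLap, h, dir_neg]
  abel

theorem flatLap_sub {f g : ℂ → F} (hf : ContDiff ℝ ∞ f) (hg : ContDiff ℝ ∞ g) (z : ℂ) :
    flatLap (fun x => f x - g x) z = flatLap f z - flatLap g z := by
  simp only [sub_eq_add_neg]
  rw [flatLap_add hf hg.neg, flatLap_neg]

theorem flatLap_comp {j : ℝ → ℝ} {f : ℂ → ℝ} (hj : ContDiff ℝ ∞ j) (hf : ContDiff ℝ ∞ f) (z : ℂ) :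
    flatLap (fun x => j (f x)) z =
      deriv (deriv j) (f z) * Complex.normSq (gr f z) + deriv j (f z) * flatLap f z := by
  have hj' : ContDiff ℝ ∞ (deriv j) := hj.deriv'
  have h : ∀ e, dir e (fun x => j (f x)) = fun x => deriv j (f x) * dir e f x := fun e =>
    funext fun x => dir_comp e x (hj.differentiable (by simp) _) (hf.diffAt x)
  have h2 : ∀ e, dir e (fun x => deriv j (f x) * dir e f x) z =
      deriv (deriv j) (f z) * dir e f z * dir e f z + deriv j (f z) * dir e (dir e f) z := by
    intro e
    rw [dir_mul (f := fun x => deriv j (f x)) e z ((hj'.comp hf).diffAt z) ((hf.dir e).diffAt z),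
      dir_comp e z (hj'.differentiable (by simp) _) (hf.diffAt z)]
  simp only [flatLap, h, h2, gr, Complex.normSq_mk]
  ring

theorem gr_comp {j : ℝ → ℝ} {f : ℂ → ℝ} (z : ℂ) (hj : DifferentiableAt ℝ j (f z))
    (hf : DifferentiableAt ℝ f z) : gr (fun x => j (f x)) z = ((deriv j (f z) : ℝ) : ℂ) * gr f z := by
  apply Complex.ext <;> simp [gr, dir_comp _ z hj hf]

theorem gr_sub {f g : ℂ → ℝ} (z : ℂ) (hf : DifferentiableAt ℝ f z)
    (hg : DifferentiableAt ℝ g z) : gr (fun x => f x - g x) z = gr f z - gr g z := by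
  apply Complex.ext <;> simp [gr, dir_sub _ z hf hg]

/-- Cutting off a smooth function at the boundary of an open set containing its support. -/
theorem contDiff_indicator {Ω K : Set ℂ} (hΩ : IsOpen Ω) (hK : IsClosed K) (hKΩ : K ⊆ Ω)
    {g : ℂ → F} (hg : ContDiff ℝ ∞ g) (h0 : ∀ x ∈ Ω, x ∉ K → g x = 0) :
    ContDiff ℝ ∞ (Ω.indicator g) := by
  rw [contDiff_iff_contDiffAt]
  intro x
  by_cases hx : x ∈ Ω
  · apply hg.contDiffAt.congr_of_eventuallyEq
    filter_upwards [hΩ.mem_nhds hx] with y hy using indicator_of_mem hy g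
  · have hxK : x ∉ K := fun h => hx (hKΩ h)
    apply (contDiffAt_const (c := (0:F))).congr_of_eventuallyEq
    filter_upwards [hK.isOpen_compl.mem_nhds hxK] with y hy
    by_cases hyΩ : y ∈ Ω
    · rw [indicator_of_mem hyΩ, h0 y hyΩ hy]
    · exact indicator_of_notMem hyΩ g

theorem dir_indicator {Ω K : Set ℂ} (hΩ : IsOpen Ω) (hK : IsClosed K) (hKΩ : K ⊆ Ω)
    {g : ℂ → F} (h0 : ∀ x ∈ Ω, x ∉ K → g x = 0) (e : ℂ) :
    dir e (Ω.indicator g) = Ω.indicator (dir e g) := by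
  ext x
  by_cases hx : x ∈ Ω
  · rw [indicator_of_mem hx]
    apply dir_congr
    filter_upwards [hΩ.mem_nhds hx] with y hy using indicator_of_mem hy g
  · have hxK : x ∉ K := fun h => hx (hKΩ h)
    rw [indicator_of_notMem hx, ← dir_const (0:F) e x]
    apply dir_congr
    filter_upwards [hK.isOpen_compl.mem_nhds hxK] with y hy
    by_cases hyΩ : y ∈ Ω
    · rw [indicator_of_mem hyΩ, h0 y hyΩ hy]
    · exact indicator_of_notMem hyΩ g

end PlaneCalculus

theorem hasCompactSupport_indicator {F : Type*} [Zero F] {Ω K : Set ℂ} (hK : IsCompact K)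
    {g : ℂ → F} (h0 : ∀ x ∈ Ω, x ∉ K → g x = 0) : HasCompactSupport (Ω.indicator g) := by
  apply HasCompactSupport.intro hK
  intro x hx
  by_cases hxΩ : x ∈ Ω
  · rw [Set.indicator_of_mem hxΩ, h0 x hxΩ hx]
  · exact Set.indicator_of_notMem hxΩ g

section Wirtinger

open Topology Filter Set ComplexConjugate

/-- The Wirtinger derivative `∂f/∂z`. -/
noncomputable def dz (f : ℂ → ℂ) (z : ℂ) : ℂ := (dir 1 f z - Complex.I * dir Complex.I f z) / 2

/-- `f` is real differentiable at `z` with Wirtinger derivative `d`. -/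
def HasDz (f : ℂ → ℂ) (d z : ℂ) : Prop := DifferentiableAt ℝ f z ∧ dz f z = d

theorem HasDz.mul {f g : ℂ → ℂ} {a b z : ℂ} (hf : HasDz f a z) (hg : HasDz g b z) :
    HasDz (fun x => f x * g x) (a * g z + f z * b) z := by
  refine ⟨hf.1.fun_mul hg.1, ?_⟩
  rw [← hf.2, ← hg.2]
  simp only [dz, dir_mul _ _ hf.1 hg.1]
  ring

theorem HasDz.add {f g : ℂ → ℂ} {a b z : ℂ} (hf : HasDz f a z) (hg : HasDz g b z) :
    HasDz (fun x => f x + g x) (a + b) z := by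
  refine ⟨hf.1.fun_add hg.1, ?_⟩
  rw [← hf.2, ← hg.2]
  simp only [dz, dir_add _ _ hf.1 hg.1]
  ring

theorem hasDz_const (c z : ℂ) : HasDz (fun _ => c) 0 z :=
  ⟨differentiableAt_const c, by simp [dz, dir_const]⟩

/-- Chain rule for a real-differentiable function after a holomorphic one. -/
theorem HasDz.comp {k H : ℂ → ℂ} {d h z : ℂ} (hk : HasDz k d (H z)) (hH : HasDerivAt H h z) :
    HasDz (fun x => k (H x)) (d * h) z := by
  have hHr : HasFDerivAt H ((ContinuousLinearMap.smulRight (1 : ℂ →L[ℂ] ℂ) h).restrictScalars ℝ) z :=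
    hH.hasFDerivAt.restrictScalars ℝ
  have hc := hk.1.hasFDerivAt.comp z hHr
  refine ⟨hc.differentiableAt, ?_⟩
  rw [← hk.2]
  have e1 : ∀ e, dir e (fun x => k (H x)) z = dir (e * h) k (H z) := by
    intro e
    simp only [dir]
    erw [hc.fderiv]
    simp
  have e2 : ∀ e : ℂ, dir e k (H z) = e.re * dir 1 k (H z) + e.im * dir Complex.I k (H z) := by
    intro e
    simp only [dir]
    conv_lhs => rw [show e = e.re • (1:ℂ) + e.im • Complex.I by simp [Complex.re_add_im]]
    rw [map_add, map_smul, map_smul]; simp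
  simp only [dz, e1]
  rw [e2, e2 (Complex.I * h)]
  simp
  conv_rhs => rw [← Complex.re_add_im h]
  ring_nf
  simp only [Complex.I_sq]
  ring

theorem hasDz_of_hasDerivAt {H : ℂ → ℂ} {h z : ℂ} (hH : HasDerivAt H h z) : HasDz H h z := by
  have := HasDz.comp (k := fun x => x) (d := 1) (H := H) (h := h) (z := z)
    ⟨differentiableAt_id, by simp [dz, dir]⟩ hH
  simpa using this

theorem hasDz_conj {H : ℂ → ℂ} {h z : ℂ} (hH : HasDerivAt H h z) :
    HasDz (fun x => conj (H x)) 0 z := by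
  have := HasDz.comp (k := fun x => conj x) (d := 0) (H := H) (h := h) (z := z)
    ⟨Complex.conjCLE.differentiableAt, by
      have : ∀ e w : ℂ, dir e (fun x : ℂ => conj x) w = conj e := by
        intro e w
        simp only [dir]
        erw [Complex.conjCLE.hasFDerivAt.fderiv]; rfl
      simp [dz, this]⟩ hH
  simpa using this

theorem HasDz.inv {f : ℂ → ℂ} {a z : ℂ} (hf : HasDz f a z) (h0 : f z ≠ 0) :
    HasDz (fun x => (f x)⁻¹) (-a / (f z) ^ 2) z := by
  have hd := hf.1.fun_inv h0
  refine ⟨hd, ?_⟩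
  have h1 := HasDz.mul hf ⟨hd, rfl⟩
  have h2 : HasDz (fun x => f x * (f x)⁻¹) 0 z := by
    have he : (fun x => f x * (f x)⁻¹) =ᶠ[𝓝 z] fun _ => 1 := by
      filter_upwards [hf.1.continuousAt.eventually_ne h0] with x hx using mul_inv_cancel₀ hx
    refine ⟨h1.1, ?_⟩
    simp only [dz, dir_congr he, dir_const]; simp
  have h3 := h1.2.symm.trans h2.2
  field_simp
  field_simp at h3
  linear_combination h3

theorem integral_mul_dz {f g : ℂ → ℂ} (hf : ContDiff ℝ ∞ f) (hg : ContDiff ℝ ∞ g)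
    (h : HasCompactSupport f ∨ HasCompactSupport g) :
    ∫ z, f z * dz g z = - ∫ z, dz f z * g z := by
  have i1 : ∀ e, Integrable (fun z => f z * dir e g z) := fun e =>
    integrable_mul_of_hasCompactSupport hf.continuous (hg.dir e).continuous
      (h.imp id (hasCompactSupport_dir · e))
  have i2 : ∀ e, Integrable (fun z => dir e f z * g z) := fun e =>
    integrable_mul_of_hasCompactSupport (hf.dir e).continuous hg.continuous
      (h.imp (hasCompactSupport_dir · e) id)
  have e1 : ∀ z, f z * dz g z =
      (1 / 2) * (f z * dir 1 g z) - (Complex.I / 2) * (f z * dir Complex.I g z) := by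
    intro z; simp only [dz]; ring
  have e2 : ∀ z, dz f z * g z =
      (1 / 2) * (dir 1 f z * g z) - (Complex.I / 2) * (dir Complex.I f z * g z) := by
    intro z; simp only [dz]; ring
  simp only [e1, e2]
  rw [integral_sub ((i1 _).const_mul _) ((i1 _).const_mul _),
    integral_sub ((i2 _).const_mul _) ((i2 _).const_mul _)]
  simp only [integral_const_mul]
  rw [integral_mul_dir hf hg h, integral_mul_dir hf hg h]
  ring

theorem norm_dz_ofReal {f : ℂ → ℝ} (hf : ContDiff ℝ ∞ f) (z : ℂ) :
    ‖dz (fun x => (f x : ℂ)) z‖ = ‖gr f z‖ / 2 := by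
  have : ∀ e, dir e (fun x => (f x : ℂ)) z = ((dir e f z : ℝ) : ℂ) := by
    intro e
    have := (Complex.ofRealCLM.hasFDerivAt.comp z (hf.diffAt z).hasFDerivAt).fderiv
    simp only [dir]
    erw [this]; rfl
  have e : dz (fun x => (f x : ℂ)) z = conj (gr f z) / 2 := by
    simp only [dz, this]
    apply Complex.ext <;> simp [gr]
  rw [e]
  simp

end Wirtinger

section Kernel

open ComplexConjugate

/-- A smooth regularisation of `z / conj z`. -/
noncomputable def twistKer (c : ℝ) (z : ℂ) : ℂ := (z * z) * (z * conj z + (c : ℂ))⁻¹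

/-- The Wirtinger derivative of `twistKer`. -/
noncomputable def twistKer' (c : ℝ) (z : ℂ) : ℂ :=
  (z * (z * conj z + (2 * c : ℂ))) * ((z * conj z + (c : ℂ))⁻¹ * (z * conj z + (c : ℂ))⁻¹)

variable {c : ℝ}

theorem twistKer_denom_ne (hc : 0 < c) (z : ℂ) : z * conj z + (c : ℂ) ≠ 0 := by
  rw [Complex.mul_conj]
  have : 0 < Complex.normSq z + c := by have := Complex.normSq_nonneg z; linarith
  exact_mod_cast this.ne'

theorem hasDz_denom (c : ℝ) (z : ℂ) : HasDz (fun z => z * conj z + (c : ℂ)) (conj z) z := by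
  have h := (hasDz_of_hasDerivAt (hasDerivAt_id z)).mul (hasDz_conj (hasDerivAt_id z))
  have := h.add (hasDz_const (c : ℂ) z)
  simpa using this

theorem hasDz_twistKer (hc : 0 < c) (z : ℂ) : HasDz (twistKer c) (twistKer' c z) z := by
  have hid := hasDz_of_hasDerivAt (hasDerivAt_id z)
  have h : HasDz (twistKer c) _ z := (hid.mul hid).mul ((hasDz_denom c z).inv (twistKer_denom_ne hc z))
  convert h using 1
  have := twistKer_denom_ne hc z
  simp only [id, twistKer']
  field_simp
  ring

theorem hasDz_twistKer' (hc : 0 < c) (z : ℂ) :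
    HasDz (twistKer' c) ((2 * c ^ 2 / (Complex.normSq z + c) ^ 3 : ℝ) : ℂ) z := by
  have hid := hasDz_of_hasDerivAt (hasDerivAt_id z)
  have hi := (hasDz_denom c z).inv (twistKer_denom_ne hc z)
  have hd : HasDz (fun z => z * conj z + (2 * c : ℂ)) (conj z) z := by
    simpa using hasDz_denom (2 * c) z
  have h : HasDz (twistKer' c) _ z := (hid.mul hd).mul (hi.mul hi)
  convert h using 1
  have := twistKer_denom_ne hc z
  push_cast
  rw [← Complex.mul_conj]
  simp only [id]
  field_simp
  ring

theorem contDiff_conj : ContDiff ℝ ∞ (fun z : ℂ => conj z) := Complex.conjCLE.contDiff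

theorem contDiff_denom (c : ℝ) : ContDiff ℝ ∞ (fun z : ℂ => z * conj z + (c : ℂ)) :=
  (contDiff_id.mul contDiff_conj).add contDiff_const

theorem contDiff_twistKer (hc : 0 < c) : ContDiff ℝ ∞ (twistKer c) :=
  (contDiff_id.mul contDiff_id).mul ((contDiff_denom c).inv (twistKer_denom_ne hc))

theorem contDiff_twistKer' (hc : 0 < c) : ContDiff ℝ ∞ (twistKer' c) := by
  have hi := (contDiff_denom c).inv (twistKer_denom_ne hc)
  have hd : ContDiff ℝ ∞ (fun z : ℂ => z * conj z + (2 * c : ℂ)) := by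
    simpa using contDiff_denom (2 * c)
  exact (contDiff_id.mul hd).mul (hi.mul hi)

theorem norm_twistKer_le (hc : 0 < c) (z : ℂ) : ‖twistKer c z‖ ≤ 1 := by
  have hn := Complex.normSq_nonneg z
  have : 0 < Complex.normSq z + c := by linarith
  simp only [twistKer]
  rw [Complex.mul_conj, ← Complex.ofReal_add, norm_mul, norm_inv, norm_mul, Complex.norm_real,
    Real.norm_of_nonneg this.le, ← sq, ← Complex.normSq_eq_norm_sq, ← div_eq_mul_inv,
    div_le_one this]
  linarith

end Kernel

section WeightedSobolev

open ComplexConjugate Topology Filter Set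

/-- The value of the double integral whose diagonal concentration gives the weighted Sobolev
inequality. -/
theorem integral_twist_le {f : ℂ → ℝ} (hf : ContDiff ℝ ∞ f) (hfc : HasCompactSupport f)
    {G F : ℂ → ℂ} (hG : ∀ z, HasDerivAt G (F z) z) {c : ℝ} (hc : 0 < c) :
    ∫ x, ∫ y, f x * f y * Complex.normSq (F x) * Complex.normSq (F y) *
        (2 * c ^ 2 / (Complex.normSq (G x - G y) + c) ^ 3) ≤
      (∫ x, ‖gr f x‖ * ‖F x‖) ^ 2 / 4 := by
  have hGd : Differentiable ℂ G := fun z => (hG z).differentiableAt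
  have hFG : F = deriv G := funext fun z => (hG z).deriv.symm
  have hGs : ContDiff ℝ ∞ G := (hGd.contDiff (n := ∞)).restrict_scalars ℝ
  have hFd : Differentiable ℂ F := by
    have h2 : ContDiff ℂ ∞ (deriv G) := (hGd.contDiff (n := ∞)).deriv'
    rw [← hFG] at h2
    exact h2.differentiable (by simp)
  have hFs : ContDiff ℝ ∞ F := (hFd.contDiff (n := ∞)).restrict_scalars ℝ
  have hF' : ∀ z, HasDerivAt F (deriv F z) z := fun z => (hFd z).hasDerivAt
  have hcF : ContDiff ℝ ∞ (fun z => conj (F z)) := contDiff_conj.comp hFs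
  set φ : ℂ → ℂ := fun x => (f x : ℂ) with hφ
  have hφs : ContDiff ℝ ∞ φ := Complex.ofRealCLM.contDiff.comp hf
  have hφc : HasCompactSupport φ := hfc.comp_left (g := fun t : ℝ => (t : ℂ)) (by simp)
  have hdφs : ContDiff ℝ ∞ (dz φ) := by
    exact ((hφs.dir 1).sub (contDiff_const.mul (hφs.dir Complex.I))).div_const 2
  have hdφc : HasCompactSupport (dz φ) := by
    refine HasCompactSupport.of_support_subset_isCompact hφc ?_
    intro z hz
    by_contra h
    have he : φ =ᶠ[𝓝 z] fun _ => 0 := notMem_tsupport_iff_eventuallyEq.mp h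
    exact hz (by simp only [dz, dir_congr he, dir_const]; simp)
  -- the kernels
  set k : ℂ → ℂ → ℂ := fun x y => twistKer c (G x - G y) with hk
  set k' : ℂ → ℂ → ℂ := fun x y => twistKer' c (G x - G y) with hk'
  set K : ℂ → ℂ → ℝ := fun x y => 2 * c ^ 2 / (Complex.normSq (G x - G y) + c) ^ 3 with hK
  have step1 : ∀ y, ∫ x, (k x y * conj (F x)) * dz φ x =
      - ∫ x, (k' x y * F x * conj (F x)) * φ x := by
    intro y
    have hs : ContDiff ℝ ∞ fun x => k x y * conj (F x) :=
      ((contDiff_twistKer hc).comp (hGs.sub contDiff_const)).mul hcF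
    rw [integral_mul_dz hs hφs (Or.inr hφc)]
    congr 2
    ext x
    have h1 := ((hasDz_twistKer hc (G x - G y)).comp (H := fun x => G x - G y)
      ((hG x).sub_const _)).mul (hasDz_conj (hF' x))
    rw [h1.2]
    simp [hk']
  have step2 : ∀ x, ∫ y, (k' x y * conj (F y)) * dz φ y =
      ∫ y, ((K x y : ℂ) * F y * conj (F y)) * φ y := by
    intro x
    have hs : ContDiff ℝ ∞ fun y => k' x y * conj (F y) :=
      ((contDiff_twistKer' hc).comp (contDiff_const.sub hGs)).mul hcF
    rw [integral_mul_dz hs hφs (Or.inr hφc), ← integral_neg]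
    congr 1
    ext y
    have h1 := ((hasDz_twistKer' hc (G x - G y)).comp (H := fun y => G x - G y)
      ((hG y).const_sub _)).mul (hasDz_conj (hF' y))
    rw [h1.2]
    simp [hK]
  set I : ℂ := ∫ y, (∫ x, (k x y * conj (F x)) * dz φ x) * (conj (F y) * dz φ y) with hI
  set T : ℝ := ∫ x, ‖gr f x‖ * ‖F x‖ with hT
  have hT0 : 0 ≤ T := integral_nonneg fun x => by positivity
  have hnd : ∀ x, ‖conj (F x) * dz φ x‖ = ‖gr f x‖ * ‖F x‖ / 2 := by
    intro x
    rw [norm_mul, norm_dz_ofReal hf, RCLike.norm_conj]; ring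
  have hTint : Integrable fun x => ‖gr f x‖ * ‖F x‖ / 2 :=
    (integrable_mul_of_hasCompactSupport hf.gr.continuous.norm hFs.continuous.norm
      (Or.inl (hasCompactSupport_gr hfc).norm)).div_const 2
  have inner : ∀ y, ‖∫ x, (k x y * conj (F x)) * dz φ x‖ ≤ T / 2 := by
    intro y
    refine (norm_integral_le_of_norm_le hTint (ae_of_all _ fun x => ?_)).trans_eq
      (integral_div _ _)
    rw [mul_assoc, norm_mul, hnd]
    exact mul_le_of_le_one_left (by positivity) (norm_twistKer_le hc _)
  have hIle : ‖I‖ ≤ T ^ 2 / 4 := by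
    have h2 : Integrable fun y => T / 2 * (‖gr f y‖ * ‖F y‖ / 2) := hTint.const_mul _
    refine (norm_integral_le_of_norm_le h2 (ae_of_all _ fun y => ?_)).trans_eq ?_
    · rw [norm_mul, hnd]
      exact mul_le_mul_of_nonneg_right (inner y) (by positivity)
    · rw [integral_const_mul, integral_div]; ring
  have hIeq : I = - ((∫ x, ∫ y, f x * f y * Complex.normSq (F x) * Complex.normSq (F y) *
        K x y : ℝ) : ℂ) := by
    calc I = - ∫ y, ∫ x, ((k' x y * F x * conj (F x)) * φ x) * (conj (F y) * dz φ y) := by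
          rw [hI, ← integral_neg]
          congr 1; ext y
          rw [step1, integral_mul_const]; ring
      _ = - ∫ x, ∫ y, ((k' x y * F x * conj (F x)) * φ x) * (conj (F y) * dz φ y) := by
          rw [integral_integral_swap]
          apply Continuous.integrable_of_hasCompactSupport
          · have hc1 : Continuous fun p : ℂ × ℂ => k' p.2 p.1 :=
              (contDiff_twistKer' hc).continuous.comp
                ((hGs.continuous.comp continuous_snd).sub (hGs.continuous.comp continuous_fst))
            exact (((hc1.mul (hFs.continuous.comp continuous_snd)).mul
              (hcF.continuous.comp continuous_snd)).mul
              (hφs.continuous.comp continuous_snd)).mul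
              ((hcF.continuous.comp continuous_fst).mul (hdφs.continuous.comp continuous_fst))
          · apply HasCompactSupport.intro (hdφc.prod hφc)
            rintro ⟨y, x⟩ hyx
            simp only [mem_prod, not_and_or] at hyx
            rcases hyx with h | h
            · simp [Function.uncurry, image_eq_zero_of_notMem_tsupport h]
            · simp [Function.uncurry, image_eq_zero_of_notMem_tsupport h]
      _ = - ∫ x, ∫ y, ((f x * f y * Complex.normSq (F x) * Complex.normSq (F y) *
            K x y : ℝ) : ℂ) := by
          congr 2; ext x
          have : ∀ y, ((k' x y * F x * conj (F x)) * φ x) * (conj (F y) * dz φ y) =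
              (F x * conj (F x) * φ x) * ((k' x y * conj (F y)) * dz φ y) := fun y => by ring
          simp only [this]
          rw [integral_const_mul, step2, ← integral_const_mul]
          congr 1; ext y
          simp only [hφ]
          rw [Complex.mul_conj, mul_assoc (K x y : ℂ), Complex.mul_conj]
          push_cast; ring
      _ = _ := by
          congr 1
          rw [← integral_complex_ofReal]
          congr 1; ext x
          exact integral_complex_ofReal
  have : ‖I‖ = |∫ x, ∫ y, f x * f y * Complex.normSq (F x) * Complex.normSq (F y) * K x y| := by
    rw [hIeq, norm_neg, Complex.norm_real, Real.norm_eq_abs]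
  exact (le_abs_self _).trans (this ▸ hIle)

theorem integral_bubble {a : ℝ} (ha : 0 < a) :
    Integrable (fun η : ℂ => 2 / (a * Complex.normSq η + 1) ^ 3) ∧
    ∫ η : ℂ, 2 / (a * Complex.normSq η + 1) ^ 3 = π / a := by
  set g : ℝ → ℝ := fun r => 2 / (a * r ^ 2 + 1) ^ 3 with hg
  have he : ∀ η : ℂ, 2 / (a * Complex.normSq η + 1) ^ 3 = g ‖η‖ := by
    intro η; rw [Complex.normSq_eq_norm_sq]
  have hder : ∀ r ∈ Ici (0:ℝ), HasDerivAt (fun r => - (1 / (2 * a)) * ((a * r ^ 2 + 1) ^ 2)⁻¹)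
      (r * g r) r := by
    intro r _
    have hp : a * r ^ 2 + 1 ≠ 0 := by positivity
    have h := (((((hasDerivAt_id r).pow 2).const_mul a).add_const 1).pow 2).inv
      (pow_ne_zero 2 hp) |>.const_mul (-(1 / (2 * a)))
    refine h.congr_deriv ?_
    simp only [hg, id, Pi.pow_apply]
    field_simp
    ring
  have htend : Tendsto (fun r : ℝ => - (1 / (2 * a)) * ((a * r ^ 2 + 1) ^ 2)⁻¹) atTop (𝓝 0) := by
    rw [show (0:ℝ) = - (1 / (2 * a)) * 0 by simp]
    apply Tendsto.const_mul
    apply tendsto_inv_atTop_zero.comp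
    refine (tendsto_pow_atTop (by norm_num)).comp ?_
    exact tendsto_atTop_add_const_right _ _ ((tendsto_pow_atTop (by norm_num)).const_mul_atTop ha)
  have hpos : ∀ r ∈ Ioi (0:ℝ), 0 ≤ r * g r := by
    intro r hr
    have : (0:ℝ) < r := hr
    simp only [hg]; positivity
  have hI := integrableOn_Ioi_deriv_of_nonneg' hder hpos htend
  have hV := integral_Ioi_of_hasDerivAt_of_nonneg' hder hpos htend
  constructor
  · simp only [he]
    rw [integrable_fun_norm_addHaar (volume : Measure ℂ) (f := g)]
    simpa [Complex.finrank_real_complex] using hI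
  · simp only [he]
    rw [integral_fun_norm_addHaar (volume : Measure ℂ) g]
    simp only [Complex.finrank_real_complex, Nat.add_one_sub_one, pow_one, smul_eq_mul, hV]
    simp [measureReal_def, Complex.volume_ball]
    field_simp

/-- Sharp weighted Sobolev inequality on the plane, with weight the modulus of a nowhere vanishing
holomorphic function. -/
theorem weighted_sobolev_holomorphic {f : ℂ → ℝ} (hf : ContDiff ℝ ∞ f) (hfc : HasCompactSupport f)
    (hf0 : ∀ z, 0 ≤ f z) {G F : ℂ → ℂ} (hG : ∀ z, HasDerivAt G (F z) z) (hF0 : ∀ z, F z ≠ 0) :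
    4 * π * ∫ x, f x ^ 2 * Complex.normSq (F x) ≤ (∫ x, ‖gr f x‖ * ‖F x‖) ^ 2 := by
  have hGd : Differentiable ℂ G := fun z => (hG z).differentiableAt
  have hFG : F = deriv G := funext fun z => (hG z).deriv.symm
  have hFc : Continuous F := by
    have h2 : ContDiff ℂ ∞ (deriv G) := (hGd.contDiff (n := ∞)).deriv'
    rw [hFG]; exact h2.continuous
  have hGc : Continuous G := hGd.continuous
  have hn : Continuous fun z => Complex.normSq (F z) := Complex.continuous_normSq.comp hFc
  set T : ℝ := ∫ x, ‖gr f x‖ * ‖F x‖ with hT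
  set ε : ℕ → ℝ := fun n => 1 / ((n : ℝ) + 1) with hε
  have hε0 : ∀ n, 0 < ε n := fun n => by positivity
  set h : ℕ → ℂ × ℂ → ℝ := fun n p => f p.1 * f (p.1 + ε n • p.2) * Complex.normSq (F p.1) *
    Complex.normSq (F (p.1 + ε n • p.2)) *
      (2 / (Complex.normSq ((ε n)⁻¹ • (G (p.1 + ε n • p.2) - G p.1)) + 1) ^ 3) with hh
  have hpos : ∀ w : ℂ, 0 < Complex.normSq w + 1 := fun w => by
    have := Complex.normSq_nonneg w; linarith
  have hcont : ∀ n, Continuous (h n) := by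
    intro n
    have hc1 : Continuous fun p : ℂ × ℂ => p.1 + ε n • p.2 := by fun_prop
    refine ((((hf.continuous.comp continuous_fst).mul (hf.continuous.comp hc1)).mul
      (hn.comp continuous_fst)).mul (hn.comp hc1)).mul ?_
    refine continuous_const.div ?_ fun p => (pow_pos (hpos _) 3).ne'
    exact ((Complex.continuous_normSq.comp (((hGc.comp hc1).sub
      (hGc.comp continuous_fst)).const_smul (ε n)⁻¹)).add continuous_const).pow 3
  have hsupp : ∀ n, HasCompactSupport (h n) := by
    intro n
    obtain ⟨R, hR⟩ := (hfc : IsCompact (tsupport f)).isBounded.subset_closedBall (0:ℂ)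
    apply HasCompactSupport.intro
      ((isCompact_closedBall (0:ℂ) R).prod (isCompact_closedBall (0:ℂ) ((ε n)⁻¹ * (R + R))))
    rintro ⟨x, η⟩ hx
    by_contra hne
    apply hx
    have h1 : x ∈ tsupport f := by
      by_contra hc; exact hne (by simp [hh, image_eq_zero_of_notMem_tsupport hc])
    have h2 : x + ε n • η ∈ tsupport f := by
      by_contra hc; exact hne (by simp only [hh, image_eq_zero_of_notMem_tsupport hc]; simp)
    have h1' := hR h1
    have h2' := hR h2
    refine ⟨h1', ?_⟩
    simp only [mem_closedBall_zero_iff] at *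
    have h3 : ‖ε n • η‖ ≤ R + R := by
      calc ‖ε n • η‖ = ‖(x + ε n • η) - x‖ := by congr 1; ring
        _ ≤ _ := (norm_sub_le _ _).trans (add_le_add h2' h1')
    rw [norm_smul, Real.norm_of_nonneg (hε0 n).le] at h3
    rw [inv_mul_eq_div, le_div_iff₀' (hε0 n)]
    exact h3
  have hInt : ∀ n, Integrable (h n) := fun n => (hcont n).integrable_of_hasCompactSupport (hsupp n)
  have hnn : ∀ n p, 0 ≤ h n p := by
    intro n p
    have := hpos ((ε n)⁻¹ • (G (p.1 + ε n • p.2) - G p.1))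
    simp only [hh]
    exact mul_nonneg (mul_nonneg (mul_nonneg (mul_nonneg (hf0 _) (hf0 _))
      (Complex.normSq_nonneg _)) (Complex.normSq_nonneg _)) (by positivity)
  have hle : ∀ n, ∫ p, h n p ≤ T ^ 2 / 4 := by
    intro n
    refine le_trans (le_of_eq ?_)
      (integral_twist_le hf hfc hG (c := ε n ^ 2) (pow_pos (hε0 n) 2))
    rw [show (volume : Measure (ℂ × ℂ)) = (volume : Measure ℂ).prod volume from rfl,
      integral_prod _ (hInt n)]
    congr 1; ext x
    have key := Measure.integral_comp_smul (volume : Measure ℂ) (fun y => f x * f (x + y) *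
      Complex.normSq (F x) * Complex.normSq (F (x + y)) *
      (2 * (ε n ^ 2) ^ 2 / (Complex.normSq (G x - G (x + y)) + ε n ^ 2) ^ 3)) (ε n)
    rw [eq_comm, ← integral_add_left_eq_self _ x]
    rw [Complex.finrank_real_complex, abs_of_pos (by have := hε0 n; positivity), smul_eq_mul,
      eq_comm, inv_mul_eq_iff_eq_mul₀ (pow_pos (hε0 n) 2).ne'] at key
    rw [key, ← integral_const_mul]
    congr 1; ext η
    have hsq : Complex.normSq (G x - G (x + ε n • η)) =
        ε n ^ 2 * Complex.normSq ((ε n)⁻¹ • (G (x + ε n • η) - G x)) := by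
      rw [← Complex.normSq_neg, neg_sub, Complex.normSq_eq_norm_sq, Complex.normSq_eq_norm_sq,
        norm_smul, Real.norm_of_nonneg (inv_nonneg.2 (hε0 n).le), mul_pow, ← mul_assoc,
        ← mul_pow, mul_inv_cancel₀ (hε0 n).ne']
      simp
    have := hpos ((ε n)⁻¹ • (G (x + ε n • η) - G x))
    have h0 := hε0 n
    simp only [hh]
    rw [hsq]
    field_simp
  set g : ℂ × ℂ → ℝ := fun p => f p.1 ^ 2 * Complex.normSq (F p.1) ^ 2 *
    (2 / (Complex.normSq (F p.1) * Complex.normSq p.2 + 1) ^ 3) with hg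
  have hlim : ∀ p, Tendsto (fun n => h n p) atTop (𝓝 (g p)) := by
    rintro ⟨x, η⟩
    have hε1 : Tendsto ε atTop (𝓝 0) := tendsto_one_div_add_atTop_nhds_zero_nat
    have hε2 : Tendsto ε atTop (𝓝[≠] 0) := tendsto_nhdsWithin_iff.2
      ⟨hε1, Eventually.of_forall fun n => (hε0 n).ne'⟩
    have hy : Tendsto (fun n => x + ε n • η) atTop (𝓝 x) := by
      have := tendsto_const_nhds (x := x).add (hε1.smul_const η)
      simpa using this
    have hd : HasDerivAt (fun t : ℝ => G (x + t • η)) (F x * η) 0 := by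
      have h1 : HasDerivAt (fun t : ℝ => x + t • η) η 0 := by
        simpa using ((hasDerivAt_id (0:ℝ)).smul_const η).const_add x
      have h2 : HasDerivAt G (F (x + (0:ℝ) • η)) (x + (0:ℝ) • η) := hG _
      have h3 := HasDerivAt.comp_of_eq (0:ℝ) h2 h1 rfl
      simpa [Function.comp_def] using h3
    have hs := (hasDerivAt_iff_tendsto_slope_zero.1 hd).comp hε2
    simp only [Function.comp_def, zero_add, zero_smul, add_zero] at hs
    have e : g (x, η) = f x * f x * Complex.normSq (F x) * Complex.normSq (F x) *
        (2 / (Complex.normSq (F x * η) + 1) ^ 3) := by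
      simp only [hg, Complex.normSq_mul]; ring
    rw [e]
    refine Tendsto.mul (Tendsto.mul (Tendsto.mul (Tendsto.mul tendsto_const_nhds
      ((hf.continuous.tendsto x).comp hy)) tendsto_const_nhds) ((hn.tendsto x).comp hy)) ?_
    refine Tendsto.div tendsto_const_nhds ?_ (pow_pos (hpos _) 3).ne'
    exact (((Complex.continuous_normSq.tendsto _).comp hs).add_const 1).pow 3
  have fatou : ∫⁻ p, ENNReal.ofReal (g p) ≤ ENNReal.ofReal (T ^ 2 / 4) := by
    have h1 : ∀ p, liminf (fun n => ENNReal.ofReal (h n p)) atTop = ENNReal.ofReal (g p) := fun p =>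
      (ENNReal.tendsto_ofReal (hlim p)).liminf_eq
    calc ∫⁻ p, ENNReal.ofReal (g p)
        = ∫⁻ p, liminf (fun n => ENNReal.ofReal (h n p)) atTop := by simp only [h1]
      _ ≤ liminf (fun n => ∫⁻ p, ENNReal.ofReal (h n p)) atTop :=
          lintegral_liminf_le fun n => (hcont n).measurable.ennreal_ofReal
      _ ≤ ENNReal.ofReal (T ^ 2 / 4) := by
          refine liminf_le_of_le (by isBoundedDefault) fun b hb => ?_
          obtain ⟨n, hn⟩ := hb.exists
          refine hn.trans ?_
          rw [← ofReal_integral_eq_lintegral_ofReal (hInt n) (ae_of_all _ (hnn n))]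
          exact ENNReal.ofReal_le_ofReal (hle n)
  have inner : ∀ x, ∫⁻ η, ENNReal.ofReal (g (x, η)) =
      ENNReal.ofReal (π * (f x ^ 2 * Complex.normSq (F x))) := by
    intro x
    have ha : 0 < Complex.normSq (F x) := Complex.normSq_pos.2 (hF0 x)
    obtain ⟨b1, b2⟩ := integral_bubble ha
    rw [← ofReal_integral_eq_lintegral_ofReal]
    · simp only [hg]
      rw [integral_const_mul, b2]
      congr 1
      field_simp
    · exact b1.const_mul (f x ^ 2 * Complex.normSq (F x) ^ 2)
    · refine ae_of_all _ fun η => ?_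
      have := Complex.normSq_nonneg η
      simp only [hg, Pi.zero_apply]; positivity
  have hgc : Measurable g := measurable_of_tendsto_metrizable (fun n => (hcont n).measurable)
    (tendsto_pi_nhds.2 hlim)
  have hfin : Integrable fun x => π * (f x ^ 2 * Complex.normSq (F x)) := by
    apply Integrable.const_mul
    have hc : HasCompactSupport fun x => f x ^ 2 :=
      hfc.comp_left (g := fun t : ℝ => t ^ 2) (by simp)
    exact integrable_mul_of_hasCompactSupport (hf.continuous.pow 2) hn (Or.inl hc)
  rw [show (volume : Measure (ℂ × ℂ)) = (volume : Measure ℂ).prod volume from rfl,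
    lintegral_prod _ hgc.ennreal_ofReal.aemeasurable] at fatou
  simp only [inner] at fatou
  rw [← ofReal_integral_eq_lintegral_ofReal hfin (ae_of_all _ fun x => by
    have := Complex.normSq_nonneg (F x)
    simp only [Pi.zero_apply]; positivity),
    ENNReal.ofReal_le_ofReal_iff (by positivity), integral_const_mul] at fatou
  linarith

/-- Sharp weighted Sobolev inequality with weight `exp q`, `q` the real part of an entire
function. -/
theorem weighted_sobolev {f : ℂ → ℝ} (hf : ContDiff ℝ ∞ f) (hfc : HasCompactSupport f)
    (hf0 : ∀ z, 0 ≤ f z) {Q : ℂ → ℂ} (hQ : Differentiable ℂ Q) :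
    4 * π * ∫ x, f x ^ 2 * rexp (2 * (Q x).re) ≤ (∫ x, ‖gr f x‖ * rexp (Q x).re) ^ 2 := by
  obtain ⟨G, hG⟩ : ∃ G : ℂ → ℂ, ∀ z, HasDerivAt G (Complex.exp (Q z)) z := by
    have := (hQ.cexp).isExactOn_univ
    obtain ⟨G, hG⟩ := this
    exact ⟨G, fun z => hG z (mem_univ z)⟩
  have := weighted_sobolev_holomorphic hf hfc hf0 hG fun z => Complex.exp_ne_zero _
  simp only [Complex.norm_exp, Complex.normSq_eq_norm_sq, ← Real.exp_nat_mul] at this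
  exact_mod_cast this

end WeightedSobolev

section LogKernel

open Topology Filter Set

/-- A smooth convex function vanishing on the negative half line and with slope one after `1`. -/
theorem exists_smooth_ramp : ∃ j : ℝ → ℝ, ContDiff ℝ ∞ j ∧ (∀ s ≤ 0, j s = 0) ∧
    (∀ s, 0 ≤ deriv (deriv j) s) ∧ (∃ c, ∀ s, 1 ≤ s → j s = s + c) ∧
    (∀ s, 1 < s → deriv (deriv j) s = 0) ∧ ∃ s, 0 < s ∧ 0 < deriv (deriv j) s := by
  have hc : Continuous Real.smoothTransition := Real.smoothTransition.continuous
  set j : ℝ → ℝ := fun s => ∫ t in (0:ℝ)..s, Real.smoothTransition t with hj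
  have hd : ∀ s, HasDerivAt j (Real.smoothTransition s) s := fun s =>
    intervalIntegral.integral_hasDerivAt_right (hc.intervalIntegrable _ _)
      hc.stronglyMeasurable.stronglyMeasurableAtFilter hc.continuousAt
  have hd' : deriv j = Real.smoothTransition := funext fun s => (hd s).deriv
  refine ⟨j, ?_, ?_, ?_, ?_, ?_, ?_⟩
  · rw [contDiff_infty_iff_deriv]
    exact ⟨fun s => (hd s).differentiableAt, hd' ▸ Real.smoothTransition.contDiff⟩
  · intro s hs
    have : ∫ t in (0:ℝ)..s, Real.smoothTransition t = ∫ t in (0:ℝ)..s, (0:ℝ) := by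
      apply intervalIntegral.integral_congr
      intro t ht
      rw [uIcc_of_ge hs] at ht
      exact Real.smoothTransition.zero_of_nonpos ht.2
    simp only [hj, this]; simp
  · rw [hd']
    intro s
    exact Real.smoothTransition.monotone.deriv_nonneg
  · refine ⟨j 1 - 1, fun s hs => ?_⟩
    have h1 : ∫ t in (1:ℝ)..s, Real.smoothTransition t = ∫ t in (1:ℝ)..s, (1:ℝ) := by
      apply intervalIntegral.integral_congr
      intro t ht
      rw [uIcc_of_le hs] at ht
      exact Real.smoothTransition.one_of_one_le ht.1
    have h2 := intervalIntegral.integral_add_adjacent_intervals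
      (hc.intervalIntegrable (μ := volume) 0 1) (hc.intervalIntegrable 1 s)
    rw [h1] at h2
    simp only [hj, ← h2]; simp; ring
  · intro s hs
    rw [hd']
    have : Real.smoothTransition =ᶠ[𝓝 s] fun _ => 1 := by
      filter_upwards [lt_mem_nhds hs] with t ht using Real.smoothTransition.one_of_one_le ht.le
    rw [this.deriv_eq]; simp
  · have hdiff : Differentiable ℝ Real.smoothTransition :=
      (Real.smoothTransition.contDiff (n := 1)).differentiable (by simp)
    obtain ⟨s, hs, h⟩ := exists_deriv_eq_slope Real.smoothTransition (zero_lt_one)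
      hc.continuousOn hdiff.differentiableOn
    refine ⟨s, hs.1, ?_⟩
    rw [hd', h, Real.smoothTransition.one, Real.smoothTransition.zero]
    norm_num

theorem contDiff_normSq : ContDiff ℝ ∞ (fun z : ℂ => Complex.normSq z) := by
  have : (fun z : ℂ => Complex.normSq z) = fun z => z.re * z.re + z.im * z.im := by
    ext z; exact Complex.normSq_apply z
  rw [this]
  exact (Complex.reCLM.contDiff.mul Complex.reCLM.contDiff).add
    (Complex.imCLM.contDiff.mul Complex.imCLM.contDiff)

theorem dir_normSq (e z : ℂ) : dir e (fun z : ℂ => Complex.normSq z) z =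
    2 * (z.re * e.re + z.im * e.im) := by
  have h1 : HasFDerivAt (fun z : ℂ => z.re * z.re + z.im * z.im) _ z :=
    (Complex.reCLM.hasFDerivAt.mul Complex.reCLM.hasFDerivAt).add
    (Complex.imCLM.hasFDerivAt.mul Complex.imCLM.hasFDerivAt)
  have : (fun z : ℂ => Complex.normSq z) = fun z => z.re * z.re + z.im * z.im := by
    ext z; exact Complex.normSq_apply z
  rw [this]
  simp only [dir]
  rw [h1.fderiv]
  simp
  ring

theorem gr_normSq (z : ℂ) : gr (fun z : ℂ => Complex.normSq z) z = 2 * z := by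
  apply Complex.ext <;> simp [gr, dir_normSq]

theorem flatLap_normSq (z : ℂ) : flatLap (fun z : ℂ => Complex.normSq z) z = 4 := by
  have h : ∀ e : ℂ, dir e (fun z : ℂ => Complex.normSq z) = fun z =>
      2 * (z.re * e.re + z.im * e.im) := fun e => funext fun z => dir_normSq e z
  have h2 : ∀ e : ℂ, dir e (fun z : ℂ => 2 * (z.re * e.re + z.im * e.im)) z =
      2 * (e.re * e.re + e.im * e.im) := by
    intro e
    have h1 : HasFDerivAt (fun z : ℂ => 2 * (z.re * e.re + z.im * e.im)) _ z :=
      ((Complex.reCLM.hasFDerivAt.mul_const e.re).add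
        (Complex.imCLM.hasFDerivAt.mul_const e.im)).const_mul 2
    simp only [dir]
    rw [h1.fderiv]
    simp
    ring
  simp only [flatLap, h, h2]
  simp; norm_num

theorem flatLap_radial {h : ℝ → ℝ} (hh : ContDiff ℝ ∞ h) (z : ℂ) :
    flatLap (fun z => h (Complex.normSq z)) z =
      4 * (Complex.normSq z * deriv (deriv h) (Complex.normSq z) +
        deriv h (Complex.normSq z)) := by
  rw [flatLap_comp hh contDiff_normSq, gr_normSq, flatLap_normSq]
  simp; ring

/-- A smooth subharmonic function equal to `log ‖z‖ + c` outside a small ball. -/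
theorem exists_log_kernel {δ : ℝ} (hδ : 0 < δ) : ∃ N : ℂ → ℝ, ContDiff ℝ ∞ N ∧
    (∀ z, 0 ≤ flatLap N z) ∧ (∀ z, δ ≤ ‖z‖ → flatLap N z = 0) ∧
    (∃ c, ∀ z, δ ≤ ‖z‖ → N z = Real.log ‖z‖ + c) ∧ 0 < ∫ z, flatLap N z := by
  obtain ⟨j, hj, hj0, hj2, ⟨c, hjc⟩, hj1, s0, hs0, hjs0⟩ := exists_smooth_ramp
  set a : ℝ := (δ / Real.exp 2) ^ 2 with ha
  have ha0 : 0 < a := by positivity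
  set l : ℝ → ℝ := fun t => 1 / 2 * Real.log (t / a) with hl
  set h : ℝ → ℝ := fun t => j (l t) with hh
  have hld : ∀ t, 0 < t → HasDerivAt l (1 / (2 * t)) t := by
    intro t ht
    have := (((hasDerivAt_id t).div_const a).log (div_pos ht ha0).ne').const_mul (1 / 2)
    refine this.congr_deriv ?_
    simp only [id]
    field_simp
  have hd1 : ∀ t, 0 < t → HasDerivAt h (deriv j (l t) * (1 / (2 * t))) t := fun t ht =>
    ((hj.differentiable (by simp) (l t)).hasDerivAt).comp t (hld t ht)
  have hd2 : ∀ t, 0 < t → deriv (deriv h) t =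
      deriv (deriv j) (l t) * (1 / (2 * t)) * (1 / (2 * t)) +
        deriv j (l t) * (-1 / (2 * t ^ 2)) := by
    intro t ht
    have he : deriv h =ᶠ[𝓝 t] fun t => deriv j (l t) * (1 / (2 * t)) := by
      filter_upwards [lt_mem_nhds ht] with s hs using (hd1 s hs).deriv
    rw [he.deriv_eq]
    have hj' : ContDiff ℝ ∞ (deriv j) := hj.deriv'
    have h1 : HasDerivAt (fun t => deriv j (l t)) (deriv (deriv j) (l t) * (1 / (2 * t))) t :=
      ((hj'.differentiable (by simp) (l t)).hasDerivAt).comp t (hld t ht)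
    have h2 : HasDerivAt (fun t : ℝ => 1 / (2 * t)) (-1 / (2 * t ^ 2)) t := by
      have := (((hasDerivAt_id t).const_mul 2).inv (by simpa using ht.ne'))
      simp only [one_div]
      refine this.congr_deriv ?_
      simp only [id]
      field_simp
    exact (h1.mul h2).deriv
  have hsm : ContDiff ℝ ∞ h := by
    rw [contDiff_iff_contDiffAt]
    intro t
    rcases le_or_gt t (a / 2) with ht | ht
    · rcases le_or_gt t (-(a / 2)) with ht' | ht'
      · have h0 : t / a ≠ 0 := div_ne_zero (by linarith) ha0.ne'
        exact hj.contDiffAt.comp t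
          (contDiffAt_const.mul ((contDiffAt_id.div_const a).log h0))
      · apply (contDiffAt_const (c := (0:ℝ))).congr_of_eventuallyEq
        have : Ioo (-a) a ∈ 𝓝 t := Ioo_mem_nhds (by linarith) (by linarith)
        filter_upwards [this] with s hs
        apply hj0
        have : Real.log (s / a) ≤ 0 := by
          rw [← Real.log_abs]
          apply Real.log_nonpos (abs_nonneg _)
          rw [abs_div, abs_of_pos ha0, div_le_one ha0]
          exact abs_le.2 ⟨hs.1.le, hs.2.le⟩
        simp only [hl]; linarith
    · have h0 : t / a ≠ 0 := div_ne_zero (by linarith) ha0.ne'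
      exact hj.contDiffAt.comp t (contDiffAt_const.mul ((contDiffAt_id.div_const a).log h0))
  have hlap : ∀ z : ℂ, z ≠ 0 → flatLap (fun z => h (Complex.normSq z)) z =
      deriv (deriv j) (l (Complex.normSq z)) / Complex.normSq z := by
    intro z hz
    have hp := Complex.normSq_pos.2 hz
    rw [flatLap_radial hsm, hd2 _ hp, (hd1 _ hp).deriv]
    field_simp
    ring
  have hlap0 : flatLap (fun z => h (Complex.normSq z)) 0 = 0 := by
    have : h =ᶠ[𝓝 0] fun _ => 0 := by
      have : Ioo (-a) a ∈ 𝓝 (0:ℝ) := Ioo_mem_nhds (by linarith) (by linarith)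
      filter_upwards [this] with s hs
      apply hj0
      have : Real.log (s / a) ≤ 0 := by
        rw [← Real.log_abs]
        apply Real.log_nonpos (abs_nonneg _)
        rw [abs_div, abs_of_pos ha0, div_le_one ha0]
        exact abs_le.2 ⟨hs.1.le, hs.2.le⟩
      simp only [hl]; linarith
    rw [flatLap_radial hsm]
    simp [this.deriv_eq]
  have hNs : ContDiff ℝ ∞ fun z => h (Complex.normSq z) := hsm.comp contDiff_normSq
  have hpos : ∀ z, 0 ≤ flatLap (fun z => h (Complex.normSq z)) z := by
    intro z
    by_cases hz : z = 0
    · rw [hz, hlap0]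
    · rw [hlap z hz]
      exact div_nonneg (hj2 _) (Complex.normSq_nonneg z)
  have hlbig : ∀ z : ℂ, δ ≤ ‖z‖ → l (Complex.normSq z) = Real.log ‖z‖ - Real.log δ + 2 := by
    intro z hz
    have : 0 < ‖z‖ := hδ.trans_le hz
    simp only [hl, ha]
    rw [Complex.normSq_eq_norm_sq, ← div_pow, Real.log_pow, Real.log_div this.ne' (by positivity),
      Real.log_div hδ.ne' (by positivity), Real.log_exp]
    push_cast; ring
  have hvan : ∀ z : ℂ, δ ≤ ‖z‖ → flatLap (fun z => h (Complex.normSq z)) z = 0 := by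
    intro z hz
    have h0 : z ≠ 0 := norm_pos_iff.1 (hδ.trans_le hz)
    rw [hlap z h0, hj1, zero_div]
    rw [hlbig z hz]
    have := Real.log_le_log hδ hz
    linarith
  refine ⟨fun z => h (Complex.normSq z), hNs, hpos, hvan, ⟨2 - Real.log δ + c, ?_⟩, ?_⟩
  · intro z hz
    have := Real.log_le_log hδ hz
    simp only [hh]
    rw [hlbig z hz, hjc _ (by linarith)]
    ring
  · apply hNs.flatLap.continuous.integral_pos_of_hasCompactSupport_nonneg_nonzero
      (x := ((Real.sqrt (a * Real.exp (2 * s0)) : ℝ) : ℂ))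
    · apply HasCompactSupport.intro (isCompact_closedBall (0:ℂ) δ)
      intro z hz
      apply hvan
      simp at hz; exact hz.le
    · exact hpos
    · have hq : Complex.normSq ((Real.sqrt (a * Real.exp (2 * s0)) : ℝ) : ℂ) =
          a * Real.exp (2 * s0) := by
        rw [Complex.normSq_ofReal, Real.mul_self_sqrt (by positivity)]
      have hp : 0 < a * Real.exp (2 * s0) := by positivity
      rw [hlap _ (Complex.normSq_pos.1 (by rw [hq]; exact hp)), hq]
      have : l (a * Real.exp (2 * s0)) = s0 := by
        simp only [hl]
        rw [mul_div_cancel_left₀ _ ha0.ne', Real.log_exp]; ring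
      rw [this]
      exact (div_pos hjs0 hp).ne'

end LogKernel

section FunctionalConvolution

open Topology Filter Set

/-- Restriction of a function on the plane to a compact set, as a continuous map
(zero if the function is not continuous). -/
noncomputable def restr (A : Set ℂ) (f : ℂ → ℝ) : C(A, ℝ) :=
  open Classical in
  if h : Continuous f then ⟨fun y => f y, h.comp continuous_subtype_val⟩ else 0

theorem restr_apply {A : Set ℂ} {f : ℂ → ℝ} (hf : Continuous f) (y : A) : restr A f y = f y := by
  simp [restr, hf]

/-- Convolution of a function with a functional on `C(A)`. -/
noncomputable def fconv {A : Set ℂ} [CompactSpace A] (l : C(A, ℝ) →L[ℝ] ℝ) (N : ℂ → ℝ) (x : ℂ) : ℝ :=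
  l (restr A (fun y => N (x - y)))

theorem continuous_translate {N : ℂ → ℝ} (hN : Continuous N) (x : ℂ) :
    Continuous (fun y => N (x - y)) := by fun_prop

theorem continuous_restr_translate {A : Set ℂ} {N : ℂ → ℝ} (hN : Continuous N) :
    Continuous (fun x => restr A (fun y => N (x - y))) := by
  let F : C(ℂ × A, ℝ) := ⟨fun q => N (q.1 - q.2), by fun_prop⟩
  have : (fun x => restr A (fun y => N (x - y))) = F.curry := by
    ext x y
    rw [restr_apply (continuous_translate hN x)]
    rfl
  rw [this]
  exact F.curry.continuous

variable {A : Set ℂ} [CompactSpace A] (l : C(A, ℝ) →L[ℝ] ℝ)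

theorem continuous_fconv {N : ℂ → ℝ} (hN : Continuous N) : Continuous (fconv l N) :=
  l.continuous.comp (continuous_restr_translate hN)

theorem fconv_add {N M : ℂ → ℝ} (hN : Continuous N) (hM : Continuous M) (x : ℂ) :
    fconv l (fun z => N z + M z) x = fconv l N x + fconv l M x := by
  simp only [fconv]
  rw [← map_add]
  congr 1
  ext y
  rw [ContinuousMap.add_apply, restr_apply (continuous_translate hN x),
    restr_apply (continuous_translate hM x), restr_apply (by fun_prop)]

theorem hasFDerivAt_fconv {N : ℂ → ℝ} (hN : ContDiff ℝ ∞ N) (x : ℂ) :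
    HasFDerivAt (fconv l N) ((fconv l (dir 1 N) x) • Complex.reCLM +
      (fconv l (dir Complex.I N) x) • Complex.imCLM) x := by
  have key : HasFDerivAt (fun x => restr A (fun y => N (x - y)))
      (Complex.reCLM.smulRight (restr A (fun y => dir 1 N (x - y))) +
        Complex.imCLM.smulRight (restr A (fun y => dir Complex.I N (x - y)))) x := by
    rw [hasFDerivAt_iff_isLittleO, Asymptotics.isLittleO_iff]
    intro ε hε
    have hAc : IsCompact A := isCompact_iff_compactSpace.2 ‹_›
    have hK : IsCompact (Metric.cthickening 1 ((fun y => x - y) '' A)) :=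
      (hAc.image (by fun_prop)).cthickening
    have hcont : Continuous (fderiv ℝ N) := hN.continuous_fderiv (by simp)
    obtain ⟨δ, hδ, huc⟩ := Metric.uniformContinuousOn_iff.1
      (hK.uniformContinuousOn_of_continuous hcont.continuousOn) ε hε
    filter_upwards [Metric.ball_mem_nhds x (lt_min hδ one_pos)] with x' hx'
    rw [Metric.mem_ball, dist_eq_norm] at hx'
    rw [ContinuousMap.norm_le _ (by positivity)]
    intro y
    have hd : ∀ z, DifferentiableAt ℝ N z := fun z => hN.diffAt z
    have e1 := (convex_ball (x - (y:ℂ)) (min δ 1)).norm_image_sub_le_of_norm_fderiv_le'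
      (f := N) (𝕜 := ℝ) (C := ε) (φ := fderiv ℝ N (x - y)) (x := x - y) (y := x' - y)
      (fun z _ => hd z) ?_ (Metric.mem_ball_self (lt_min hδ one_pos)) ?_
    · simp only [ContinuousMap.sub_apply, _root_.add_apply,
        ContinuousLinearMap.smulRight_apply, ContinuousMap.add_apply, ContinuousMap.smul_apply,
        Complex.reCLM_apply, Complex.imCLM_apply, smul_eq_mul]
      rw [restr_apply (continuous_translate hN.continuous _),
        restr_apply (continuous_translate hN.continuous _),
        restr_apply (continuous_translate (hN.dir 1).continuous _),
        restr_apply (continuous_translate (hN.dir Complex.I).continuous _)]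
      have h2 : x' - (y:ℂ) - (x - y) = x' - x := by ring
      rw [h2] at e1
      have h3 : fderiv ℝ N (x - y) (x' - x) = dir (x' - x) N (x - y) := rfl
      rw [h3, dir_eq_gr] at e1
      simpa [gr] using e1
    · intro z hz
      rw [← dist_eq_norm]
      have hz' : dist z (x - y) < min δ 1 := hz
      have hm : x - (y:ℂ) ∈ (fun y => x - y) '' A := ⟨y, y.2, rfl⟩
      exact (huc z (Metric.mem_cthickening_of_dist_le z _ 1 _ hm
        (hz'.le.trans (min_le_right _ _))) (x - y)
        (Metric.self_subset_cthickening _ hm) (hz'.trans_le (min_le_left _ _))).le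
    · rw [Metric.mem_ball, dist_eq_norm]; simpa using hx'
  have := l.hasFDerivAt.comp x key
  refine this.congr_fderiv ?_
  ext e
  simp [fconv]
  ring

theorem dir_fconv {N : ℂ → ℝ} (hN : ContDiff ℝ ∞ N) (e : ℂ) :
    dir e (fconv l N) = fun x => e.re * fconv l (dir 1 N) x + e.im * fconv l (dir Complex.I N) x := by
  ext x
  rw [dir, (hasFDerivAt_fconv l hN x).fderiv]
  simp; ring

theorem contDiff_fconv {N : ℂ → ℝ} (hN : ContDiff ℝ ∞ N) : ContDiff ℝ ∞ (fconv l N) := by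
  rw [contDiff_infty]
  intro n
  induction n generalizing N with
  | zero => exact contDiff_zero.2 (continuous_fconv l hN.continuous)
  | succ n ih =>
    push_cast
    rw [contDiff_succ_iff_fderiv]
    refine ⟨fun x => (hasFDerivAt_fconv l hN x).differentiableAt, by simp, ?_⟩
    have : fderiv ℝ (fconv l N) = fun x => (fconv l (dir 1 N) x) • Complex.reCLM +
      (fconv l (dir Complex.I N) x) • Complex.imCLM := by
      ext1 x; exact (hasFDerivAt_fconv l hN x).fderiv
    rw [this]
    exact ((ih (hN.dir 1)).smul contDiff_const).add ((ih (hN.dir _)).smul contDiff_const)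

theorem flatLap_fconv {N : ℂ → ℝ} (hN : ContDiff ℝ ∞ N) :
    flatLap (fconv l N) = fconv l (flatLap N) := by
  ext x
  have h1 : dir 1 (fconv l N) = fconv l (dir 1 N) := by rw [dir_fconv l hN]; simp
  have h2 : dir Complex.I (fconv l N) = fconv l (dir Complex.I N) := by
    rw [dir_fconv l hN]; simp
  rw [flatLap, h1, h2, dir_fconv l (hN.dir 1), dir_fconv l (hN.dir Complex.I)]
  simp only [Complex.one_re, Complex.one_im, Complex.I_re, Complex.I_im, one_mul, zero_mul,
    add_zero, zero_add]
  rw [← fconv_add l ((hN.dir _).dir _).continuous ((hN.dir _).dir _).continuous]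
  rfl

theorem abs_integral_fconv_mul_sub_le {φ : ℂ → ℝ} (hφ : Continuous φ) (hφc : HasCompactSupport φ)
    {g v : ℂ → ℝ} (hg : Continuous g) (hv : Continuous v) {c B : ℝ} (hB : 0 ≤ B)
    (h : ∀ y ∈ A, |(∫ x, φ (x - y) * g x) - c * v y| ≤ B) :
    |(∫ x, fconv l φ x * g x) - c * l (restr A v)| ≤ ‖l‖ * B := by
  have hAc : IsCompact A := isCompact_iff_compactSpace.2 ‹_›
  let F : ℂ → C(A, ℝ) := fun x => g x • restr A (fun y => φ (x - y))
  have hFc : Continuous F := hg.smul (continuous_restr_translate hφ)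
  have hFs : HasCompactSupport F := by
    apply HasCompactSupport.intro (hφc.isCompact.add hAc)
    intro x hx
    ext y
    simp only [F, ContinuousMap.smul_apply, smul_eq_mul, ContinuousMap.zero_apply]
    rw [restr_apply (continuous_translate hφ x),
      image_eq_zero_of_notMem_tsupport (f := φ) fun hm => hx ⟨x - y, hm, y, y.2, by simp⟩, mul_zero]
  have hFi : Integrable F := hFc.integrable_of_hasCompactSupport hFs
  have e1 : ∫ x, fconv l φ x * g x = l (∫ x, F x) := by
    rw [← l.integral_comp_comm hFi]
    congr 1; ext x
    simp only [F, map_smul, fconv, smul_eq_mul]; ring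
  rw [e1, ← smul_eq_mul, ← map_smul, ← map_sub, ← Real.norm_eq_abs]
  refine (l.le_opNorm _).trans ?_
  gcongr
  rw [ContinuousMap.norm_le _ hB]
  intro y
  have e2 : (∫ x, F x) y = ∫ x, φ (x - y) * g x := by
    have := (ContinuousMap.evalCLM ℝ y : C(A, ℝ) →L[ℝ] ℝ).integral_comp_comm hFi
    simp only [ContinuousMap.evalCLM_apply] at this
    rw [← this]
    congr 1; ext x
    simp only [F, ContinuousMap.smul_apply, smul_eq_mul]
    rw [restr_apply (continuous_translate hφ x)]; ring
  rw [ContinuousMap.sub_apply, e2, ContinuousMap.smul_apply, restr_apply hv]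
  exact h y y.2

end FunctionalConvolution

section HarmonicApproximation

open Topology Filter Set

/-- A planar set such that no point of its complement is enclosed by a compact subset. -/
def Full (Ω : Set ℂ) : Prop :=
  ∀ K, IsCompact K → K ⊆ Ω → ∀ x ∉ Ω, ¬ Bornology.IsBounded (connectedComponentIn Kᶜ x)

variable {A : Set ℂ} [CompactSpace A] (l : C(A, ℝ) →L[ℝ] ℝ)

theorem fconv_log_kernel_eq_zero
    (hl : ∀ Q : ℂ → ℂ, Differentiable ℂ Q → l (restr A fun y => (Q y).re) = 0)
    {N : ℂ → ℝ} (hN : Continuous N) {δ c : ℝ} (hδ : 0 < δ)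
    (hlog : ∀ z, δ ≤ ‖z‖ → N z = Real.log ‖z‖ + c) :
    ∃ R, ∀ x, R ≤ ‖x‖ → fconv l N x = 0 := by
  have hAc : IsCompact A := isCompact_iff_compactSpace.2 ‹_›
  obtain ⟨R0, hR0, hA⟩ := hAc.isBounded.exists_pos_norm_le
  refine ⟨2 * R0 + δ, fun x hx => ?_⟩
  have hxpos : 0 < ‖x‖ := by linarith
  have hx0 : x ≠ 0 := norm_pos_iff.1 hxpos
  have key : ∀ n : ℕ, ‖fconv l N x‖ ≤ ‖l‖ * (1 / 2) ^ n := by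
    intro n
    let Q : ℂ → ℂ := fun y => Complex.logTaylor (n + 1) (-y / x) + ((Real.log ‖x‖ + c : ℝ) : ℂ)
    have hQ : Differentiable ℂ Q := by
      have h1 : Differentiable ℂ (Complex.logTaylor (n + 1)) := fun z =>
        (Complex.hasDerivAt_logTaylor n z).differentiableAt
      exact (h1.comp (by fun_prop)).add_const _
    have hQc : Continuous fun y => (Q y).re := Complex.continuous_re.comp hQ.continuous
    have : fconv l N x = l (restr A (fun y => N (x - y)) - restr A (fun y => (Q y).re)) := by
      rw [map_sub, hl Q hQ, sub_zero]; rfl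
    rw [this]
    refine (l.le_opNorm _).trans ?_
    gcongr
    rw [ContinuousMap.norm_le _ (by positivity)]
    intro y
    rw [ContinuousMap.sub_apply, restr_apply (continuous_translate hN x), restr_apply hQc]
    have hy : ‖(y:ℂ)‖ ≤ R0 := hA y y.2
    have hyx : ‖-(y:ℂ) / x‖ ≤ 1 / 2 := by
      rw [norm_div, norm_neg, div_le_iff₀ hxpos]; linarith
    have hxy : δ ≤ ‖x - y‖ := by
      have := norm_sub_norm_le x (y:ℂ); linarith
    rw [hlog _ hxy]
    have hfac : x - (y:ℂ) = x * (1 + -(y:ℂ) / x) := by field_simp; ring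
    have hne : 1 + -(y:ℂ) / x ≠ 0 := by
      intro h0
      rw [h0, mul_zero] at hfac
      rw [hfac, norm_zero] at hxy; linarith
    have h3 : Real.log ‖x - y‖ = Real.log ‖x‖ + (Complex.log (1 + -(y:ℂ) / x)).re := by
      rw [hfac, norm_mul, Real.log_mul hxpos.ne' (norm_ne_zero_iff.2 hne), Complex.log_re]
    have h4 := Complex.norm_log_sub_logTaylor_le n (z := -(y:ℂ) / x) (by linarith)
    have h5 : Real.log ‖x - y‖ + c - (Q y).re =
        (Complex.log (1 + -(y:ℂ) / x) - Complex.logTaylor (n + 1) (-(y:ℂ) / x)).re := by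
      rw [h3]; simp only [Q, Complex.add_re, Complex.sub_re, Complex.ofReal_re]; ring
    rw [h5]
    refine ((Complex.abs_re_le_norm _).trans h4).trans ?_
    have hn : (1:ℝ) ≤ (n:ℝ) + 1 := by linarith [(Nat.cast_nonneg n : (0:ℝ) ≤ n)]
    calc ‖-(y:ℂ) / x‖ ^ (n + 1) * (1 - ‖-(y:ℂ) / x‖)⁻¹ / (n + 1)
        ≤ ‖-(y:ℂ) / x‖ ^ (n + 1) * (1 - ‖-(y:ℂ) / x‖)⁻¹ / 1 := by
          have : 0 ≤ (1 - ‖-(y:ℂ) / x‖)⁻¹ := inv_nonneg.2 (by linarith)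
          gcongr
      _ ≤ (1 / 2) ^ (n + 1) * 2 := by
          rw [div_one]
          have : (1 - ‖-(y:ℂ) / x‖)⁻¹ ≤ 2 := by
            rw [inv_le_comm₀ (by linarith) two_pos]; linarith
          have h0 : 0 ≤ (1 - ‖-(y:ℂ) / x‖)⁻¹ := inv_nonneg.2 (by linarith)
          gcongr
      _ = (1 / 2) ^ n := by rw [pow_succ]; ring
  have hlim : Tendsto (fun n : ℕ => ‖l‖ * (1 / 2 : ℝ) ^ n) atTop (𝓝 (‖l‖ * 0)) :=
    (tendsto_pow_atTop_nhds_zero_of_lt_one (by norm_num) (by norm_num)).const_mul _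
  rw [mul_zero] at hlim
  exact norm_le_zero_iff.1 (ge_of_tendsto' hlim key)

/-- A smooth function harmonic off a compact set and vanishing near infinity has its support
inside every full open set containing that compact set. -/
theorem tsupport_subset_of_harmonic {ψ : ℂ → ℝ} (hψ : ContDiff ℝ ∞ ψ) {K E : Set ℂ}
    (hK : IsCompact K) (hKE : K ⊆ E) (hE : Full E) (hh : ∀ x ∉ K, flatLap ψ x = 0)
    {R : ℝ} (hR : ∀ x, R ≤ ‖x‖ → ψ x = 0) : tsupport ψ ⊆ E := by
  have hKo : IsOpen Kᶜ := hK.isClosed.isOpen_compl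
  have hvan : ∀ x ∉ E, ∀ y ∈ connectedComponentIn Kᶜ x, ψ y = 0 := by
    intro x hx y hy
    have hub := hE K hK hKE x hx
    obtain ⟨x0, hx0, hx0R⟩ : ∃ x0 ∈ connectedComponentIn Kᶜ x, R < ‖x0‖ := by
      by_contra! hcon
      exact hub (isBounded_iff_forall_norm_le.2 ⟨R, hcon⟩)
    have han : AnalyticOnNhd ℝ ψ (connectedComponentIn Kᶜ x) := by
      intro z hz
      apply HarmonicAt.analyticAt
      refine ⟨hψ.contDiffAt.of_le (by simpa using ENat.LEInfty.out), ?_⟩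
      rw [← flatLap_eq_laplacian hψ]
      filter_upwards [hKo.mem_nhds (connectedComponentIn_subset _ _ hz)] with w hw using hh w hw
    refine han.eqOn_zero_of_preconnected_of_eventuallyEq_zero isPreconnected_connectedComponentIn
      hx0 ?_ hy
    filter_upwards [continuous_norm.continuousAt.eventually (lt_mem_nhds hx0R)] with w hw
      using hR w hw.le
  intro x hx
  by_contra hxE
  have hxK : x ∈ Kᶜ := fun h => hxE (hKE h)
  have hopen : IsOpen (connectedComponentIn Kᶜ x) := hKo.connectedComponentIn
  have : x ∉ tsupport ψ := by
    rw [notMem_tsupport_iff_eventuallyEq]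
    filter_upwards [hopen.mem_nhds (mem_connectedComponentIn hxK)] with y hy using hvan x hxE y hy
  exact this hx

end HarmonicApproximation

section Kato

open Topology Filter Set

/-- A smooth convex approximation of the absolute value. -/
noncomputable def softAbs (κ t : ℝ) : ℝ := Real.sqrt (t ^ 2 + κ ^ 2) - κ

variable {κ : ℝ}

theorem softAbs_zero (hκ : 0 < κ) : softAbs κ 0 = 0 := by
  simp [softAbs, Real.sqrt_sq hκ.le]

theorem abs_sub_le_softAbs (t : ℝ) : |t| - κ ≤ softAbs κ t := by
  simp only [softAbs]
  gcongr
  exact Real.le_sqrt_of_sq_le (by rw [sq_abs]; nlinarith [sq_nonneg κ])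

theorem contDiff_softAbs (hκ : 0 < κ) : ContDiff ℝ ∞ (softAbs κ) :=
  (((contDiff_id.pow 2).add contDiff_const).sqrt fun t => by
    have : 0 < t ^ 2 + κ ^ 2 := by positivity
    exact this.ne').sub contDiff_const

theorem deriv_softAbs (hκ : 0 < κ) : deriv (softAbs κ) = fun t => t / Real.sqrt (t ^ 2 + κ ^ 2) := by
  ext t
  have h0 : 0 < t ^ 2 + κ ^ 2 := by positivity
  have := ((((hasDerivAt_id t).pow 2).add_const (κ ^ 2)).sqrt (by simpa using h0.ne')).sub_const κ
  refine this.deriv.trans ?_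
  simp
  field_simp

theorem abs_deriv_softAbs_le (hκ : 0 < κ) (t : ℝ) : |deriv (softAbs κ) t| ≤ 1 := by
  have h0 : 0 < t ^ 2 + κ ^ 2 := by positivity
  rw [deriv_softAbs hκ, abs_div, abs_of_pos (Real.sqrt_pos.2 h0), div_le_one (Real.sqrt_pos.2 h0)]
  exact Real.le_sqrt_of_sq_le (by rw [sq_abs]; nlinarith [sq_nonneg κ])

theorem deriv_deriv_softAbs_nonneg (hκ : 0 < κ) (t : ℝ) : 0 ≤ deriv (deriv (softAbs κ)) t := by
  have h0 : 0 < t ^ 2 + κ ^ 2 := by positivity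
  have hs := Real.sqrt_pos.2 h0
  rw [deriv_softAbs hκ]
  have h1 := (((hasDerivAt_id t).pow 2).add_const (κ ^ 2)).sqrt (by simpa using h0.ne')
  have h2 := (hasDerivAt_id t).div h1 (by simpa using hs.ne')
  have h3 : deriv (fun t => t / Real.sqrt (t ^ 2 + κ ^ 2)) t = _ := h2.deriv
  rw [h3]
  apply div_nonneg _ (by positivity)
  simp only [id, Pi.pow_apply, Nat.cast_ofNat]
  have hsq := Real.sq_sqrt h0.le
  rw [sub_nonneg, one_mul, mul_div_assoc', div_le_iff₀ (by positivity)]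
  norm_num
  nlinarith [sq_nonneg κ]

theorem flatLap_const (c : ℝ) (z : ℂ) : flatLap (fun _ => c) z = 0 := by
  have h : ∀ e, dir e (fun _ : ℂ => c) = fun _ => 0 := fun e => funext fun x => dir_const c e x
  simp only [flatLap, h, dir_const, add_zero]

theorem kato_softAbs (hκ : 0 < κ) {ψ b : ℂ → ℝ} {E : Set ℂ} {c : ℝ} (hψ : ContDiff ℝ ∞ ψ)
    (hψc : HasCompactSupport ψ) (hE : tsupport ψ ⊆ E) (hb : ContDiff ℝ ∞ b)
    (hb0 : ∀ x ∈ E, 0 ≤ b x) (hΔ : ∀ x ∈ E, c ≤ - flatLap b x) :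
    c * ∫ x, softAbs κ (ψ x) ≤ - ∫ x, flatLap ψ x * (b x * deriv (softAbs κ) (ψ x)) := by
  have hj := contDiff_softAbs hκ
  have hg : ContDiff ℝ ∞ fun x => softAbs κ (ψ x) := hj.comp hψ
  have hgc : HasCompactSupport fun x => softAbs κ (ψ x) := hψc.comp_left (softAbs_zero hκ)
  have hgr := integral_mul_flatLap_comm hg hb (Or.inl hgc)
  have hψ0 : ∀ x ∉ E, ψ x = 0 := fun x hx => image_eq_zero_of_notMem_tsupport fun h => hx (hE h)
  have hj0 : ∀ t, 0 ≤ softAbs κ t := by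
    intro t
    simp only [softAbs, sub_nonneg]
    exact Real.le_sqrt_of_sq_le (by nlinarith [sq_nonneg t])
  have i1 : Integrable fun x => c * softAbs κ (ψ x) :=
    (hg.continuous.integrable_of_hasCompactSupport hgc).const_mul c
  have i2 : Integrable fun x => softAbs κ (ψ x) * flatLap b x :=
    integrable_mul_of_hasCompactSupport hg.continuous hb.flatLap.continuous (Or.inl hgc)
  have i3 : Integrable fun x => flatLap (fun x => softAbs κ (ψ x)) x * b x :=
    integrable_mul_of_hasCompactSupport hg.flatLap.continuous hb.continuous
      (Or.inl (hasCompactSupport_flatLap hgc))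
  have i4 : Integrable fun x => flatLap ψ x * (b x * deriv (softAbs κ) (ψ x)) :=
    integrable_mul_of_hasCompactSupport hψ.flatLap.continuous
      (hb.continuous.mul ((hj.continuous_deriv (by simp)).comp hψ.continuous))
      (Or.inl (hasCompactSupport_flatLap hψc))
  calc c * ∫ x, softAbs κ (ψ x) = ∫ x, c * softAbs κ (ψ x) := (integral_const_mul _ _).symm
    _ ≤ ∫ x, -(softAbs κ (ψ x) * flatLap b x) := by
        apply integral_mono i1 i2.neg
        intro x
        by_cases hx : x ∈ E
        · have := mul_le_mul_of_nonneg_right (hΔ x hx) (hj0 (ψ x))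
          show c * softAbs κ (ψ x) ≤ -(softAbs κ (ψ x) * flatLap b x)
          simp only [neg_mul] at this
          linarith [mul_comm (flatLap b x) (softAbs κ (ψ x))]
        · simp [hψ0 x hx, softAbs_zero hκ]
    _ = - ∫ x, flatLap (fun x => softAbs κ (ψ x)) x * b x := by rw [integral_neg, hgr]
    _ ≤ - ∫ x, flatLap ψ x * (b x * deriv (softAbs κ) (ψ x)) := by
        apply neg_le_neg
        apply integral_mono i4 i3
        intro x
        simp only
        by_cases hx : x ∈ E
        · rw [flatLap_comp hj hψ]
          have h1 := mul_nonneg (mul_nonneg (deriv_deriv_softAbs_nonneg hκ (ψ x))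
            (Complex.normSq_nonneg (gr ψ x))) (hb0 x hx)
          linarith
        · have hE' : ψ =ᶠ[𝓝 x] 0 :=
            notMem_tsupport_iff_eventuallyEq.1 fun h => hx (hE h)
          have e1 : flatLap ψ x = 0 := by
            rw [flatLap_congr hE']; exact flatLap_const 0 x
          have e2 : flatLap (fun x => softAbs κ (ψ x)) x = 0 := by
            have : (fun x => softAbs κ (ψ x)) =ᶠ[𝓝 x] fun _ => 0 := by
              filter_upwards [hE'] with y hy
              rw [hy]; exact softAbs_zero hκ
            rw [flatLap_congr this, flatLap_const]
          rw [e1, e2]; simp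

end Kato

section HarmonicApproximation

open Topology Filter Set

theorem kato_abs {ψ b : ℂ → ℝ} {E : Set ℂ} {c B : ℝ} (hc : 0 < c) (hψ : ContDiff ℝ ∞ ψ)
    (hψc : HasCompactSupport ψ) (hE : tsupport ψ ⊆ E) (hb : ContDiff ℝ ∞ b)
    (hb0 : ∀ x ∈ E, 0 ≤ b x) (hΔ : ∀ x ∈ E, c ≤ - flatLap b x)
    (hB : ∀ κ, 0 < κ → - ∫ x, flatLap ψ x * (b x * deriv (softAbs κ) (ψ x)) ≤ B) :
    c * ∫ x, |ψ x| ≤ B := by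
  obtain ⟨R, -, hR⟩ := hψc.isCompact.isBounded.exists_pos_norm_le
  set V := volume.real (Metric.closedBall (0:ℂ) R) with hV
  have hV0 : 0 ≤ V := measureReal_nonneg
  refine le_of_forall_pos_le_add fun ε hε => ?_
  set κ := ε / (c * (V + 1)) with hκd
  have hκ : 0 < κ := by positivity
  have h1 := (kato_softAbs hκ hψ hψc hE hb hb0 hΔ).trans (hB κ hκ)
  have hs : HasCompactSupport fun x => softAbs κ (ψ x) := hψc.comp_left (softAbs_zero hκ)
  have i1 : Integrable fun x => softAbs κ (ψ x) :=
    ((contDiff_softAbs hκ).continuous.comp hψ.continuous).integrable_of_hasCompactSupport hs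
  have i2 : Integrable ((Metric.closedBall (0:ℂ) R).indicator fun _ => κ) :=
    (integrable_indicator_iff measurableSet_closedBall).2
      (integrableOn_const (hs := (isCompact_closedBall _ _).measure_lt_top.ne))
  have h2 : ∫ x, |ψ x| ≤
      ∫ x, (softAbs κ (ψ x) + (Metric.closedBall (0:ℂ) R).indicator (fun _ => κ) x) := by
    apply integral_mono
    · exact (hψ.continuous.abs).integrable_of_hasCompactSupport
        (hψc.comp_left (g := fun t => |t|) abs_zero)
    · exact i1.add i2
    intro x
    simp only
    by_cases hx : x ∈ Metric.closedBall (0:ℂ) R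
    · rw [indicator_of_mem hx]; linarith [abs_sub_le_softAbs (κ := κ) (ψ x)]
    · rw [indicator_of_notMem hx, image_eq_zero_of_notMem_tsupport (f := ψ)
          fun h => hx (by simpa using hR x h),
        softAbs_zero hκ]; simp
  rw [integral_add i1 i2, integral_indicator measurableSet_closedBall, setIntegral_const, smul_eq_mul,
    ← hV] at h2
  have h3 : c * (V * κ) ≤ ε := by
    rw [hκd]
    have : c * (V * (ε / (c * (V + 1)))) = ε * (V / (V + 1)) := by field_simp
    rw [this]
    have : V / (V + 1) ≤ 1 := by rw [div_le_one (by positivity)]; linarith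
    nlinarith
  nlinarith [mul_le_mul_of_nonneg_left h2 hc.le]

theorem functional_le {A : Set ℂ} [CompactSpace A] (l : C(A, ℝ) →L[ℝ] ℝ)
    (hl : ∀ Q : ℂ → ℂ, Differentiable ℂ Q → l (restr A fun y => (Q y).re) = 0)
    {E : Set ℂ} (hE : Full E) {b v : ℂ → ℝ} (hb : ContDiff ℝ ∞ b) (hv : ContDiff ℝ ∞ v)
    (hb0 : ∀ x ∈ E, 0 ≤ b x) {c C : ℝ} (hc : 0 < c) (hC : 0 ≤ C)
    (hΔb : ∀ x ∈ E, c ≤ - flatLap b x) (hΔv : ∀ x ∈ E, |flatLap v x| ≤ C)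
    {δ τ β : ℝ} (hδ : 0 < δ) (hτ : 0 ≤ τ) (hβ : 0 ≤ β) (hδE : Metric.cthickening δ A ⊆ E)
    (hbβ : ∀ x ∈ Metric.cthickening δ A, b x ≤ β)
    (hvτ : ∀ y ∈ A, ∀ x, ‖x - y‖ ≤ δ → |v x - v y| ≤ τ) :
    l (restr A v) ≤ ‖l‖ * (τ + C / c * β) := by
  have hAc : IsCompact A := isCompact_iff_compactSpace.2 ‹_›
  obtain ⟨N, hN, hφ0, hφδ, ⟨k, hk⟩, hm⟩ := exists_log_kernel hδ
  set φ := flatLap N with hφd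
  set m := ∫ z, φ z with hmd
  have hφs : ContDiff ℝ ∞ φ := hN.flatLap
  have hφc : HasCompactSupport φ := by
    apply HasCompactSupport.intro (isCompact_closedBall (0:ℂ) δ)
    intro z hz
    apply hφδ
    simp at hz; exact hz.le
  have hφi : Integrable φ := hφs.continuous.integrable_of_hasCompactSupport hφc
  set ψ := fconv l N with hψd
  have hψ : ContDiff ℝ ∞ ψ := contDiff_fconv l hN
  have hT : flatLap ψ = fconv l φ := flatLap_fconv l hN
  obtain ⟨R, hR⟩ := fconv_log_kernel_eq_zero l hl hN.continuous hδ hk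
  have hψc : HasCompactSupport ψ := by
    apply HasCompactSupport.intro (isCompact_closedBall (0:ℂ) R)
    intro z hz
    apply hR
    simp at hz; exact hz.le
  have hT0 : ∀ x ∉ Metric.cthickening δ A, flatLap ψ x = 0 := by
    intro x hx
    rw [hT, fconv]
    have : restr A (fun y => φ (x - y)) = 0 := by
      ext y
      rw [restr_apply (continuous_translate hφs.continuous x), ContinuousMap.zero_apply]
      apply hφδ
      by_contra! h
      exact hx (Metric.mem_cthickening_of_dist_le x y δ A y.2 (by rw [dist_eq_norm]; exact h.le))
    rw [this, map_zero]
  have hsupp : tsupport ψ ⊆ E :=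
    tsupport_subset_of_harmonic hψ hAc.cthickening hδE hE hT0 hR
  have hloc : ∀ y ∈ A, ∀ g : ℂ → ℝ, Continuous g → ∀ B, (∀ x, ‖x - y‖ ≤ δ → |g x| ≤ B) →
      |∫ x, φ (x - y) * g x| ≤ m * B := by
    intro y hy g hg B hB
    have hi : Integrable fun x => φ (x - y) * B := (hφi.comp_sub_right y).mul_const B
    have : ∫ x, φ (x - y) * B = m * B := by
      rw [integral_mul_const, integral_sub_right_eq_self φ y]
    rw [← this, ← Real.norm_eq_abs]
    apply norm_integral_le_of_norm_le hi
    refine Eventually.of_forall fun x => ?_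
    rw [norm_mul, Real.norm_eq_abs, Real.norm_eq_abs, abs_of_nonneg (hφ0 _)]
    rcases le_or_gt δ ‖x - y‖ with h | h
    · rw [hφδ _ h]; simp
    · exact mul_le_mul_of_nonneg_left (hB x h.le) (hφ0 _)
  have hkato : c * ∫ x, |ψ x| ≤ ‖l‖ * (m * β) := by
    apply kato_abs hc hψ hψc hsupp hb hb0 hΔb
    intro κ hκ
    set g : ℂ → ℝ := fun x => b x * deriv (softAbs κ) (ψ x) with hg
    have hgc : Continuous g := hb.continuous.mul
      (((contDiff_softAbs hκ).continuous_deriv (by simp)).comp hψ.continuous)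
    have := abs_integral_fconv_mul_sub_le l hφs.continuous hφc hgc (continuous_const (y := (0:ℝ)))
      (c := 0) (B := m * β) (by positivity) (fun y hy => by
        rw [zero_mul, sub_zero]
        refine hloc y hy g hgc β fun x hx => ?_
        have hxm := Metric.mem_cthickening_of_dist_le x y δ A hy (by rw [dist_eq_norm]; exact hx)
        rw [hg, abs_mul, abs_of_nonneg (hb0 x (hδE hxm))]
        calc b x * |deriv (softAbs κ) (ψ x)| ≤ b x * 1 :=
              mul_le_mul_of_nonneg_left (abs_deriv_softAbs_le hκ _) (hb0 x (hδE hxm))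
          _ ≤ β := by rw [mul_one]; exact hbβ x hxm)
    rw [zero_mul, sub_zero, ← hT] at this
    exact (neg_le_abs _).trans this
  have hpair : ∫ x, flatLap ψ x * v x ≤ C * ∫ x, |ψ x| := by
    rw [← integral_mul_flatLap_comm hψ hv (Or.inl hψc), ← integral_const_mul]
    apply integral_mono
    · exact integrable_mul_of_hasCompactSupport hψ.continuous hv.flatLap.continuous (Or.inl hψc)
    · exact ((hψ.continuous.abs).integrable_of_hasCompactSupport
        (hψc.comp_left (g := fun t => |t|) abs_zero)).const_mul C
    intro x
    simp only
    by_cases hx : x ∈ E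
    · calc ψ x * flatLap v x ≤ |ψ x * flatLap v x| := le_abs_self _
        _ = |ψ x| * |flatLap v x| := abs_mul _ _
        _ ≤ |ψ x| * C := mul_le_mul_of_nonneg_left (hΔv x hx) (abs_nonneg _)
        _ = C * |ψ x| := mul_comm _ _
    · rw [image_eq_zero_of_notMem_tsupport (f := ψ) fun h => hx (hsupp h)]; simp
  have hdiff := abs_integral_fconv_mul_sub_le l hφs.continuous hφc hv.continuous hv.continuous
    (c := m) (B := m * τ) (by positivity) (fun y hy => by
      have e : (∫ x, φ (x - y) * v x) - m * v y = ∫ x, φ (x - y) * (v x - v y) := by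
        have i1 : Integrable fun x => φ (x - y) * v x := by
          apply integrable_mul_of_hasCompactSupport (by fun_prop) hv.continuous (Or.inl _)
          exact hφc.comp_homeomorph (Homeomorph.subRight y)
        simp only [mul_sub]
        rw [integral_sub i1 ((hφi.comp_sub_right y).mul_const _), integral_mul_const,
          integral_sub_right_eq_self φ y]
      rw [e]
      exact hloc y hy _ (by fun_prop) τ (hvτ y hy))
  rw [← hT] at hdiff
  have h1 := (abs_le.1 hdiff).1
  have h2 : C * ∫ x, |ψ x| ≤ C / c * (‖l‖ * (m * β)) := by
    have := mul_le_mul_of_nonneg_left hkato (by positivity : 0 ≤ C / c)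
    rwa [← mul_assoc, div_mul_cancel₀ _ hc.ne'] at this
  have h3 : m * l (restr A v) ≤ m * (‖l‖ * (τ + C / c * β)) := by
    linarith
  exact le_of_mul_le_mul_left h3 hm

/-- Approximation of functions with bounded Laplacian by harmonic functions near the boundary of a
full open set carrying a good barrier. -/
theorem exists_entire_approx {E A : Set ℂ} (hEo : IsOpen E) (hA : IsCompact A) (hAE : A ⊆ E)
    (hE : Full E) {b v : ℂ → ℝ} (hb : ContDiff ℝ ∞ b) (hv : ContDiff ℝ ∞ v)
    (hb0 : ∀ x ∈ E, 0 ≤ b x) {c C ε η : ℝ} (hc : 0 < c) (hC : 0 ≤ C) (hε : 0 ≤ ε)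
    (hΔb : ∀ x ∈ E, c ≤ - flatLap b x) (hΔv : ∀ x ∈ E, |flatLap v x| ≤ C)
    (hbA : ∀ x ∈ A, b x ≤ ε) (hη : C / c * ε < η) :
    ∃ Q : ℂ → ℂ, Differentiable ℂ Q ∧ ∀ x ∈ A, |v x - (Q x).re| ≤ η := by
  by_contra! hcon
  have hη0 : 0 < η := lt_of_le_of_lt (by positivity) hη
  have : CompactSpace A := isCompact_iff_compactSpace.1 hA
  have hre : ∀ Q : ℂ → ℂ, Differentiable ℂ Q → Continuous fun y => (Q y).re :=
    fun Q hQ => Complex.continuous_re.comp hQ.continuous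
  let M : Submodule ℝ C(A, ℝ) :=
    { carrier := {g | ∃ Q : ℂ → ℂ, Differentiable ℂ Q ∧ g = restr A fun y => (Q y).re}
      add_mem' := by
        rintro _ _ ⟨P, hP, rfl⟩ ⟨Q, hQ, rfl⟩
        refine ⟨fun z => P z + Q z, hP.add hQ, ?_⟩
        ext y
        rw [ContinuousMap.add_apply, restr_apply (hre P hP), restr_apply (hre Q hQ),
          restr_apply (hre (fun z => P z + Q z) (hP.add hQ))]
        simp
      zero_mem' := ⟨fun _ => 0, by fun_prop, by
        ext y; rw [restr_apply (by simpa using continuous_const)]; simp⟩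
      smul_mem' := by
        rintro r _ ⟨P, hP, rfl⟩
        refine ⟨fun z => (r:ℂ) * P z, by fun_prop, ?_⟩
        ext y
        rw [ContinuousMap.smul_apply, restr_apply (hre P hP), restr_apply (hre _ (by fun_prop))]
        simp }
  set v' := restr A v with hv'
  have hdisj : Disjoint (Metric.ball v' η) (M : Set C(A, ℝ)) := by
    rw [Set.disjoint_left]
    rintro g hg ⟨Q, hQ, rfl⟩
    obtain ⟨x, hx, hxη⟩ := hcon Q hQ
    rw [Metric.mem_ball, dist_comm, dist_eq_norm] at hg
    have := (ContinuousMap.norm_coe_le_norm (v' - restr A fun y => (Q y).re) ⟨x, hx⟩).trans_lt hg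
    rw [ContinuousMap.sub_apply, hv', restr_apply hv.continuous, restr_apply (hre Q hQ),
      Real.norm_eq_abs] at this
    exact lt_asymm this hxη
  obtain ⟨f, u, hfu, hfM⟩ := geometric_hahn_banach_open (convex_ball v' η) Metric.isOpen_ball
    M.convex hdisj
  have hu0 : u ≤ 0 := by simpa using hfM 0 M.zero_mem
  have hM0 : ∀ g ∈ M, f g = 0 := by
    intro g hg
    by_contra h0
    have := hfM (((u - 1) / f g) • g) (M.smul_mem _ hg)
    rw [map_smul, smul_eq_mul, div_mul_cancel₀ _ h0] at this
    linarith
  have hfn : ∀ η', 0 < η' → η' < η → ‖f‖ * η' ≤ - f v' := by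
    intro η' h0 h1
    have hneg : 0 ≤ - f v' := by
      have := hfu v' (Metric.mem_ball_self hη0); linarith
    rw [← le_div_iff₀ h0]
    apply ContinuousLinearMap.opNorm_le_bound _ (by positivity)
    intro g
    rcases eq_or_ne g 0 with rfl | hg
    · simp
    have hgp := norm_pos_iff.2 hg
    have key : ∀ s : ℝ, |s| = η' / ‖g‖ → s * f g ≤ - f v' := by
      intro s hs
      have := hfu (v' + s • g) (by
        rw [Metric.mem_ball, dist_eq_norm, add_sub_cancel_left, norm_smul, Real.norm_eq_abs, hs,
          div_mul_cancel₀ _ hgp.ne']; exact h1)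
      rw [map_add, map_smul, smul_eq_mul] at this
      linarith
    have hpos : 0 < η' / ‖g‖ := by positivity
    have k1 := key (η' / ‖g‖) (abs_of_pos hpos)
    have k2 := key (-(η' / ‖g‖)) (by rw [abs_neg, abs_of_pos hpos])
    have k3 : η' / ‖g‖ * ‖f g‖ ≤ - f v' := by
      rw [Real.norm_eq_abs]
      rcases abs_cases (f g) with ⟨h, _⟩ | ⟨h, _⟩ <;> rw [h] <;> linarith
    rw [div_mul_eq_mul_div, le_div_iff₀ h0]
    rw [div_mul_eq_mul_div, div_le_iff₀ hgp] at k3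
    linarith
  have hf0 : 0 < ‖f‖ := by
    refine lt_of_le_of_ne (norm_nonneg f) fun h0 => ?_
    have h1 := f.le_opNorm v'
    rw [← h0, zero_mul] at h1
    have h2 := hfu v' (Metric.mem_ball_self hη0)
    linarith [(abs_le.1 h1).1]
  have hann : ∀ Q : ℂ → ℂ, Differentiable ℂ Q → (-f) (restr A fun y => (Q y).re) = 0 :=
    fun Q hQ => by simpa using hM0 _ ⟨Q, hQ, rfl⟩
  set s := (η - C / c * ε) / 4 with hs
  have hs0 : 0 < s := by rw [hs]; linarith
  set r := min s (s / (C / c + 1)) with hr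
  have hCc : 0 ≤ C / c := by positivity
  have hr0 : 0 < r := lt_min hs0 (by positivity)
  have hrC : C / c * r ≤ s := by
    have : r ≤ s / (C / c + 1) := min_le_right _ _
    calc C / c * r ≤ (C / c + 1) * (s / (C / c + 1)) := by gcongr; linarith
      _ = s := by field_simp
  obtain ⟨δ1, hδ1, hδ1E⟩ := hA.exists_cthickening_subset_open hEo hAE
  have hK : IsCompact (Metric.cthickening 1 A) := hA.cthickening
  obtain ⟨δ2, hδ2, hbu⟩ := Metric.uniformContinuousOn_iff.1
    (hK.uniformContinuousOn_of_continuous hb.continuous.continuousOn) r hr0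
  obtain ⟨δ3, hδ3, hvu⟩ := Metric.uniformContinuousOn_iff.1
    (hK.uniformContinuousOn_of_continuous hv.continuous.continuousOn) s hs0
  set δ := min (min δ1 1) (min (δ2 / 2) (δ3 / 2)) with hδd
  have hδ : 0 < δ := by positivity
  have l1 : δ ≤ δ1 := (min_le_left _ _).trans (min_le_left _ _)
  have l2 : δ ≤ 1 := (min_le_left _ _).trans (min_le_right _ _)
  have l3 : δ < δ2 := ((min_le_right _ _).trans (min_le_left _ _)).trans_lt (by linarith)
  have l4 : δ < δ3 := ((min_le_right _ _).trans (min_le_right _ _)).trans_lt (by linarith)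
  have hmain := functional_le (-f) hann hE hb hv hb0 hc hC hΔb hΔv hδ hs0.le
    (β := ε + r) (by positivity) ((Metric.cthickening_mono l1 A).trans hδ1E)
    (by
      intro x hx
      obtain ⟨y, hy, hxy⟩ := hA.exists_infDist_eq_dist (by
        by_contra hne
        rw [Set.not_nonempty_iff_eq_empty] at hne
        simp [hne] at hx) x
      have hd : dist x y ≤ δ := by
        rw [← hxy]
        exact ENNReal.toReal_le_of_le_ofReal hδ.le (Metric.mem_cthickening_iff.1 hx)
      have := hbu x (Metric.cthickening_mono l2 A hx) y (Metric.self_subset_cthickening _ hy)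
        (hd.trans_lt l3)
      rw [Real.dist_eq] at this
      linarith [(abs_lt.1 this).2, hbA y hy])
    (by
      intro y hy x hxy
      have hd : dist x y ≤ δ := by rwa [dist_eq_norm]
      have := hvu x (Metric.mem_cthickening_of_dist_le x y 1 A hy (hd.trans l2)) y
        (Metric.self_subset_cthickening _ hy) (hd.trans_lt l4)
      rw [Real.dist_eq] at this
      exact this.le)
  rw [ContinuousLinearMap.opNorm_neg] at hmain
  have h6 : (-f) v' = - f v' := rfl
  rw [← hv', h6] at hmain
  have h5 := hfn (η - s) (by
    have : 0 ≤ C / c * ε := by positivity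
    linarith) (by linarith)
  have h7 : η - s ≤ s + C / c * (ε + r) := le_of_mul_le_mul_left (h5.trans hmain) hf0
  linarith

end HarmonicApproximation

section Layers

open Topology Filter Set

/-- A smooth step from `0` on `(-∞, 1/3]` to `1` on `[2/3, ∞)`. -/
noncomputable def step (t : ℝ) : ℝ := Real.smoothTransition (3 * t - 1)

theorem contDiff_step : ContDiff ℝ ∞ step :=
  Real.smoothTransition.contDiff.comp ((contDiff_const.mul contDiff_id).sub contDiff_const)

theorem step_nonneg (t : ℝ) : 0 ≤ step t := Real.smoothTransition.nonneg _

theorem step_le_one (t : ℝ) : step t ≤ 1 := Real.smoothTransition.le_one _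

theorem step_eq_zero {t : ℝ} (h : t ≤ 1 / 3) : step t = 0 :=
  Real.smoothTransition.zero_of_nonpos (by linarith)

theorem step_eq_one {t : ℝ} (h : 2 / 3 ≤ t) : step t = 1 :=
  Real.smoothTransition.one_of_one_le (by linarith)

theorem deriv_step_nonneg (t : ℝ) : 0 ≤ deriv step t := by
  have : Monotone step := fun a b hab => Real.smoothTransition.monotone (by linarith)
  exact this.deriv_nonneg

theorem deriv_step_of_le {t : ℝ} (h : t ≤ 1 / 3) : deriv step t = 0 := by
  apply IsLocalMin.deriv_eq_zero
  exact Eventually.of_forall fun s => by rw [step_eq_zero h]; exact step_nonneg s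

theorem deriv_step_of_ge {t : ℝ} (h : 2 / 3 ≤ t) : deriv step t = 0 := by
  apply IsLocalMax.deriv_eq_zero
  exact Eventually.of_forall fun s => by rw [step_eq_one h]; exact step_le_one s

theorem continuous_deriv_step : Continuous (deriv step) := contDiff_step.continuous_deriv (by simp)

theorem exists_deriv_step_le : ∃ C, 0 ≤ C ∧ ∀ t, deriv step t ≤ C := by
  obtain ⟨C, hC⟩ := (isCompact_Icc (a := (0:ℝ)) (b := 1)).exists_bound_of_continuousOn
    continuous_deriv_step.continuousOn
  refine ⟨|C|, abs_nonneg _, fun t => ?_⟩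
  by_cases ht : t ∈ Icc (0:ℝ) 1
  · exact ((le_abs_self _).trans (hC t ht)).trans (le_abs_self _)
  · have : deriv step t = 0 := by
      rw [mem_Icc, not_and_or, not_le, not_le] at ht
      rcases ht with h | h
      · exact deriv_step_of_le (by linarith)
      · exact deriv_step_of_ge (by linarith)
    rw [this]; exact abs_nonneg _

/-- The derivative of a smoothed distribution function. -/
theorem hasDerivAt_integral_step {X : Type*} [MeasurableSpace X] {μ : Measure X} {g h : X → ℝ}
    (hg : Integrable g μ) (hh : AEStronglyMeasurable h μ) {ε : ℝ} (hε : 0 < ε) (s : ℝ) :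
    HasDerivAt (fun s => ∫ x, g x * step ((h x - s) / ε) ∂μ)
      (-∫ x, g x * (deriv step ((h x - s) / ε) / ε) ∂μ) s := by
  obtain ⟨C, hC0, hC⟩ := exists_deriv_step_le
  have hm : ∀ s, AEStronglyMeasurable (fun x => g x * step ((h x - s) / ε)) μ := fun s =>
    hg.1.mul (contDiff_step.continuous.comp_aestronglyMeasurable
      ((hh.sub aestronglyMeasurable_const).div₀ aestronglyMeasurable_const))
  have := hasDerivAt_integral_of_dominated_loc_of_deriv_le (μ := μ) (s := univ) (x₀ := s)
    (F := fun s x => g x * step ((h x - s) / ε))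
    (F' := fun s x => - (g x * (deriv step ((h x - s) / ε) / ε)))
    (bound := fun x => ‖g x‖ * (C / ε)) univ_mem (Eventually.of_forall hm)
    (by
      refine hg.norm.mono' (hm s) (Eventually.of_forall fun x => ?_)
      rw [norm_mul, Real.norm_eq_abs (step _), abs_of_nonneg (step_nonneg _)]
      exact mul_le_of_le_one_right (norm_nonneg _) (step_le_one _))
    (by
      refine (hg.1.mul ?_).neg
      refine AEStronglyMeasurable.div₀ ?_ aestronglyMeasurable_const
      exact continuous_deriv_step.comp_aestronglyMeasurable
        ((hh.sub aestronglyMeasurable_const).div₀ aestronglyMeasurable_const))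
    (Eventually.of_forall fun x t _ => by
      rw [norm_neg, norm_mul]
      gcongr
      rw [norm_div, Real.norm_eq_abs, Real.norm_eq_abs, abs_of_nonneg (deriv_step_nonneg _),
        abs_of_pos hε]
      gcongr
      exact hC _)
    (hg.norm.mul_const _)
    (Eventually.of_forall fun x t _ => by
      have h1 : HasDerivAt (fun t => (h x - t) / ε) (-1 / ε) t := by
        simpa using ((hasDerivAt_const t (h x)).sub (hasDerivAt_id t)).div_const ε
      have h2 := (((contDiff_step.differentiable (by simp)) _).hasDerivAt.comp t h1).const_mul (g x)
      refine h2.congr_deriv ?_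
      ring)
  simpa [integral_neg] using this.2

/-- The layer cake inequality with exponential weight. -/
theorem layer_le {X : Type*} [MeasurableSpace X] {μ : Measure X} [SFinite μ] {g h : X → ℝ}
    (hg : Integrable g μ) (hg0 : ∀ x, 0 ≤ g x) (hh : AEStronglyMeasurable h μ) {ε a M : ℝ}
    (hε : 0 < ε) (haM : a ≤ M) (hM : ∀ᵐ x ∂μ, h x ≤ M) (n : ℕ) :
    (∫ x, g x * (rexp (2 * (h x - ε)) - rexp (2 * a)) ∂μ) ≤
      ∫ s in a..M, 2 * rexp (2 * s) * ∫ x, g x * step ((h x - s) / ε) ^ n ∂μ := by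
  have hstepm : Continuous step := contDiff_step.continuous
  have e1 : ∀ s, 2 * rexp (2 * s) * ∫ x, g x * step ((h x - s) / ε) ^ n ∂μ =
      ∫ x, 2 * rexp (2 * s) * (g x * step ((h x - s) / ε) ^ n) ∂μ := fun s =>
    (integral_const_mul _ _).symm
  simp_rw [e1]
  have hI : Integrable (Function.uncurry fun s x => 2 * rexp (2 * s) * (g x * step ((h x - s) / ε) ^ n))
      ((volume.restrict (Set.uIoc a M)).prod μ) := by
    have hb : Integrable (fun q : ℝ × X => 2 * rexp (2 * M) * g q.2)
        ((volume.restrict (Set.uIoc a M)).prod μ) := by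
      have h1 : Integrable (fun _ : ℝ => 2 * rexp (2 * M)) (volume.restrict (Set.uIoc a M)) :=
        continuous_const.integrableOn_uIoc
      exact h1.mul_prod hg
    refine hb.mono' ?_ ?_
    · have h2 : AEStronglyMeasurable (fun q : ℝ × X => h q.2) ((volume.restrict (Set.uIoc a M)).prod μ) :=
        hh.comp_snd
      have h3 : AEStronglyMeasurable (fun q : ℝ × X => g q.2) ((volume.restrict (Set.uIoc a M)).prod μ) :=
        hg.1.comp_snd
      have h4 : AEStronglyMeasurable (fun q : ℝ × X => q.1) ((volume.restrict (Set.uIoc a M)).prod μ) :=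
        measurable_fst.aestronglyMeasurable
      have h5 : AEStronglyMeasurable (fun q : ℝ × X => 2 * rexp (2 * q.1))
          ((volume.restrict (Set.uIoc a M)).prod μ) :=
        (by fun_prop : Continuous fun t : ℝ => 2 * rexp (2 * t)).comp_aestronglyMeasurable h4
      exact h5.mul (h3.mul ((hstepm.comp_aestronglyMeasurable
        ((h2.sub h4).div₀ aestronglyMeasurable_const)).pow n))
    · have hms : MeasurableSet (Set.uIoc a M ×ˢ (univ : Set X)) := measurableSet_uIoc.prod .univ
      have : ∀ᵐ q : ℝ × X ∂((volume.restrict (Set.uIoc a M)).prod μ),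
          q ∈ Set.uIoc a M ×ˢ (univ : Set X) := by
        have h6 : (volume.restrict (Set.uIoc a M)).prod μ =
            ((volume : Measure ℝ).prod μ).restrict (Set.uIoc a M ×ˢ univ) := by
          rw [← Measure.prod_restrict, Measure.restrict_univ]
        rw [h6]
        exact ae_restrict_mem hms
      filter_upwards [this] with q hq
      have hq1 : q.1 ≤ M := by
        have := hq.1
        rw [Set.uIoc_of_le haM] at this
        exact this.2
      simp only [Function.uncurry]
      rw [Real.norm_eq_abs, abs_of_nonneg (by
        have := hg0 q.2; have := step_nonneg ((h q.2 - q.1) / ε); positivity)]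
      have h7 : step ((h q.2 - q.1) / ε) ^ n ≤ 1 := pow_le_one₀ (step_nonneg _) (step_le_one _)
      have h8 : g q.2 * step ((h q.2 - q.1) / ε) ^ n ≤ g q.2 := mul_le_of_le_one_right (hg0 _) h7
      have h9 := mul_nonneg (hg0 q.2) (pow_nonneg (step_nonneg ((h q.2 - q.1) / ε)) n)
      gcongr
  rw [intervalIntegral_integral_swap hI]
  apply integral_mono_ae
  · refine (hg.norm.mul_const (rexp (2 * M) + rexp (2 * a))).mono' ?_ ?_
    · exact hg.1.mul (((by fun_prop : Continuous fun t => rexp (2 * (t - ε))).comp_aestronglyMeasurable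
        hh).sub aestronglyMeasurable_const)
    · filter_upwards [hM] with x hx
      rw [norm_mul]
      gcongr
      refine (norm_sub_le _ _).trans ?_
      rw [Real.norm_eq_abs, Real.norm_eq_abs, Real.abs_exp, Real.abs_exp]
      gcongr; linarith
  · have := hI.integral_prod_right
    simp only [Function.uncurry] at this
    refine this.congr (Eventually.of_forall fun x => ?_)
    simp only
    rw [intervalIntegral.integral_of_le haM, Set.uIoc_of_le haM]
  · filter_upwards [hM] with x hx
    have hc : Continuous fun s => 2 * rexp (2 * s) * (g x * step ((h x - s) / ε) ^ n) := by fun_prop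
    have hnn : ∀ s, 0 ≤ 2 * rexp (2 * s) * (g x * step ((h x - s) / ε) ^ n) := fun s => by
      have := hg0 x; have := step_nonneg ((h x - s) / ε); positivity
    rcases le_or_gt a (h x - ε) with h1 | h1
    · have h2 : ∫ s in a..(h x - ε), 2 * rexp (2 * s) * (g x * step ((h x - s) / ε) ^ n) =
          g x * (rexp (2 * (h x - ε)) - rexp (2 * a)) := by
        have : ∀ s ∈ Set.uIcc a (h x - ε), 2 * rexp (2 * s) * (g x * step ((h x - s) / ε) ^ n) =
            g x * (2 * rexp (2 * s)) := by
          intro s hs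
          rw [Set.uIcc_of_le h1] at hs
          rw [step_eq_one (by rw [le_div_iff₀ hε]; linarith [hs.2])]; ring
        rw [intervalIntegral.integral_congr this, intervalIntegral.integral_const_mul]
        congr 1
        have hd : ∀ s ∈ Set.uIcc a (h x - ε), HasDerivAt (fun s => rexp (2 * s)) (2 * rexp (2 * s)) s := by
          intro s _
          have := ((hasDerivAt_id s).const_mul 2).exp
          simpa [mul_comm] using this
        rw [intervalIntegral.integral_eq_sub_of_hasDerivAt hd
          ((by fun_prop : Continuous fun s : ℝ => 2 * rexp (2 * s)).intervalIntegrable _ _)]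
      rw [← h2]
      exact intervalIntegral.integral_mono_interval le_rfl h1 (by linarith)
        (Eventually.of_forall hnn) (hc.intervalIntegrable _ _)
    · refine le_trans ?_ (intervalIntegral.integral_nonneg haM fun s _ => hnn s)
      apply mul_nonpos_of_nonneg_of_nonpos (hg0 x)
      rw [sub_nonpos]
      gcongr

theorem weighted_cauchy_schwarz {X : Type*} [MeasurableSpace X] {μ : Measure X} {p a b : X → ℝ}
    (hp : ∀ x, 0 ≤ p x) (haa : Integrable (fun x => p x * a x ^ 2) μ)
    (hab : Integrable (fun x => p x * (a x * b x)) μ) (hbb : Integrable (fun x => p x * b x ^ 2) μ) :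
    (∫ x, p x * (a x * b x) ∂μ) ^ 2 ≤ (∫ x, p x * a x ^ 2 ∂μ) * ∫ x, p x * b x ^ 2 ∂μ := by
  have h : ∀ t : ℝ, 0 ≤ (∫ x, p x * a x ^ 2 ∂μ) * (t * t) + (2 * ∫ x, p x * (a x * b x) ∂μ) * t +
      ∫ x, p x * b x ^ 2 ∂μ := by
    intro t
    have e : (∫ x, p x * a x ^ 2 ∂μ) * (t * t) + (2 * ∫ x, p x * (a x * b x) ∂μ) * t +
        ∫ x, p x * b x ^ 2 ∂μ = ∫ x, p x * (a x * t + b x) ^ 2 ∂μ := by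
      have i1 : Integrable (fun x => p x * a x ^ 2 * (t * t) + 2 * t * (p x * (a x * b x))) μ :=
        (haa.mul_const _).add (hab.const_mul _)
      have e2 : ∀ x, p x * (a x * t + b x) ^ 2 =
          p x * a x ^ 2 * (t * t) + 2 * t * (p x * (a x * b x)) + p x * b x ^ 2 := fun x => by ring
      simp_rw [e2]
      rw [integral_add i1 hbb, integral_add (haa.mul_const _) (hab.const_mul _),
        integral_mul_const, integral_const_mul]
      ring
    rw [e]
    exact integral_nonneg fun x => mul_nonneg (hp x) (sq_nonneg _)
  have := discrim_le_zero h
  rw [discrim] at this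
  nlinarith

end Layers

section StepEnergy

open Topology Filter Set

theorem gr_indicator {Ω K : Set ℂ} (hΩ : IsOpen Ω) (hK : IsClosed K) (hKΩ : K ⊆ Ω)
    {g : ℂ → ℝ} (h0 : ∀ x ∈ Ω, x ∉ K → g x = 0) :
    gr (Ω.indicator g) = Ω.indicator (gr g) := by
  ext1 x
  simp only [gr, dir_indicator hΩ hK hKΩ h0]
  by_cases hx : x ∈ Ω
  · simp [hx]; rfl
  · simp [hx]; rfl

theorem contDiff_step_comp {z : ℂ → ℝ} (hz : ContDiff ℝ ∞ z) (σ ε : ℝ) :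
    ContDiff ℝ ∞ fun x => step ((z x - σ) / ε) :=
  contDiff_step.comp ((hz.sub contDiff_const).div_const ε)

theorem hasDerivAt_step_scaled (σ ε t : ℝ) :
    HasDerivAt (fun t => step ((t - σ) / ε)) (deriv step ((t - σ) / ε) / ε) t := by
  have h1 : HasDerivAt (fun t => (t - σ) / ε) (1 / ε) t :=
    ((hasDerivAt_id t).sub_const σ).div_const ε
  refine (((contDiff_step.differentiable (by simp)) _).hasDerivAt.comp t h1).congr_deriv ?_
  ring

theorem gr_step_comp {z : ℂ → ℝ} (hz : ContDiff ℝ ∞ z) (σ ε : ℝ) (x : ℂ) :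
    gr (fun x => step ((z x - σ) / ε)) x =
      ((deriv step ((z x - σ) / ε) / ε : ℝ) : ℂ) * gr z x := by
  have h := hasDerivAt_step_scaled σ ε (z x)
  have := gr_comp x h.differentiableAt (hz.diffAt x)
  rw [h.deriv] at this
  exact this

/-- Cauchy–Schwarz for the gradient of a smoothed level set of a function. -/
theorem step_energy {Y K : Set ℂ} (hY : IsOpen Y) (hK : IsCompact K) (hKY : K ⊆ Y) {z ρ : ℂ → ℝ}
    (hz : ContDiff ℝ ∞ z) (hρ : Continuous ρ) {σ ε : ℝ} (hε : 0 < ε)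
    (h0 : ∀ x ∈ Y, x ∉ K → z x ≤ σ + ε / 3) :
    (∫ x, ‖gr (Y.indicator fun x => step ((z x - σ) / ε)) x‖ * rexp (ρ x)) ^ 2 ≤
      (∫ x in Y, step ((z x - σ) / ε) * -flatLap z x) *
        ∫ x in Y, (deriv step ((z x - σ) / ε) / ε) * rexp (2 * ρ x) := by
  have hle : ∀ x ∈ Y, x ∉ K → (z x - σ) / ε ≤ 1 / 3 := fun x hx hxK => by
    rw [div_le_iff₀ hε]; linarith [h0 x hx hxK]
  have hs0 : ∀ x ∈ Y, x ∉ K → step ((z x - σ) / ε) = 0 := fun x hx hxK =>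
    step_eq_zero (hle x hx hxK)
  have hd0 : ∀ x ∈ Y, x ∉ K → deriv step ((z x - σ) / ε) / ε = 0 := fun x hx hxK => by
    rw [deriv_step_of_le (hle x hx hxK), zero_div]
  set ψ := Y.indicator fun x => step ((z x - σ) / ε) with hψ
  set p := Y.indicator fun x => deriv step ((z x - σ) / ε) / ε with hp
  have hdsm : ContDiff ℝ ∞ fun x => deriv step ((z x - σ) / ε) / ε :=
    (contDiff_step.deriv'.comp ((hz.sub contDiff_const).div_const ε)).div_const ε
  have hψs : ContDiff ℝ ∞ ψ := contDiff_indicator hY hK.isClosed hKY (contDiff_step_comp hz σ ε) hs0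
  have hψc : HasCompactSupport ψ := hasCompactSupport_indicator hK hs0
  have hps : ContDiff ℝ ∞ p := contDiff_indicator hY hK.isClosed hKY hdsm hd0
  have hpc : HasCompactSupport p := hasCompactSupport_indicator hK hd0
  have hp0 : ∀ x, 0 ≤ p x := fun x => by
    apply indicator_nonneg
    intro x _
    have := deriv_step_nonneg ((z x - σ) / ε)
    positivity
  have hgr : ∀ x, gr ψ x = (p x : ℂ) * gr z x := fun x => by
    rw [hψ, gr_indicator hY hK.isClosed hKY hs0, hp]
    by_cases hx : x ∈ Y
    · simp only [hx, indicator_of_mem, gr_step_comp hz]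
    · simp [hx]
  have hcp := hps.continuous
  have hcg : Continuous fun x => ‖gr z x‖ := hz.gr.continuous.norm
  have hce : Continuous fun x => rexp (ρ x) := by fun_prop
  have hInt : ∀ g : ℂ → ℝ, Continuous g → Integrable fun x => p x * g x := fun g hg =>
    integrable_mul_of_hasCompactSupport hcp hg (Or.inl hpc)
  have cs := weighted_cauchy_schwarz (μ := volume) hp0 (hInt _ (hcg.pow 2))
    (hInt _ (hcg.mul hce)) (hInt _ (hce.pow 2))
  have e1 : ∀ x, ‖gr ψ x‖ * rexp (ρ x) = p x * (‖gr z x‖ * rexp (ρ x)) := fun x => by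
    rw [hgr, norm_mul, Complex.norm_real, Real.norm_of_nonneg (hp0 x), mul_assoc]
  simp_rw [e1]
  have e2 : ∫ x in Y, step ((z x - σ) / ε) * -flatLap z x = ∫ x, p x * ‖gr z x‖ ^ 2 := by
    rw [← integral_indicator hY.measurableSet]
    have h1 := integral_mul_flatLap hψs hz (Or.inl hψc)
    have h2 : ∀ x, Y.indicator (fun x => step ((z x - σ) / ε) * -flatLap z x) x =
        -(ψ x * flatLap z x) := fun x => by
      by_cases hx : x ∈ Y <;> simp [hψ, hx]
    simp_rw [h2]
    rw [integral_neg, h1, neg_neg]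
    congr 1; ext x
    rw [hgr, Complex.sq_norm, Complex.normSq_apply]
    simp; ring
  have e3 : ∫ x in Y, (deriv step ((z x - σ) / ε) / ε) * rexp (2 * ρ x) =
      ∫ x, p x * rexp (ρ x) ^ 2 := by
    rw [← integral_indicator hY.measurableSet]
    congr 1; ext x
    by_cases hx : x ∈ Y
    · simp only [hx, indicator_of_mem, hp, ← Real.exp_nat_mul]; norm_num
    · simp [hp, hx]
  rw [e2, e3]
  exact cs

end StepEnergy

section BolCore

open Topology Filter Set

theorem contDiff_re_entire {Q : ℂ → ℂ} (hQ : Differentiable ℂ Q) :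
    ContDiff ℝ ∞ fun z => (Q z).re :=
  Complex.reCLM.contDiff.comp (hQ.contDiff.restrict_scalars ℝ)

theorem dir_re_of_hasDerivAt {Q : ℂ → ℂ} {d z : ℂ} (h : HasDerivAt Q d z) (e : ℂ) :
    dir e (fun z => (Q z).re) z = (d * e).re := by
  have h1 := (Complex.reCLM.hasFDerivAt.comp z (h.hasFDerivAt.restrictScalars ℝ)).fderiv
  simp only [dir]
  erw [h1]
  simp [mul_comm]

theorem flatLap_re_entire {Q : ℂ → ℂ} (hQ : Differentiable ℂ Q) (z : ℂ) :
    flatLap (fun z => (Q z).re) z = 0 := by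
  have hQ' : Differentiable ℂ (deriv Q) :=
    fun z => ((hQ.analyticAt z).deriv).differentiableAt
  have h1 : ∀ e, dir e (fun z => (Q z).re) = fun z => (deriv Q z * e).re := fun e =>
    funext fun z => dir_re_of_hasDerivAt (hQ z).hasDerivAt e
  have h2 : ∀ e, dir e (fun z => (deriv Q z * e).re) z = (deriv (deriv Q) z * e * e).re :=
    fun e => dir_re_of_hasDerivAt ((hQ' z).hasDerivAt.mul_const e) e
  simp only [flatLap, h1, h2, mul_assoc]
  simp

theorem continuous_integral_step_pow {X : Type*} [MeasurableSpace X] {μ : Measure X} {g h : X → ℝ}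
    (hg : Integrable g μ) (hh : AEStronglyMeasurable h μ) (ε : ℝ) (n : ℕ) :
    Continuous fun s => ∫ x, g x * step ((h x - s) / ε) ^ n ∂μ := by
  apply continuous_of_dominated (bound := fun x => ‖g x‖)
  · exact fun s => hg.1.mul ((contDiff_step.continuous.comp_aestronglyMeasurable
      ((hh.sub aestronglyMeasurable_const).div₀ aestronglyMeasurable_const)).pow n)
  · refine fun s => Eventually.of_forall fun x => ?_
    rw [norm_mul, norm_pow, Real.norm_of_nonneg (step_nonneg _)]
    exact mul_le_of_le_one_right (norm_nonneg _) (pow_le_one₀ (step_nonneg _) (step_le_one _))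
  · exact hg.norm
  · refine Eventually.of_forall fun x => ?_
    have := contDiff_step.continuous
    fun_prop

theorem exp_mul_deriv_step_le {ε : ℝ} (hε : 0 < ε) (s t : ℝ) :
    rexp (2 * s) * (deriv step ((t - s) / ε) / ε) ≤
      rexp (2 * t) * (deriv step ((t - s) / ε) / ε) := by
  have h := deriv_step_nonneg ((t - s) / ε)
  rcases le_or_gt s t with h1 | h1
  · gcongr
  · rw [deriv_step_of_le (div_nonpos_of_nonpos_of_nonneg (by linarith) hε.le |>.trans (by norm_num))]
    simp

/-- A Bol-type isoperimetric inequality on a domain on whose boundary the conformal factor is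
dominated by a flat one. -/
theorem bol_core {Y K : Set ℂ} (hY : IsOpen Y) (hYb : Bornology.IsBounded Y) (hK : IsCompact K)
    (hKY : K ⊆ Y) {v : ℂ → ℝ} (hv : ContDiff ℝ ∞ v) {Q : ℂ → ℂ} (hQ : Differentiable ℂ Q)
    (hvQ : ∀ x ∈ Y, x ∉ K → v x ≤ (Q x).re) {k : ℝ} (hk : 0 ≤ k)
    (hΔ : ∀ x ∈ Y, -flatLap v x ≤ k * rexp (2 * v x)) :
    4 * π * ((∫ x in Y, rexp (2 * v x)) - ∫ x in Y, rexp (2 * (Q x).re)) ≤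
      k * (∫ x in Y, rexp (2 * v x)) ^ 2 := by
  set ρ : ℂ → ℝ := fun x => (Q x).re with hρd
  have hρ : ContDiff ℝ ∞ ρ := contDiff_re_entire hQ
  set z : ℂ → ℝ := fun x => v x - ρ x with hzd
  have hz : ContDiff ℝ ∞ z := hv.sub hρ
  have hΔz : ∀ x, flatLap z x = flatLap v x := fun x => by
    rw [hzd, flatLap_sub hv hρ, flatLap_re_entire hQ, sub_zero]
  have hcl : IsCompact (closure Y) := hYb.isCompact_closure
  have hInt : ∀ g : ℂ → ℝ, Continuous g → Integrable g (volume.restrict Y) := fun g hg =>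
    (hg.continuousOn.integrableOn_compact hcl).mono_set subset_closure
  have hiρ := hInt (fun x => rexp (2 * ρ x)) (by have := hρ.continuous; fun_prop)
  have hiv := hInt (fun x => rexp (2 * v x)) (by have := hv.continuous; fun_prop)
  have hzm : AEStronglyMeasurable z (volume.restrict Y) := hz.continuous.aestronglyMeasurable
  obtain ⟨T, hT0, hT⟩ : ∃ T, 0 ≤ T ∧ ∀ x ∈ Y, z x ≤ T := by
    obtain ⟨T, hT⟩ := hcl.exists_bound_of_continuousOn hz.continuous.continuousOn
    exact ⟨|T|, abs_nonneg _, fun x hx =>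
      ((le_abs_self _).trans (hT x (subset_closure hx))).trans (le_abs_self _)⟩
  set m := ∫ x in Y, rexp (2 * v x) with hm
  have key : ∀ ε : ℝ, 0 < ε → 4 * π * (rexp (-2 * ε) * m - ∫ x in Y, rexp (2 * ρ x)) ≤ k * m ^ 2 := by
    intro ε hε
    have hlay := layer_le hiρ (fun x => (Real.exp_pos _).le) hzm hε hT0
      ((ae_restrict_mem hY.measurableSet).mono hT) 2
    have ha := hasDerivAt_integral_step hiρ hzm hε
    have hb := hasDerivAt_integral_step hiv hzm hε
    set b : ℝ → ℝ := fun s => ∫ x in Y, rexp (2 * v x) * step ((z x - s) / ε) with hbd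
    have hb0 : ∀ s, 0 ≤ b s := fun s =>
      integral_nonneg fun x => mul_nonneg (Real.exp_pos _).le (step_nonneg _)
    have hsm : ∀ s, Continuous fun x => step ((z x - s) / ε) :=
      fun s => (contDiff_step_comp hz s ε).continuous
    have hdm : ∀ s, Continuous fun x => deriv step ((z x - s) / ε) / ε := fun s => by
      have := hz.continuous; have := continuous_deriv_step; fun_prop
    have hvc := hv.continuous
    have hρc := hρ.continuous
    have hfw : ∀ s, 0 ≤ s → 2 * rexp (2 * s) *
        (4 * π * ∫ x in Y, rexp (2 * ρ x) * step ((z x - s) / ε) ^ 2) ≤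
        - (k * (2 * b s * -∫ x in Y, rexp (2 * v x) * (deriv step ((z x - s) / ε) / ε))) := by
      intro s hs
      have h0 : ∀ x ∈ Y, x ∉ K → z x ≤ s + ε / 3 := fun x hx hxK => by
        have := hvQ x hx hxK
        simp only [hzd]; linarith
      have hs0 : ∀ x ∈ Y, x ∉ K → step ((z x - s) / ε) = 0 := fun x hx hxK =>
        step_eq_zero (by rw [div_le_iff₀ hε]; linarith [h0 x hx hxK])
      have h1 := step_energy hY hK hKY hz hρc hε h0
      have h2 := weighted_sobolev (contDiff_indicator hY hK.isClosed hKY (contDiff_step_comp hz s ε) hs0)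
        (hasCompactSupport_indicator hK hs0) (fun x => indicator_nonneg (fun x _ => step_nonneg _) x) hQ
      have h3 : ∫ x, (Y.indicator (fun x => step ((z x - s) / ε)) x) ^ 2 * rexp (2 * (Q x).re) =
          ∫ x in Y, rexp (2 * ρ x) * step ((z x - s) / ε) ^ 2 := by
        rw [← integral_indicator hY.measurableSet]
        congr 1; ext x
        by_cases hx : x ∈ Y <;> simp [hx, mul_comm, hρd]
      rw [h3] at h2
      have h4 : ∫ x in Y, step ((z x - s) / ε) * -flatLap z x ≤ k * b s := by
        rw [hbd, ← integral_const_mul]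
        refine setIntegral_mono_on (hInt _ ((hsm s).mul hz.flatLap.continuous.neg))
          (hInt _ (by have := hsm s; fun_prop)) hY.measurableSet fun x hx => ?_
        rw [hΔz]
        have := mul_le_mul_of_nonneg_left (hΔ x hx) (step_nonneg ((z x - s) / ε))
        linarith
      have h5 : rexp (2 * s) * ∫ x in Y, (deriv step ((z x - s) / ε) / ε) * rexp (2 * ρ x) ≤
          ∫ x in Y, rexp (2 * v x) * (deriv step ((z x - s) / ε) / ε) := by
        rw [← integral_const_mul]
        refine setIntegral_mono_on (hInt _ (by have := hdm s; fun_prop))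
          (hInt _ (by have := hdm s; fun_prop)) hY.measurableSet fun x _ => ?_
        have h6 := mul_le_mul_of_nonneg_right (exp_mul_deriv_step_le hε s (z x))
          (Real.exp_pos (2 * ρ x)).le
        have h7 : rexp (2 * v x) = rexp (2 * z x) * rexp (2 * ρ x) := by
          rw [← Real.exp_add]; congr 1; simp only [hzd]; ring
        rw [h7]; linarith
      have h8 : 0 ≤ ∫ x in Y, (deriv step ((z x - s) / ε) / ε) * rexp (2 * ρ x) :=
        integral_nonneg fun x => mul_nonneg (div_nonneg (deriv_step_nonneg _) hε.le) (Real.exp_pos _).le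
      have h9 := h2.trans (h1.trans (mul_le_mul_of_nonneg_right h4 h8))
      have h10 := mul_le_mul_of_nonneg_left h9 (Real.exp_pos (2 * s)).le
      have h11 := mul_le_mul_of_nonneg_left h5 (mul_nonneg hk (hb0 s))
      linarith
    have hbc : Continuous b := continuous_iff_continuousAt.2 fun s => (hb s).continuousAt
    have hφc : Continuous fun s => 2 * rexp (2 * s) *
        (4 * π * ∫ x in Y, rexp (2 * ρ x) * step ((z x - s) / ε) ^ 2) := by
      have := continuous_integral_step_pow hiρ hzm ε 2
      fun_prop
    have hftc := intervalIntegral.integral_le_sub_of_hasDeriv_right_of_le hT0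
      (g := fun s => -(k * b s ^ 2)) (g' := fun s => - (k * (2 * b s *
        -∫ x in Y, rexp (2 * v x) * (deriv step ((z x - s) / ε) / ε))))
      (by fun_prop)
      (fun s _ => by
        refine HasDerivAt.hasDerivWithinAt ?_
        refine ((((hb s).pow 2).const_mul k).neg).congr_deriv ?_
        simp [hbd])
      (hφc.continuousOn.integrableOn_Icc) (fun s hs => hfw s hs.1.le)
    have e1 : ∫ s in (0:ℝ)..T, 2 * rexp (2 * s) *
        (4 * π * ∫ x in Y, rexp (2 * ρ x) * step ((z x - s) / ε) ^ 2) = 4 * π *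
        ∫ s in (0:ℝ)..T, 2 * rexp (2 * s) * ∫ x in Y, rexp (2 * ρ x) * step ((z x - s) / ε) ^ 2 := by
      rw [← intervalIntegral.integral_const_mul]
      congr 1; ext s; ring
    have e2 : ∫ x in Y, rexp (2 * ρ x) * (rexp (2 * (z x - ε)) - rexp (2 * 0)) =
        rexp (-2 * ε) * m - ∫ x in Y, rexp (2 * ρ x) := by
      rw [hm, ← integral_const_mul, ← integral_sub (hiv.const_mul _) hiρ]
      congr 1; ext x
      rw [mul_sub, ← Real.exp_add, ← Real.exp_add, ← Real.exp_add]
      simp only [hzd]; ring_nf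
    have hbm : b 0 ≤ m := by
      refine integral_mono (hInt _ (by have := hsm 0; fun_prop)) hiv fun x => ?_
      exact mul_le_of_le_one_right (Real.exp_pos _).le (step_le_one _)
    rw [e2] at hlay
    rw [e1] at hftc
    have h12 : b 0 ^ 2 ≤ m ^ 2 := by gcongr; exact hb0 0
    have h13 := mul_le_mul_of_nonneg_left h12 hk
    have h14 := mul_nonneg hk (sq_nonneg (b T))
    have h15 := mul_le_mul_of_nonneg_left hlay (by positivity : (0:ℝ) ≤ 4 * π)
    linarith
  have hlim : Tendsto (fun ε : ℝ => 4 * π * (rexp (-2 * ε) * m - ∫ x in Y, rexp (2 * ρ x))) (𝓝[>] 0)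
      (𝓝 (4 * π * (m - ∫ x in Y, rexp (2 * ρ x)))) := by
    have : Continuous fun ε : ℝ => 4 * π * (rexp (-2 * ε) * m - ∫ x in Y, rexp (2 * ρ x)) := by fun_prop
    have h := (this.tendsto 0).mono_left (nhdsWithin_le_nhds (s := Ioi 0))
    simpa using h
  exact le_of_tendsto hlim (by filter_upwards [self_mem_nhdsWithin] with ε hε using key ε hε)

end BolCore

section MinPrinciple

open Topology Filter Set

theorem dir_dir_nonneg_of_isLocalMin {w : ℂ → ℝ} (hw : ContDiff ℝ ∞ w) {y : ℂ} (h : IsLocalMin w y)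
    (e : ℂ) : 0 ≤ dir e (dir e w) y := by
  have hline : ∀ t : ℝ, HasDerivAt (fun t : ℝ => y + t * e) e t := fun t => by
    simpa using ((Complex.ofRealCLM.hasDerivAt (x := t)).mul_const e).const_add y
  have hd : ∀ f : ℂ → ℝ, ContDiff ℝ ∞ f → ∀ t : ℝ,
      HasDerivAt (fun t : ℝ => f (y + t * e)) (dir e f (y + t * e)) t := fun f hf t =>
    (hf.diffAt _).hasFDerivAt.comp_hasDerivAt t (hline t)
  set g : ℝ → ℝ := fun t => w (y + t * e) with hg
  have hg' : deriv g = fun t : ℝ => dir e w (y + t * e) := funext fun t => (hd w hw t).deriv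
  have hg'' : deriv (deriv g) = fun t : ℝ => dir e (dir e w) (y + t * e) := by
    rw [hg']; exact funext fun t => (hd _ (hw.dir e) t).deriv
  have hcont : ContinuousAt (fun t : ℝ => y + t * e) 0 := (hline 0).continuousAt
  have hmin : IsLocalMin g 0 := by
    have : Tendsto (fun t : ℝ => y + t * e) (𝓝 0) (𝓝 y) := by simpa [ContinuousAt] using hcont
    have h2 := this.eventually h
    filter_upwards [h2] with t ht
    simpa [hg] using ht
  by_contra! hneg
  have hneg' : deriv (deriv g) 0 < 0 := by rw [hg'']; simpa using hneg
  have hmax := isLocalMax_of_deriv_deriv_neg hneg' hmin.deriv_eq_zero (hd w hw 0).continuousAt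
  have hconst : g =ᶠ[𝓝 0] fun _ => g 0 := by
    filter_upwards [hmin, hmax] with t h1 h2 using le_antisymm h2 h1
  have : deriv (deriv g) 0 = 0 := by
    rw [hconst.deriv.deriv_eq]; simp
  linarith

theorem flatLap_nonneg_of_isLocalMin {w : ℂ → ℝ} (hw : ContDiff ℝ ∞ w) {y : ℂ}
    (h : IsLocalMin w y) : 0 ≤ flatLap w y :=
  add_nonneg (dir_dir_nonneg_of_isLocalMin hw h _) (dir_dir_nonneg_of_isLocalMin hw h _)

/-- The weak minimum principle for superharmonic functions. -/
theorem le_of_flatLap_nonpos {V K : Set ℂ} (hV : IsOpen V) (hVb : Bornology.IsBounded V)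
    (hVK : closure V ⊆ V ∪ K) {w : ℂ → ℝ} (hw : ContDiff ℝ ∞ w) (hΔ : ∀ y ∈ V, flatLap w y ≤ 0)
    {s : ℝ} (hs : ∀ y ∈ K, s ≤ w y) : ∀ x ∈ V, s ≤ w x := by
  intro x hx
  obtain ⟨R, hR⟩ := hVb.closure.exists_norm_le
  have key : ∀ δ : ℝ, 0 < δ → s - δ * R ^ 2 ≤ w x := by
    intro δ hδ
    set W : ℂ → ℝ := fun x => w x - δ * Complex.normSq x with hW
    have hn : ContDiff ℝ ∞ fun x : ℂ => δ * Complex.normSq x := contDiff_const.mul contDiff_normSq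
    have hWs : ContDiff ℝ ∞ W := hw.sub hn
    obtain ⟨y, hy, hmin⟩ := hVb.isCompact_closure.exists_isMinOn ⟨x, subset_closure hx⟩
      hWs.continuous.continuousOn
    have hyx : W y ≤ W x := hmin (subset_closure hx)
    have h0x := mul_nonneg hδ.le (Complex.normSq_nonneg x)
    have hyR : Complex.normSq y ≤ R ^ 2 := by
      rw [← Complex.sq_norm]
      exact pow_le_pow_left₀ (norm_nonneg _) (hR y hy) 2
    have hyR' := mul_le_mul_of_nonneg_left hyR hδ.le
    rcases hVK hy with hyV | hyK
    · exfalso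
      have hloc : IsLocalMin W y := by
        filter_upwards [hV.mem_nhds hyV] with t ht using hmin (subset_closure ht)
      have h1 := flatLap_nonneg_of_isLocalMin hWs hloc
      have h2 : flatLap (fun x : ℂ => δ * Complex.normSq x) y = δ * 4 := by
        have hj : ContDiff ℝ ∞ fun t : ℝ => δ * t := contDiff_const.mul contDiff_id
        rw [flatLap_comp hj contDiff_normSq, flatLap_normSq]
        have : deriv (fun t : ℝ => δ * t) = fun _ => δ := by
          ext t; simp
        rw [this]; simp
      rw [hW, flatLap_sub hw hn, h2] at h1
      linarith [hΔ y hyV]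
    · have := hs y hyK
      simp only [hW] at hyx
      linarith
  have hlim : Tendsto (fun δ : ℝ => s - δ * R ^ 2) (𝓝[>] 0) (𝓝 s) := by
    have : Continuous fun δ : ℝ => s - δ * R ^ 2 := by fun_prop
    simpa using (this.tendsto 0).mono_left (nhdsWithin_le_nhds (s := Ioi 0))
  exact le_of_tendsto hlim (by filter_upwards [self_mem_nhdsWithin] with δ hδ using key δ hδ)

theorem closure_connectedComponentIn_compl_subset {K : Set ℂ} (hK : IsClosed K) (x : ℂ) :
    closure (connectedComponentIn Kᶜ x) ⊆ connectedComponentIn Kᶜ x ∪ K := by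
  intro y hy
  by_cases hyK : y ∈ K
  · exact Or.inr hyK
  · left
    have ho : IsOpen (connectedComponentIn Kᶜ y) := hK.isOpen_compl.connectedComponentIn
    obtain ⟨t, ht1, ht2⟩ := mem_closure_iff.1 hy _ ho (mem_connectedComponentIn hyK)
    rw [connectedComponentIn_eq ht2, ← connectedComponentIn_eq ht1]
    exact mem_connectedComponentIn hyK

theorem exists_lt_forall_le_of_isCompact {K : Set ℂ} (hK : IsCompact K) {w : ℂ → ℝ}
    (hw : Continuous w) {s : ℝ} (h : ∀ y ∈ K, s < w y) : ∃ s', s < s' ∧ ∀ y ∈ K, s' ≤ w y := by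
  rcases K.eq_empty_or_nonempty with rfl | hne
  · exact ⟨s + 1, by linarith, by simp⟩
  · obtain ⟨y, hy, hmin⟩ := hK.exists_isMinOn hne hw.continuousOn
    exact ⟨w y, h y hy, fun t ht => hmin ht⟩

theorem full_superlevel {Ω : Set ℂ} (hΩ : Full Ω) {w : ℂ → ℝ} (hw : ContDiff ℝ ∞ w)
    (hΔ : ∀ x ∈ Ω, flatLap w x ≤ 0) (s : ℝ) : Full {x | x ∈ Ω ∧ s < w x} := by
  intro K hK hKE x hx hb
  have hKΩ : K ⊆ Ω := fun y hy => (hKE hy).1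
  have hxK : x ∈ Kᶜ := fun h => hx (hKE h)
  have hVΩ : connectedComponentIn Kᶜ x ⊆ Ω := by
    intro y hy
    by_contra hyΩ
    exact hΩ K hK hKΩ y hyΩ (by rwa [← connectedComponentIn_eq hy])
  obtain ⟨s', hs', hKs⟩ := exists_lt_forall_le_of_isCompact hK hw.continuous fun y hy => (hKE hy).2
  have hxV := mem_connectedComponentIn hxK
  have := le_of_flatLap_nonpos hK.isClosed.isOpen_compl.connectedComponentIn hb
    (closure_connectedComponentIn_compl_subset hK.isClosed x) hw (fun y hy => hΔ y (hVΩ hy)) hKs x hxV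
  exact hx ⟨hVΩ hxV, by linarith⟩

end MinPrinciple

section BolLevel

open Topology Filter Set

/-- Two conformal factors with the same curvature-type equation, the first one being the larger
on a domain `Ω` and both agreeing on the boundary in the sense of compactness of superlevels. -/
structure Comparison (Ω : Set ℂ) (v₁ v₂ : ℂ → ℝ) (k : ℝ) : Prop where
  isOpen : IsOpen Ω
  full : Full Ω
  smooth₁ : ContDiff ℝ ∞ v₁
  smooth₂ : ContDiff ℝ ∞ v₂
  lt : ∀ x ∈ Ω, v₂ x < v₁ x
  compact : ∀ s, 0 < s → IsCompact {x | x ∈ Ω ∧ s ≤ v₁ x - v₂ x}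
  flatLap_sub : ∀ x ∈ Ω, flatLap (fun x => v₁ x - v₂ x) x = -(rexp (2 * v₁ x) - rexp (2 * v₂ x))
  nonneg : 0 ≤ k
  lt_one : k < 1
  curvature_le : ∀ x ∈ Ω, -flatLap v₂ x ≤ k * rexp (2 * v₂ x)

variable {Ω : Set ℂ} {v₁ v₂ : ℂ → ℝ} {k : ℝ}

theorem Comparison.smooth_sub (h : Comparison Ω v₁ v₂ k) : ContDiff ℝ ∞ fun x => v₁ x - v₂ x :=
  h.smooth₁.sub h.smooth₂

theorem Comparison.flatLap_neg (h : Comparison Ω v₁ v₂ k) {x : ℂ} (hx : x ∈ Ω) :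
    flatLap (fun x => v₁ x - v₂ x) x < 0 := by
  rw [h.flatLap_sub x hx]
  have := h.lt x hx
  have : rexp (2 * v₂ x) < rexp (2 * v₁ x) := by gcongr
  linarith

theorem Comparison.div_le_third (_h : Comparison Ω v₁ v₂ k) {s ε : ℝ} (hε : 0 < ε) {x : ℂ} (hx : x ∈ Ω)
    (hxK : x ∉ {x | x ∈ Ω ∧ s + ε / 3 ≤ v₁ x - v₂ x}) : (v₁ x - v₂ x - s) / ε ≤ 1 / 3 := by
  rw [div_le_iff₀ hε]
  by_contra! h
  exact hxK ⟨hx, by linarith⟩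

/-- Isoperimetric inequality for smoothed superlevel sets of the difference of two conformal
factors. -/
theorem Comparison.bol_level (h : Comparison Ω v₁ v₂ k) {s₀ : ℝ} (hs₀ : 0 < s₀) :
    ∃ C, 0 ≤ C ∧ ∀ s ε, s₀ ≤ s → 0 < ε →
      4 * π * (∫ x in {x | x ∈ Ω ∧ s + 2 * ε / 3 < v₁ x - v₂ x}, rexp (2 * v₂ x)) -
        k * (∫ x in {x | x ∈ Ω ∧ s + 2 * ε / 3 < v₁ x - v₂ x}, rexp (2 * v₂ x)) ^ 2 ≤
      rexp (4 * (C * ε)) *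
        (∫ x, ‖gr (Ω.indicator fun x => step ((v₁ x - v₂ x - s) / ε)) x‖ * rexp (v₂ x)) ^ 2 := by
  set w : ℂ → ℝ := fun x => v₁ x - v₂ x with hw
  have hws : ContDiff ℝ ∞ w := h.smooth_sub
  have hK₀ := h.compact s₀ hs₀
  obtain ⟨c, hc0, hc⟩ := exists_lt_forall_le_of_isCompact hK₀ (w := fun x => -flatLap w x)
    hws.flatLap.continuous.neg (s := 0) (fun y hy => by linarith [h.flatLap_neg hy.1])
  obtain ⟨C, hC⟩ := hK₀.exists_bound_of_continuousOn h.smooth₂.flatLap.continuous.continuousOn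
  have hC' : ∀ x ∈ Ω, s₀ ≤ w x → |flatLap v₂ x| ≤ |C| := fun x hx hx' =>
    (hC x ⟨hx, hx'⟩).trans (le_abs_self _)
  refine ⟨|C| / c + 1, by positivity, fun s ε hs hε => ?_⟩
  set η := (|C| / c + 1) * ε with hη
  have hEo : IsOpen {x | x ∈ Ω ∧ s < w x} := h.isOpen.inter (isOpen_lt continuous_const hws.continuous)
  have hAc : IsCompact {x | x ∈ Ω ∧ s + ε / 3 ≤ w x ∧ w x ≤ s + ε} := by
    have := (h.compact (s + ε / 3) (by linarith)).inter_right
      (isClosed_le hws.continuous (continuous_const (y := s + ε)))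
    refine this.of_isClosed_subset ?_ (fun x hx => ⟨⟨hx.1, hx.2.1⟩, hx.2.2⟩)
    have e : {x | x ∈ Ω ∧ s + ε / 3 ≤ w x ∧ w x ≤ s + ε} =
        {x | x ∈ Ω ∧ s + ε / 3 ≤ v₁ x - v₂ x} ∩ {b | w b ≤ s + ε} :=
      Set.ext fun x => and_assoc.symm
    rw [e]; exact this.isClosed
  obtain ⟨Q, hQ, hQA⟩ := exists_entire_approx hEo hAc
    (fun x hx => ⟨hx.1, by linarith [hx.2.1]⟩)
    (full_superlevel h.full hws (fun x hx => (h.flatLap_neg hx).le) s)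
    (b := fun x => w x - s) (v := v₂) (hws.sub contDiff_const) h.smooth₂
    (fun x hx => by linarith [hx.2]) hc0 (abs_nonneg C) hε.le
    (fun x hx => by
      rw [_root_.flatLap_sub hws contDiff_const, flatLap_const, sub_zero]
      exact hc x ⟨hx.1, hs.trans hx.2.le⟩)
    (fun x hx => hC' x hx.1 (hs.trans hx.2.le)) (fun x hx => by linarith [hx.2.2])
    (show |C| / c * ε < η by rw [hη]; linarith)
  have hYo : IsOpen {x | x ∈ Ω ∧ s + 2 * ε / 3 < w x} :=
    h.isOpen.inter (isOpen_lt continuous_const hws.continuous)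
  set Y := {x | x ∈ Ω ∧ s + 2 * ε / 3 < w x} with hY
  have hYb : Bornology.IsBounded Y :=
    hK₀.isBounded.subset fun x hx => ⟨hx.1, by show s₀ ≤ w x; linarith [hx.2]⟩
  have hcore := bol_core hYo hYb (h.compact (s + ε) (by linarith))
    (fun x hx => ⟨hx.1, by show s + 2 * ε / 3 < w x; have : s + ε ≤ w x := hx.2; linarith⟩)
    h.smooth₂ (hQ.add_const (η : ℂ))
    (fun x hx hxK => by
      have h1 : w x ≤ s + ε := by
        by_contra! h'
        exact hxK ⟨hx.1, h'.le⟩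
      have h2 := hQA x ⟨hx.1, by linarith [hx.2], h1⟩
      have := (abs_le.1 h2).2
      simp only [Complex.add_re, Complex.ofReal_re]
      linarith)
    h.nonneg (fun x hx => h.curvature_le x hx.1)
  have hKf := h.compact (s + ε / 3) (by linarith)
  have hsub : {x | x ∈ Ω ∧ s + ε / 3 ≤ v₁ x - v₂ x} ⊆ Ω := fun x hx => hx.1
  have hs0 : ∀ x ∈ Ω, x ∉ {x | x ∈ Ω ∧ s + ε / 3 ≤ v₁ x - v₂ x} → step ((w x - s) / ε) = 0 :=
    fun x hx hxK => step_eq_zero (h.div_le_third hε hx hxK)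
  set f := Ω.indicator fun x => step ((w x - s) / ε) with hf
  have hfs : ContDiff ℝ ∞ f :=
    contDiff_indicator h.isOpen hKf.isClosed hsub (contDiff_step_comp hws s ε) hs0
  have hfc : HasCompactSupport f := hasCompactSupport_indicator hKf hs0
  have hf0 : ∀ x, 0 ≤ f x := fun x => indicator_nonneg (fun x _ => step_nonneg _) x
  have hfw := weighted_sobolev hfs hfc hf0 hQ
  have hQc : Continuous fun x => (Q x).re := (contDiff_re_entire hQ).continuous
  have hvc := h.smooth₂.continuous
  have hgrc : Continuous fun x => ‖gr f x‖ := hfs.gr.continuous.norm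
  have hgrs : HasCompactSupport fun x => ‖gr f x‖ := (hasCompactSupport_gr hfc).norm
  have h1 : ∫ x, ‖gr f x‖ * rexp (Q x).re ≤ rexp η * ∫ x, ‖gr f x‖ * rexp (v₂ x) := by
    rw [← integral_const_mul]
    refine integral_mono (integrable_mul_of_hasCompactSupport hgrc (by fun_prop) (Or.inl hgrs))
      ((integrable_mul_of_hasCompactSupport hgrc (by fun_prop) (Or.inl hgrs)).const_mul _) fun x => ?_
    simp only
    by_cases hx : x ∈ {x | x ∈ Ω ∧ s + ε / 3 ≤ w x ∧ w x ≤ s + ε}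
    · have h2 := (abs_le.1 (hQA x hx)).1
      rw [mul_left_comm, ← Real.exp_add]
      gcongr
      linarith
    · have : gr f x = 0 := by
        rw [hf, gr_indicator h.isOpen hKf.isClosed hsub hs0]
        by_cases hxΩ : x ∈ Ω
        · rw [indicator_of_mem hxΩ, gr_step_comp hws]
          have : deriv step ((w x - s) / ε) = 0 := by
            rcases lt_or_ge (w x) (s + ε / 3) with h3 | h3
            · apply deriv_step_of_le; rw [div_le_iff₀ hε]; linarith
            · have : s + ε < w x := by
                by_contra! h4
                exact hx ⟨hxΩ, h3, h4⟩
              apply deriv_step_of_ge; rw [le_div_iff₀ hε]; linarith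
          simp [this]
        · simp [hxΩ]
      simp [this]
  have h2 : ∫ x in Y, rexp (2 * (Q x).re) ≤ ∫ x, f x ^ 2 * rexp (2 * (Q x).re) := by
    rw [← integral_indicator hYo.measurableSet]
    have hi : Integrable fun x => f x ^ 2 * rexp (2 * (Q x).re) := by
      refine integrable_mul_of_hasCompactSupport (hfs.continuous.pow 2) (by fun_prop) (Or.inl ?_)
      exact hfc.comp_left (g := fun t : ℝ => t ^ 2) (by simp)
    have hi2 : Integrable (Y.indicator fun x => rexp (2 * (Q x).re)) :=
      (integrable_indicator_iff hYo.measurableSet).2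
        (((by fun_prop : Continuous fun x => rexp (2 * (Q x).re)).continuousOn.integrableOn_compact
          hYb.isCompact_closure).mono_set subset_closure)
    refine integral_mono hi2 hi fun x => ?_
    by_cases hx : x ∈ Y
    · have : f x = 1 := by
        rw [hf, indicator_of_mem hx.1]
        exact step_eq_one (by rw [le_div_iff₀ hε]; linarith [hx.2])
      simp [hx, this]
    · simp only [hx, not_false_eq_true, indicator_of_notMem]
      positivity
  have h3 : ∫ x in Y, rexp (2 * (Q x + (η : ℂ)).re) = rexp (2 * η) * ∫ x in Y, rexp (2 * (Q x).re) := by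
    rw [← integral_const_mul]
    congr 1; ext x
    rw [← Real.exp_add]; simp; ring_nf
  rw [h3] at hcore
  set G := ∫ x, ‖gr f x‖ * rexp (v₂ x)
  have hI0 : 0 ≤ ∫ x, ‖gr f x‖ * rexp (Q x).re := integral_nonneg fun x => by positivity
  have h4 : (∫ x, ‖gr f x‖ * rexp (Q x).re) ^ 2 ≤ (rexp η * G) ^ 2 := pow_le_pow_left₀ hI0 h1 2
  have h5 : 4 * π * ∫ x in Y, rexp (2 * (Q x).re) ≤ (rexp η * G) ^ 2 := by
    refine le_trans ?_ (hfw.trans h4)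
    gcongr
  have h6 := mul_le_mul_of_nonneg_left h5 (Real.exp_pos (2 * η)).le
  have h7 : rexp (2 * η) * (rexp η * G) ^ 2 = rexp (4 * η) * G ^ 2 := by
    rw [mul_pow, ← mul_assoc, ← Real.exp_nat_mul, ← Real.exp_add]
    congr 2; push_cast; ring
  linarith

end BolLevel

section Covering

open Topology Filter Set

/-- Mass of a smoothed superlevel set of `w` for the density `e^{2v}`. -/
noncomputable def levelMass (Ω : Set ℂ) (v w : ℂ → ℝ) (ε s : ℝ) : ℝ :=
  ∫ x in Ω, rexp (2 * v x) * step ((w x - s) / ε)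

variable {Ω : Set ℂ} {v w : ℂ → ℝ}

theorem integrable_levelMass (hv : IntegrableOn (fun x => rexp (2 * v x)) Ω) (hw : Continuous w)
    (ε s : ℝ) : IntegrableOn (fun x => rexp (2 * v x) * step ((w x - s) / ε)) Ω := by
  refine hv.norm.mono' (hv.1.mul ?_) (Eventually.of_forall fun x => ?_)
  · have := contDiff_step.continuous
    exact (by fun_prop : Continuous fun x => step ((w x - s) / ε)).aestronglyMeasurable
  · rw [norm_mul, Real.norm_of_nonneg (step_nonneg _)]
    exact mul_le_of_le_one_right (norm_nonneg _) (step_le_one _)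

theorem levelMass_nonneg (ε s : ℝ) : 0 ≤ levelMass Ω v w ε s :=
  integral_nonneg fun _ => mul_nonneg (Real.exp_pos _).le (step_nonneg _)

theorem levelMass_le (hv : IntegrableOn (fun x => rexp (2 * v x)) Ω) (hw : Continuous w) (ε s : ℝ) :
    levelMass Ω v w ε s ≤ ∫ x in Ω, rexp (2 * v x) :=
  integral_mono (integrable_levelMass hv hw ε s) hv fun _ =>
    mul_le_of_le_one_right (Real.exp_pos _).le (step_le_one _)

theorem levelMass_le_levelMass (hv : IntegrableOn (fun x => rexp (2 * v x)) Ω) (hw : Continuous w)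
    {ε ε' s s' : ℝ} (hε : 0 < ε) (hε' : 0 < ε') (h : s' + ε' ≤ s) :
    levelMass Ω v w ε s ≤ levelMass Ω v w ε' s' := by
  refine integral_mono (integrable_levelMass hv hw ε s) (integrable_levelMass hv hw ε' s') fun x => ?_
  simp only
  gcongr
  rcases le_or_gt (w x) s with h1 | h1
  · rw [step_eq_zero (by rw [div_le_iff₀ hε]; linarith)]
    exact step_nonneg _
  · refine (step_le_one _).trans (step_eq_one ?_).ge
    rw [le_div_iff₀ hε']; linarith

theorem levelMass_eq_zero {M ε s : ℝ} (hM : ∀ x ∈ Ω, w x ≤ M) (hε : 0 < ε)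
    (hs : M ≤ s) : levelMass Ω v w ε s = 0 := by
  refine setIntegral_eq_zero_of_forall_eq_zero fun x hx => ?_
  rw [step_eq_zero, mul_zero]
  rw [div_le_iff₀ hε]
  linarith [hM x hx]

theorem tendsto_levelMass (hΩ : MeasurableSet Ω) (hv : IntegrableOn (fun x => rexp (2 * v x)) Ω)
    (hw : Continuous w) (hpos : ∀ x ∈ Ω, 0 < w x) :
    Tendsto (fun s => levelMass Ω v w s (2 * s)) (𝓝[>] 0) (𝓝 (∫ x in Ω, rexp (2 * v x))) := by
  refine tendsto_integral_filter_of_dominated_convergence (fun x => ‖rexp (2 * v x)‖)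
    (Eventually.of_forall fun s => (integrable_levelMass hv hw _ _).1)
    (Eventually.of_forall fun s => Eventually.of_forall fun x => ?_) hv.norm ?_
  · rw [norm_mul, Real.norm_of_nonneg (step_nonneg _)]
    exact mul_le_of_le_one_right (norm_nonneg _) (step_le_one _)
  · filter_upwards [ae_restrict_mem hΩ] with x hx
    refine tendsto_const_nhds.congr' ?_
    have h1 : ∀ᶠ s : ℝ in 𝓝[>] 0, s < w x / 3 :=
      nhdsWithin_le_nhds (Iio_mem_nhds (by linarith [hpos x hx]))
    filter_upwards [h1, self_mem_nhdsWithin] with s h2 h3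
    have h4 : (0:ℝ) < s := h3
    rw [step_eq_one (by rw [le_div_iff₀ h4]; linarith), mul_one]

variable {v₁ v₂ : ℂ → ℝ} {k : ℝ}

theorem Comparison.integral_levelMass_le (h : Comparison Ω v₁ v₂ k)
    (h1 : IntegrableOn (fun x => rexp (2 * v₁ x)) Ω) (h2 : IntegrableOn (fun x => rexp (2 * v₂ x)) Ω)
    {s₀ M : ℝ} (hs₀ : 0 < s₀) (hsM : s₀ ≤ M) (hM : ∀ x ∈ Ω, v₁ x - v₂ x ≤ M) :
    ∃ C, ∀ ε, 0 < ε →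
      rexp (-(4 * (C * ε))) * (∫ s in s₀..M, 2 * rexp (2 * s) *
        (4 * π * levelMass Ω v₂ (fun x => v₁ x - v₂ x) ε (s + ε) +
          (1 - k) * levelMass Ω v₂ (fun x => v₁ x - v₂ x) ε (s + ε) ^ 2)) ≤
      levelMass Ω v₁ (fun x => v₁ x - v₂ x) ε s₀ ^ 2 -
        rexp (2 * s₀) * levelMass Ω v₂ (fun x => v₁ x - v₂ x) ε s₀ ^ 2 := by
  obtain ⟨C, hC0, hC⟩ := h.bol_level hs₀
  refine ⟨C, fun ε hε => ?_⟩
  set w : ℂ → ℝ := fun x => v₁ x - v₂ x with hw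
  have hws : ContDiff ℝ ∞ w := h.smooth_sub
  have hΩm := h.isOpen.measurableSet
  have hwm : AEStronglyMeasurable w (volume.restrict Ω) := hws.continuous.aestronglyMeasurable
  set a : ℝ → ℝ := levelMass Ω v₂ w ε with had
  set b : ℝ → ℝ := levelMass Ω v₁ w ε with hbd
  have ha0 : ∀ s, 0 ≤ a s := levelMass_nonneg ε
  have hb0 : ∀ s, 0 ≤ b s := levelMass_nonneg ε
  have ha : ∀ s, HasDerivAt a _ s := hasDerivAt_integral_step h2 hwm hε
  have hb : ∀ s, HasDerivAt b _ s := hasDerivAt_integral_step h1 hwm hε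
  set a' : ℝ → ℝ := fun s => ∫ x in Ω, rexp (2 * v₂ x) * (deriv step ((w x - s) / ε) / ε) with ha'
  set b' : ℝ → ℝ := fun s => ∫ x in Ω, rexp (2 * v₁ x) * (deriv step ((w x - s) / ε) / ε) with hb'
  obtain ⟨D, hD0, hD⟩ := exists_deriv_step_le
  have hInt' : ∀ v : ℂ → ℝ, IntegrableOn (fun x => rexp (2 * v x)) Ω → ∀ s,
      IntegrableOn (fun x => rexp (2 * v x) * (deriv step ((w x - s) / ε) / ε)) Ω := fun v hv s => by
    refine (hv.norm.mul_const (D / ε)).mono' (hv.1.mul ?_) (Eventually.of_forall fun x => ?_)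
    · have := continuous_deriv_step
      have := hws.continuous
      exact (by fun_prop : Continuous fun x => deriv step ((w x - s) / ε) / ε).aestronglyMeasurable
    · have h3 := deriv_step_nonneg ((w x - s) / ε)
      rw [norm_mul, Real.norm_of_nonneg (by positivity : 0 ≤ deriv step ((w x - s) / ε) / ε)]
      gcongr
      exact hD _
  have ha'0 : ∀ s, 0 ≤ a' s := fun s => integral_nonneg fun x =>
    mul_nonneg (Real.exp_pos _).le (div_nonneg (deriv_step_nonneg _) hε.le)
  have hab' : ∀ s, rexp (2 * s) * a' s ≤ b' s := fun s => by
    rw [ha', hb', ← integral_const_mul]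
    refine integral_mono ((hInt' v₂ h2 s).const_mul _) (hInt' v₁ h1 s) fun x => ?_
    have h3 := mul_le_mul_of_nonneg_left (exp_mul_deriv_step_le hε s (w x)) (Real.exp_pos (2 * v₂ x)).le
    have h4 : rexp (2 * v₁ x) = rexp (2 * v₂ x) * rexp (2 * w x) := by
      rw [← Real.exp_add, hw]; ring_nf
    simp only
    rw [h4]; linarith
  have henergy : ∀ s, s₀ ≤ s →
      (∫ x, ‖gr (Ω.indicator fun x => step ((w x - s) / ε)) x‖ * rexp (v₂ x)) ^ 2 ≤
        (b s - a s) * a' s := fun s hs => by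
    have h3 := step_energy (z := w) (σ := s) h.isOpen (h.compact (s + ε / 3) (by linarith))
      (fun x hx => hx.1) hws h.smooth₂.continuous hε
      (fun x hx hxK => by
        by_contra! h4
        exact hxK ⟨hx, h4.le⟩)
    have h4 : ∫ x in Ω, step ((w x - s) / ε) * -flatLap w x = b s - a s := by
      rw [hbd, had, levelMass, levelMass, ← integral_sub (integrable_levelMass h1 hws.continuous _ _)
        (integrable_levelMass h2 hws.continuous _ _)]
      refine setIntegral_congr_fun hΩm fun x hx => ?_
      rw [hw, h.flatLap_sub x hx]; ring
    have h5 : ∫ x in Ω, (deriv step ((w x - s) / ε) / ε) * rexp (2 * v₂ x) = a' s := by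
      rw [ha']; congr 1; ext x; ring
    rwa [h4, h5] at h3
  set N : ℝ → ℝ := fun s => ∫ x in {x | x ∈ Ω ∧ s + 2 * ε / 3 < w x}, rexp (2 * v₂ x) with hN
  have hN0 : ∀ s, 0 ≤ N s := fun s => integral_nonneg fun x => (Real.exp_pos _).le
  have hYm : ∀ s, MeasurableSet {x | x ∈ Ω ∧ s + 2 * ε / 3 < w x} := fun s =>
    hΩm.inter (measurableSet_lt measurable_const hws.continuous.measurable)
  have hYi : ∀ s, N s = ∫ x in Ω, {x | x ∈ Ω ∧ s + 2 * ε / 3 < w x}.indicator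
      (fun x => rexp (2 * v₂ x)) x := fun s => by
    rw [integral_indicator (hYm s), Measure.restrict_restrict (hYm s)]
    have : {x | x ∈ Ω ∧ s + 2 * ε / 3 < w x} ∩ Ω = {x | x ∈ Ω ∧ s + 2 * ε / 3 < w x} :=
      inter_eq_left.2 fun x hx => hx.1
    rw [this]
  have hNa : ∀ s, N s ≤ a s := fun s => by
    rw [hYi]
    refine setIntegral_mono_on (h2.indicator (hYm s)) (integrable_levelMass h2 hws.continuous _ _) hΩm
      fun x hx => ?_
    by_cases h3 : s + 2 * ε / 3 < w x
    · rw [indicator_of_mem (show x ∈ {x | x ∈ Ω ∧ s + 2 * ε / 3 < w x} from ⟨hx, h3⟩),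
        step_eq_one (by rw [le_div_iff₀ hε]; linarith), mul_one]
    · rw [indicator_of_notMem (fun h4 => h3 h4.2)]
      exact mul_nonneg (Real.exp_pos _).le (step_nonneg _)
  have haN : ∀ s, a (s + ε) ≤ N s := fun s => by
    rw [hYi]
    refine setIntegral_mono_on (integrable_levelMass h2 hws.continuous _ _) (h2.indicator (hYm s)) hΩm
      fun x hx => ?_
    by_cases h3 : s + 2 * ε / 3 < w x
    · rw [indicator_of_mem (show x ∈ {x | x ∈ Ω ∧ s + 2 * ε / 3 < w x} from ⟨hx, h3⟩)]
      exact mul_le_of_le_one_right (Real.exp_pos _).le (step_le_one _)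
    · rw [indicator_of_notMem (fun h4 => h3 h4.2), step_eq_zero, mul_zero]
      rw [div_le_iff₀ hε]; linarith
  have hac : Continuous a := continuous_iff_continuousAt.2 fun s => (ha s).continuousAt
  have hbc : Continuous b := continuous_iff_continuousAt.2 fun s => (hb s).continuousAt
  set E := rexp (-(4 * (C * ε))) with hE
  have hE1 : E ≤ 1 := Real.exp_le_one_iff.2 (by have := mul_nonneg hC0 hε.le; linarith)
  have hE0 : 0 < E := Real.exp_pos _
  have hkey : ∀ s, s₀ ≤ s → E * (2 * rexp (2 * s) * (4 * π * a (s + ε) + (1 - k) * a (s + ε) ^ 2)) ≤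
      -(2 * b s * -b' s - (2 * rexp (2 * s) * a s ^ 2 + rexp (2 * s) * (2 * a s * -a' s))) := by
    intro s hs
    have h3 := (hC s ε hs hε).trans (mul_le_mul_of_nonneg_left (henergy s hs) (Real.exp_pos _).le)
    have h4 : 4 * π * N s - k * N s ^ 2 ≤ rexp (4 * (C * ε)) * ((b s - a s) * a' s) := h3
    have h5 : E * (4 * π * N s - k * N s ^ 2) ≤ (b s - a s) * a' s := by
      have := mul_le_mul_of_nonneg_left h4 hE0.le
      rwa [← mul_assoc, hE, ← Real.exp_add, neg_add_cancel, Real.exp_zero, one_mul] at this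
    have h6 : N s ^ 2 ≤ a s ^ 2 := pow_le_pow_left₀ (hN0 s) (hNa s) 2
    have h7 : E * N s ^ 2 ≤ a s ^ 2 := (mul_le_of_le_one_left (sq_nonneg _) hE1).trans h6
    have h8 : 4 * π * a (s + ε) + (1 - k) * a (s + ε) ^ 2 ≤ 4 * π * N s + (1 - k) * N s ^ 2 := by
      have := h.lt_one
      have h9 : a (s + ε) ^ 2 ≤ N s ^ 2 := pow_le_pow_left₀ (ha0 _) (haN s) 2
      have h10 := mul_le_mul_of_nonneg_left h9 (by linarith : 0 ≤ 1 - k)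
      have h11 := mul_le_mul_of_nonneg_left (haN s) (by positivity : 0 ≤ 4 * π)
      linarith
    have h9 : E * (4 * π * a (s + ε) + (1 - k) * a (s + ε) ^ 2) ≤ (b s - a s) * a' s + a s ^ 2 := by
      have := mul_le_mul_of_nonneg_left h8 hE0.le
      linarith
    have h10 := mul_le_mul_of_nonneg_left h9 (by positivity : 0 ≤ 2 * rexp (2 * s))
    have h11 := mul_le_mul_of_nonneg_left (hab' s) (by linarith [hb0 s] : 0 ≤ 2 * b s)
    linarith
  have hftc := intervalIntegral.integral_le_sub_of_hasDeriv_right_of_le hsM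
    (g := fun s => -(b s ^ 2 - rexp (2 * s) * a s ^ 2))
    (g' := fun s => -(2 * b s * -b' s - (2 * rexp (2 * s) * a s ^ 2 + rexp (2 * s) * (2 * a s * -a' s))))
    (φ := fun s => E * (2 * rexp (2 * s) * (4 * π * a (s + ε) + (1 - k) * a (s + ε) ^ 2)))
    (by fun_prop)
    (fun s _ => by
      refine HasDerivAt.hasDerivWithinAt ?_
      have he : HasDerivAt (fun s => rexp (2 * s)) (2 * rexp (2 * s)) s := by
        simpa [mul_comm] using ((hasDerivAt_id s).const_mul 2).exp
      refine ((((hb s).pow 2).sub (he.mul ((ha s).pow 2))).neg).congr_deriv ?_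
      simp [ha', hb'])
    ((by fun_prop : Continuous fun s =>
      E * (2 * rexp (2 * s) * (4 * π * a (s + ε) + (1 - k) * a (s + ε) ^ 2))).continuousOn.integrableOn_Icc)
    (fun s hs => hkey s hs.1.le)
  rw [intervalIntegral.integral_const_mul] at hftc
  have hbM : b M = 0 := levelMass_eq_zero hM hε le_rfl
  have haM : a M = 0 := levelMass_eq_zero hM hε le_rfl
  simp only [hbM, haM] at hftc
  linarith

end Covering

section SphereCovering

open Topology Filter Set

variable {Ω : Set ℂ} {v₁ v₂ : ℂ → ℝ} {k : ℝ}

/-- A sphere-covering inequality for two conformal factors of curvature less than one. -/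
theorem Comparison.mass_gt (h : Comparison Ω v₁ v₂ k)
    (h1 : IntegrableOn (fun x => rexp (2 * v₁ x)) Ω) (h2 : IntegrableOn (fun x => rexp (2 * v₂ x)) Ω)
    (hne : Ω.Nonempty) :
    4 * π < (∫ x in Ω, rexp (2 * v₁ x)) + ∫ x in Ω, rexp (2 * v₂ x) := by
  have hΩm := h.isOpen.measurableSet
  set w : ℂ → ℝ := fun x => v₁ x - v₂ x with hw
  have hws : ContDiff ℝ ∞ w := h.smooth_sub
  have hpos : ∀ x ∈ Ω, 0 < w x := fun x hx => sub_pos.2 (h.lt x hx)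
  obtain ⟨x₀, hx₀⟩ := hne
  set t := w x₀ with ht
  have ht0 : 0 < t := hpos x₀ hx₀
  obtain ⟨M, hM⟩ : ∃ M, ∀ x ∈ Ω, w x ≤ M := by
    obtain ⟨M, hM⟩ := (h.compact t ht0).exists_bound_of_continuousOn hws.continuous.continuousOn
    refine ⟨max M t, fun x hx => ?_⟩
    rcases le_or_gt t (w x) with h3 | h3
    · exact ((le_abs_self _).trans (hM x ⟨hx, h3⟩)).trans (le_max_left _ _)
    · exact h3.le.trans (le_max_right _ _)
  have htM : t ≤ M := hM x₀ hx₀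
  set μ₁ := ∫ x in Ω, rexp (2 * v₁ x) with hμ₁
  set μ₂ := ∫ x in Ω, rexp (2 * v₂ x) with hμ₂
  have hμ : μ₂ ≤ μ₁ := setIntegral_mono_on h2 h1 hΩm fun x hx => by
    have := h.lt x hx
    gcongr
  set m := levelMass Ω v₂ w (t / 2) (t / 2) with hm
  have hm0 : 0 < m := by
    have hKs : ∀ x ∈ Ω, x ∉ {x | x ∈ Ω ∧ t / 2 ≤ v₁ x - v₂ x} →
        rexp (2 * v₂ x) * step ((w x - t / 2) / (t / 2)) = 0 := fun x hx hxK => by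
      rw [step_eq_zero, mul_zero]
      rw [div_le_iff₀ (by linarith)]
      by_contra! h3
      exact hxK ⟨hx, by show t / 2 ≤ w x; linarith⟩
    have hK := h.compact (t / 2) (by linarith)
    have hs := contDiff_indicator h.isOpen hK.isClosed (fun x hx => hx.1)
      (g := fun x => rexp (2 * v₂ x) * step ((w x - t / 2) / (t / 2)))
      ((contDiff_const.mul h.smooth₂).exp.mul (contDiff_step_comp hws _ _)) hKs
    have hc : HasCompactSupport (Ω.indicator
      fun x => rexp (2 * v₂ x) * step ((w x - t / 2) / (t / 2))) := hasCompactSupport_indicator hK hKs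
    rw [hm, levelMass, ← integral_indicator hΩm]
    refine hs.continuous.integral_pos_of_hasCompactSupport_nonneg_nonzero hc
      (fun x => indicator_nonneg (fun x _ => mul_nonneg (Real.exp_pos _).le (step_nonneg _)) x)
      (x := x₀) ?_
    rw [indicator_of_mem hx₀, step_eq_one (by rw [le_div_iff₀ (by linarith)]; linarith)]
    positivity
  set κ := (1 - k) * (t / 4 * m ^ 2) with hκ
  have hκ0 : 0 < κ := mul_pos (by linarith [h.lt_one]) (by positivity)
  have key : ∀ s₀, 0 < s₀ → s₀ ≤ t / 8 → 4 * π * (μ₁ - rexp (2 * s₀) * μ₂) + κ ≤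
      μ₁ ^ 2 - rexp (2 * s₀) * levelMass Ω v₂ w s₀ (2 * s₀) ^ 2 := by
    intro s₀ hs₀ hs₀t
    have hsM : s₀ ≤ M := by linarith
    obtain ⟨C, hC⟩ := h.integral_levelMass_le h1 h2 hs₀ hsM hM
    have hε : ∀ ε, 0 < ε → ε ≤ s₀ → rexp (-(4 * (C * ε))) *
        (4 * π * (rexp (-4 * ε) * μ₁ - rexp (2 * s₀) * μ₂) + κ) ≤
        μ₁ ^ 2 - rexp (2 * s₀) * levelMass Ω v₂ w s₀ (2 * s₀) ^ 2 := by
      intro ε hε hεs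
      have h3 := hC ε hε
      have h4 : levelMass Ω v₁ w ε s₀ ^ 2 ≤ μ₁ ^ 2 :=
        pow_le_pow_left₀ (levelMass_nonneg _ _) (levelMass_le h1 hws.continuous _ _) 2
      have h5 : levelMass Ω v₂ w s₀ (2 * s₀) ^ 2 ≤ levelMass Ω v₂ w ε s₀ ^ 2 :=
        pow_le_pow_left₀ (levelMass_nonneg _ _)
          (levelMass_le_levelMass h2 hws.continuous hs₀ hε (by linarith)) 2
      have h6 := mul_le_mul_of_nonneg_left h5 (Real.exp_pos (2 * s₀)).le
      refine le_trans (le_trans (mul_le_mul_of_nonneg_left ?_ (Real.exp_pos _).le) h3) (by linarith)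
      have hcs : ∀ n : ℕ, Continuous fun s => levelMass Ω v₂ w ε (s + ε) ^ n := fun n => by
        have := continuous_integral_step_pow h2
          (hws.continuous.aestronglyMeasurable (μ := volume.restrict Ω)) ε 1
        simp only [pow_one] at this
        exact (this.comp (continuous_add_const ε)).pow n
      have hi1 : Continuous fun s => 2 * rexp (2 * s) * levelMass Ω v₂ w ε (s + ε) := by
        have := hcs 1
        simp only [pow_one] at this
        fun_prop
      have hi2 : Continuous fun s => 2 * rexp (2 * s) * levelMass Ω v₂ w ε (s + ε) ^ 2 := by
        have := hcs 2
        fun_prop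
      have e1 : ∫ s in s₀..M, 2 * rexp (2 * s) * (4 * π * levelMass Ω v₂ w ε (s + ε) +
          (1 - k) * levelMass Ω v₂ w ε (s + ε) ^ 2) =
          4 * π * (∫ s in s₀..M, 2 * rexp (2 * s) * levelMass Ω v₂ w ε (s + ε)) +
          (1 - k) * ∫ s in s₀..M, 2 * rexp (2 * s) * levelMass Ω v₂ w ε (s + ε) ^ 2 := by
        rw [← intervalIntegral.integral_const_mul, ← intervalIntegral.integral_const_mul,
          ← intervalIntegral.integral_add ((hi1.const_mul _).intervalIntegrable _ _)
            ((hi2.const_mul _).intervalIntegrable _ _)]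
        congr 1; ext s; ring
      rw [e1]
      have h7 := layer_le (h := fun x => w x - ε) (ε := ε) (M := M) (a := s₀) h2
        (fun x => (Real.exp_pos _).le)
        (hws.continuous.sub continuous_const).aestronglyMeasurable hε hsM
        ((ae_restrict_mem hΩm).mono fun x hx => by linarith [hM x hx]) 1
      have e2 : ∫ x in Ω, rexp (2 * v₂ x) * (rexp (2 * (w x - ε - ε)) - rexp (2 * s₀)) =
          rexp (-4 * ε) * μ₁ - rexp (2 * s₀) * μ₂ := by
        rw [hμ₁, hμ₂, ← integral_const_mul, ← integral_const_mul,
          ← integral_sub (h1.const_mul _) (h2.const_mul _)]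
        congr 1; ext x
        rw [mul_sub, ← Real.exp_add, ← Real.exp_add, ← Real.exp_add, ← Real.exp_add]
        simp only [hw]; ring_nf
      have e3 : ∀ s, ∫ x in Ω, rexp (2 * v₂ x) * step ((w x - ε - s) / ε) ^ 1 =
          levelMass Ω v₂ w ε (s + ε) := fun s => by
        rw [levelMass]
        congr 1; ext x; rw [pow_one]; congr 3; ring
      simp_rw [e3] at h7
      rw [e2] at h7
      have h8 : t / 4 * m ^ 2 ≤ ∫ s in s₀..M, 2 * rexp (2 * s) * levelMass Ω v₂ w ε (s + ε) ^ 2 := by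
        have h9 : ∫ s in t / 8..t / 4, 2 * rexp (2 * s) * levelMass Ω v₂ w ε (s + ε) ^ 2 ≤
            ∫ s in s₀..M, 2 * rexp (2 * s) * levelMass Ω v₂ w ε (s + ε) ^ 2 :=
          intervalIntegral.integral_mono_interval hs₀t (by linarith) (by linarith)
            (Eventually.of_forall fun s => by positivity) (hi2.intervalIntegrable _ _)
        have h10 : ∫ s in t / 8..t / 4, 2 * m ^ 2 ≤
            ∫ s in t / 8..t / 4, 2 * rexp (2 * s) * levelMass Ω v₂ w ε (s + ε) ^ 2 := by
          refine intervalIntegral.integral_mono_on (by linarith) (by simp)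
            (hi2.intervalIntegrable _ _) fun s hs => ?_
          have h11 : m ≤ levelMass Ω v₂ w ε (s + ε) :=
            levelMass_le_levelMass h2 hws.continuous (by linarith) hε (by linarith [hs.2])
          have h12 : 1 ≤ rexp (2 * s) := Real.one_le_exp (by linarith [hs.1])
          nlinarith [pow_le_pow_left₀ hm0.le h11 2, sq_nonneg m]
        rw [intervalIntegral.integral_const, smul_eq_mul] at h10
        linarith
      have h13 := mul_le_mul_of_nonneg_left h7 (by positivity : 0 ≤ 4 * π)
      have h14 := mul_le_mul_of_nonneg_left h8 (by linarith [h.lt_one] : 0 ≤ 1 - k)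
      linarith
    have hlim : Tendsto (fun ε => rexp (-(4 * (C * ε))) *
        (4 * π * (rexp (-4 * ε) * μ₁ - rexp (2 * s₀) * μ₂) + κ)) (𝓝[>] 0)
        (𝓝 (4 * π * (μ₁ - rexp (2 * s₀) * μ₂) + κ)) := by
      have : Continuous fun ε => rexp (-(4 * (C * ε))) *
        (4 * π * (rexp (-4 * ε) * μ₁ - rexp (2 * s₀) * μ₂) + κ) := by fun_prop
      simpa using (this.tendsto 0).mono_left (nhdsWithin_le_nhds (s := Ioi 0))
    refine le_of_tendsto hlim ?_
    filter_upwards [self_mem_nhdsWithin, nhdsWithin_le_nhds (Iio_mem_nhds hs₀)] with ε h3 h4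
    exact hε ε h3 (le_of_lt h4)
  have hexp : Tendsto (fun s₀ : ℝ => rexp (2 * s₀)) (𝓝[>] 0) (𝓝 1) := by
    have : Continuous fun s₀ : ℝ => rexp (2 * s₀) := by fun_prop
    simpa using (this.tendsto 0).mono_left (nhdsWithin_le_nhds (s := Ioi 0))
  have hl : Tendsto (fun s₀ => 4 * π * (μ₁ - rexp (2 * s₀) * μ₂) + κ) (𝓝[>] 0)
      (𝓝 (4 * π * (μ₁ - 1 * μ₂) + κ)) :=
    (((hexp.mul_const μ₂).const_sub μ₁).const_mul _).add_const κ
  have hr : Tendsto (fun s₀ => μ₁ ^ 2 - rexp (2 * s₀) * levelMass Ω v₂ w s₀ (2 * s₀) ^ 2) (𝓝[>] 0)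
      (𝓝 (μ₁ ^ 2 - 1 * μ₂ ^ 2)) :=
    (hexp.mul ((tendsto_levelMass hΩm h2 hws.continuous hpos).pow 2)).const_sub _
  have hfin := le_of_tendsto_of_tendsto hl hr (by
    filter_upwards [self_mem_nhdsWithin,
      nhdsWithin_le_nhds (Iio_mem_nhds (by linarith : (0:ℝ) < t / 8))] with s h3 h4
    exact key s h3 (le_of_lt h4))
  by_contra! hle
  nlinarith [mul_nonneg (sub_nonneg.2 hμ) (sub_nonneg.2 hle)]

end SphereCovering

section Components

open Topology Filter Set

/-- `C` is a connected component of `W`. -/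
def IsComp (W C : Set ℂ) : Prop := ∃ y ∈ W, C = connectedComponentIn W y

variable {W C D : Set ℂ}

theorem IsComp.isOpen (h : IsComp W C) (hW : IsOpen W) : IsOpen C := by
  obtain ⟨y, -, rfl⟩ := h
  exact hW.connectedComponentIn

theorem IsComp.subset (h : IsComp W C) : C ⊆ W := by
  obtain ⟨y, -, rfl⟩ := h
  exact connectedComponentIn_subset _ _

theorem IsComp.isPreconnected (h : IsComp W C) : IsPreconnected C := by
  obtain ⟨y, -, rfl⟩ := h
  exact isPreconnected_connectedComponentIn

theorem IsComp.nonempty (h : IsComp W C) : C.Nonempty := by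
  obtain ⟨y, hy, rfl⟩ := h
  exact ⟨y, mem_connectedComponentIn hy⟩

theorem IsComp.eq_of_mem (h : IsComp W C) {x : ℂ} (hx : x ∈ C) : C = connectedComponentIn W x := by
  obtain ⟨y, -, rfl⟩ := h
  exact connectedComponentIn_eq hx

theorem IsComp.subset_of_isPreconnected (h : IsComp W C) {V : Set ℂ} (hV : IsPreconnected V)
    (hVW : V ⊆ W) (hm : (V ∩ C).Nonempty) : V ⊆ C := by
  obtain ⟨x, hxV, hxC⟩ := hm
  rw [h.eq_of_mem hxC]
  exact hV.subset_connectedComponentIn hxV hVW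

theorem IsComp.eq_of_inter (hC : IsComp W C) (hD : IsComp W D) (h : (C ∩ D).Nonempty) : C = D := by
  obtain ⟨x, hxC, hxD⟩ := h
  rw [hC.eq_of_mem hxC, hD.eq_of_mem hxD]

theorem IsComp.disjoint (hC : IsComp W C) (hD : IsComp W D) (h : C ≠ D) : Disjoint C D := by
  rw [disjoint_iff_inter_eq_empty, ← not_nonempty_iff_eq_empty]
  exact fun h' => h (hC.eq_of_inter hD h')

theorem not_isBounded_univ_complex : ¬ Bornology.IsBounded (univ : Set ℂ) := by
  intro h
  obtain ⟨R, hR⟩ := h.exists_norm_le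
  have := hR ((|R| + 1 : ℝ) : ℂ) (mem_univ _)
  rw [Complex.norm_real, Real.norm_of_nonneg (by positivity)] at this
  linarith [le_abs_self R]

theorem frontier_nonempty_of_isBounded {V : Set ℂ} (hV : Bornology.IsBounded V) (hne : V.Nonempty) :
    (frontier V).Nonempty := by
  rw [nonempty_iff_ne_empty, Ne, frontier_eq_empty_iff]
  rintro (h | h)
  · exact hne.ne_empty h
  · exact not_isBounded_univ_complex (h ▸ hV)

theorem frontier_connectedComponentIn_compl_subset {K : Set ℂ} (hK : IsClosed K) (x : ℂ) :
    frontier (connectedComponentIn Kᶜ x) ⊆ K := by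
  intro y hy
  rcases closure_connectedComponentIn_compl_subset hK x hy.1 with h | h
  · exact absurd (hK.isOpen_compl.connectedComponentIn.interior_eq.symm ▸ h) hy.2
  · exact h

theorem inter_nonempty_of_frontier {U V : Set ℂ} (hU : IsOpen U) {y : ℂ} (hy : y ∈ frontier V)
    (hyU : y ∈ U) : (V ∩ U).Nonempty := by
  obtain ⟨t, ht1, ht2⟩ := mem_closure_iff.1 hy.1 U hU hyU
  exact ⟨t, ht2, ht1⟩

/-- A hole of a component lying in a hole of another component is contained in the latter hole. -/
theorem hole_subset_hole (hC : IsComp W C) (hD : IsComp W D) {K K' : Set ℂ}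
    (hK : IsCompact K) (hKC : K ⊆ C) (hK' : IsCompact K') (hKD : K' ⊆ D) {x x' : ℂ} (hx' : x' ∈ K'ᶜ)
    (hb : Bornology.IsBounded (connectedComponentIn Kᶜ x))
    (hb' : Bornology.IsBounded (connectedComponentIn K'ᶜ x'))
    (hDV : D ⊆ connectedComponentIn Kᶜ x) :
    connectedComponentIn K'ᶜ x' ⊆ connectedComponentIn Kᶜ x := by
  set V := connectedComponentIn Kᶜ x with hV
  set V' := connectedComponentIn K'ᶜ x' with hV'
  have hVo : IsOpen V := hK.isClosed.isOpen_compl.connectedComponentIn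
  have hVo' : IsOpen V' := hK'.isClosed.isOpen_compl.connectedComponentIn
  have hVK : V ⊆ Kᶜ := connectedComponentIn_subset _ _
  have hne' : V'.Nonempty := ⟨x', mem_connectedComponentIn hx'⟩
  have hne : V.Nonempty := hD.nonempty.mono hDV
  have hKne : K.Nonempty := by
    obtain ⟨y, hy⟩ := frontier_nonempty_of_isBounded hb hne
    exact ⟨y, frontier_connectedComponentIn_compl_subset hK.isClosed x hy⟩
  have hdisj : Disjoint C D := hC.disjoint hD fun h => by
    obtain ⟨y, hy⟩ := hKne
    exact hVK (hDV (h ▸ hKC hy)) hy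
  by_cases hm : (C ∩ V').Nonempty
  · exfalso
    have hCV' : C ⊆ V' := by
      obtain ⟨y, hyC, hyV⟩ := hm
      rw [hV', connectedComponentIn_eq hyV]
      exact hC.isPreconnected.subset_connectedComponentIn hyC fun t ht htK =>
        disjoint_left.1 hdisj ht (hKD htK)
    have hcl : closure (V ∪ V') ⊆ V ∪ V' := by
      rw [closure_union]
      rintro y (hy | hy)
      · rcases closure_connectedComponentIn_compl_subset hK.isClosed x hy with h | h
        · exact Or.inl h
        · exact Or.inr (hCV' (hKC h))
      · rcases closure_connectedComponentIn_compl_subset hK'.isClosed x' hy with h | h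
        · exact Or.inr h
        · exact Or.inl (hDV (hKD h))
    have hclopen : IsClopen (V ∪ V') := ⟨closure_subset_iff_isClosed.1 hcl, hVo.union hVo'⟩
    rcases isClopen_iff.1 hclopen with h | h
    · exact (hne.mono subset_union_left).ne_empty h
    · exact not_isBounded_univ_complex (h ▸ hb.union hb')
  · obtain ⟨y, hy⟩ := frontier_nonempty_of_isBounded hb' hne'
    obtain ⟨t, ht', ht⟩ := inter_nonempty_of_frontier hVo hy
      (hDV (hKD (frontier_connectedComponentIn_compl_subset hK'.isClosed x' hy)))
    rw [hV, connectedComponentIn_eq ht]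
    refine isPreconnected_connectedComponentIn.subset_connectedComponentIn ht' fun u hu huK => ?_
    exact hm ⟨u, hKC huK, hu⟩

/-- If every component that is not full has a component in one of its holes, and bounded regions
contain finitely many components, then every component is full or has a full one in a hole. -/
theorem exists_full_component
    (hfin : ∀ V : Set ℂ, Bornology.IsBounded V → {D | IsComp W D ∧ D ⊆ V}.Finite)
    (hhole : ∀ C, IsComp W C → ¬ Full C → ∃ K, IsCompact K ∧ K ⊆ C ∧ ∃ x ∈ Kᶜ,
      Bornology.IsBounded (connectedComponentIn Kᶜ x) ∧
        ∃ D, IsComp W D ∧ D ⊆ connectedComponentIn Kᶜ x)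
    (hC : IsComp W C) :
    ∃ D, IsComp W D ∧ Full D ∧ (D = C ∨ ∃ K, IsCompact K ∧ K ⊆ C ∧ ∃ x ∈ Kᶜ,
      Bornology.IsBounded (connectedComponentIn Kᶜ x) ∧ D ⊆ connectedComponentIn Kᶜ x) := by
  have key : ∀ n : ℕ, ∀ C K x, IsComp W C → IsCompact K → K ⊆ C → x ∈ Kᶜ →
      Bornology.IsBounded (connectedComponentIn Kᶜ x) →
      {D | IsComp W D ∧ D ⊆ connectedComponentIn Kᶜ x}.ncard ≤ n →
      (∃ D, IsComp W D ∧ D ⊆ connectedComponentIn Kᶜ x) →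
      ∃ D, IsComp W D ∧ Full D ∧ D ⊆ connectedComponentIn Kᶜ x := by
    intro n
    induction n with
    | zero =>
      intro C K x _ _ _ _ hb hn ⟨D, hD, hDV⟩
      have := (ncard_eq_zero (hfin _ hb)).1 (Nat.le_zero.1 hn)
      exact absurd (show D ∈ (∅ : Set (Set ℂ)) from this ▸ ⟨hD, hDV⟩) (notMem_empty _)
    | succ n ih =>
      intro C K x hC hK hKC hx hb hn ⟨D, hD, hDV⟩
      by_cases hF : Full D
      · exact ⟨D, hD, hF, hDV⟩
      obtain ⟨K', hK', hKD, x', hx', hb', D', hD', hDV'⟩ := hhole D hD hF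
      have hsub := hole_subset_hole hC hD hK hKC hK' hKD hx' hb hb' hDV
      have hlt : {D | IsComp W D ∧ D ⊆ connectedComponentIn K'ᶜ x'}.ncard <
          {D | IsComp W D ∧ D ⊆ connectedComponentIn Kᶜ x}.ncard := by
        refine ncard_lt_ncard ?_ (hfin _ hb)
        refine ⟨fun E hE => ⟨hE.1, hE.2.trans hsub⟩, fun h => ?_⟩
        have hDD : D ⊆ connectedComponentIn K'ᶜ x' :=
          (h (show D ∈ {D | IsComp W D ∧ D ⊆ connectedComponentIn Kᶜ x} from ⟨hD, hDV⟩)).2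
        obtain ⟨y, hy⟩ := frontier_nonempty_of_isBounded hb' ⟨x', mem_connectedComponentIn hx'⟩
        have hyK := frontier_connectedComponentIn_compl_subset hK'.isClosed x' hy
        exact connectedComponentIn_subset _ _ (hDD (hKD hyK)) hyK
      obtain ⟨E, hE, hEF, hEV⟩ := ih D K' x' hD hK' hKD hx' hb' (by omega) ⟨D', hD', hDV'⟩
      exact ⟨E, hE, hEF, hEV.trans hsub⟩
  by_cases hF : Full C
  · exact ⟨C, hC, hF, Or.inl rfl⟩
  · obtain ⟨K, hK, hKC, x, hx, hb, hD⟩ := hhole C hC hF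
    obtain ⟨E, hE, hEF, hEV⟩ := key _ C K x hC hK hKC hx hb le_rfl hD
    exact ⟨E, hE, hEF, Or.inr ⟨K, hK, hKC, x, hx, hb, hEV⟩⟩

/-- Full components obtained from distinct components touching a boundary point are distinct. -/
theorem full_components_distinct {S : Set ℂ} (hWS : W ⊆ S) (hS : Full S)
    {o : ℂ} (ho : o ∉ S) {C₁ C₂ D₁ D₂ : Set ℂ} (hC₁ : IsComp W C₁) (hC₂ : IsComp W C₂)
    (ho₁ : o ∈ closure C₁) (ho₂ : o ∈ closure C₂) (hne : C₁ ≠ C₂) (hD₁ : D₁.Nonempty)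
    (h₁ : D₁ = C₁ ∨ ∃ K, IsCompact K ∧ K ⊆ C₁ ∧ ∃ x ∈ Kᶜ,
      Bornology.IsBounded (connectedComponentIn Kᶜ x) ∧ D₁ ⊆ connectedComponentIn Kᶜ x)
    (h₂ : D₂ = C₂ ∨ ∃ K, IsCompact K ∧ K ⊆ C₂ ∧ ∃ x ∈ Kᶜ,
      Bornology.IsBounded (connectedComponentIn Kᶜ x) ∧ D₂ ⊆ connectedComponentIn Kᶜ x) :
    D₁ ≠ D₂ := by
  have hout : ∀ C, IsComp W C → ∀ K, IsCompact K → K ⊆ C → ∀ x,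
      Bornology.IsBounded (connectedComponentIn Kᶜ x) → o ∉ closure (connectedComponentIn Kᶜ x) := by
    intro C hC K hK hKC x hb h
    have hKS : K ⊆ S := hKC.trans (hC.subset.trans hWS)
    rcases closure_connectedComponentIn_compl_subset hK.isClosed x h with h | h
    · exact hS K hK hKS o ho (by rwa [← connectedComponentIn_eq h])
    · exact ho (hKS h)
  rintro rfl
  rcases h₁ with h₁ | ⟨K, hK, hKC, x, hx, hb, hDV⟩ <;> rcases h₂ with h₂ | ⟨L, hL, hLC, y, hy, hb', hDV'⟩
  · exact hne (h₁.symm.trans h₂)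
  · exact hout C₂ hC₂ L hL hLC y hb' (closure_mono hDV' (h₁ ▸ ho₁))
  · exact hout C₁ hC₁ K hK hKC x hb (closure_mono hDV (h₂ ▸ ho₂))
  · set V := connectedComponentIn Kᶜ x with hV
    set V' := connectedComponentIn Lᶜ y with hV'
    have hdisj := hC₁.disjoint hC₂ hne
    have hVo : IsOpen V := hK.isClosed.isOpen_compl.connectedComponentIn
    have hVo' : IsOpen V' := hL.isClosed.isOpen_compl.connectedComponentIn
    obtain ⟨t, ht⟩ := hD₁
    have hC₂V : ∀ u ∈ C₂, u ∉ V := fun u hu huV => by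
      refine hout C₁ hC₁ K hK hKC x hb (closure_mono ?_ ho₂)
      rw [connectedComponentIn_eq huV]
      exact hC₂.isPreconnected.subset_connectedComponentIn hu fun t ht htK =>
        disjoint_left.1 hdisj (hKC htK) ht
    have hC₁V : ∀ u ∈ C₁, u ∉ V' := fun u hu huV => by
      refine hout C₂ hC₂ L hL hLC y hb' (closure_mono ?_ ho₁)
      rw [connectedComponentIn_eq huV]
      exact hC₁.isPreconnected.subset_connectedComponentIn hu fun t ht htK =>
        disjoint_left.1 hdisj ht (hLC htK)
    have h12 : V ⊆ V' := by
      rw [hV', connectedComponentIn_eq (hDV' ht)]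
      exact isPreconnected_connectedComponentIn.subset_connectedComponentIn (hDV ht)
        fun u hu huL => hC₂V u (hLC huL) hu
    have h21 : V' ⊆ V := by
      rw [hV, connectedComponentIn_eq (hDV ht)]
      exact isPreconnected_connectedComponentIn.subset_connectedComponentIn (hDV' ht)
        fun u hu huK => hC₁V u (hKC huK) hu
    have hVV : V = V' := h12.antisymm h21
    obtain ⟨f, hf⟩ := frontier_nonempty_of_isBounded hb ⟨t, hDV ht⟩
    have h3 := frontier_connectedComponentIn_compl_subset hK.isClosed x hf
    have h4 := frontier_connectedComponentIn_compl_subset hL.isClosed y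
      (show f ∈ frontier V' from hVV ▸ hf)
    exact disjoint_left.1 hdisj (hKC h3) (hLC h4)

end Components

section Nodal

open Topology Filter Set

/-- Two conformal factors on the plane with asymptotically equal metrics of curvature at most one
and the same curvature defect. -/
structure NodalPair (v₁ v₂ : ℂ → ℝ) (k : ℝ) : Prop where
  smooth₁ : ContDiff ℝ ∞ v₁
  smooth₂ : ContDiff ℝ ∞ v₂
  flatLap_sub : ∀ x, flatLap (fun x => v₁ x - v₂ x) x = -(rexp (2 * v₁ x) - rexp (2 * v₂ x))
  nonneg : 0 ≤ k
  lt_one : k < 1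
  curvature₁ : ∀ x, -flatLap v₁ x ≤ k * rexp (2 * v₁ x)
  curvature₂ : ∀ x, -flatLap v₂ x ≤ k * rexp (2 * v₂ x)
  tendsto : Tendsto (fun x => v₁ x - v₂ x) (cocompact ℂ) (𝓝 0)
  integrable₁ : Integrable fun x => rexp (2 * v₁ x)
  integrable₂ : Integrable fun x => rexp (2 * v₂ x)
  bdd : ∃ B, ∀ x, rexp (2 * v₁ x) ≤ B ∧ rexp (2 * v₂ x) ≤ B

/-- The part of `S` where the two functions differ. -/
def diffSet (S : Set ℂ) (v₁ v₂ : ℂ → ℝ) : Set ℂ := {x | x ∈ S ∧ v₁ x ≠ v₂ x}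

variable {S D : Set ℂ} {v₁ v₂ : ℂ → ℝ} {k : ℝ}

theorem diffSet_comm : diffSet S v₁ v₂ = diffSet S v₂ v₁ := by
  ext x; simp only [diffSet, mem_ofPred_eq, ne_comm]

theorem NodalPair.symm (h : NodalPair v₁ v₂ k) : NodalPair v₂ v₁ k where
  smooth₁ := h.smooth₂
  smooth₂ := h.smooth₁
  flatLap_sub x := by
    have e : (fun x => v₂ x - v₁ x) = fun x => -(v₁ x - v₂ x) := by ext x; ring
    rw [e, flatLap_neg, h.flatLap_sub]; ring
  nonneg := h.nonneg
  lt_one := h.lt_one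
  curvature₁ := h.curvature₂
  curvature₂ := h.curvature₁
  tendsto := by simpa using h.tendsto.neg
  integrable₁ := h.integrable₂
  integrable₂ := h.integrable₁
  bdd := h.bdd.imp fun B hB x => (hB x).symm

theorem NodalPair.smooth_sub (h : NodalPair v₁ v₂ k) : ContDiff ℝ ∞ fun x => v₁ x - v₂ x :=
  h.smooth₁.sub h.smooth₂

theorem NodalPair.isOpen_diffSet (h : NodalPair v₁ v₂ k) (hS : IsOpen S) :
    IsOpen (diffSet S v₁ v₂) :=
  hS.inter (isOpen_ne_fun h.smooth₁.continuous h.smooth₂.continuous)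

theorem NodalPair.lt_or_gt (h : NodalPair v₁ v₂ k) (hD : IsPreconnected D)
    (hDS : D ⊆ diffSet S v₁ v₂) : (∀ x ∈ D, v₂ x < v₁ x) ∨ ∀ x ∈ D, v₁ x < v₂ x := by
  by_contra! hcon
  obtain ⟨⟨x, hx, hx'⟩, y, hy, hy'⟩ := hcon
  obtain ⟨z, hz, hz'⟩ := hD.intermediate_value hx hy h.smooth_sub.continuous.continuousOn
    (show (0 : ℝ) ∈ Icc (v₁ x - v₂ x) (v₁ y - v₂ y) from ⟨by linarith, by linarith⟩)
  exact (hDS hz).2 (sub_eq_zero.1 hz')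

theorem NodalPair.isCompact_superlevel (h : NodalPair v₁ v₂ k) (hS : IsOpen S)
    (hfr : ∀ x ∈ frontier S, v₁ x = v₂ x) (hD : IsComp (diffSet S v₁ v₂) D) {s : ℝ} (hs : 0 < s) :
    IsCompact {x | x ∈ D ∧ s ≤ v₁ x - v₂ x} := by
  have hc := h.smooth_sub.continuous
  refine Metric.isCompact_of_isClosed_isBounded ?_ ?_
  · rw [← closure_subset_iff_isClosed]
    intro x hx
    have hxs : s ≤ v₁ x - v₂ x :=
      closure_minimal (fun y hy => hy.2) (isClosed_le continuous_const hc) hx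
    have hne : v₁ x ≠ v₂ x := fun e => by rw [e, sub_self] at hxs; linarith
    have hxS : x ∈ S := by
      by_contra hxS
      refine hne (hfr x ⟨closure_mono (fun y hy => (hD.subset hy.1).1) hx, ?_⟩)
      rwa [hS.interior_eq]
    have hxW : x ∈ diffSet S v₁ v₂ := ⟨hxS, hne⟩
    refine ⟨?_, hxs⟩
    obtain ⟨y, hy1, hy2⟩ := mem_closure_iff.1 hx _ (h.isOpen_diffSet hS).connectedComponentIn
      (mem_connectedComponentIn hxW)
    rw [hD.eq_of_mem hy2.1, ← connectedComponentIn_eq hy1]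
    exact mem_connectedComponentIn hxW
  · have := h.tendsto.eventually (gt_mem_nhds hs)
    obtain ⟨K, hK, hKs⟩ := mem_cocompact.1 this
    refine hK.isBounded.subset fun x hx => ?_
    by_contra hxK
    exact absurd (hKs hxK) (not_lt.2 hx.2)

theorem NodalPair.comparison (h : NodalPair v₁ v₂ k) (hS : IsOpen S)
    (hfr : ∀ x ∈ frontier S, v₁ x = v₂ x) (hD : IsComp (diffSet S v₁ v₂) D) (hF : Full D)
    (hlt : ∀ x ∈ D, v₂ x < v₁ x) : Comparison D v₁ v₂ k where
  isOpen := hD.isOpen (h.isOpen_diffSet hS)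
  full := hF
  smooth₁ := h.smooth₁
  smooth₂ := h.smooth₂
  lt := hlt
  compact _ hs := h.isCompact_superlevel hS hfr hD hs
  flatLap_sub x _ := h.flatLap_sub x
  nonneg := h.nonneg
  lt_one := h.lt_one
  curvature_le x _ := h.curvature₂ x

theorem NodalPair.mass_gt (h : NodalPair v₁ v₂ k) (hS : IsOpen S)
    (hfr : ∀ x ∈ frontier S, v₁ x = v₂ x) (hD : IsComp (diffSet S v₁ v₂) D) (hF : Full D) :
    4 * π < ∫ x in D, (rexp (2 * v₁ x) + rexp (2 * v₂ x)) := by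
  rw [integral_add h.integrable₁.integrableOn h.integrable₂.integrableOn]
  rcases h.lt_or_gt hD.isPreconnected hD.subset with hlt | hlt
  · exact (h.comparison hS hfr hD hF hlt).mass_gt h.integrable₁.integrableOn
      h.integrable₂.integrableOn hD.nonempty
  · rw [add_comm]
    rw [diffSet_comm] at hD
    exact (h.symm.comparison hS (fun x hx => (hfr x hx).symm) hD hF hlt).mass_gt
      h.integrable₂.integrableOn h.integrable₁.integrableOn hD.nonempty

/-- A Faber-Krahn type lower bound for the area of nodal domains. -/
theorem NodalPair.area_ge_of_lt (h : NodalPair v₁ v₂ k) (hS : IsOpen S)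
    (hfr : ∀ x ∈ frontier S, v₁ x = v₂ x) (hD : IsComp (diffSet S v₁ v₂) D)
    (hlt : ∀ x ∈ D, v₂ x < v₁ x) (hb : Bornology.IsBounded D) {B : ℝ}
    (hB : ∀ x, rexp (2 * v₁ x) ≤ B ∧ rexp (2 * v₂ x) ≤ B) : π ≤ B * volume.real D := by
  have hDo := hD.isOpen (h.isOpen_diffSet hS)
  set w : ℂ → ℝ := fun x => v₁ x - v₂ x with hw
  have hws : ContDiff ℝ ∞ w := h.smooth_sub
  have hwc := hws.continuous
  have hw0 : ∀ x ∈ D, 0 < w x := fun x hx => sub_pos.2 (hlt x hx)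
  have hfinD : volume D ≠ ⊤ := hb.measure_lt_top.ne
  have hA : 0 < volume.real D :=
    ENNReal.toReal_pos (hDo.measure_pos volume hD.nonempty).ne' hfinD
  obtain ⟨M, hM⟩ := hb.isCompact_closure.exists_bound_of_continuousOn hwc.continuousOn
  have hM' : ∀ x ∈ D, |w x| ≤ M := fun x hx => hM x (subset_closure hx)
  have hM0 : 0 ≤ M := by
    obtain ⟨x, hx⟩ := hD.nonempty
    exact (abs_nonneg _).trans (hM' x hx)
  have hInt : ∀ f : ℂ → ℝ, Continuous f → IntegrableOn f D := fun f hf =>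
    (hf.continuousOn.integrableOn_compact hb.isCompact_closure).mono_set subset_closure
  set F : ℝ → ℝ := fun t => ∫ x in D, rexp (2 * (t * w x)) with hF
  have hFc : ContinuousOn F (Icc 0 (volume.real D / (2 * ∫ x in D, w x))) := by
    intro t₀ _
    refine (continuousAt_of_dominated (bound := fun _ => rexp (2 * ((|t₀| + 1) * M))) ?_ ?_ ?_ ?_).continuousWithinAt
    · exact Eventually.of_forall fun t => by
        have : Continuous fun x => rexp (2 * (t * w x)) := by fun_prop
        exact this.aestronglyMeasurable
    · have : ∀ᶠ t in 𝓝 t₀, |t| < |t₀| + 1 :=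
        continuous_abs.continuousAt.eventually (gt_mem_nhds (by linarith))
      filter_upwards [this] with t ht
      refine (ae_restrict_iff' hDo.measurableSet).2 (Eventually.of_forall fun x hx => ?_)
      rw [Real.norm_of_nonneg (Real.exp_pos _).le]
      refine Real.exp_le_exp.2 (mul_le_mul_of_nonneg_left ?_ zero_le_two)
      calc t * w x ≤ |t * w x| := le_abs_self _
        _ = |t| * |w x| := abs_mul _ _
        _ ≤ (|t₀| + 1) * M := mul_le_mul ht.le (hM' x hx) (abs_nonneg _) (by positivity)
    · exact hInt _ continuous_const
    · exact Eventually.of_forall fun x => by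
        have : Continuous fun t => rexp (2 * (t * w x)) := by fun_prop
        exact this.continuousAt
  have hwpos : 0 < ∫ x in D, w x := by
    rw [setIntegral_pos_iff_support_of_nonneg_ae ?_ (hInt _ hwc)]
    · have : Function.support w ∩ D = D := inter_eq_right.2 fun x hx => (hw0 x hx).ne'
      rw [this]
      exact hDo.measure_pos volume hD.nonempty
    · exact (ae_restrict_iff' hDo.measurableSet).2 (Eventually.of_forall fun x hx => (hw0 x hx).le)
  set b := volume.real D / (2 * ∫ x in D, w x) with hbdef
  have hb0 : 0 ≤ b := by positivity
  have hF0 : F 0 = volume.real D := by simp [hF]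
  have hFb : 2 * volume.real D ≤ F b := by
    have h1 : ∫ x in D, (1 + 2 * b * w x) ≤ F b :=
      integral_mono (hInt _ (by fun_prop)) (hInt _ (by fun_prop)) fun x => by
        have := Real.add_one_le_exp (2 * (b * w x))
        simp only
        linarith
    rw [integral_add (hInt _ continuous_const) (hInt _ (by fun_prop)), integral_const_mul] at h1
    have h2 : 2 * b * ∫ x in D, w x = volume.real D := by rw [hbdef]; field_simp
    simp only [integral_const, MeasurableSet.univ, measureReal_restrict_apply, univ_inter,
      smul_eq_mul, mul_one] at h1
    linarith
  obtain ⟨t, ht, hFt⟩ := intermediate_value_Icc hb0 hFc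
    (show 2 * volume.real D ∈ Icc (F 0) (F b) from ⟨by rw [hF0]; linarith, hFb⟩)
  have ht0 : 0 < t := by
    rcases ht.1.eq_or_lt with e | e
    · rw [← e, hF0] at hFt; linarith
    · exact e
  have hB0 : 0 ≤ B := (Real.exp_pos _).le.trans (hB 0).1
  have htw : ContDiff ℝ ∞ fun x => t * w x := contDiff_const.mul hws
  have hlap : ∀ x ∈ D, -flatLap (fun x => t * w x) x ≤ B * rexp (2 * (t * w x)) := by
    intro x hx
    have hj : ContDiff ℝ ∞ fun r : ℝ => t * r := contDiff_const.mul contDiff_id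
    have e : deriv (fun r : ℝ => t * r) = fun _ => t := by ext r; simp
    rw [flatLap_comp hj hws, e, h.flatLap_sub]
    have h1 : rexp (2 * v₁ x) - rexp (2 * v₂ x) ≤ B * (2 * w x) := by
      have e2 : rexp (2 * v₂ x) = rexp (2 * v₁ x) * rexp (-(2 * w x)) := by
        rw [← Real.exp_add]; congr 1; simp only [hw]; ring
      have h3 := Real.add_one_le_exp (-(2 * w x))
      have h4 := mul_le_mul_of_nonneg_left h3 (Real.exp_pos (2 * v₁ x)).le
      have h5 := mul_le_mul_of_nonneg_right (hB x).1 (by linarith [hw0 x hx] : 0 ≤ 2 * w x)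
      rw [e2]; linarith
    have h2 := mul_le_mul_of_nonneg_left (Real.add_one_le_exp (2 * (t * w x))) hB0
    have h3 := mul_le_mul_of_nonneg_left h1 ht0.le
    simp only [deriv_const, zero_mul]
    linarith
  have hcore : ∀ ε : ℝ, 0 < ε →
      4 * π * (2 * volume.real D - rexp (2 * ε) * volume.real D) ≤ B * (2 * volume.real D) ^ 2 := by
    intro ε hε
    have := bol_core hDo hb (h.isCompact_superlevel hS hfr hD (div_pos hε ht0)) (fun x hx => hx.1)
      htw (differentiable_const (ε : ℂ)) (fun x hx hxK => by
        have : w x < ε / t := by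
          by_contra! h'
          exact hxK ⟨hx, h'⟩
        rw [lt_div_iff₀ ht0] at this
        simp only [Complex.ofReal_re]
        linarith) hB0 hlap
    have e : ∫ x in D, rexp (2 * (t * w x)) = 2 * volume.real D := hFt
    rw [e] at this
    simpa [mul_comm] using this
  have hlim : 4 * π * (2 * volume.real D - rexp (2 * 0) * volume.real D) ≤
      B * (2 * volume.real D) ^ 2 := by
    have hc : Continuous fun ε : ℝ => 4 * π * (2 * volume.real D - rexp (2 * ε) * volume.real D) := by
      fun_prop
    exact le_of_tendsto ((hc.tendsto 0).mono_left (nhdsWithin_le_nhds (s := Ioi 0)))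
      (by filter_upwards [self_mem_nhdsWithin] with ε hε using hcore ε hε)
  simp only [mul_zero, Real.exp_zero, one_mul] at hlim
  have : volume.real D * π ≤ volume.real D * (B * volume.real D) := by nlinarith
  exact le_of_mul_le_mul_left this hA

theorem NodalPair.finite_components (h : NodalPair v₁ v₂ k) (hS : IsOpen S)
    (hfr : ∀ x ∈ frontier S, v₁ x = v₂ x) {V : Set ℂ} (hV : Bornology.IsBounded V) :
    {D | IsComp (diffSet S v₁ v₂) D ∧ D ⊆ V}.Finite := by
  obtain ⟨B, hB⟩ := h.bdd
  have hB0 : 0 < B := (Real.exp_pos _).trans_le (hB 0).1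
  have harea : ∀ D, IsComp (diffSet S v₁ v₂) D → D ⊆ V → π / B ≤ volume.real D := by
    intro D hD hDV
    rw [div_le_iff₀' hB0]
    rcases h.lt_or_gt hD.isPreconnected hD.subset with hlt | hlt
    · exact h.area_ge_of_lt hS hfr hD hlt (hV.subset hDV) hB
    · rw [diffSet_comm] at hD
      exact h.symm.area_ge_of_lt hS (fun x hx => (hfr x hx).symm) hD hlt (hV.subset hDV)
        fun x => (hB x).symm
  set I := {D | IsComp (diffSet S v₁ v₂) D ∧ D ⊆ V} with hI
  have hfin := Measure.finite_const_le_meas_of_disjoint_iUnion (ι := I) (volume : Measure ℂ)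
    (ε := ENNReal.ofReal (π / B)) (by simp; positivity) (As := fun D => (D : Set ℂ))
    (fun D => (D.2.1.isOpen (h.isOpen_diffSet hS)).measurableSet)
    (fun D E hDE => D.2.1.disjoint E.2.1 fun e => hDE (Subtype.ext e))
    ((hV.subset (iUnion_subset fun D => D.2.2)).measure_lt_top.ne)
  have huniv : {D : I | ENNReal.ofReal (π / B) ≤ volume (D : Set ℂ)} = univ := by
    ext D
    simp only [mem_ofPred_eq, mem_univ, iff_true]
    rw [ENNReal.ofReal_le_iff_le_toReal (hV.subset D.2.2).measure_lt_top.ne]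
    exact harea D D.2.1 D.2.2
  rw [huniv] at hfin
  exact finite_coe_iff.1 (finite_univ_iff.1 hfin)

theorem NodalPair.exists_hole_component_of_lt (h : NodalPair v₁ v₂ k) (hS : IsOpen S) (hSF : Full S)
    {C : Set ℂ} (hC : IsComp (diffSet S v₁ v₂) C) (hlt : ∀ x ∈ C, v₂ x < v₁ x) (hF : ¬ Full C) :
    ∃ K, IsCompact K ∧ K ⊆ C ∧ ∃ x ∈ Kᶜ, Bornology.IsBounded (connectedComponentIn Kᶜ x) ∧
      ∃ D, IsComp (diffSet S v₁ v₂) D ∧ D ⊆ connectedComponentIn Kᶜ x := by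
  simp only [Full, not_forall, not_not] at hF
  obtain ⟨K, hK, hKC, x, hxC, hb⟩ := hF
  have hxK : x ∈ Kᶜ := fun hx => hxC (hKC hx)
  refine ⟨K, hK, hKC, x, hxK, hb, ?_⟩
  set V := connectedComponentIn Kᶜ x with hV
  have hxV : x ∈ V := mem_connectedComponentIn hxK
  have hVo : IsOpen V := hK.isClosed.isOpen_compl.connectedComponentIn
  have hVS : V ⊆ S := by
    intro y hy
    by_contra hyS
    exact hSF K hK (fun z hz => (hC.subset (hKC hz)).1) y hyS
      (by rwa [← connectedComponentIn_eq hy])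
  by_cases hneg : ∃ y ∈ V, v₁ y < v₂ y
  · obtain ⟨y, hy, hlt'⟩ := hneg
    have hyW : y ∈ diffSet S v₁ v₂ := ⟨hVS hy, hlt'.ne⟩
    refine ⟨connectedComponentIn (diffSet S v₁ v₂) y, ⟨y, hyW, rfl⟩, ?_⟩
    rw [hV, connectedComponentIn_eq hy]
    refine isPreconnected_connectedComponentIn.subset_connectedComponentIn
      (mem_connectedComponentIn hyW) fun t ht htK => ?_
    have e : connectedComponentIn (diffSet S v₁ v₂) y = C := by
      rw [hC.eq_of_mem (hKC htK), connectedComponentIn_eq ht]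
    exact absurd (hlt y (e ▸ mem_connectedComponentIn hyW)) hlt'.not_gt
  · exfalso
    push Not at hneg
    obtain ⟨s, hs, hKs⟩ := exists_lt_forall_le_of_isCompact hK h.smooth_sub.continuous (s := 0)
      fun y hy => sub_pos.2 (hlt y (hKC hy))
    have hVpos := le_of_flatLap_nonpos hVo hb (closure_connectedComponentIn_compl_subset hK.isClosed x)
      h.smooth_sub (fun y hy => by
        rw [h.flatLap_sub]
        have : rexp (2 * v₂ y) ≤ rexp (2 * v₁ y) :=
          Real.exp_le_exp.2 (mul_le_mul_of_nonneg_left (hneg y hy) zero_le_two)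
        linarith) hKs
    have hVW : V ⊆ diffSet S v₁ v₂ := fun y hy => ⟨hVS hy, fun e => by
      have := hVpos y hy
      rw [e, sub_self] at this
      linarith⟩
    obtain ⟨y, hy⟩ := frontier_nonempty_of_isBounded hb ⟨x, hxV⟩
    have hyK := frontier_connectedComponentIn_compl_subset hK.isClosed x hy
    have hmeet := inter_nonempty_of_frontier (hC.isOpen (h.isOpen_diffSet hS)) hy (hKC hyK)
    exact hxC (hC.subset_of_isPreconnected isPreconnected_connectedComponentIn hVW hmeet hxV)

theorem NodalPair.exists_hole_component (h : NodalPair v₁ v₂ k) (hS : IsOpen S) (hSF : Full S)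
    {C : Set ℂ} (hC : IsComp (diffSet S v₁ v₂) C) (hF : ¬ Full C) :
    ∃ K, IsCompact K ∧ K ⊆ C ∧ ∃ x ∈ Kᶜ, Bornology.IsBounded (connectedComponentIn Kᶜ x) ∧
      ∃ D, IsComp (diffSet S v₁ v₂) D ∧ D ⊆ connectedComponentIn Kᶜ x := by
  rcases h.lt_or_gt hC.isPreconnected hC.subset with hlt | hlt
  · exact h.exists_hole_component_of_lt hS hSF hC hlt hF
  · rw [diffSet_comm] at hC ⊢
    exact h.symm.exists_hole_component_of_lt hS hSF hC hlt hF

/-- Every nodal domain is full or has a full nodal domain in one of its holes. -/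
theorem NodalPair.exists_full_component (h : NodalPair v₁ v₂ k) (hS : IsOpen S) (hSF : Full S)
    (hfr : ∀ x ∈ frontier S, v₁ x = v₂ x) {C : Set ℂ} (hC : IsComp (diffSet S v₁ v₂) C) :
    ∃ D, IsComp (diffSet S v₁ v₂) D ∧ Full D ∧ (D = C ∨ ∃ K, IsCompact K ∧ K ⊆ C ∧ ∃ x ∈ Kᶜ,
      Bornology.IsBounded (connectedComponentIn Kᶜ x) ∧ D ⊆ connectedComponentIn Kᶜ x) :=
  _root_.exists_full_component (fun _ hV => h.finite_components hS hfr hV)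
    (fun _ hC hF => h.exists_hole_component hS hSF hC hF) hC

/-- Three disjoint sets each containing the mass of a full nodal domain. -/
theorem NodalPair.mass_gt_of_disjoint (h : NodalPair v₁ v₂ k) {H D₁ D₂ D₃ : Set ℂ}
    (o₂ : IsOpen D₂) (o₃ : IsOpen D₃) (s₁ : D₁ ⊆ H)
    (s₂ : D₂ ⊆ H) (s₃ : D₃ ⊆ H) (d₁₂ : Disjoint D₁ D₂) (d₁₃ : Disjoint D₁ D₃) (d₂₃ : Disjoint D₂ D₃)
    (m₁ : 4 * π < ∫ x in D₁, (rexp (2 * v₁ x) + rexp (2 * v₂ x)))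
    (m₂ : 4 * π < ∫ x in D₂, (rexp (2 * v₁ x) + rexp (2 * v₂ x)))
    (m₃ : 4 * π < ∫ x in D₃, (rexp (2 * v₁ x) + rexp (2 * v₂ x))) :
    12 * π < ∫ x in H, (rexp (2 * v₁ x) + rexp (2 * v₂ x)) := by
  have hi : Integrable fun x => rexp (2 * v₁ x) + rexp (2 * v₂ x) := h.integrable₁.add h.integrable₂
  have h1 : ∫ x in D₁ ∪ D₂ ∪ D₃, (rexp (2 * v₁ x) + rexp (2 * v₂ x)) ≤
      ∫ x in H, (rexp (2 * v₁ x) + rexp (2 * v₂ x)) :=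
    setIntegral_mono_set hi.integrableOn
      (Eventually.of_forall fun x => by positivity)
      (LE.le.eventuallyLE (union_subset (union_subset s₁ s₂) s₃))
  rw [setIntegral_union (disjoint_union_left.2 ⟨d₁₃, d₂₃⟩) o₃.measurableSet hi.integrableOn
    hi.integrableOn, setIntegral_union d₁₂ o₂.measurableSet hi.integrableOn hi.integrableOn] at h1
  linarith

/-- Three nodal domains touching a common boundary point force a large mass. -/
theorem NodalPair.mass_gt_of_three (h : NodalPair v₁ v₂ k) (hS : IsOpen S) (hSF : Full S)
    (hfr : ∀ x ∈ frontier S, v₁ x = v₂ x) {o : ℂ} (ho : o ∉ S) {C₁ C₂ C₃ : Set ℂ}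
    (h₁ : IsComp (diffSet S v₁ v₂) C₁) (h₂ : IsComp (diffSet S v₁ v₂) C₂)
    (h₃ : IsComp (diffSet S v₁ v₂) C₃) (o₁ : o ∈ closure C₁) (o₂ : o ∈ closure C₂)
    (o₃ : o ∈ closure C₃) (n₁₂ : C₁ ≠ C₂) (n₁₃ : C₁ ≠ C₃) (n₂₃ : C₂ ≠ C₃) :
    12 * π < ∫ x in S, (rexp (2 * v₁ x) + rexp (2 * v₂ x)) := by
  have hW := h.isOpen_diffSet hS
  have hWS : diffSet S v₁ v₂ ⊆ S := fun x hx => hx.1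
  obtain ⟨D₁, c₁, f₁, e₁⟩ := h.exists_full_component hS hSF hfr h₁
  obtain ⟨D₂, c₂, f₂, e₂⟩ := h.exists_full_component hS hSF hfr h₂
  obtain ⟨D₃, c₃, f₃, e₃⟩ := h.exists_full_component hS hSF hfr h₃
  exact h.mass_gt_of_disjoint (c₂.isOpen hW) (c₃.isOpen hW)
    (c₁.subset.trans hWS) (c₂.subset.trans hWS) (c₃.subset.trans hWS)
    (c₁.disjoint c₂ (full_components_distinct hWS hSF ho h₁ h₂ o₁ o₂ n₁₂ c₁.nonempty e₁ e₂))
    (c₁.disjoint c₃ (full_components_distinct hWS hSF ho h₁ h₃ o₁ o₃ n₁₃ c₁.nonempty e₁ e₃))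
    (c₂.disjoint c₃ (full_components_distinct hWS hSF ho h₂ h₃ o₂ o₃ n₂₃ c₂.nonempty e₂ e₃))
    (h.mass_gt hS hfr c₁ f₁) (h.mass_gt hS hfr c₂ f₂) (h.mass_gt hS hfr c₃ f₃)

end Nodal

section Planarity

open Topology Filter Set

theorem exists_continuous_log {F : ℝ × ℝ → ℂ} (hF : Continuous F) (h0 : ∀ x, F x ≠ 0) :
    ∃ L : ℝ × ℝ → ℂ, Continuous L ∧ ∀ x, Complex.exp (L x) = F x := by
  obtain ⟨L, ⟨-, hL⟩, -⟩ := Complex.isCoveringMap_exp.existsUnique_continuousMap_lifts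
    (A := ℝ × ℝ) ⟨fun x => (⟨F x, h0 x⟩ : {z : ℂ // z ≠ 0}), by fun_prop⟩ 0 (Complex.log (F 0))
    (Subtype.ext (Complex.exp_log (h0 0)))
  exact ⟨L, L.continuous, fun x => congrArg Subtype.val (congrFun hL x)⟩

theorem log_increment {L g : ℝ → ℂ} (hL : Continuous L) (hg : Continuous g)
    (hs : ∀ t ∈ Icc (0 : ℝ) 1, g t ∈ Complex.slitPlane) {c : ℂ}
    (he : ∀ t, Complex.exp (L t) = c * g t) :
    (L 1).im - (L 0).im = (g 1).arg - (g 0).arg := by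
  set D : ℝ → ℂ := fun t => L t - Complex.log (g t) with hD
  have hDc : ContinuousOn D (Icc 0 1) := fun t ht =>
    (hL.continuousAt.sub (hg.continuousAt.clog (hs t ht))).continuousWithinAt
  have hDe : ∀ t ∈ Icc (0 : ℝ) 1, Complex.exp (D t) = c := by
    intro t ht
    have h0 : g t ≠ 0 := Complex.slitPlane_ne_zero (hs t ht)
    rw [hD, Complex.exp_sub, he, Complex.exp_log h0, mul_div_assoc, div_self h0, mul_one]
  have hInt : ∀ t ∈ Icc (0 : ℝ) 1, ∃ n : ℤ, D t = D 0 + n * (2 * π * Complex.I) := fun t ht =>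
    Complex.exp_eq_exp_iff_exists_int.1 ((hDe t ht).trans (hDe 0 (by simp)).symm)
  set h : ℝ → ℝ := fun t => ((D t).im - (D 0).im) / (2 * π) with hh
  have hhc : ContinuousOn h (Icc 0 1) :=
    ((Complex.continuous_im.comp_continuousOn hDc).sub continuousOn_const).div_const _
  have hhn : ∀ t ∈ Icc (0 : ℝ) 1, ∃ n : ℤ, h t = n := by
    intro t ht
    obtain ⟨n, hn⟩ := hInt t ht
    refine ⟨n, ?_⟩
    rw [hh]
    simp only
    rw [hn, div_eq_iff (by positivity)]
    simp
  have hzero : h 1 = 0 := by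
    obtain ⟨n, hn⟩ := hhn 1 (by simp)
    rcases lt_trichotomy n 0 with hn0 | hn0 | hn0
    · exfalso
      have : (n : ℝ) ≤ -1 := by exact_mod_cast (by omega : n ≤ -1)
      obtain ⟨t, ht, htt⟩ := intermediate_value_Icc' zero_le_one hhc
        (show (-1 / 2 : ℝ) ∈ Icc (h 1) (h 0) from ⟨by rw [hn]; linarith, by simp [hh]; norm_num⟩)
      obtain ⟨m, hm⟩ := hhn t ht
      rw [hm] at htt
      have : (2 * m : ℤ) = -1 := by
        have : (2 * m : ℝ) = -1 := by linarith
        exact_mod_cast this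
      omega
    · rw [hn, hn0]; simp
    · exfalso
      have : (1 : ℝ) ≤ n := by exact_mod_cast (by omega : 1 ≤ n)
      obtain ⟨t, ht, htt⟩ := intermediate_value_Icc zero_le_one hhc
        (show (1 / 2 : ℝ) ∈ Icc (h 0) (h 1) from ⟨by simp [hh], by rw [hn]; linarith⟩)
      obtain ⟨m, hm⟩ := hhn t ht
      rw [hm] at htt
      have : (2 * m : ℤ) = 1 := by
        have : (2 * m : ℝ) = 1 := by linarith
        exact_mod_cast this
      omega
  rw [hh] at hzero
  simp only at hzero
  rw [div_eq_zero_iff] at hzero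
  have := hzero.resolve_right (by positivity)
  simp only [hD, Complex.sub_im, Complex.log_im] at this
  linarith

/-- Two continuous paths whose difference has the boundary behaviour of a nontrivial loop meet. -/
theorem exists_eq_of_winding {a b : ℝ → ℂ} (ha : Continuous a) (hb : Continuous b)
    (h0 : ∀ s ∈ Icc (0 : ℝ) 1, a s - b 0 ∈ Complex.slitPlane)
    (h1 : ∀ s ∈ Icc (0 : ℝ) 1, a s - b 1 ∈ Complex.slitPlane)
    (h2 : ∀ t ∈ Icc (0 : ℝ) 1, -(a 0 - b t) ∈ Complex.slitPlane)
    (h3 : ∀ t ∈ Icc (0 : ℝ) 1, -(a 1 - b t) ∈ Complex.slitPlane)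
    (i00 : (a 0 - b 0).im < 0) (i10 : 0 < (a 1 - b 0).im) (i11 : (a 1 - b 1).im < 0)
    (i01 : (a 0 - b 1).im < 0) : ∃ s t, a s = b t := by
  by_contra! hne
  obtain ⟨L, hL, hLe⟩ := exists_continuous_log (F := fun x => a x.1 - b x.2) (by fun_prop)
    fun x => sub_ne_zero.2 (hne _ _)
  have e0 := log_increment (L := fun s => L (s, 0)) (by fun_prop) (by fun_prop) h0
    (c := 1) fun s => by rw [hLe, one_mul]
  have e1 := log_increment (L := fun s => L (s, 1)) (by fun_prop) (by fun_prop) h1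
    (c := 1) fun s => by rw [hLe, one_mul]
  have e2 := log_increment (L := fun t => L (0, t)) (by fun_prop) (by fun_prop) h2
    (c := -1) fun t => by rw [hLe]; ring
  have e3 := log_increment (L := fun t => L (1, t)) (by fun_prop) (by fun_prop) h3
    (c := -1) fun t => by rw [hLe]; ring
  rw [Complex.arg_neg_eq_arg_add_pi_of_im_neg i00, Complex.arg_neg_eq_arg_add_pi_of_im_neg i01] at e2
  rw [Complex.arg_neg_eq_arg_add_pi_of_im_neg i11, Complex.arg_neg_eq_arg_sub_pi_of_im_pos i10] at e3
  linarith [Real.pi_pos]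

/-- Rays to the left end of the plane inside two disjoint connected sets do not alternate. -/
theorem not_disjoint_of_alternating {A B : Set ℂ} (hA : IsPathConnected A) (hB : IsPathConnected B)
    {m θ₁ θ₂ θ₃ θ₄ : ℝ} (h12 : θ₁ < θ₂) (h23 : θ₂ < θ₃) (h34 : θ₃ < θ₄)
    (r₁ : ∀ x ≤ m, (⟨x, θ₁⟩ : ℂ) ∈ A) (r₂ : ∀ x ≤ m, (⟨x, θ₂⟩ : ℂ) ∈ B)
    (r₃ : ∀ x ≤ m, (⟨x, θ₃⟩ : ℂ) ∈ A) (r₄ : ∀ x ≤ m, (⟨x, θ₄⟩ : ℂ) ∈ B) : ¬ Disjoint A B := by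
  intro hd
  have hc : ∀ (θ : ℝ), Continuous fun x : ℝ => (⟨x, θ⟩ : ℂ) := fun θ => by
    have : (fun x : ℝ => (⟨x, θ⟩ : ℂ)) = fun x : ℝ => (x : ℂ) + θ * Complex.I := by
      ext x; apply Complex.ext <;> simp
    rw [this]; fun_prop
  have hseg : ∀ (θ x y : ℝ), x ≤ y → JoinedIn ((fun x : ℝ => (⟨x, θ⟩ : ℂ)) '' Icc x y) ⟨x, θ⟩ ⟨y, θ⟩ := by
    intro θ x y hxy
    have hp : IsPathConnected (Icc x y) := (convex_Icc x y).isPathConnected ⟨x, left_mem_Icc.2 hxy⟩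
    exact (hp.image' (hc θ).continuousOn).joinedIn _ ⟨x, left_mem_Icc.2 hxy, rfl⟩ _
      ⟨y, right_mem_Icc.2 hxy, rfl⟩
  obtain ⟨γ, hγ⟩ := hA.joinedIn _ (r₁ m le_rfl) _ (r₃ m le_rfl)
  obtain ⟨η, hη⟩ := hB.joinedIn _ (r₂ m le_rfl) _ (r₄ m le_rfl)
  obtain ⟨M₁, hM₁⟩ := (isCompact_range γ.continuous).isBounded.exists_norm_le
  obtain ⟨M₂, hM₂⟩ := (isCompact_range η.continuous).isBounded.exists_norm_le
  obtain ⟨M, hM1, hM2, hM3⟩ : ∃ M : ℝ, M₁ < M ∧ M₂ < M ∧ -M ≤ m :=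
    ⟨max (max M₁ M₂ + 1) (-m), by
      have := le_max_left M₁ M₂; exact lt_of_lt_of_le (by linarith) (le_max_left _ _), by
      have := le_max_right M₁ M₂; exact lt_of_lt_of_le (by linarith) (le_max_left _ _), by
      have := le_max_right (max M₁ M₂ + 1) (-m); linarith⟩
  have hre : ∀ z : ℂ, -‖z‖ ≤ z.re := fun z => (abs_le.1 (Complex.abs_re_le_norm z)).1
  have hjoin : ∀ (ζ : Set ℂ) (x θ θ' : ℝ), x ≤ m → JoinedIn ζ ⟨m, θ⟩ ⟨m, θ'⟩ →
      JoinedIn ((fun x : ℝ => (⟨x, θ⟩ : ℂ)) '' Icc x m ∪ ζ ∪ (fun x : ℝ => (⟨x, θ'⟩ : ℂ)) '' Icc x m)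
        ⟨x, θ⟩ ⟨x, θ'⟩ := fun ζ x θ θ' hx hj =>
    (((hseg θ x m hx).mono (subset_union_left.trans subset_union_left)).trans
      (hj.mono (subset_union_right.trans subset_union_left))).trans
      ((hseg θ' x m hx).symm.mono subset_union_right)
  obtain ⟨a, ha⟩ := hjoin (range γ) (-M - 1) θ₁ θ₃ (by linarith) ⟨γ, fun t => mem_range_self t⟩
  obtain ⟨b, hb⟩ := hjoin (range η) (-M) θ₂ θ₄ hM3 ⟨η, fun t => mem_range_self t⟩
  have ha' : ∀ s, a.extend s ∈ _ := fun s => by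
    obtain ⟨t, ht⟩ : a.extend s ∈ range a := a.extend_range ▸ mem_range_self s
    exact ht ▸ ha t
  have hb' : ∀ s, b.extend s ∈ _ := fun s => by
    obtain ⟨t, ht⟩ : b.extend s ∈ range b := b.extend_range ▸ mem_range_self s
    exact ht ▸ hb t
  have hbre : ∀ t, -M ≤ (b.extend t).re := by
    intro t
    rcases hb' t with (⟨x, hx, e⟩ | ⟨x, e⟩) | ⟨x, hx, e⟩
    · rw [← e]; exact hx.1
    · have := hM₂ _ (mem_range_self x)
      rw [← e]
      linarith [hre (η x)]
    · rw [← e]; exact hx.1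
  have hare : ∀ s, (a.extend s).im = θ₁ ∨ -M < (a.extend s).re ∨ (a.extend s).im = θ₃ := by
    intro t
    rcases ha' t with (⟨x, hx, e⟩ | ⟨x, e⟩) | ⟨x, hx, e⟩
    · rw [← e]; exact Or.inl rfl
    · have := hM₁ _ (mem_range_self x)
      rw [← e]
      exact Or.inr (Or.inl (by linarith [hre (γ x)]))
    · rw [← e]; exact Or.inr (Or.inr rfl)
  obtain ⟨s, t, hst⟩ := exists_eq_of_winding a.continuous_extend b.continuous_extend
    (fun s _ => by
      rw [b.extend_zero, Complex.mem_slitPlane_iff]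
      rcases hare s with h | h | h
      · right; simp only [Complex.sub_im, h]; linarith
      · left; simp only [Complex.sub_re]; linarith
      · right; simp only [Complex.sub_im, h]; linarith)
    (fun s _ => by
      rw [b.extend_one, Complex.mem_slitPlane_iff]
      rcases hare s with h | h | h
      · right; simp only [Complex.sub_im, h]; linarith
      · left; simp only [Complex.sub_re]; linarith
      · right; simp only [Complex.sub_im, h]; linarith)
    (fun t _ => by
      rw [a.extend_zero, Complex.mem_slitPlane_iff]
      left
      simp only [Complex.neg_re, Complex.sub_re]
      linarith [hbre t])
    (fun t _ => by
      rw [a.extend_one, Complex.mem_slitPlane_iff]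
      left
      simp only [Complex.neg_re, Complex.sub_re]
      linarith [hbre t])
    (by simp only [a.extend_zero, b.extend_zero, Complex.sub_im]; linarith)
    (by simp only [a.extend_one, b.extend_zero, Complex.sub_im]; linarith)
    (by simp only [a.extend_one, b.extend_one, Complex.sub_im]; linarith)
    (by simp only [a.extend_zero, b.extend_one, Complex.sub_im]; linarith)
  have hAs : a.extend s ∈ A := by
    rcases ha' s with (⟨x, hx, e⟩ | ⟨x, e⟩) | ⟨x, hx, e⟩
    · exact e ▸ r₁ x hx.2
    · exact e ▸ hγ x
    · exact e ▸ r₃ x hx.2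
  have hBt : b.extend t ∈ B := by
    rcases hb' t with (⟨x, hx, e⟩ | ⟨x, e⟩) | ⟨x, hx, e⟩
    · exact e ▸ r₂ x hx.2
    · exact e ▸ hη x
    · exact e ▸ r₄ x hx.2
  exact disjoint_left.1 hd hAs (hst ▸ hBt)

/-- Radial segments at the origin inside two disjoint connected open subsets of the upper half
plane do not alternate. -/
theorem not_disjoint_of_alternating_rays {A B : Set ℂ} (hAo : IsOpen A) (hBo : IsOpen B)
    (hA : IsPreconnected A) (hB : IsPreconnected B) (hAH : ∀ z ∈ A, 0 < z.im)
    (hBH : ∀ z ∈ B, 0 < z.im) {δ θ₁ θ₂ θ₃ θ₄ : ℝ} (hδ : 0 < δ) (h01 : 0 < θ₁) (h12 : θ₁ < θ₂)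
    (h23 : θ₂ < θ₃) (h34 : θ₃ < θ₄) (h4 : θ₄ < π)
    (r₁ : ∀ r : ℝ, 0 < r → r < δ → (r * Complex.exp (θ₁ * Complex.I) : ℂ) ∈ A)
    (r₂ : ∀ r : ℝ, 0 < r → r < δ → (r * Complex.exp (θ₂ * Complex.I) : ℂ) ∈ B)
    (r₃ : ∀ r : ℝ, 0 < r → r < δ → (r * Complex.exp (θ₃ * Complex.I) : ℂ) ∈ A)
    (r₄ : ∀ r : ℝ, 0 < r → r < δ → (r * Complex.exp (θ₄ * Complex.I) : ℂ) ∈ B) :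
    ¬ Disjoint A B := by
  intro hd
  have hlogc : ∀ E : Set ℂ, (∀ z ∈ E, 0 < z.im) → ContinuousOn Complex.log E := fun E hE z hz =>
    (continuousAt_clog (Complex.mem_slitPlane_iff.2 (Or.inr (hE z hz).ne'))).continuousWithinAt
  have hpc : ∀ E : Set ℂ, IsOpen E → IsPreconnected E → E.Nonempty → (∀ z ∈ E, 0 < z.im) →
      IsPathConnected (Complex.log '' E) := fun E hE hEp hEn hEH =>
    (hE.isConnected_iff_isPathConnected.1 ⟨hEn, hEp⟩).image' (hlogc E hEH)
  have hray : ∀ (E : Set ℂ) (θ : ℝ), 0 < θ → θ < π →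
      (∀ r : ℝ, 0 < r → r < δ → (r * Complex.exp (θ * Complex.I) : ℂ) ∈ E) →
      ∀ x ≤ Real.log δ - 1, (⟨x, θ⟩ : ℂ) ∈ Complex.log '' E := by
    intro E θ hθ hθ' hr x hx
    refine ⟨_, hr (rexp x) (Real.exp_pos x) ?_, ?_⟩
    · rw [← Real.lt_log_iff_exp_lt hδ]; linarith
    · rw [Complex.ofReal_exp, ← Complex.exp_add, Complex.log_exp]
      · apply Complex.ext <;> simp
      · simp; linarith
      · simp; linarith
  have hδ2 : 0 < δ / 2 := by linarith
  refine not_disjoint_of_alternating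
    (hpc A hAo hA ⟨_, r₁ _ hδ2 (by linarith)⟩ hAH) (hpc B hBo hB ⟨_, r₂ _ hδ2 (by linarith)⟩ hBH)
    h12 h23 h34 (hray A θ₁ h01 (by linarith) r₁) (hray B θ₂ (by linarith) (by linarith) r₂)
    (hray A θ₃ (by linarith) (by linarith) r₃) (hray B θ₄ (by linarith) h4 r₄) ?_
  rw [disjoint_left]
  rintro _ ⟨z, hz, rfl⟩ ⟨z', hz', e⟩
  have h0 : ∀ z : ℂ, 0 < z.im → z ≠ 0 := fun z hz h => by simp [h] at hz
  have : z' = z := by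
    rw [← Complex.exp_log (h0 z' (hBH z' hz')), e, Complex.exp_log (h0 z (hAH z hz))]
  exact disjoint_left.1 hd hz (this ▸ hz')

end Planarity

section Alternating

open Topology Filter Set

theorem full_of_convex {S : Set ℂ} (hS : Convex ℝ S) (hSo : IsOpen S) : Full S := by
  intro K _ hKS x hx hb
  obtain ⟨f, hf⟩ := geometric_hahn_banach_open_point hS hSo hx
  obtain ⟨e, he, hfe⟩ : ∃ e : ℂ, ‖e‖ = 1 ∧ 0 ≤ f e := by
    rcases le_total 0 (f 1) with h | h
    · exact ⟨1, by simp, h⟩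
    · exact ⟨-1, by simp, by rw [map_neg]; linarith⟩
  have hsub : {y | f x ≤ f y} ⊆ connectedComponentIn Kᶜ x :=
    (convex_halfSpace_ge f.toLinearMap.isLinear (f x)).isPreconnected.subset_connectedComponentIn
      (le_refl (f x)) fun y hy hyK => absurd (hf y (hKS hyK)) (not_lt.2 hy)
  obtain ⟨R, hR⟩ := (hb.subset hsub).exists_norm_le
  have := hR (x + ((|R| + ‖x‖ + 1 : ℝ) : ℝ) • e) (by
    show f x ≤ f (x + ((|R| + ‖x‖ + 1 : ℝ) : ℝ) • e)
    rw [map_add, map_smul, smul_eq_mul]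
    have : 0 ≤ (|R| + ‖x‖ + 1) * f e := by positivity
    linarith)
  have h1 : ‖(|R| + ‖x‖ + 1) • e‖ = |R| + ‖x‖ + 1 := by
    rw [norm_smul, he, mul_one, Real.norm_of_nonneg (by positivity)]
  have h2 := norm_sub_le (x + (|R| + ‖x‖ + 1) • e) x
  rw [add_sub_cancel_left, h1] at h2
  linarith [le_abs_self R]

theorem convex_upperHalf : Convex ℝ {z : ℂ | 0 < z.im} :=
  convex_halfSpace_im_gt 0

theorem isOpen_upperHalf : IsOpen {z : ℂ | 0 < z.im} :=
  isOpen_lt continuous_const Complex.continuous_im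

variable {S : Set ℂ} {v₁ v₂ : ℂ → ℝ} {k : ℝ}

theorem exists_component_of_ray {δ θ : ℝ} (hδ : 0 < δ)
    (hr : ∀ r : ℝ, 0 < r → r < δ → (r * Complex.exp (θ * Complex.I) : ℂ) ∈ diffSet S v₁ v₂) :
    ∃ C, IsComp (diffSet S v₁ v₂) C ∧ 0 ∈ closure C ∧
      ∀ r : ℝ, 0 < r → r < δ → (r * Complex.exp (θ * Complex.I) : ℂ) ∈ C := by
  have hδ2 : δ / 2 ∈ Ioo 0 δ := ⟨by linarith, by linarith⟩
  have hpre : IsPreconnected ((fun r : ℝ => (r * Complex.exp (θ * Complex.I) : ℂ)) '' Ioo 0 δ) :=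
    isPreconnected_Ioo.image _ (by fun_prop)
  have hsub : (fun r : ℝ => (r * Complex.exp (θ * Complex.I) : ℂ)) '' Ioo 0 δ ⊆
      diffSet S v₁ v₂ := by
    rintro _ ⟨r, hr', rfl⟩
    exact hr r hr'.1 hr'.2
  have hin := hpre.subset_connectedComponentIn (mem_image_of_mem _ hδ2) hsub
  refine ⟨_, ⟨_, hr _ hδ2.1 hδ2.2, rfl⟩, ?_, fun r h0 h1 => hin ⟨r, ⟨h0, h1⟩, rfl⟩⟩
  refine closure_mono hin ?_
  have hc : Continuous fun r : ℝ => (r * Complex.exp (θ * Complex.I) : ℂ) := by fun_prop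
  have := image_closure_subset_closure_image hc (s := Ioo 0 δ)
  rw [closure_Ioo hδ.ne] at this
  exact this ⟨0, left_mem_Icc.2 hδ.le, by simp⟩

/-- If the difference is odd with four alternating nodal sectors in the half plane, then the mass
is large. -/
theorem NodalPair.mass_gt_of_alternating (h : NodalPair v₁ v₂ k)
    (hfr : ∀ z : ℂ, z.im = 0 → v₁ z = v₂ z) {δ θ₁ θ₂ θ₃ θ₄ : ℝ} (hδ : 0 < δ) (h01 : 0 < θ₁)
    (h12 : θ₁ < θ₂) (h23 : θ₂ < θ₃) (h34 : θ₃ < θ₄) (h4 : θ₄ < π)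
    (r₁ : ∀ r : ℝ, 0 < r → r < δ →
      v₂ (r * Complex.exp (θ₁ * Complex.I)) < v₁ (r * Complex.exp (θ₁ * Complex.I)))
    (r₂ : ∀ r : ℝ, 0 < r → r < δ →
      v₁ (r * Complex.exp (θ₂ * Complex.I)) < v₂ (r * Complex.exp (θ₂ * Complex.I)))
    (r₃ : ∀ r : ℝ, 0 < r → r < δ →
      v₂ (r * Complex.exp (θ₃ * Complex.I)) < v₁ (r * Complex.exp (θ₃ * Complex.I)))
    (r₄ : ∀ r : ℝ, 0 < r → r < δ →
      v₁ (r * Complex.exp (θ₄ * Complex.I)) < v₂ (r * Complex.exp (θ₄ * Complex.I))) :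
    12 * π < ∫ x in {z : ℂ | 0 < z.im}, (rexp (2 * v₁ x) + rexp (2 * v₂ x)) := by
  set H := {z : ℂ | 0 < z.im} with hH
  have hray : ∀ θ : ℝ, 0 < θ → θ < π → ∀ r : ℝ, 0 < r →
      (r * Complex.exp (θ * Complex.I) : ℂ) ∈ H := by
    intro θ h0 h1 r hr
    rw [hH, mem_ofPred_eq, Complex.exp_mul_I, ← Complex.ofReal_cos, ← Complex.ofReal_sin]
    have := Real.sin_pos_of_pos_of_lt_pi h0 h1
    simp only [Complex.mul_im, Complex.add_im, Complex.ofReal_re, Complex.ofReal_im, Complex.I_im,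
      Complex.I_re]
    simp only [mul_zero, mul_one, zero_mul, add_zero, zero_add]
    positivity
  have hδ2 : 0 < δ / 2 ∧ δ / 2 < δ := ⟨by linarith, by linarith⟩
  obtain ⟨C₁, c₁, o₁, m₁⟩ := exists_component_of_ray (S := H) hδ fun r h0 h1 =>
    ⟨hray θ₁ h01 (by linarith) r h0, (r₁ r h0 h1).ne'⟩
  obtain ⟨C₂, c₂, o₂, m₂⟩ := exists_component_of_ray (S := H) hδ fun r h0 h1 =>
    ⟨hray θ₂ (by linarith) (by linarith) r h0, (r₂ r h0 h1).ne⟩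
  obtain ⟨C₃, c₃, o₃, m₃⟩ := exists_component_of_ray (S := H) hδ fun r h0 h1 =>
    ⟨hray θ₃ (by linarith) (by linarith) r h0, (r₃ r h0 h1).ne'⟩
  obtain ⟨C₄, c₄, o₄, m₄⟩ := exists_component_of_ray (S := H) hδ fun r h0 h1 =>
    ⟨hray θ₄ (by linarith) h4 r h0, (r₄ r h0 h1).ne⟩
  have hdiff : ∀ {C D : Set ℂ}, IsComp (diffSet H v₁ v₂) C → ∀ {x y : ℂ}, x ∈ C → y ∈ D →
      v₂ x < v₁ x → v₁ y < v₂ y → C ≠ D := by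
    rintro C D hC x y hx hy h1 h2 rfl
    rcases h.lt_or_gt hC.isPreconnected hC.subset with h' | h'
    · exact absurd (h' y hy) h2.not_gt
    · exact absurd (h' x hx) h1.not_gt
  have n₁₂ : C₁ ≠ C₂ := hdiff c₁ (m₁ _ hδ2.1 hδ2.2) (m₂ _ hδ2.1 hδ2.2) (r₁ _ hδ2.1 hδ2.2)
    (r₂ _ hδ2.1 hδ2.2)
  have n₁₄ : C₁ ≠ C₄ := hdiff c₁ (m₁ _ hδ2.1 hδ2.2) (m₄ _ hδ2.1 hδ2.2) (r₁ _ hδ2.1 hδ2.2)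
    (r₄ _ hδ2.1 hδ2.2)
  have n₃₂ : C₃ ≠ C₂ := hdiff c₃ (m₃ _ hδ2.1 hδ2.2) (m₂ _ hδ2.1 hδ2.2) (r₃ _ hδ2.1 hδ2.2)
    (r₂ _ hδ2.1 hδ2.2)
  have hHF : Full H := full_of_convex convex_upperHalf isOpen_upperHalf
  have hfr' : ∀ x ∈ frontier H, v₁ x = v₂ x := fun x hx => by
    rw [hH, Complex.frontier_setOfPred_lt_im] at hx
    exact hfr x hx
  have h0H : (0 : ℂ) ∉ H := by simp [hH]
  by_cases n₁₃ : C₁ = C₃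
  · by_cases n₂₄ : C₂ = C₄
    · exfalso
      subst n₁₃ n₂₄
      have hW := h.isOpen_diffSet isOpen_upperHalf
      exact not_disjoint_of_alternating_rays (c₁.isOpen hW) (c₂.isOpen hW) c₁.isPreconnected
        c₂.isPreconnected (fun z hz => (c₁.subset hz).1) (fun z hz => (c₂.subset hz).1) hδ h01 h12
        h23 h34 h4 m₁ m₂ m₃ m₄ (c₁.disjoint c₂ n₁₂)
    · exact h.mass_gt_of_three isOpen_upperHalf hHF hfr' h0H c₁ c₂ c₄ o₁ o₂ o₄ n₁₂ n₁₄ n₂₄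
  · exact h.mass_gt_of_three isOpen_upperHalf hHF hfr' h0H c₁ c₂ c₃ o₁ o₂ o₃ n₁₂ n₁₃ n₃₂.symm

end Alternating

noncomputable section Vanishing

open Topology Filter Set

/-- All partial derivatives of order less than `n` vanish at the origin. -/
def Vanish : ℕ → (ℂ → ℝ) → Prop
  | 0, _ => True
  | n + 1, f => f 0 = 0 ∧ Vanish n (dir 1 f) ∧ Vanish n (dir Complex.I f)

theorem Vanish.of_succ {n : ℕ} : ∀ {f : ℂ → ℝ}, Vanish (n + 1) f → Vanish n f := by
  induction n with
  | zero => intro f _; trivial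
  | succ n ih => exact fun h => ⟨h.1, ih h.2.1, ih h.2.2⟩

theorem Vanish.mono {m n : ℕ} (hmn : m ≤ n) {f : ℂ → ℝ} (h : Vanish n f) : Vanish m f := by
  induction n, hmn using Nat.le_induction with
  | base => exact h
  | succ n _ ih => exact ih h.of_succ

theorem Vanish.add {n : ℕ} : ∀ {f g : ℂ → ℝ}, ContDiff ℝ ∞ f → ContDiff ℝ ∞ g → Vanish n f →
    Vanish n g → Vanish n fun x => f x + g x := by
  induction n with
  | zero => intros; trivial
  | succ n ih =>
    intro f g hf hg h1 h2
    have h : ∀ e, dir e (fun x => f x + g x) = fun x => dir e f x + dir e g x := fun e =>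
      funext fun x => dir_add e x (hf.diffAt x) (hg.diffAt x)
    refine ⟨by simp [h1.1, h2.1], ?_, ?_⟩ <;> rw [h]
    · exact ih (hf.dir _) (hg.dir _) h1.2.1 h2.2.1
    · exact ih (hf.dir _) (hg.dir _) h1.2.2 h2.2.2

theorem Vanish.mul {n : ℕ} : ∀ {f g : ℂ → ℝ}, ContDiff ℝ ∞ f → ContDiff ℝ ∞ g → Vanish n f →
    Vanish n fun x => g x * f x := by
  induction n with
  | zero => intros; trivial
  | succ n ih =>
    intro f g hf hg h
    have hd : ∀ e, dir e (fun x => g x * f x) = fun x => dir e g x * f x + g x * dir e f x := fun e =>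
      funext fun x => dir_mul e x (hg.diffAt x) (hf.diffAt x)
    have h1 := fun e => ih hf (hg.dir e) h.of_succ
    refine ⟨by simp [h.1], ?_, ?_⟩ <;> rw [hd]
    · exact (h1 _).add ((hg.dir _).mul hf) (hg.mul (hf.dir _)) (ih (hf.dir _) hg h.2.1)
    · exact (h1 _).add ((hg.dir _).mul hf) (hg.mul (hf.dir _)) (ih (hf.dir _) hg h.2.2)

theorem Vanish.neg {n : ℕ} {f : ℂ → ℝ} (hf : ContDiff ℝ ∞ f) (h : Vanish n f) :
    Vanish n fun x => -f x := by
  simpa using h.mul hf (contDiff_const (c := (-1 : ℝ)))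

theorem Vanish.sub {n : ℕ} {f g : ℂ → ℝ} (hf : ContDiff ℝ ∞ f) (hg : ContDiff ℝ ∞ g)
    (h1 : Vanish n f) (h2 : Vanish n g) : Vanish n fun x => f x - g x := by
  simpa [sub_eq_add_neg] using h1.add hf hg.neg (h2.neg hg)

theorem Vanish.comp {n : ℕ} {f : ℂ → ℝ} {j : ℝ → ℝ} (hj : ContDiff ℝ ∞ j) (hj0 : j 0 = 0)
    (hf : ContDiff ℝ ∞ f) (h : Vanish n f) : Vanish n fun x => j (f x) := by
  cases n with
  | zero => trivial
  | succ n =>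
    have hd : ∀ e, dir e (fun x => j (f x)) = fun x => deriv j (f x) * dir e f x := fun e =>
      funext fun x => dir_comp e x (hj.differentiable (by simp) _) (hf.diffAt x)
    have hj' : ContDiff ℝ ∞ fun x => deriv j (f x) := hj.deriv'.comp hf
    refine ⟨by simp [h.1, hj0], ?_, ?_⟩ <;> rw [hd]
    · exact h.2.1.mul (hf.dir _) hj'
    · exact h.2.2.mul (hf.dir _) hj'

theorem dir_eq_add {f : ℂ → ℝ} (e : ℂ) :
    dir e f = fun z => e.re * dir 1 f z + e.im * dir Complex.I f z :=
  funext fun z => dir_eq_gr f z e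

theorem Vanish.dir {n : ℕ} {f : ℂ → ℝ} (hf : ContDiff ℝ ∞ f) (h : Vanish (n + 1) f) (e : ℂ) :
    Vanish n (dir e f) := by
  rw [dir_eq_add]
  exact (h.2.1.mul (hf.dir _) contDiff_const).add (contDiff_const.mul (hf.dir _))
    (contDiff_const.mul (hf.dir _)) (h.2.2.mul (hf.dir _) contDiff_const)

theorem Vanish.comp_linear {n : ℕ} (L : ℂ →L[ℝ] ℂ) : ∀ {f : ℂ → ℝ}, ContDiff ℝ ∞ f → Vanish n f →
    Vanish n fun x => f (L x) := by
  induction n with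
  | zero => intros; trivial
  | succ n ih =>
    intro f hf h
    have hd : ∀ e, _root_.dir e (fun x => f (L x)) = fun x => _root_.dir (L e) f (L x) := fun e => by
      ext x
      have := ((hf.diffAt (L x)).hasFDerivAt.comp x L.hasFDerivAt).fderiv
      simp only [_root_.dir]
      change (fderiv ℝ (f ∘ L) x) e = _
      rw [this]; rfl
    refine ⟨by simp [h.1], ?_, ?_⟩ <;> rw [hd] <;> exact ih (hf.dir _) (h.dir hf _)

theorem Vanish.bound {n : ℕ} : ∀ {f : ℂ → ℝ}, ContDiff ℝ ∞ f → Vanish n f →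
    ∃ C, 0 ≤ C ∧ ∀ z : ℂ, ‖z‖ ≤ 1 → |f z| ≤ C * ‖z‖ ^ n := by
  induction n with
  | zero =>
    intro f hf _
    obtain ⟨C, hC⟩ := (isCompact_closedBall (0 : ℂ) 1).exists_bound_of_continuousOn
      hf.continuous.continuousOn
    refine ⟨|C|, abs_nonneg _, fun z hz => ?_⟩
    rw [pow_zero, mul_one]
    exact (hC z (by simpa using hz)).trans (le_abs_self _)
  | succ n ih =>
    intro f hf h
    obtain ⟨C₁, h₁, hC₁⟩ := ih (hf.dir 1) h.2.1
    obtain ⟨C₂, h₂, hC₂⟩ := ih (hf.dir Complex.I) h.2.2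
    refine ⟨C₁ + C₂, by positivity, fun z hz => ?_⟩
    have hb : ∀ x ∈ Metric.closedBall (0 : ℂ) ‖z‖, ‖fderiv ℝ f x‖ ≤ (C₁ + C₂) * ‖z‖ ^ n := by
      intro x hx
      have hxz : ‖x‖ ≤ ‖z‖ := by simpa using hx
      have hx1 := hxz.trans hz
      refine ContinuousLinearMap.opNorm_le_bound _ (by positivity) fun e => ?_
      have e1 : fderiv ℝ f x e = e.re * _root_.dir 1 f x + e.im * _root_.dir Complex.I f x :=
        dir_eq_gr f x e
      have hp : ‖x‖ ^ n ≤ ‖z‖ ^ n := pow_le_pow_left₀ (norm_nonneg _) hxz n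
      rw [e1, Real.norm_eq_abs]
      calc |e.re * _root_.dir 1 f x + e.im * _root_.dir Complex.I f x|
          ≤ |e.re| * |_root_.dir 1 f x| + |e.im| * |_root_.dir Complex.I f x| := by
            rw [← abs_mul, ← abs_mul]; exact abs_add_le _ _
        _ ≤ ‖e‖ * (C₁ * ‖z‖ ^ n) + ‖e‖ * (C₂ * ‖z‖ ^ n) := by
            gcongr
            · exact Complex.abs_re_le_norm e
            · exact (hC₁ x hx1).trans (by gcongr)
            · exact Complex.abs_im_le_norm e
            · exact (hC₂ x hx1).trans (by gcongr)
        _ = (C₁ + C₂) * ‖z‖ ^ n * ‖e‖ := by ring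
    have := (convex_closedBall (0 : ℂ) ‖z‖).norm_image_sub_le_of_norm_fderiv_le
      (fun x _ => hf.diffAt x) hb (by simp : (0 : ℂ) ∈ _) (by simp : z ∈ _)
    rw [h.1, sub_zero, sub_zero, Real.norm_eq_abs] at this
    rw [pow_succ, ← mul_assoc]
    exact this

theorem hasDerivAt_mul_pow (b : ℂ) (n : ℕ) (z : ℂ) :
    HasDerivAt (fun z : ℂ => b * z ^ (n + 1)) ((n + 1) * b * z ^ n) z := by
  have := (hasDerivAt_pow (n + 1) z).const_mul b
  refine this.congr_deriv ?_
  push_cast [Nat.add_sub_cancel]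
  ring

theorem dir_re_pow (b : ℂ) (n : ℕ) (e : ℂ) :
    dir e (fun z : ℂ => (b * z ^ (n + 1)).re) = fun z => ((n + 1) * b * e * z ^ n).re :=
  funext fun z => by rw [dir_re_of_hasDerivAt (hasDerivAt_mul_pow b n z)]; congr 1; ring

theorem contDiff_re_pow (b : ℂ) (n : ℕ) : ContDiff ℝ ∞ fun z : ℂ => (b * z ^ n).re :=
  contDiff_re_entire (Q := fun z => b * z ^ n) (by fun_prop)

theorem re_eq_zero_of_vanish {b : ℂ} {n : ℕ} (h : Vanish (n + 1) fun z : ℂ => (b * z ^ n).re) (z : ℂ) :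
    (b * z ^ n).re = 0 := by
  obtain ⟨C, hC0, hC⟩ := h.bound (contDiff_re_pow b n)
  have key : ∀ r : ℝ, 0 < r → r * ‖z‖ ≤ 1 → |(b * z ^ n).re| ≤ r * (C * ‖z‖ ^ (n + 1)) := by
    intro r hr hrz
    have hn : ‖(r : ℂ) * z‖ = r * ‖z‖ := by
      rw [norm_mul, Complex.norm_real, Real.norm_of_nonneg hr.le]
    have := hC (r * z) (by rw [hn]; exact hrz)
    have e : (b * ((r : ℂ) * z) ^ n).re = r ^ n * (b * z ^ n).re := by
      rw [mul_pow, mul_left_comm, ← Complex.ofReal_pow, Complex.re_ofReal_mul]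
    rw [e, hn, abs_mul, abs_of_nonneg (by positivity), mul_pow] at this
    have hp : 0 < r ^ n := by positivity
    refine le_of_mul_le_mul_left (this.trans_eq ?_) hp
    ring
  have hlim : Tendsto (fun r : ℝ => r * (C * ‖z‖ ^ (n + 1))) (𝓝[>] 0) (𝓝 0) := by
    have : Continuous fun r : ℝ => r * (C * ‖z‖ ^ (n + 1)) := by fun_prop
    simpa using (this.tendsto 0).mono_left (nhdsWithin_le_nhds (s := Ioi 0))
  have h2 : Tendsto (fun r : ℝ => r * ‖z‖) (𝓝[>] 0) (𝓝 0) := by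
    have : Continuous fun r : ℝ => r * ‖z‖ := by fun_prop
    simpa using (this.tendsto 0).mono_left (nhdsWithin_le_nhds (s := Ioi 0))
  refine abs_nonpos_iff.1 (ge_of_tendsto hlim ?_)
  filter_upwards [self_mem_nhdsWithin, h2.eventually (gt_mem_nhds zero_lt_one)] with r hr hr'
    using key r hr hr'.le

/-- The leading part of a function with small Laplacian is a harmonic homogeneous polynomial. -/
theorem Vanish.exists_leading {n : ℕ} : ∀ {w : ℂ → ℝ}, ContDiff ℝ ∞ w → Vanish (n + 1) w →
    Vanish n (flatLap w) → ∃ b : ℂ, Vanish (n + 2) fun z => w z - (b * z ^ (n + 1)).re := by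
  induction n with
  | zero =>
    intro w hw h _
    refine ⟨⟨_root_.dir 1 w 0, -_root_.dir Complex.I w 0⟩, by simp [h.1], ?_⟩
    have hd : ∀ b e, _root_.dir e (fun z => w z - (b * z ^ (0 + 1)).re) 0 =
        _root_.dir e w 0 - (b * e).re := by
      intro b e
      rw [dir_sub e 0 (hw.diffAt 0) ((contDiff_re_pow b _).diffAt 0), dir_re_pow]
      simp
    exact ⟨⟨by rw [hd]; simp, trivial, trivial⟩, ⟨by rw [hd]; simp, trivial, trivial⟩⟩
  | succ n ih =>
    intro w hw h hΔ
    have hcomm : ∀ e, flatLap (_root_.dir e w) = _root_.dir e (flatLap w) := by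
      intro e
      ext z
      have h1 : ∀ e', _root_.dir e' (_root_.dir e' (_root_.dir e w)) z =
          _root_.dir e (_root_.dir e' (_root_.dir e' w)) z := by
        intro e'
        have : _root_.dir e' (_root_.dir e w) = _root_.dir e (_root_.dir e' w) :=
          funext fun x => dir_comm hw _ _ _
        rw [this, dir_comm (hw.dir e')]
      have h2 : flatLap w = fun x => _root_.dir 1 (_root_.dir 1 w) x +
        _root_.dir Complex.I (_root_.dir Complex.I w) x := rfl
      rw [h2, flatLap, h1, h1, dir_add e z (((hw.dir _).dir _).diffAt z) (((hw.dir _).dir _).diffAt z)]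
    obtain ⟨b, hb⟩ := ih (hw.dir 1) h.2.1 (by rw [hcomm]; exact hΔ.2.1)
    obtain ⟨c, hc⟩ := ih (hw.dir Complex.I) h.2.2 (by rw [hcomm]; exact hΔ.2.2)
    have hdd : ∀ (a e e' : ℂ), _root_.dir e (fun z => _root_.dir e' w z - (a * z ^ (n + 1)).re) =
        fun z => _root_.dir e (_root_.dir e' w) z - ((n + 1) * a * e * z ^ n).re := by
      intro a e e'
      ext z
      rw [dir_sub e z ((hw.dir e').diffAt z) ((contDiff_re_pow a _).diffAt z), dir_re_pow]
    have hs : ∀ (a e e' : ℂ), ContDiff ℝ ∞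
        fun z => _root_.dir e (_root_.dir e' w) z - ((n + 1) * a * e * z ^ n).re :=
      fun a e e' => ((hw.dir e').dir e).sub (contDiff_re_pow _ n)
    have hb1 := hb.2.1
    have hbI := hb.2.2
    have hc1 := hc.2.1
    have hcI := hc.2.2
    rw [hdd] at hb1 hbI hc1 hcI
    have hn0 : ((n : ℂ) + 1) ≠ 0 := by exact_mod_cast Nat.succ_ne_zero n
    have hd1 : Vanish (n + 1) fun z : ℂ => ((n + 1) * (c - b * Complex.I) * z ^ n).re := by
      have := hbI.sub (hs _ _ _) (hs _ _ _) hc1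
      convert this using 2 with z
      rw [dir_comm hw Complex.I 1 z, sub_sub_sub_cancel_left, ← Complex.sub_re]
      congr 1; ring
    have hd2 : Vanish (n + 1) fun z : ℂ => ((n + 1) * (c - b * Complex.I) * Complex.I * z ^ n).re := by
      have h1 := (hb1.add (hs _ _ _) (hs _ _ _) hcI)
      have h2 := hΔ.sub hw.flatLap ((hs _ _ _).add (hs _ _ _)) h1
      convert h2 using 2 with z
      simp only [flatLap]
      have : ((n + 1) * (c - b * Complex.I) * Complex.I * z ^ n : ℂ) =
          (n + 1) * b * 1 * z ^ n + (n + 1) * c * Complex.I * z ^ n := by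
        linear_combination -((n + 1) * b * z ^ n : ℂ) * Complex.I_sq
      rw [this, Complex.add_re]
      ring
    have z1 := re_eq_zero_of_vanish hd1 1
    have z2 := re_eq_zero_of_vanish hd2 1
    have hcb : c = b * Complex.I := by
      have : (n + 1) * (c - b * Complex.I) = 0 := by
        apply Complex.ext
        · simpa using z1
        · simpa using z2
      exact sub_eq_zero.1 ((mul_eq_zero.1 this).resolve_left hn0)
    have hn2 : ((n : ℂ) + 1 + 1) ≠ 0 := by exact_mod_cast Nat.succ_ne_zero (n + 1)
    have hfin : ∀ e, _root_.dir e (fun z => w z - (b / (n + 1 + 1) * z ^ (n + 1 + 1)).re) =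
        fun z => _root_.dir e w z - (b * e * z ^ (n + 1)).re := by
      intro e
      ext z
      rw [dir_sub e z (hw.diffAt z) ((contDiff_re_pow _ _).diffAt z), dir_re_pow]
      congr 3
      push_cast
      field_simp
    refine ⟨b / (n + 1 + 1), by simp [h.1], ?_, ?_⟩ <;> rw [hfin]
    · simpa using hb
    · rw [← hcb]; exact hc

end Vanishing

section Carleman

open Topology Filter Set ComplexConjugate

/-- The Wirtinger derivative `∂f/∂z̄`. -/
noncomputable def dzb (f : ℂ → ℂ) (z : ℂ) : ℂ := (dir 1 f z + Complex.I * dir Complex.I f z) / 2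

theorem ContDiff.dz {f : ℂ → ℂ} (hf : ContDiff ℝ ∞ f) : ContDiff ℝ ∞ (dz f) :=
  ((hf.dir 1).sub (contDiff_const.mul (hf.dir Complex.I))).div_const 2

theorem ContDiff.dzb {f : ℂ → ℂ} (hf : ContDiff ℝ ∞ f) : ContDiff ℝ ∞ (dzb f) :=
  ((hf.dir 1).add (contDiff_const.mul (hf.dir Complex.I))).div_const 2

theorem ContDiff.conj {f : ℂ → ℂ} (hf : ContDiff ℝ ∞ f) : ContDiff ℝ ∞ fun z => conj (f z) :=
  contDiff_conj.comp hf

theorem dir_conj {f : ℂ → ℂ} {z : ℂ} (hf : DifferentiableAt ℝ f z) (e : ℂ) :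
    dir e (fun z => conj (f z)) z = conj (dir e f z) := by
  have := (Complex.conjCLE.hasFDerivAt.comp z hf.hasFDerivAt).fderiv
  simp only [dir]
  erw [this]; rfl

theorem dir_ofReal {f : ℂ → ℝ} {z : ℂ} (hf : DifferentiableAt ℝ f z) (e : ℂ) :
    dir e (fun z => (f z : ℂ)) z = (dir e f z : ℝ) := by
  have := (Complex.ofRealCLM.hasFDerivAt.comp z hf.hasFDerivAt).fderiv
  simp only [dir]
  erw [this]; rfl

theorem conj_dz {f : ℂ → ℂ} {z : ℂ} (hf : DifferentiableAt ℝ f z) :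
    conj (dz f z) = dzb (fun z => conj (f z)) z := by
  have : conj (2 : ℂ) = 2 := Complex.conj_ofNat 2
  simp [dz, dzb, dir_conj hf, this]

theorem conj_dzb {f : ℂ → ℂ} {z : ℂ} (hf : DifferentiableAt ℝ f z) :
    conj (dzb f z) = dz (fun z => conj (f z)) z := by
  have : conj (2 : ℂ) = 2 := Complex.conj_ofNat 2
  simp [dz, dzb, dir_conj hf, this, sub_eq_add_neg]

theorem dz_mul {f g : ℂ → ℂ} {z : ℂ} (hf : DifferentiableAt ℝ f z) (hg : DifferentiableAt ℝ g z) :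
    dz (fun x => f x * g x) z = dz f z * g z + f z * dz g z :=
  (HasDz.mul ⟨hf, rfl⟩ ⟨hg, rfl⟩).2

theorem dz_add {f g : ℂ → ℂ} {z : ℂ} (hf : DifferentiableAt ℝ f z) (hg : DifferentiableAt ℝ g z) :
    dz (fun x => f x + g x) z = dz f z + dz g z :=
  (HasDz.add ⟨hf, rfl⟩ ⟨hg, rfl⟩).2

theorem dzb_mul {f g : ℂ → ℂ} {z : ℂ} (hf : DifferentiableAt ℝ f z) (hg : DifferentiableAt ℝ g z) :
    dzb (fun x => f x * g x) z = dzb f z * g z + f z * dzb g z := by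
  simp only [dzb, dir_mul _ _ hf hg]; ring

theorem dz_dzb {f : ℂ → ℂ} (hf : ContDiff ℝ ∞ f) (z : ℂ) : dz (dzb f) z = flatLap f z / 4 := by
  have h : ∀ e, dir e (dzb f) z = (dir e (dir 1 f) z + Complex.I * dir e (dir Complex.I f) z) / 2 := by
    intro e
    have e1 : dzb f = fun x => (1 / 2) * (dir 1 f x + Complex.I * dir Complex.I f x) := by
      ext x; simp only [dzb]; ring
    have d1 := (hf.dir 1).diffAt z
    have d2 := (hf.dir Complex.I).diffAt z
    rw [e1, dir_mul e z (by fun_prop) (by fun_prop), dir_add e z d1 (by fun_prop),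
      dir_mul e z (by fun_prop) d2, dir_const, dir_const]
    ring
  simp only [dz, h, flatLap, dir_comm hf Complex.I 1]
  linear_combination (-dir Complex.I (dir Complex.I f) z / 4) * Complex.I_sq

theorem dzb_dz {f : ℂ → ℂ} (hf : ContDiff ℝ ∞ f) (z : ℂ) : dzb (dz f) z = flatLap f z / 4 := by
  have h : ∀ e, dir e (dz f) z = (dir e (dir 1 f) z - Complex.I * dir e (dir Complex.I f) z) / 2 := by
    intro e
    have e1 : dz f = fun x => (1 / 2) * (dir 1 f x - Complex.I * dir Complex.I f x) := by
      ext x; simp only [dz]; ring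
    have d1 := (hf.dir 1).diffAt z
    have d2 := (hf.dir Complex.I).diffAt z
    rw [e1, dir_mul e z (by fun_prop) (by fun_prop), dir_sub e z d1 (by fun_prop),
      dir_mul e z (by fun_prop) d2, dir_const, dir_const]
    ring
  simp only [dzb, h, flatLap, dir_comm hf Complex.I 1]
  linear_combination (-dir Complex.I (dir Complex.I f) z / 4) * Complex.I_sq

theorem hasCompactSupport_dzb {f : ℂ → ℂ} (hf : HasCompactSupport f) : HasCompactSupport (dzb f) :=
  ((hasCompactSupport_dir hf 1).add ((hasCompactSupport_dir hf Complex.I).mul_left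
    (f := fun _ => Complex.I))).comp_left (g := fun x => x / 2) (by simp)

theorem integral_mul_dzb {f g : ℂ → ℂ} (hf : ContDiff ℝ ∞ f) (hg : ContDiff ℝ ∞ g)
    (h : HasCompactSupport f ∨ HasCompactSupport g) :
    ∫ z, f z * dzb g z = - ∫ z, dzb f z * g z := by
  have hc : ∀ {k : ℂ → ℂ}, HasCompactSupport k → HasCompactSupport fun z => conj (k z) :=
    fun hk => hk.comp_left (g := conj) (map_zero _)
  have := congrArg conj (integral_mul_dz hf.conj hg.conj (h.imp hc hc))
  rw [map_neg, ← integral_conj, ← integral_conj] at this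
  simpa only [map_mul, conj_dz (hf.conj.diffAt _), conj_dz (hg.conj.diffAt _), Complex.conj_conj]
    using this

theorem carleman_dz {φ : ℂ → ℂ} (hφ : ContDiff ℝ ∞ φ) (hc : HasCompactSupport φ) (τ : ℝ) :
    τ * ∫ z, ‖φ z‖ ^ 2 * rexp (τ * Complex.normSq z) ≤
      ∫ z, ‖dz φ z‖ ^ 2 * rexp (τ * Complex.normSq z) := by
  set w : ℂ → ℝ := fun z => rexp (τ * Complex.normSq z) with hw
  have hws : ContDiff ℝ ∞ w := (contDiff_const.mul contDiff_normSq).exp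
  set W : ℂ → ℂ := fun z => (w z : ℂ) with hW
  have hWs : ContDiff ℝ ∞ W := Complex.ofRealCLM.contDiff.comp hws
  have hwd : ∀ e z, dir e w z = τ * (2 * (z.re * e.re + z.im * e.im)) * w z := by
    intro e z
    have hj : ContDiff ℝ ∞ fun t => rexp (τ * t) := by fun_prop
    have := dir_comp (j := fun t => rexp (τ * t)) e z (hj.differentiable (by simp) _)
      (contDiff_normSq.diffAt z)
    rw [dir_normSq] at this
    have hd : deriv (fun t => rexp (τ * t)) (Complex.normSq z) = τ * w z := by
      have := ((hasDerivAt_id (Complex.normSq z)).const_mul τ).exp.deriv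
      simpa [mul_comm] using this
    rw [hd] at this
    rw [this]; ring
  have hWz : ∀ z, dz W z = τ * conj z * W z := by
    intro z
    simp only [dz, hW, dir_ofReal (hws.diffAt z), hwd]
    apply Complex.ext <;> simp <;> ring
  have hWb : ∀ z, dzb W z = τ * z * W z := by
    intro z
    simp only [dzb, hW, dir_ofReal (hws.diffAt z), hwd]
    apply Complex.ext <;> simp <;> ring
  set Q : ℂ → ℂ := fun z => conj (φ z) with hQ
  have hQs : ContDiff ℝ ∞ Q := hφ.conj
  have hQc : HasCompactSupport Q := hc.comp_left (g := conj) (map_zero _)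
  set T : ℂ → ℂ := fun z => dzb φ z + τ * z * φ z with hT
  have hlin : ContDiff ℝ ∞ fun z : ℂ => (τ : ℂ) * z := by fun_prop
  have hTs : ContDiff ℝ ∞ T := hφ.dzb.add (hlin.mul hφ)
  have I1 := integral_mul_dzb (hφ.dz.mul hWs) hQs (Or.inr hQc)
  have I2 := integral_mul_dz hTs (hWs.mul hQs) (Or.inr hQc.mul_left)
  have e1 : ∀ z, dz φ z * W z * dzb Q z = ((‖dz φ z‖ ^ 2 * w z : ℝ) : ℂ) := by
    intro z
    rw [hQ, ← conj_dz (hφ.diffAt z), mul_right_comm, Complex.mul_conj, Complex.normSq_eq_norm_sq]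
    simp [hW]
  have hmulτ : ∀ z : ℂ, dz (fun z => (τ : ℂ) * z) z = τ := by
    intro z
    exact (hasDz_of_hasDerivAt (by simpa using (hasDerivAt_id z).const_mul (τ : ℂ))).2
  have e2 : ∀ z, T z * dz (fun z => W z * Q z) z = ((‖T z‖ ^ 2 * w z : ℝ) : ℂ) := by
    intro z
    have : dz (fun z => W z * Q z) z = W z * conj (T z) := by
      rw [dz_mul (hWs.diffAt z) (hQs.diffAt z), hWz, hQ, ← conj_dzb (hφ.diffAt z)]
      simp only [hT, map_add, map_mul, Complex.conj_ofReal]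
      ring
    rw [this, mul_left_comm, Complex.mul_conj, Complex.normSq_eq_norm_sq]
    simp [hW, mul_comm]
  have e3 : ∀ z, dzb (fun z => dz φ z * W z) z * Q z =
      (flatLap φ z / 4 + τ * z * dz φ z) * (W z * Q z) := by
    intro z
    rw [dzb_mul (hφ.dz.diffAt z) (hWs.diffAt z), dzb_dz hφ, hWb]
    ring
  have e4 : ∀ z, dz T z * (W z * Q z) =
      (flatLap φ z / 4 + τ * z * dz φ z) * (W z * Q z) + ((τ * (‖φ z‖ ^ 2 * w z) : ℝ) : ℂ) := by
    intro z
    have : ((‖φ z‖ ^ 2 : ℝ) : ℂ) = φ z * Q z := by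
      rw [hQ, Complex.mul_conj, Complex.normSq_eq_norm_sq]
    rw [hT, dz_add (hφ.dzb.diffAt z) ((hlin.mul hφ).diffAt z), dz_dzb hφ,
      dz_mul (hlin.diffAt z) (hφ.diffAt z), hmulτ, Complex.ofReal_mul, Complex.ofReal_mul, this]
    simp only [hW]
    ring
  have i3 : Integrable fun z => (flatLap φ z / 4 + τ * z * dz φ z) * (W z * Q z) :=
    integrable_mul_of_hasCompactSupport
      ((hφ.flatLap.div_const 4).add (hlin.mul hφ.dz)).continuous (hWs.mul hQs).continuous
      (Or.inr hQc.mul_left)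
  have i4 : Integrable fun z => τ * (‖φ z‖ ^ 2 * w z) := by
    refine Continuous.integrable_of_hasCompactSupport
      (continuous_const.mul ((hφ.continuous.norm.pow 2).mul hws.continuous)) ?_
    have : HasCompactSupport fun z => ‖φ z‖ ^ 2 :=
      hc.comp_left (g := fun x => ‖x‖ ^ 2) (by simp)
    exact this.mul_right.mul_left
  have i4' : Integrable fun z => ((τ * (‖φ z‖ ^ 2 * w z) : ℝ) : ℂ) := i4.ofReal
  simp only [e1, e2, e3, e4] at I1 I2
  rw [integral_add i3 i4'] at I2
  have hcast : ∀ g : ℂ → ℝ, ∫ z, (g z : ℂ) = ((∫ z, g z : ℝ) : ℂ) := fun g => integral_ofReal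
  rw [hcast fun z => ‖dz φ z‖ ^ 2 * w z] at I1
  rw [hcast fun z => ‖T z‖ ^ 2 * w z, hcast fun z => τ * (‖φ z‖ ^ 2 * w z)] at I2
  have key : (∫ z, ‖dz φ z‖ ^ 2 * w z) = (∫ z, ‖T z‖ ^ 2 * w z) + ∫ z, τ * (‖φ z‖ ^ 2 * w z) := by
    have : ((∫ z, ‖dz φ z‖ ^ 2 * w z : ℝ) : ℂ) =
      ((∫ z, ‖T z‖ ^ 2 * w z : ℝ) : ℂ) + ((∫ z, τ * (‖φ z‖ ^ 2 * w z) : ℝ) : ℂ) := by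
      linear_combination I1 - I2
    exact_mod_cast this
  rw [key, ← integral_const_mul]
  have : 0 ≤ ∫ z, ‖T z‖ ^ 2 * w z := integral_nonneg fun z => by positivity
  linarith

theorem contDiff_inv_conj_pow_mul {F : ℂ → ℂ} (hF : ContDiff ℝ ∞ F) (h0 : F =ᶠ[𝓝 0] 0) (N : ℕ) :
    ContDiff ℝ ∞ fun z => (conj z)⁻¹ ^ N * F z := by
  rw [contDiff_iff_contDiffAt]
  intro z
  by_cases hz : z = 0
  · subst hz
    refine (contDiffAt_const (c := (0 : ℂ))).congr_of_eventuallyEq ?_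
    filter_upwards [h0] with x hx
    simp [hx]
  · exact ((contDiff_conj.contDiffAt.inv (by simpa using hz)).pow N).mul hF.contDiffAt

theorem dz_inv_conj_pow_mul {F : ℂ → ℂ} (hF : ContDiff ℝ ∞ F) (h0 : F =ᶠ[𝓝 0] 0) (N : ℕ) (z : ℂ) :
    dz (fun z => (conj z)⁻¹ ^ N * F z) z = (conj z)⁻¹ ^ N * dz F z := by
  by_cases hz : z = 0
  · subst hz
    have e1 : (fun z => (conj z)⁻¹ ^ N * F z) =ᶠ[𝓝 0] fun _ => 0 := by
      filter_upwards [h0] with x hx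
      simp [hx]
    have e2 : F =ᶠ[𝓝 0] fun _ => 0 := h0
    simp only [dz, dir_congr e1, dir_congr e2, dir_const]
    simp
  · have h1 : HasDerivAt (fun z : ℂ => z⁻¹ ^ N) _ z := (hasDerivAt_inv hz).fun_pow N
    have h2 := (hasDz_conj h1).mul ⟨hF.diffAt z, rfl⟩
    simpa using h2.2

theorem dir_eventually_zero {F : Type*} [NormedAddCommGroup F] [NormedSpace ℝ F] {f : ℂ → F} {z : ℂ}
    (h : f =ᶠ[𝓝 z] 0) (e : ℂ) : dir e f =ᶠ[𝓝 z] 0 := by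
  filter_upwards [dir_congr_nhds (g := fun _ => 0) h e] with x hx
  rw [hx, dir_const]; rfl

theorem flatLap_ofReal {w : ℂ → ℝ} (hw : ContDiff ℝ ∞ w) (z : ℂ) :
    flatLap (fun z => (w z : ℂ)) z = (flatLap w z : ℝ) := by
  have h : ∀ e, dir e (fun z => (w z : ℂ)) = fun z => ((dir e w z : ℝ) : ℂ) := fun e =>
    funext fun z => dir_ofReal (hw.diffAt z) e
  simp only [flatLap, h, dir_ofReal ((hw.dir _).diffAt z)]
  push_cast; rfl

/-- A Carleman estimate for the planar Laplacian. -/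
theorem carleman_flatLap {w : ℂ → ℝ} (hw : ContDiff ℝ ∞ w) (hc : HasCompactSupport w)
    (h0 : w =ᶠ[𝓝 0] 0) {τ : ℝ} (hτ : 0 ≤ τ) (N : ℕ) :
    16 * τ ^ 2 * ∫ z, (‖z‖ ^ (2 * N))⁻¹ * w z ^ 2 * rexp (τ * Complex.normSq z) ≤
      ∫ z, (‖z‖ ^ (2 * N))⁻¹ * flatLap w z ^ 2 * rexp (τ * Complex.normSq z) := by
  set F : ℂ → ℂ := fun z => (w z : ℂ) with hF
  have hFs : ContDiff ℝ ∞ F := Complex.ofRealCLM.contDiff.comp hw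
  have hFc : HasCompactSupport F := hc.comp_left (g := Complex.ofReal) (by simp)
  have hF0 : F =ᶠ[𝓝 0] 0 := by
    filter_upwards [h0] with x hx
    simp [hF, hx]
  have hG0 : dzb F =ᶠ[𝓝 0] 0 := by
    filter_upwards [dir_eventually_zero hF0 1, dir_eventually_zero hF0 Complex.I] with x h1 h2
    simp [dzb, h1, h2]
  have hn : ∀ (z v : ℂ), ‖(conj z)⁻¹ ^ N * v‖ ^ 2 = (‖z‖ ^ (2 * N))⁻¹ * ‖v‖ ^ 2 := by
    intro z v
    rw [norm_mul, mul_pow, norm_pow, norm_inv, Complex.norm_conj, ← pow_mul, inv_pow, mul_comm N 2]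
  have K1 := carleman_dz (contDiff_inv_conj_pow_mul hFs hF0 N) hFc.mul_left τ
  have K2 := carleman_dz (contDiff_inv_conj_pow_mul hFs.dzb hG0 N)
    (hasCompactSupport_dzb hFc).mul_left τ
  simp only [dz_inv_conj_pow_mul hFs hF0, dz_inv_conj_pow_mul hFs.dzb hG0, hn] at K1 K2
  have e1 : ∀ z, ‖dzb F z‖ = ‖dz F z‖ := by
    intro z
    rw [← Complex.norm_conj, conj_dzb (hFs.diffAt z)]
    simp only [hF, Complex.conj_ofReal]
  have e2 : ∀ z, ‖dz (dzb F) z‖ ^ 2 = flatLap w z ^ 2 / 16 := by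
    intro z
    rw [dz_dzb hFs, hF, flatLap_ofReal hw, norm_div, Complex.norm_real, div_pow, Real.norm_eq_abs,
      sq_abs]
    norm_num
  have e3 : ∀ z, ‖F z‖ ^ 2 = w z ^ 2 := by
    intro z
    rw [hF, Complex.norm_real, Real.norm_eq_abs, sq_abs]
  simp only [e1, e2, e3] at K1 K2
  have e4 : (∫ z, (‖z‖ ^ (2 * N))⁻¹ * (flatLap w z ^ 2 / 16) * rexp (τ * Complex.normSq z)) =
      (∫ z, (‖z‖ ^ (2 * N))⁻¹ * flatLap w z ^ 2 * rexp (τ * Complex.normSq z)) / 16 := by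
    rw [← integral_div]
    congr 1 with z
    ring
  rw [e4] at K2
  have := mul_le_mul_of_nonneg_left K1 hτ
  nlinarith

end Carleman

section UniqueContinuation

open Topology Filter Set ComplexConjugate

theorem flatLap_mul {f g : ℂ → ℝ} (hf : ContDiff ℝ ∞ f) (hg : ContDiff ℝ ∞ g) (z : ℂ) :
    flatLap (fun x => f x * g x) z = flatLap f z * g z + f z * flatLap g z +
      2 * (dir 1 f z * dir 1 g z + dir Complex.I f z * dir Complex.I g z) := by
  have h : ∀ e, dir e (fun x => f x * g x) = fun x => dir e f x * g x + f x * dir e g x :=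
    fun e => funext fun x => dir_mul e x (hf.diffAt x) (hg.diffAt x)
  have h2 : ∀ e, dir e (fun x => dir e f x * g x + f x * dir e g x) z =
      dir e (dir e f) z * g z + f z * dir e (dir e g) z + 2 * (dir e f z * dir e g z) := by
    intro e
    rw [dir_add e z (((hf.dir e).mul hg).diffAt z) ((hf.mul (hg.dir e)).diffAt z),
      dir_mul e z ((hf.dir e).diffAt z) (hg.diffAt z), dir_mul e z (hf.diffAt z) ((hg.dir e).diffAt z)]
    ring
  simp only [flatLap, h, h2]
  ring

/-- A cutoff vanishing near the origin and equal to one outside a disc of radius `ε`. -/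
noncomputable def innerCutoff (ε : ℝ) (z : ℂ) : ℝ := step ((ε ^ 2)⁻¹ * Complex.normSq z)

theorem contDiff_innerCutoff (ε : ℝ) : ContDiff ℝ ∞ (innerCutoff ε) :=
  contDiff_step.comp (contDiff_const.mul contDiff_normSq)

theorem innerCutoff_of_le {ε : ℝ} (hε : 0 < ε) {z : ℂ} (h : ε ≤ ‖z‖) : innerCutoff ε z = 1 := by
  refine step_eq_one ?_
  rw [Complex.normSq_eq_norm_sq, inv_mul_eq_div, le_div_iff₀ (by positivity)]
  nlinarith [pow_le_pow_left₀ hε.le h 2, sq_nonneg ε]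

theorem innerCutoff_eventually_zero {ε : ℝ} : innerCutoff ε =ᶠ[𝓝 0] 0 := by
  have hc : Continuous fun z : ℂ => (ε ^ 2)⁻¹ * Complex.normSq z :=
    continuous_const.mul Complex.continuous_normSq
  have : ∀ᶠ z : ℂ in 𝓝 0, (ε ^ 2)⁻¹ * Complex.normSq z < 1 / 3 :=
    hc.continuousAt.eventually_lt_const (by simp)
  filter_upwards [this] with z hz using step_eq_zero hz.le

theorem exists_innerCutoff_bound : ∃ c, 0 ≤ c ∧ ∀ ε, 0 < ε → ∀ z : ℂ, ‖z‖ ≤ ε →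
    |flatLap (innerCutoff ε) z| * ‖z‖ ^ 2 ≤ c ∧
      ∀ e : ℂ, ‖e‖ = 1 → |dir e (innerCutoff ε) z| * ‖z‖ ≤ c := by
  have hs1 : ContDiff ℝ ∞ (deriv step) := contDiff_step.deriv'
  have hs2 : ContDiff ℝ ∞ (deriv (deriv step)) := hs1.deriv'
  have c1 := hs1.continuous
  have c2 := hs2.continuous
  obtain ⟨a, ha⟩ := isCompact_Icc.exists_bound_of_continuousOn (s := Icc (0:ℝ) 1)
    (f := fun s => 4 * (s ^ 2 * deriv (deriv step) s + s * deriv step s)) (by fun_prop)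
  obtain ⟨b, hb⟩ := isCompact_Icc.exists_bound_of_continuousOn (s := Icc (0:ℝ) 1)
    (f := fun s => 2 * (s * deriv step s)) (by fun_prop)
  refine ⟨max a b, ?_, ?_⟩
  · exact ((norm_nonneg _).trans (ha 0 (by simp))).trans (le_max_left _ _)
  intro ε hε z hz
  set k := (ε ^ 2)⁻¹ with hk
  have hk0 : 0 < k := by positivity
  have hsm : k * Complex.normSq z ∈ Icc (0:ℝ) 1 := by
    refine ⟨mul_nonneg hk0.le (Complex.normSq_nonneg z), ?_⟩
    rw [hk, Complex.normSq_eq_norm_sq, inv_mul_eq_div, div_le_one (by positivity)]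
    exact pow_le_pow_left₀ (norm_nonneg z) hz 2
  have d1 : deriv (fun t => step (k * t)) = fun t => k * deriv step (k * t) := by
    ext t
    rw [deriv_comp_mul_left]; simp
  have d2 : deriv (fun t => k * deriv step (k * t)) = fun t => k ^ 2 * deriv (deriv step) (k * t) := by
    ext t
    have : DifferentiableAt ℝ (fun t => deriv step (k * t)) t :=
      (hs1.comp (contDiff_const.mul contDiff_id)).differentiable (by simp) t
    rw [deriv_const_mul _ this, deriv_comp_mul_left]; simp; ring
  have hkc : ContDiff ℝ ∞ fun t => step (k * t) := contDiff_step.comp (contDiff_const.mul contDiff_id)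
  constructor
  · have : flatLap (innerCutoff ε) z = _ := flatLap_radial hkc z
    rw [this, d1, d2, ← abs_of_nonneg (sq_nonneg ‖z‖), ← abs_mul, ← Complex.normSq_eq_norm_sq]
    refine le_trans (le_of_eq ?_) ((ha _ hsm).trans (le_max_left _ _))
    rw [Real.norm_eq_abs]
    congr 1; ring
  · intro e he
    have : dir e (innerCutoff ε) z = _ := dir_comp (j := fun t => step (k * t)) e z
      (hkc.differentiable (by simp) _) (contDiff_normSq.diffAt z)
    rw [this, d1, dir_normSq, abs_mul]
    have hcs : |2 * (z.re * e.re + z.im * e.im)| ≤ 2 * ‖z‖ := by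
      have h1 : z.re * e.re + z.im * e.im = (z * conj e).re := by simp
      rw [h1, abs_mul, abs_two]
      have := Complex.abs_re_le_norm (z * conj e)
      rw [norm_mul, Complex.norm_conj, he, mul_one] at this
      linarith
    calc _ ≤ |k * deriv step (k * Complex.normSq z)| * (2 * ‖z‖) * ‖z‖ := by gcongr
      _ = |2 * (k * Complex.normSq z * deriv step (k * Complex.normSq z))| := by
        rw [Complex.normSq_eq_norm_sq]
        have : (2 * (k * ‖z‖ ^ 2 * deriv step (k * ‖z‖ ^ 2))) =
          (k * deriv step (k * ‖z‖ ^ 2)) * (2 * ‖z‖ * ‖z‖) := by ring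
        rw [this, abs_mul _ (2 * ‖z‖ * ‖z‖), abs_of_nonneg (by positivity : 0 ≤ 2 * ‖z‖ * ‖z‖)]
        ring
      _ ≤ _ := (hb _ hsm).trans (le_max_right _ _)

theorem exists_flatLap_cutoff_bound {f : ℂ → ℝ} (hf : ContDiff ℝ ∞ f) (hflat : ∀ n, Vanish n f)
    (N : ℕ) : ∃ K, 0 ≤ K ∧ ∀ ε, 0 < ε → ε ≤ 1 → ∀ z : ℂ, ‖z‖ ≤ ε →
      |flatLap (fun x => innerCutoff ε x * f x) z| ≤ K * ‖z‖ ^ N := by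
  obtain ⟨c, hc0, hc⟩ := exists_innerCutoff_bound
  obtain ⟨A, hA0, hA⟩ := (hflat (N + 2)).bound hf
  have hdir : ∀ e n, Vanish n (dir e f) := fun e n => (hflat (n + 1)).dir hf e
  obtain ⟨B, hB0, hB⟩ := (hdir 1 (N + 1)).bound (hf.dir 1)
  obtain ⟨B', hB0', hB'⟩ := (hdir Complex.I (N + 1)).bound (hf.dir Complex.I)
  obtain ⟨D, hD0, hD⟩ := (((hdir 1 (N + 1)).dir (hf.dir 1) 1).add ((hf.dir 1).dir 1)
    ((hf.dir Complex.I).dir Complex.I)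
    ((hdir Complex.I (N + 1)).dir (hf.dir Complex.I) Complex.I)).bound hf.flatLap
  refine ⟨c * A + D + 2 * (c * B + c * B'), by positivity, ?_⟩
  intro ε hε hε1 z hz
  obtain ⟨h1, h2⟩ := hc ε hε z hz
  have hz1 := hz.trans hε1
  have b1 := hA z hz1
  have b2 := hB z hz1
  have b3 := hB' z hz1
  have b4 : |flatLap f z| ≤ D * ‖z‖ ^ N := hD z hz1
  have hη : |innerCutoff ε z| ≤ 1 := by
    rw [innerCutoff, abs_of_nonneg (step_nonneg _)]; exact step_le_one _
  have hmul : ∀ {a b k l m : ℝ} {p q : ℕ}, 0 ≤ m → |a| * ‖z‖ ^ q ≤ k → |b| ≤ m * ‖z‖ ^ (p + q) →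
      |a * b| ≤ k * m * ‖z‖ ^ p := by
    intro a b k l m p q hm ha hb
    rw [abs_mul]
    calc |a| * |b| ≤ |a| * (m * ‖z‖ ^ (p + q)) := by gcongr
      _ = |a| * ‖z‖ ^ q * (m * ‖z‖ ^ p) := by ring
      _ ≤ k * (m * ‖z‖ ^ p) := by gcongr
      _ = _ := by ring
  rw [flatLap_mul (contDiff_innerCutoff ε) hf]
  have t1 := hmul (l := 0) (p := N) (q := 2) hA0 h1 b1
  have t2 := hmul (l := 0) (p := N) (q := 0) hD0 (by simpa using hη) b4
  have t3 := hmul (l := 0) (p := N) (q := 1) hB0 (by simpa using h2 1 (by simp)) b2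
  have t4 := hmul (l := 0) (p := N) (q := 1) hB0' (by simpa using h2 Complex.I (by simp)) b3
  rw [abs_le] at *
  constructor <;> nlinarith

theorem integrable_inv_pow_mul_sq {F W : ℂ → ℝ} (hF : ContDiff ℝ ∞ F) (hc : HasCompactSupport F)
    (h0 : F =ᶠ[𝓝 0] 0) (hW : Continuous W) (N : ℕ) :
    Integrable fun z => (‖z‖ ^ (2 * N))⁻¹ * F z ^ 2 * W z := by
  have h1 := contDiff_inv_conj_pow_mul (F := fun z => (F z : ℂ))
    (Complex.ofRealCLM.contDiff.comp hF) (by filter_upwards [h0] with x hx; simp [hx]) N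
  obtain ⟨G, hG⟩ : ∃ G : ℂ → ℂ, G = fun z => (conj z)⁻¹ ^ N * (F z : ℂ) := ⟨_, rfl⟩
  have h1' : ContDiff ℝ ∞ G := by rw [hG]; exact h1
  have h2 : HasCompactSupport G := by
    rw [hG]
    exact (hc.comp_left (g := Complex.ofReal) (by simp)).mul_left
  have h3 : Continuous fun z => ‖G z‖ ^ 2 := h1'.continuous.norm.pow 2
  have h4 : HasCompactSupport fun z => ‖G z‖ ^ 2 :=
    h2.comp_left (g := fun x => ‖x‖ ^ 2) (by simp)
  have h5 : ∀ z, (‖z‖ ^ (2 * N))⁻¹ * F z ^ 2 = ‖G z‖ ^ 2 := by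
    intro z
    rw [hG]
    simp only [norm_mul, mul_pow, norm_pow, norm_inv, Complex.norm_conj, ← pow_mul, inv_pow,
      Complex.norm_real, Real.norm_eq_abs, sq_abs, mul_comm N 2]
  simp only [h5]
  exact integrable_mul_of_hasCompactSupport h3 hW (Or.inl h4)

theorem innerCutoff_mul_eventuallyEq {ε : ℝ} (hε : 0 < ε) (f : ℂ → ℝ) {z : ℂ} (hz : ε < ‖z‖) :
    (fun x => innerCutoff ε x * f x) =ᶠ[𝓝 z] f := by
  filter_upwards [(isOpen_lt continuous_const continuous_norm).mem_nhds hz] with x hx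
  simp [innerCutoff_of_le hε (le_of_lt hx)]

theorem innerCutoff_mul_eventually_zero (ε : ℝ) (f : ℂ → ℝ) :
    (fun x => innerCutoff ε x * f x) =ᶠ[𝓝 0] 0 := by
  filter_upwards [innerCutoff_eventually_zero (ε := ε)] with x hx
  simp [hx]

theorem carleman_absorb {f : ℂ → ℝ} (hf : ContDiff ℝ ∞ f) (hc : HasCompactSupport f)
    (hflat : ∀ n, Vanish n f) {C R : ℝ} (hC0 : 0 ≤ C) (hR : 0 < R)
    (hC : ∀ z : ℂ, ‖z‖ < R → |flatLap f z| ≤ C * |f z|) (N : ℕ) :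
    ∃ K, ∀ ε, 0 < ε → ε ≤ 1 →
      ∫ z, (‖z‖ ^ (2 * N))⁻¹ * (innerCutoff ε z * f z) ^ 2 * rexp ((C + 1) * Complex.normSq z) ≤
        K * ε ^ 2 + (R ^ (2 * N))⁻¹ * ∫ z, flatLap f z ^ 2 * rexp ((C + 1) * Complex.normSq z) := by
  obtain ⟨K, hK0, hK⟩ := exists_flatLap_cutoff_bound hf hflat N
  refine ⟨K ^ 2 * rexp (C + 1) * π, fun ε hε0 hε1 => ?_⟩
  have hFs : ContDiff ℝ ∞ fun x => innerCutoff ε x * f x := (contDiff_innerCutoff ε).mul hf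
  have hFc : HasCompactSupport fun x => innerCutoff ε x * f x := hc.mul_left
  have hF0 := innerCutoff_mul_eventually_zero ε f
  have hFf : ∀ z : ℂ, ε < ‖z‖ → _ := fun z hz => innerCutoff_mul_eventuallyEq hε0 f hz
  have hKz : ∀ z : ℂ, ‖z‖ ≤ ε → |flatLap (fun x => innerCutoff ε x * f x) z| ≤ K * ‖z‖ ^ N :=
    fun z hz => hK ε hε0 hε1 z hz
  have hcar := carleman_flatLap hFs hFc hF0 (by positivity : 0 ≤ C + 1) N
  have hWc : Continuous fun z => rexp ((C + 1) * Complex.normSq z) := by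
    have := Complex.continuous_normSq; fun_prop
  have hFi := integrable_inv_pow_mul_sq hFs hFc hF0 hWc N
  have hAi : Integrable fun z => flatLap f z ^ 2 * rexp ((C + 1) * Complex.normSq z) :=
    integrable_mul_of_hasCompactSupport (hf.flatLap.continuous.pow 2) hWc
      (Or.inl ((hasCompactSupport_flatLap hc).comp_left (g := fun x => x ^ 2) (by simp)))
  have hball : Integrable ((Metric.closedBall (0:ℂ) ε).indicator fun _ => K ^ 2 * rexp (C + 1)) :=
    (integrable_indicator_iff measurableSet_closedBall).2
      (continuousOn_const.integrableOn_compact (isCompact_closedBall _ _))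
  change _ ≤ _ at hcar
  generalize hFdef : (fun x => innerCutoff ε x * f x) = F at *
  have hFz : ∀ z, innerCutoff ε z * f z = F z := fun z => by rw [← hFdef]
  simp only [hFz] at hcar hFi ⊢
  generalize hWdef : (fun z => rexp ((C + 1) * Complex.normSq z)) = W at *
  have hWz : ∀ z, rexp ((C + 1) * Complex.normSq z) = W z := fun z => by rw [← hWdef]
  have hW1 : ∀ z, 1 ≤ W z := fun z => by
    rw [← hWz]; exact Real.one_le_exp (mul_nonneg (by positivity) (Complex.normSq_nonneg z))
  have hWe : ∀ z, ‖z‖ ≤ 1 → W z ≤ rexp (C + 1) := by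
    intro z hz
    rw [← hWz]
    refine Real.exp_le_exp.2 ?_
    have : Complex.normSq z ≤ 1 := by
      rw [Complex.normSq_eq_norm_sq]
      exact pow_le_one₀ (norm_nonneg z) hz
    nlinarith
  simp only [hWz] at hcar hFi hAi ⊢
  have hpt : ∀ z, (‖z‖ ^ (2 * N))⁻¹ * flatLap F z ^ 2 * W z ≤
      C ^ 2 * ((‖z‖ ^ (2 * N))⁻¹ * F z ^ 2 * W z) +
      ((Metric.closedBall (0:ℂ) ε).indicator (fun _ => K ^ 2 * rexp (C + 1)) z +
        (R ^ (2 * N))⁻¹ * (flatLap f z ^ 2 * W z)) := by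
    intro z
    have hWz := hW1 z
    have p1 : 0 ≤ C ^ 2 * ((‖z‖ ^ (2 * N))⁻¹ * F z ^ 2 * W z) := by positivity
    have p2 : 0 ≤ (Metric.closedBall (0:ℂ) ε).indicator (fun _ => K ^ 2 * rexp (C + 1)) z :=
      indicator_nonneg (fun _ _ => by positivity) z
    have p3 : 0 ≤ (R ^ (2 * N))⁻¹ * (flatLap f z ^ 2 * W z) := by positivity
    by_cases hz : ‖z‖ ≤ ε
    · rw [indicator_of_mem (by simpa using hz)]
      have hq : (‖z‖ ^ (2 * N))⁻¹ * flatLap F z ^ 2 ≤ K ^ 2 := by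
        have h1 : flatLap F z ^ 2 ≤ (K * ‖z‖ ^ N) ^ 2 := by
          rw [← sq_abs (flatLap F z)]
          exact pow_le_pow_left₀ (abs_nonneg _) (hKz z hz) 2
        calc _ ≤ (‖z‖ ^ (2 * N))⁻¹ * (K * ‖z‖ ^ N) ^ 2 := by gcongr
          _ = K ^ 2 * ((‖z‖ ^ (2 * N))⁻¹ * ‖z‖ ^ (2 * N)) := by ring
          _ ≤ K ^ 2 * 1 := by gcongr; exact inv_mul_le_one
          _ = _ := mul_one _
      have := mul_le_mul hq (hWe z (hz.trans hε1)) (by positivity) (by positivity)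
      linarith
    · push Not at hz
      rw [flatLap_congr (hFf z hz)]
      by_cases hz2 : ‖z‖ < R
      · have : flatLap f z ^ 2 ≤ C ^ 2 * F z ^ 2 := by
          rw [(hFf z hz).eq_of_nhds, ← sq_abs, ← sq_abs (f z), ← mul_pow]
          exact pow_le_pow_left₀ (abs_nonneg _) (hC z hz2) 2
        have h2 : (‖z‖ ^ (2 * N))⁻¹ * flatLap f z ^ 2 * W z ≤
          (‖z‖ ^ (2 * N))⁻¹ * (C ^ 2 * F z ^ 2) * W z := by gcongr
        linarith
      · push Not at hz2
        have : (‖z‖ ^ (2 * N))⁻¹ ≤ (R ^ (2 * N))⁻¹ := by gcongr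
        have h2 : (‖z‖ ^ (2 * N))⁻¹ * (flatLap f z ^ 2 * W z) ≤
          (R ^ (2 * N))⁻¹ * (flatLap f z ^ 2 * W z) := by gcongr
        linarith
  have hle := integral_mono_of_nonneg
    (Eventually.of_forall fun z => by have := hW1 z; simp only [Pi.zero_apply]; positivity)
    ((hFi.const_mul (C ^ 2)).add (hball.add (hAi.const_mul _))) (Eventually.of_forall hpt)
  have hsum : (∫ z, (C ^ 2 * ((‖z‖ ^ (2 * N))⁻¹ * F z ^ 2 * W z) +
      ((Metric.closedBall (0:ℂ) ε).indicator (fun _ => K ^ 2 * rexp (C + 1)) z +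
        (R ^ (2 * N))⁻¹ * (flatLap f z ^ 2 * W z)))) =
      C ^ 2 * (∫ z, (‖z‖ ^ (2 * N))⁻¹ * F z ^ 2 * W z) + (K ^ 2 * rexp (C + 1) * π * ε ^ 2 +
        (R ^ (2 * N))⁻¹ * ∫ z, flatLap f z ^ 2 * W z) := by
    have i2 : Integrable fun z =>
        (Metric.closedBall (0:ℂ) ε).indicator (fun _ => K ^ 2 * rexp (C + 1)) z +
          (R ^ (2 * N))⁻¹ * (flatLap f z ^ 2 * W z) := hball.add (hAi.const_mul _)
    rw [integral_add (hFi.const_mul _) i2,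
      integral_add (f := (Metric.closedBall (0:ℂ) ε).indicator fun _ => K ^ 2 * rexp (C + 1))
        hball (hAi.const_mul _), integral_const_mul, integral_const_mul,
      integral_indicator measurableSet_closedBall, setIntegral_const]
    congr 2
    simp [Measure.real, hε0.le]
    ring
  have hle2 := hcar.trans (hle.trans_eq hsum)
  generalize hI : (∫ z, (‖z‖ ^ (2 * N))⁻¹ * F z ^ 2 * W z) = I at hle2 ⊢
  have hI0 : 0 ≤ I := by
    rw [← hI]; exact integral_nonneg fun z => by have := hW1 z; simp only [Pi.zero_apply]; positivity
  have : 1 ≤ 16 * (C + 1) ^ 2 - C ^ 2 := by nlinarith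
  nlinarith

/-- Strong unique continuation for solutions of a differential inequality `|Δw| ≤ C |w|`. -/
theorem eq_zero_of_flat {w : ℂ → ℝ} (hw : ContDiff ℝ ∞ w) {C : ℝ} (hC0 : 0 ≤ C)
    (hC : ∀ z, |flatLap w z| ≤ C * |w z|) (hflat : ∀ n, Vanish n w) (z₀ : ℂ) : w z₀ = 0 := by
  by_cases hz0 : z₀ = 0
  · rw [hz0]; exact (hflat 1).1
  by_contra hne
  obtain ⟨d, hd⟩ : ∃ d, d = ‖z₀‖ := ⟨_, rfl⟩
  have hd0 : 0 < d := hd ▸ norm_pos_iff.2 hz0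
  let χ : ContDiffBump (0 : ℂ) := ⟨4 * d, 5 * d, by positivity, by linarith⟩
  let ψ : ContDiffBump z₀ := ⟨d / 4, d / 2, by positivity, by linarith⟩
  have hχ : ContDiff ℝ ∞ χ := χ.contDiff
  obtain ⟨f, hf⟩ : ∃ f : ℂ → ℝ, f = fun z => χ z * w z := ⟨_, rfl⟩
  have hfs : ContDiff ℝ ∞ f := hf ▸ hχ.mul hw
  have hfc : HasCompactSupport f := hf ▸ χ.hasCompactSupport.mul_right
  have hfflat : ∀ n, Vanish n f := fun n => hf ▸ (hflat n).mul hw hχ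
  have hfw : ∀ z, ‖z‖ < 4 * d → f =ᶠ[𝓝 z] w := by
    intro z hz
    filter_upwards [(isOpen_lt continuous_norm continuous_const).mem_nhds hz] with x hx
    rw [hf]
    simp [χ.one_of_mem_closedBall (by simpa using le_of_lt hx : x ∈ Metric.closedBall (0:ℂ) (4 * d))]
  have hab := carleman_absorb hfs hfc hfflat hC0 (by positivity : 0 < 4 * d) fun z hz => by
    rw [flatLap_congr (hfw z hz), (hfw z hz).eq_of_nhds]; exact hC z
  generalize (∫ z, flatLap f z ^ 2 * rexp ((C + 1) * Complex.normSq z)) = A at hab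
  have hJi : Integrable fun z => ψ z * w z ^ 2 :=
    integrable_mul_of_hasCompactSupport ψ.continuous (hw.continuous.pow 2)
      (Or.inl ψ.hasCompactSupport)
  have hJpos : 0 < ∫ z, ψ z * w z ^ 2 := by
    refine Continuous.integral_pos_of_hasCompactSupport_nonneg_nonzero (x := z₀)
      (ψ.continuous.mul (hw.continuous.pow 2)) ψ.hasCompactSupport.mul_right
      (fun z => mul_nonneg ψ.nonneg (sq_nonneg _)) ?_
    have h1 : ψ z₀ = 1 := ψ.one_of_mem_closedBall (Metric.mem_closedBall_self (by positivity))
    simp only [h1, one_mul]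
    exact pow_ne_zero 2 hne
  have hWc : Continuous fun z => rexp ((C + 1) * Complex.normSq z) := by
    have := Complex.continuous_normSq; fun_prop
  have key : ∀ N : ℕ, ((2 * d) ^ (2 * N))⁻¹ * (∫ z, ψ z * w z ^ 2) ≤ ((4 * d) ^ (2 * N))⁻¹ * A := by
    intro N
    obtain ⟨K, hK⟩ := hab N
    have hε : ∀ ε, 0 < ε → ε ≤ 1 → ε ≤ d / 2 → ((2 * d) ^ (2 * N))⁻¹ * (∫ z, ψ z * w z ^ 2) ≤
        K * ε ^ 2 + ((4 * d) ^ (2 * N))⁻¹ * A := by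
      intro ε hε0 hε1 hεd
      refine le_trans ?_ (hK ε hε0 hε1)
      rw [← integral_const_mul]
      refine integral_mono (hJi.const_mul _) (integrable_inv_pow_mul_sq
        ((contDiff_innerCutoff ε).mul hfs) hfc.mul_left (innerCutoff_mul_eventually_zero ε f) hWc N)
        fun z => ?_
      have hWz : 1 ≤ rexp ((C + 1) * Complex.normSq z) :=
        Real.one_le_exp (mul_nonneg (by positivity) (Complex.normSq_nonneg z))
      by_cases hz : z ∈ Metric.ball z₀ (d / 2)
      · have hzd : ‖z - z₀‖ < d / 2 := by simpa [dist_eq_norm] using hz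
        have u1 : ‖z‖ < 2 * d := by
          have := norm_add_le (z - z₀) z₀
          rw [sub_add_cancel] at this
          linarith
        have u2 : ε < ‖z‖ := by
          have := norm_sub_norm_le z₀ z
          rw [norm_sub_rev] at this
          linarith
        have hz3 : 0 < ‖z‖ := hε0.trans u2
        have hfz : innerCutoff ε z * f z = w z :=
          (innerCutoff_mul_eventuallyEq hε0 f u2).eq_of_nhds.trans (hfw z (by linarith)).eq_of_nhds
        simp only [hfz]
        have h1 : ψ z * w z ^ 2 ≤ w z ^ 2 * rexp ((C + 1) * Complex.normSq z) := by
          nlinarith [mul_le_mul_of_nonneg_right (ψ.le_one (x := z)) (sq_nonneg (w z)),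
            mul_le_mul_of_nonneg_left hWz (sq_nonneg (w z))]
        have h2 : ((2 * d) ^ (2 * N))⁻¹ ≤ (‖z‖ ^ (2 * N))⁻¹ := by gcongr
        calc _ ≤ ((2 * d) ^ (2 * N))⁻¹ * (w z ^ 2 * rexp ((C + 1) * Complex.normSq z)) := by gcongr
          _ ≤ (‖z‖ ^ (2 * N))⁻¹ * (w z ^ 2 * rexp ((C + 1) * Complex.normSq z)) := by gcongr
          _ = _ := by ring
      · have : ψ z = 0 := ψ.zero_of_le_dist (by simpa using hz)
        simp only [this, zero_mul, mul_zero]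
        positivity
    have hlim : Tendsto (fun ε : ℝ => K * ε ^ 2 + ((4 * d) ^ (2 * N))⁻¹ * A)
        (𝓝[>] 0) (𝓝 (((4 * d) ^ (2 * N))⁻¹ * A)) := by
      have : Continuous fun ε : ℝ => K * ε ^ 2 + ((4 * d) ^ (2 * N))⁻¹ * A := by fun_prop
      simpa using (this.tendsto 0).mono_left (nhdsWithin_le_nhds (s := Ioi 0))
    refine ge_of_tendsto hlim ?_
    filter_upwards [self_mem_nhdsWithin, nhdsWithin_le_nhds (gt_mem_nhds zero_lt_one),
      nhdsWithin_le_nhds (gt_mem_nhds (half_pos hd0))] with ε h1 h2 h3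
    exact hε ε h1 h2.le h3.le
  have key2 : ∀ N : ℕ, (∫ z, ψ z * w z ^ 2) ≤ (1 / 4 : ℝ) ^ N * A := by
    intro N
    have h := key N
    rw [inv_mul_le_iff₀ (by positivity)] at h
    refine h.trans_eq ?_
    rw [← mul_assoc, ← div_eq_mul_inv, ← div_pow, pow_mul]
    congr 2
    field_simp
    norm_num
  have hlim : Tendsto (fun N : ℕ => (1 / 4 : ℝ) ^ N * A) atTop (𝓝 0) := by
    simpa using (tendsto_pow_atTop_nhds_zero_of_lt_one (by norm_num : (0:ℝ) ≤ 1 / 4)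
      (by norm_num)).mul_const A
  exact absurd (ge_of_tendsto' hlim key2) (not_le.2 hJpos)

end UniqueContinuation

section OddDifference

open Topology Filter Set ComplexConjugate

variable {v₁ v₂ : ℂ → ℝ} {k : ℝ}

theorem NodalPair.flatLap_sub_eq_mul (h : NodalPair v₁ v₂ k) :
    flatLap (fun x => v₁ x - v₂ x) =
      fun x => -rexp (2 * v₂ x) * (rexp (2 * (v₁ x - v₂ x)) - 1) := by
  ext x
  rw [h.flatLap_sub, mul_sub, neg_mul, ← Real.exp_add]
  ring_nf

theorem NodalPair.vanish_flatLap_sub (h : NodalPair v₁ v₂ k) {n : ℕ}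
    (hv : Vanish n fun x => v₁ x - v₂ x) : Vanish n (flatLap fun x => v₁ x - v₂ x) := by
  rw [h.flatLap_sub_eq_mul]
  have hj : ContDiff ℝ ∞ fun t : ℝ => rexp (2 * t) - 1 := by fun_prop
  have := h.smooth₂
  exact (hv.comp hj (by simp) h.smooth_sub).mul (hj.comp h.smooth_sub)
    (g := fun x => -rexp (2 * v₂ x)) (by fun_prop)

theorem NodalPair.exists_abs_flatLap_le (h : NodalPair v₁ v₂ k) :
    ∃ C, 0 ≤ C ∧ ∀ x, |flatLap (fun x => v₁ x - v₂ x) x| ≤ C * |v₁ x - v₂ x| := by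
  obtain ⟨B, hB⟩ := h.bdd
  have hB0 : 0 ≤ B := (Real.exp_pos _).le.trans (hB 0).1
  have key : ∀ s t : ℝ, rexp (2 * s) ≤ B → rexp (2 * s) - rexp (2 * t) ≤ 2 * B * |s - t| := by
    intro s t hs
    have h1 : rexp (2 * t) = rexp (2 * s) * rexp (2 * t - 2 * s) := by
      rw [← Real.exp_add]; ring_nf
    have h2 := Real.add_one_le_exp (2 * t - 2 * s)
    have h3 := le_abs_self (s - t)
    have h4 := Real.exp_pos (2 * s)
    calc rexp (2 * s) - rexp (2 * t) = rexp (2 * s) * (1 - rexp (2 * t - 2 * s)) := by rw [h1]; ring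
      _ ≤ rexp (2 * s) * (2 * |s - t|) := by gcongr; linarith
      _ ≤ B * (2 * |s - t|) := by gcongr
      _ = _ := by ring
  refine ⟨2 * B, by positivity, fun x => ?_⟩
  rw [h.flatLap_sub, abs_neg, abs_le]
  have h1 := key _ (v₂ x) (hB x).1
  have h2 := key _ (v₁ x) (hB x).2
  rw [abs_sub_comm] at h2
  constructor <;> linarith

theorem NodalPair.eq_of_flat (h : NodalPair v₁ v₂ k) (hv : ∀ n, Vanish n fun x => v₁ x - v₂ x)
    (z : ℂ) : v₁ z = v₂ z := by
  obtain ⟨C, hC0, hC⟩ := h.exists_abs_flatLap_le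
  exact sub_eq_zero.1 (eq_zero_of_flat h.smooth_sub hC0 hC hv z)

theorem exists_sign_of_leading {w : ℂ → ℝ} (hw : ContDiff ℝ ∞ w) {β : ℝ} (hβ : 0 < β) {n : ℕ}
    (hv : Vanish (n + 1) fun z => w z - ((-β * Complex.I) * z ^ n).re) :
    ∃ δ, 0 < δ ∧ ∀ r : ℝ, 0 < r → r < δ → ∀ θ : ℝ,
      (sin (n * θ) = 1 → 0 < w (r * Complex.exp (θ * Complex.I))) ∧
      (sin (n * θ) = -1 → w (r * Complex.exp (θ * Complex.I)) < 0) := by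
  obtain ⟨C, hC0, hC⟩ := hv.bound (hw.sub (contDiff_re_pow _ n))
  refine ⟨min 1 (β / (C + 1)), by positivity, fun r hr0 hr θ => ?_⟩
  have hr1 : r < 1 := hr.trans_le (min_le_left _ _)
  have hr2 : r * (C + 1) < β := by
    have := hr.trans_le (min_le_right _ _)
    rwa [lt_div_iff₀ (by positivity)] at this
  have hnorm : ‖(r : ℂ) * Complex.exp (θ * Complex.I)‖ = r := by
    rw [norm_mul, Complex.norm_exp_ofReal_mul_I, Complex.norm_real, mul_one,
      Real.norm_of_nonneg hr0.le]
  have hlead : ((-β * Complex.I) * ((r : ℂ) * Complex.exp (θ * Complex.I)) ^ n).re =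
      β * r ^ n * sin (n * θ) := by
    have : ((r : ℂ) * Complex.exp (θ * Complex.I)) ^ n =
        ((r ^ n : ℝ) : ℂ) * Complex.exp ((n * θ : ℝ) * Complex.I) := by
      rw [mul_pow, ← Complex.exp_nat_mul]
      push_cast
      ring_nf
    rw [this, Complex.exp_mul_I, ← Complex.ofReal_cos, ← Complex.ofReal_sin]
    generalize cos (n * θ) = c
    generalize sin (n * θ) = s
    generalize r ^ n = q
    simp
    ring
  have hb := hC ((r : ℂ) * Complex.exp (θ * Complex.I)) (by rw [hnorm]; exact hr1.le)
  rw [hnorm, hlead, abs_le] at hb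
  have hrn : 0 < r ^ n := by positivity
  have hsmall : C * r ^ (n + 1) < β * r ^ n := by
    rw [pow_succ]
    nlinarith
  constructor <;> intro hs <;> rw [hs] at hb <;> linarith [hb.1, hb.2]

theorem NodalPair.mass_gt_of_leading (h : NodalPair v₁ v₂ k)
    (hfr : ∀ z : ℂ, z.im = 0 → v₁ z = v₂ z) {β : ℝ} (hβ : 0 < β) {n : ℕ} (hn : 4 ≤ n)
    (hv : Vanish (n + 1) fun z => (v₁ z - v₂ z) - ((-β * Complex.I) * z ^ n).re) :
    12 * π < ∫ x in {z : ℂ | 0 < z.im}, (rexp (2 * v₁ x) + rexp (2 * v₂ x)) := by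
  obtain ⟨δ, hδ, hs⟩ := exists_sign_of_leading h.smooth_sub hβ hv
  have hn0 : (0 : ℝ) < n := by positivity
  have hnθ : ∀ c : ℝ, (n : ℝ) * (c * π / n) = c * π := fun c => by field_simp
  have hlt : ∀ c d : ℝ, c < d → c * π / n < d * π / n := fun c d hcd => by gcongr
  have s₁ : sin (n * ((1 / 2) * π / n)) = 1 := by
    rw [hnθ, one_div_mul_eq_div, sin_pi_div_two]
  have s₂ : sin (n * ((3 / 2) * π / n)) = -1 := by
    rw [hnθ, show (3 / 2 : ℝ) * π = π / 2 + π by ring, sin_add_pi, sin_pi_div_two]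
  have s₃ : sin (n * ((5 / 2) * π / n)) = 1 := by
    rw [hnθ, show (5 / 2 : ℝ) * π = π / 2 + 2 * π by ring, sin_add_two_pi, sin_pi_div_two]
  have s₄ : sin (n * ((7 / 2) * π / n)) = -1 := by
    rw [hnθ, show (7 / 2 : ℝ) * π = π / 2 + 2 * π + π by ring, sin_add_pi, sin_add_two_pi,
      sin_pi_div_two]
  refine h.mass_gt_of_alternating hfr hδ (θ₁ := (1 / 2) * π / n) (θ₂ := (3 / 2) * π / n)
    (θ₃ := (5 / 2) * π / n) (θ₄ := (7 / 2) * π / n) (by positivity) (hlt _ _ (by norm_num))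
    (hlt _ _ (by norm_num)) (hlt _ _ (by norm_num)) ?_
    (fun r h0 h1 => sub_pos.1 ((hs r h0 h1 _).1 s₁)) (fun r h0 h1 => sub_neg.1 ((hs r h0 h1 _).2 s₂))
    (fun r h0 h1 => sub_pos.1 ((hs r h0 h1 _).1 s₃)) (fun r h0 h1 => sub_neg.1 ((hs r h0 h1 _).2 s₄))
  rw [div_lt_iff₀ hn0]
  have : (4 : ℝ) ≤ n := by exact_mod_cast hn
  nlinarith [pi_pos]

theorem NodalPair.eq_of_odd (h : NodalPair v₁ v₂ k) (hodd : ∀ z, v₁ (conj z) = v₂ z)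
    (hv : Vanish 4 fun x => v₁ x - v₂ x)
    (hm : ∫ x in {z : ℂ | 0 < z.im}, (rexp (2 * v₁ x) + rexp (2 * v₂ x)) ≤ 12 * π) (z : ℂ) :
    v₁ z = v₂ z := by
  classical
  refine h.eq_of_flat (fun m => ?_) z
  by_contra hex
  have hex : ∃ n, ¬ Vanish n fun x => v₁ x - v₂ x := ⟨m, hex⟩
  have hN := Nat.find_spec hex
  have hmin : ∀ m < Nat.find hex, Vanish m fun x => v₁ x - v₂ x := fun m hm =>
    not_not.1 (Nat.find_min hex hm)
  have hN4 : 4 < Nat.find hex := by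
    by_contra hc
    exact hN (hv.mono (not_lt.1 hc))
  obtain ⟨m, hm'⟩ : ∃ m, Nat.find hex = m + 2 := ⟨Nat.find hex - 2, by omega⟩
  rw [hm'] at hN hmin hN4
  have hvm := hmin (m + 1) (by omega)
  obtain ⟨b, hb⟩ := hvm.exists_leading h.smooth_sub (h.vanish_flatLap_sub hvm).of_succ
  have hodd' : ∀ z, v₂ (conj z) = v₁ z := fun z => by rw [← hodd, Complex.conj_conj]
  have hqs := h.smooth_sub.sub (contDiff_re_pow b (m + 1))
  have hb2 := hb.comp_linear (Complex.conjCLE : ℂ →L[ℝ] ℂ) hqs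
  have hsum := hb.add hqs (hqs.comp (Complex.conjCLE : ℂ →L[ℝ] ℂ).contDiff) hb2
  have hre : b.re = 0 := by
    have e : (fun z => (v₁ z - v₂ z - (b * z ^ (m + 1)).re) +
        (v₁ ((Complex.conjCLE : ℂ →L[ℝ] ℂ) z) - v₂ ((Complex.conjCLE : ℂ →L[ℝ] ℂ) z) -
          (b * ((Complex.conjCLE : ℂ →L[ℝ] ℂ) z) ^ (m + 1)).re)) =
        fun z => ((-2 * b.re : ℝ) * z ^ (m + 1) : ℂ).re := by
      ext z
      have hc : (Complex.conjCLE : ℂ →L[ℝ] ℂ) z = conj z := rfl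
      rw [hc, hodd, hodd', ← map_pow]
      generalize z ^ (m + 1) = y
      simp
      ring
    have hsum := e ▸ hsum
    have := re_eq_zero_of_vanish hsum 1
    simpa using this
  have hbI : b = b.im * Complex.I := by
    apply Complex.ext <;> simp [hre]
  have hfr : ∀ z : ℂ, z.im = 0 → v₁ z = v₂ z := fun z hz => by
    rw [← hodd, Complex.conj_eq_iff_im.2 hz]
  rcases lt_trichotomy b.im 0 with hneg | h0 | hpos
  · refine absurd hm (not_le.2 (h.mass_gt_of_leading hfr (neg_pos.2 hneg) (by omega : 4 ≤ m + 1) ?_))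
    rw [hbI] at hb
    simpa using hb
  · rw [hbI, h0] at hb
    exact hN (by simpa using hb)
  · have hm2 : ∫ x in {z : ℂ | 0 < z.im}, (rexp (2 * v₂ x) + rexp (2 * v₁ x)) ≤ 12 * π := by
      simpa only [add_comm] using hm
    refine absurd hm2 (not_le.2 (h.symm.mass_gt_of_leading (fun z hz => (hfr z hz).symm) hpos
      (by omega : 4 ≤ m + 1) ?_))
    have := hb.neg hqs
    rw [hbI] at this
    convert this using 2 with x
    simp
    ring

end OddDifference

section TotalMass

open Topology Filter Set ComplexConjugate

theorem dir_comp_clm {f : ℂ → ℝ} (hf : ContDiff ℝ ∞ f) (L : ℂ →L[ℝ] ℂ) (e : ℂ) :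
    dir e (fun x => f (L x)) = fun x => dir (L e) f (L x) := by
  ext x
  have := (hf.diffAt (L x)).hasFDerivAt.comp x L.hasFDerivAt
  simp only [dir]
  erw [this.fderiv]
  simp

theorem flatLap_comp_clm {f : ℂ → ℝ} (hf : ContDiff ℝ ∞ f) (L : ℂ →L[ℝ] ℂ) {s : ℝ}
    (h1 : (L 1).re ^ 2 + (L Complex.I).re ^ 2 = s) (h2 : (L 1).im ^ 2 + (L Complex.I).im ^ 2 = s)
    (h3 : (L 1).re * (L 1).im + (L Complex.I).re * (L Complex.I).im = 0) (z : ℂ) :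
    flatLap (fun x => f (L x)) z = s * flatLap f (L z) := by
  have key : ∀ e, dir e (dir e fun x => f (L x)) z =
      (L e).re ^ 2 * dir 1 (dir 1 f) (L z) + (L e).im ^ 2 * dir Complex.I (dir Complex.I f) (L z) +
        2 * ((L e).re * (L e).im) * dir 1 (dir Complex.I f) (L z) := by
    intro e
    rw [dir_comp_clm hf, dir_comp_clm (hf.dir _)]
    beta_reduce
    generalize L e = a
    generalize L z = y
    have e1 : dir a (dir a f) y = a.re * dir 1 (dir a f) y + a.im * dir Complex.I (dir a f) y :=
      congrFun (dir_eq_add a) y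
    have e2 : ∀ e', dir e' (dir a f) y = a.re * dir e' (dir 1 f) y +
        a.im * dir e' (dir Complex.I f) y := by
      intro e'
      rw [dir_comm hf, congrFun (dir_eq_add a) y, dir_comm hf, dir_comm hf _ e']
    rw [e1, e2, e2, dir_comm hf Complex.I 1]
    ring
  rw [flatLap, key, key, flatLap]
  linear_combination dir 1 (dir 1 f) (L z) * h1 + dir Complex.I (dir Complex.I f) (L z) * h2 +
    2 * dir 1 (dir Complex.I f) (L z) * h3

theorem flatLap_comp_mul {f : ℂ → ℝ} (hf : ContDiff ℝ ∞ f) (c z : ℂ) :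
    flatLap (fun x => f (c * x)) z = Complex.normSq c * flatLap f (c * z) := by
  refine flatLap_comp_clm hf (ContinuousLinearMap.mul ℝ ℂ c) ?_ ?_ ?_ z <;>
    simp [Complex.normSq_apply] <;> ring

theorem flatLap_comp_conj {f : ℂ → ℝ} (hf : ContDiff ℝ ∞ f) (z : ℂ) :
    flatLap (fun x => f (conj x)) z = flatLap f (conj z) := by
  rw [← one_mul (flatLap f (conj z))]
  refine flatLap_comp_clm hf (Complex.conjCLE : ℂ →L[ℝ] ℂ) ?_ ?_ ?_ z <;> simp

theorem exists_bound_of_tendsto {U : ℂ → ℝ} (hU : Continuous U) {L : ℝ}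
    (hL : Tendsto U (cocompact ℂ) (𝓝 L)) : ∃ B, ∀ z, |U z| ≤ B := by
  obtain ⟨K, hK, hKL⟩ := mem_cocompact.1 (hL (Metric.ball_mem_nhds L one_pos))
  obtain ⟨B, hB⟩ := hK.exists_bound_of_continuousOn hU.continuousOn
  refine ⟨max B (|L| + 1), fun z => ?_⟩
  by_cases hz : z ∈ K
  · exact (hB z hz).trans (le_max_left _ _)
  · have h1 : |U z - L| < 1 := by simpa [Real.dist_eq] using hKL hz
    have h2 := abs_sub_abs_le_abs_sub (U z) L
    exact le_trans (by linarith) (le_max_right _ _)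

theorem integral_flatLap_eq_zero {U : ℂ → ℝ} (hU : ContDiff ℝ ∞ U) {L : ℝ}
    (hL : Tendsto U (cocompact ℂ) (𝓝 L)) (hi : Integrable (flatLap U)) : ∫ z, flatLap U z = 0 := by
  let χ : ContDiffBump (0 : ℂ) := ⟨1, 2, by positivity, by norm_num⟩
  obtain ⟨φ, hφ⟩ : ∃ φ : ℂ → ℝ, φ = χ := ⟨_, rfl⟩
  have hφs : ContDiff ℝ ∞ φ := hφ ▸ χ.contDiff
  have hφc : HasCompactSupport φ := hφ ▸ χ.hasCompactSupport
  have hφ0 : φ 0 = 1 := by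
    rw [hφ]; exact χ.one_of_mem_closedBall (Metric.mem_closedBall_self (by positivity))
  have hφb : ∀ z, |φ z| ≤ 1 := fun z => by
    rw [hφ, abs_of_nonneg χ.nonneg]; exact χ.le_one
  obtain ⟨B, hB⟩ := exists_bound_of_tendsto hU.continuous hL
  have hR : ∀ n : ℕ, (0:ℝ) < n + 1 := fun n => by positivity
  have hRtop : Tendsto (fun n : ℕ => (n : ℝ) + 1) atTop atTop :=
    tendsto_atTop_add_const_right _ _ tendsto_natCast_atTop_atTop
  have hL1 : ∀ n : ℕ, ∫ z, φ ((((n : ℝ) + 1 : ℝ) : ℂ)⁻¹ * z) * flatLap U z =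
      ∫ y, flatLap φ y * (U ((((n : ℝ) + 1 : ℝ) : ℂ) * y) - L) := by
    intro n
    have hn := hR n
    generalize (n : ℝ) + 1 = r at hn ⊢
    have hrc : (r : ℂ) ≠ 0 := by exact_mod_cast hn.ne'
    have hs : ContDiff ℝ ∞ fun z => φ ((r : ℂ)⁻¹ * z) := hφs.comp (contDiff_const.mul contDiff_id)
    have hc : HasCompactSupport fun z => φ ((r : ℂ)⁻¹ * z) :=
      hφc.comp_homeomorph (Homeomorph.mulLeft₀ _ (inv_ne_zero hrc))
    have hg : ∀ z, flatLap (fun z => U z - L) z = flatLap U z := fun z => by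
      rw [flatLap_sub hU contDiff_const, flatLap_const, sub_zero]
    have h1 := integral_mul_flatLap_comm hs (hU.sub (contDiff_const (c := L))) (Or.inl hc)
    simp only [hg, flatLap_comp_mul hφs] at h1
    rw [h1]
    have h2 := Measure.integral_comp_smul_of_nonneg (volume : Measure ℂ)
      (fun z => flatLap φ ((r : ℂ)⁻¹ * z) * (U z - L)) r (hR := hn.le)
    rw [Complex.finrank_real_complex, smul_eq_mul, ← integral_const_mul] at h2
    simp only [Complex.real_smul, inv_mul_cancel_left₀ hrc] at h2
    rw [h2]
    congr 1
    ext z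
    rw [map_inv₀, Complex.normSq_ofReal, pow_two]
    ring
  have hlim1 : Tendsto (fun n : ℕ => ∫ z, φ ((((n : ℝ) + 1 : ℝ) : ℂ)⁻¹ * z) * flatLap U z) atTop
      (𝓝 (∫ z, flatLap U z)) := by
    refine tendsto_integral_of_dominated_convergence (fun z => |flatLap U z|) (fun n => ?_)
      hi.abs (fun n => Eventually.of_forall fun z => ?_) (Eventually.of_forall fun z => ?_)
    · exact ((hφs.continuous.comp (by fun_prop)).mul hU.flatLap.continuous).aestronglyMeasurable
    · rw [norm_mul]
      exact mul_le_of_le_one_left (norm_nonneg _) (hφb _)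
    · have h1 : Tendsto (fun n : ℕ => (((n : ℝ) + 1 : ℝ) : ℂ)⁻¹ * z) atTop (𝓝 0) := by
        have : Tendsto (fun n : ℕ => (((((n : ℝ) + 1)⁻¹ : ℝ)) : ℂ) * z) atTop (𝓝 (((0:ℝ):ℂ) * z)) :=
          ((Complex.continuous_ofReal.tendsto 0).comp (tendsto_inv_atTop_zero.comp hRtop)).mul_const z
        simpa using this
      have h2 := ((hφs.continuous.tendsto 0).comp h1).mul_const (flatLap U z)
      rwa [hφ0, one_mul] at h2
  have hlim2 : Tendsto (fun n : ℕ => ∫ y, flatLap φ y * (U ((((n : ℝ) + 1 : ℝ) : ℂ) * y) - L)) atTop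
      (𝓝 (∫ _ : ℂ, (0 : ℝ))) := by
    refine tendsto_integral_of_dominated_convergence (fun z => |flatLap φ z| * (B + |L|))
      (fun n => ?_) ?_ (fun n => Eventually.of_forall fun z => ?_) ?_
    · exact (hφs.flatLap.continuous.mul
        ((hU.continuous.comp (by fun_prop)).sub continuous_const)).aestronglyMeasurable
    · exact (hφs.flatLap.continuous.integrable_of_hasCompactSupport
        (hasCompactSupport_flatLap hφc)).abs.mul_const _
    · rw [norm_mul]
      refine mul_le_mul_of_nonneg_left ?_ (norm_nonneg _)
      exact (abs_sub _ _).trans (by linarith [hB ((((n : ℝ) + 1 : ℝ) : ℂ) * z)])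
    · filter_upwards [compl_mem_ae_iff.2 (measure_singleton (0:ℂ))] with y hy
      have hy : y ≠ 0 := hy
      have h1 : Tendsto (fun n : ℕ => (((n : ℝ) + 1 : ℝ) : ℂ) * y) atTop (cocompact ℂ) := by
        rw [← Metric.cobounded_eq_cocompact, ← tendsto_norm_atTop_iff_cobounded]
        simp only [norm_mul, Complex.norm_real]
        refine Tendsto.atTop_mul_const (norm_pos_iff.2 hy) ?_
        exact tendsto_norm_atTop_atTop.comp hRtop
      have h2 := ((hL.comp h1).sub_const L).const_mul (flatLap φ y)
      simpa using h2
  simp only [hL1] at hlim1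
  have := tendsto_nhds_unique hlim1 hlim2
  simpa using this

/-- The density of the round metric in stereographic coordinates. -/
noncomputable def sphereDensity (z : ℂ) : ℝ := 4 / (1 + Complex.normSq z) ^ 2

theorem sphereDensity_pos (z : ℂ) : 0 < sphereDensity z := by
  have := Complex.normSq_nonneg z
  rw [sphereDensity]; positivity

theorem sphereDensity_le (z : ℂ) : sphereDensity z ≤ 4 := by
  have := Complex.normSq_nonneg z
  rw [sphereDensity]
  exact div_le_self (by norm_num) (one_le_pow₀ (by linarith))

theorem sphereDensity_conj (z : ℂ) : sphereDensity (conj z) = sphereDensity z := by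
  simp [sphereDensity]

theorem sphereDensity_mul {c : ℂ} (hc : ‖c‖ = 1) (z : ℂ) :
    sphereDensity (c * z) = sphereDensity z := by
  simp [sphereDensity, Complex.normSq_eq_norm_sq, hc]

theorem integral_sphereDensity : Integrable sphereDensity ∧ ∫ z, sphereDensity z = 4 * π := by
  set g : ℝ → ℝ := fun r => 4 / (1 + r ^ 2) ^ 2 with hg
  have he : sphereDensity = fun z => g ‖z‖ := by
    ext z; rw [sphereDensity, Complex.normSq_eq_norm_sq]
  have hder : ∀ r ∈ Ici (0:ℝ), HasDerivAt (fun r => -2 * (1 + r ^ 2)⁻¹) (r * g r) r := by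
    intro r _
    have hp : 1 + r ^ 2 ≠ 0 := by positivity
    have h := ((((hasDerivAt_id r).pow 2).const_add 1).inv hp).const_mul (-2)
    refine h.congr_deriv ?_
    simp only [hg, id, Pi.pow_apply]
    field_simp
    ring
  have htend : Tendsto (fun r : ℝ => -2 * (1 + r ^ 2)⁻¹) atTop (𝓝 0) := by
    rw [show (0:ℝ) = -2 * 0 by simp]
    apply Tendsto.const_mul
    apply tendsto_inv_atTop_zero.comp
    exact tendsto_atTop_add_const_left _ _ (tendsto_pow_atTop (by norm_num))
  have hpos : ∀ r ∈ Ioi (0:ℝ), 0 ≤ r * g r := by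
    intro r hr
    have : (0:ℝ) < r := hr
    simp only [hg]; positivity
  have hI := integrableOn_Ioi_deriv_of_nonneg' hder hpos htend
  have hV := integral_Ioi_of_hasDerivAt_of_nonneg' hder hpos htend
  rw [he]
  constructor
  · rw [integrable_fun_norm_addHaar (volume : Measure ℂ) (f := g)]
    simpa [Complex.finrank_real_complex] using hI
  · rw [integral_fun_norm_addHaar (volume : Measure ℂ) g]
    simp only [Complex.finrank_real_complex, Nat.add_one_sub_one, pow_one, smul_eq_mul, hV]
    simp [measureReal_def, Complex.volume_ball]
    ring

theorem contDiff_log_one_add_normSq : ContDiff ℝ ∞ fun z : ℂ => Real.log (1 + Complex.normSq z) :=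
  (contDiff_const.add contDiff_normSq).log fun z => by
    have := Complex.normSq_nonneg z; positivity

theorem flatLap_log_one_add_normSq (z : ℂ) :
    flatLap (fun z : ℂ => Real.log (1 + Complex.normSq z)) z = sphereDensity z := by
  have hg := contDiff_log_one_add_normSq
  have hpos : ∀ z, 0 < 1 + Complex.normSq z := fun z => by
    have := Complex.normSq_nonneg z; positivity
  have h1 := flatLap_comp Real.contDiff_exp hg z
  have h2 := gr_comp z (j := rexp) Real.differentiable_exp.differentiableAt (hg.diffAt z)
  have h3 : flatLap (fun z : ℂ => 1 + Complex.normSq z) z = 4 := by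
    rw [flatLap_add contDiff_const contDiff_normSq, flatLap_const, flatLap_normSq, zero_add]
  have h4 : gr (fun z : ℂ => 1 + Complex.normSq z) z = 2 * z := by
    have := gr_sub z (f := fun z : ℂ => Complex.normSq z) (g := fun _ => -1)
      (contDiff_normSq.diffAt z) (by fun_prop)
    have h0 : gr (fun _ : ℂ => (-1 : ℝ)) z = 0 := by apply Complex.ext <;> simp [gr, dir_const]
    rw [gr_normSq, h0, sub_zero] at this
    simpa only [sub_neg_eq_add, add_comm] using this
  simp only [Real.exp_log (hpos _), Real.deriv_exp, h3] at h1
  simp only [Real.exp_log (hpos _), Real.deriv_exp, h4] at h2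
  have h5 : 4 * Complex.normSq z = (1 + Complex.normSq z) ^ 2 *
      Complex.normSq (gr (fun z => Real.log (1 + Complex.normSq z)) z) := by
    have := congrArg Complex.normSq h2
    rw [Complex.normSq_mul, Complex.normSq_mul, Complex.normSq_ofReal] at this
    rw [pow_two, ← this]
    norm_num [Complex.normSq_apply]
  have hz := hpos z
  rw [sphereDensity, eq_div_iff (by positivity)]
  linear_combination (-(1 + Complex.normSq z)) * h1 + h5

end TotalMass

section MeanFieldPlane

open Topology Filter Set ComplexConjugate

/-- The mean field equation of the sphere in stereographic coordinates. -/
structure PlaneSolution (U : ℂ → ℝ) (α : ℝ) : Prop where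
  smooth : ContDiff ℝ ∞ U
  flatLap_eq : ∀ z, flatLap U z = sphereDensity z * (α - rexp (2 * U z))
  tendsto : ∃ L, Tendsto U (cocompact ℂ) (𝓝 L)

/-- The logarithm of the conformal factor of the metric `exp (2 U)` times the round one. -/
noncomputable def logFactor (U : ℂ → ℝ) (z : ℂ) : ℝ :=
  U z + (Real.log 2 - Real.log (1 + Complex.normSq z))

variable {U : ℂ → ℝ} {α : ℝ}

theorem exp_logFactor (U : ℂ → ℝ) (z : ℂ) :
    rexp (2 * logFactor U z) = sphereDensity z * rexp (2 * U z) := by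
  have h : 0 < 1 + Complex.normSq z := by have := Complex.normSq_nonneg z; positivity
  rw [logFactor, mul_add, Real.exp_add, mul_comm]
  congr 1
  rw [two_mul, Real.exp_add, Real.exp_sub, Real.exp_log two_pos, Real.exp_log h, sphereDensity]
  field_simp
  norm_num

theorem logFactor_conj (U : ℂ → ℝ) (z : ℂ) :
    logFactor U (conj z) = logFactor (fun x => U (conj x)) z := by
  simp [logFactor]

theorem contDiff_logFactor (hU : ContDiff ℝ ∞ U) : ContDiff ℝ ∞ (logFactor U) :=
  hU.add (contDiff_const.sub contDiff_log_one_add_normSq)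

theorem logFactor_sub (U V : ℂ → ℝ) (z : ℂ) : logFactor U z - logFactor V z = U z - V z := by
  simp [logFactor]

theorem exp_logFactor_le {B : ℝ} (hB : ∀ z, |U z| ≤ B) (z : ℂ) :
    rexp (2 * logFactor U z) ≤ rexp (2 * B) * sphereDensity z := by
  rw [exp_logFactor, mul_comm]
  have := le_of_abs_le (hB z)
  have := (sphereDensity_pos z).le
  gcongr

namespace PlaneSolution

theorem flatLap_logFactor (hU : PlaneSolution U α) (z : ℂ) :
    -flatLap (logFactor U) z = rexp (2 * logFactor U z) - (α - 1) * sphereDensity z := by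
  have h1 : flatLap (logFactor U) z = flatLap U z - sphereDensity z := by
    unfold logFactor
    rw [flatLap_add hU.smooth (contDiff_const.sub contDiff_log_one_add_normSq),
      flatLap_sub contDiff_const contDiff_log_one_add_normSq, flatLap_const,
      flatLap_log_one_add_normSq]
    ring
  rw [h1, hU.flatLap_eq, exp_logFactor]
  ring

theorem exists_abs_le (hU : PlaneSolution U α) : ∃ B, ∀ z, |U z| ≤ B :=
  let ⟨_, hL⟩ := hU.tendsto
  exists_bound_of_tendsto hU.smooth.continuous hL

theorem comp_mul (hU : PlaneSolution U α) {c : ℂ} (hc : ‖c‖ = 1) :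
    PlaneSolution (fun z => U (c * z)) α where
  smooth := hU.smooth.comp (contDiff_const.mul contDiff_id)
  flatLap_eq z := by
    rw [flatLap_comp_mul hU.smooth, hU.flatLap_eq, sphereDensity_mul hc,
      Complex.normSq_eq_norm_sq, hc]
    ring
  tendsto := by
    obtain ⟨L, hL⟩ := hU.tendsto
    have hc0 : c ≠ 0 := by rintro rfl; simp at hc
    exact ⟨L, hL.comp (Homeomorph.mulLeft₀ c hc0).isClosedEmbedding.tendsto_cocompact⟩

theorem comp_conj (hU : PlaneSolution U α) : PlaneSolution (fun z => U (conj z)) α where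
  smooth := hU.smooth.comp contDiff_conj
  flatLap_eq z := by rw [flatLap_comp_conj hU.smooth, hU.flatLap_eq, sphereDensity_conj]
  tendsto := by
    obtain ⟨L, hL⟩ := hU.tendsto
    exact ⟨L, hL.comp Complex.conjCLE.toHomeomorph.isClosedEmbedding.tendsto_cocompact⟩

theorem integrable_exp (hU : PlaneSolution U α) : Integrable fun z => rexp (2 * logFactor U z) := by
  obtain ⟨B, hB⟩ := hU.exists_abs_le
  refine (integral_sphereDensity.1.const_mul (rexp (2 * B))).mono' ?_
    (Eventually.of_forall fun z => ?_)
  · have := (contDiff_logFactor hU.smooth).continuous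
    exact (by fun_prop : Continuous fun z => rexp (2 * logFactor U z)).aestronglyMeasurable
  · rw [Real.norm_of_nonneg (Real.exp_pos _).le]
    exact exp_logFactor_le hB z

theorem integral_exp (hU : PlaneSolution U α) :
    ∫ z, rexp (2 * logFactor U z) = 4 * π * α := by
  obtain ⟨L, hL⟩ := hU.tendsto
  have he : flatLap U = fun z => α * sphereDensity z - rexp (2 * logFactor U z) := by
    ext z; rw [hU.flatLap_eq, exp_logFactor]; ring
  have hi := integral_sphereDensity.1.const_mul α
  have h := integral_flatLap_eq_zero hU.smooth hL (by rw [he]; exact hi.sub hU.integrable_exp)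
  rw [he, integral_sub hi hU.integrable_exp, integral_const_mul, integral_sphereDensity.2] at h
  linarith

theorem curvature_le (hU : PlaneSolution U α) {B : ℝ} (hB : ∀ z, |U z| ≤ B) (hα : 1 < α) (z : ℂ) :
    -flatLap (logFactor U) z ≤
      rexp (2 * B) / (rexp (2 * B) + (α - 1)) * rexp (2 * logFactor U z) := by
  rw [hU.flatLap_logFactor]
  have h1 := exp_logFactor_le hB z
  have h2 := Real.exp_pos (2 * B)
  have h3 := Real.exp_pos (2 * logFactor U z)
  have h4 : 0 < rexp (2 * B) + (α - 1) := by linarith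
  have h5 := sphereDensity_pos z
  rw [div_mul_eq_mul_div, le_div_iff₀ h4]
  have h6 : 0 < α - 1 := by linarith
  have h7 : 0 < (α - 1) ^ 2 * sphereDensity z := by positivity
  nlinarith

theorem nodalPair (hU : PlaneSolution U α) (hα : 1 < α) :
    ∃ k, NodalPair (logFactor U) (logFactor fun z => U (conj z)) k := by
  obtain ⟨B, hB⟩ := hU.exists_abs_le
  have hV := hU.comp_conj
  have hBV : ∀ z, |U (conj z)| ≤ B := fun z => hB _
  have h2 := Real.exp_pos (2 * B)
  have h4 : 0 < rexp (2 * B) + (α - 1) := by linarith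
  refine ⟨rexp (2 * B) / (rexp (2 * B) + (α - 1)), contDiff_logFactor hU.smooth,
    contDiff_logFactor hV.smooth, fun z => ?_, by positivity, ?_, hU.curvature_le hB hα,
    hV.curvature_le hBV hα, ?_, hU.integrable_exp, hV.integrable_exp, 4 * rexp (2 * B), fun z => ?_⟩
  · rw [flatLap_sub (contDiff_logFactor hU.smooth) (contDiff_logFactor hV.smooth)]
    linarith [hU.flatLap_logFactor z, hV.flatLap_logFactor z]
  · rw [div_lt_one h4]; linarith
  · obtain ⟨L, hL⟩ := hU.tendsto
    simp only [logFactor_sub]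
    have := hL.sub (hL.comp Complex.conjCLE.toHomeomorph.isClosedEmbedding.tendsto_cocompact)
    rwa [sub_self] at this
  · have h5 := sphereDensity_le z
    have : rexp (2 * B) * sphereDensity z ≤ 4 * rexp (2 * B) := by nlinarith
    exact ⟨(exp_logFactor_le hB z).trans this, (exp_logFactor_le hBV z).trans this⟩

theorem mass_upperHalf_le (hU : PlaneSolution U α) :
    ∫ z in {z : ℂ | 0 < z.im}, (rexp (2 * logFactor U z) +
      rexp (2 * logFactor (fun x => U (conj x)) z)) ≤ 4 * π * α := by
  have hi := hU.integrable_exp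
  rw [integral_add hi.integrableOn hU.comp_conj.integrable_exp.integrableOn]
  have h1 : ∫ z in {z : ℂ | 0 < z.im}, rexp (2 * logFactor (fun x => U (conj x)) z) =
      ∫ z in {z : ℂ | z.im < 0}, rexp (2 * logFactor U z) := by
    simp only [← logFactor_conj]
    have hm := Complex.conjLIE.measurePreserving.setIntegral_preimage_emb
      Complex.conjLIE.toHomeomorph.measurableEmbedding (fun z => rexp (2 * logFactor U z))
      {z : ℂ | z.im < 0}
    rw [← hm]
    congr 2
    ext z
    simp
  rw [h1, ← setIntegral_union _ (isOpen_lt Complex.continuous_im continuous_const).measurableSet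
    hi.integrableOn hi.integrableOn, ← hU.integral_exp]
  · exact setIntegral_le_integral hi (Eventually.of_forall fun z => (Real.exp_pos _).le)
  · exact Set.disjoint_left.2 fun z (h : 0 < z.im) (h' : z.im < 0) => lt_asymm h h'

theorem conj_eq_of_logFactor_eq {z : ℂ}
    (h : logFactor U z = logFactor (fun x => U (conj x)) z) : U (conj z) = U z := by
  have := logFactor_sub U (fun x => U (conj x)) z
  linarith

theorem symm_of_vanish (hU : PlaneSolution U α) (hα : 1 < α) (hα3 : α ≤ 3)
    (hv : Vanish 4 fun z => U z - U (conj z)) (z : ℂ) : U (conj z) = U z := by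
  obtain ⟨k, hk⟩ := hU.nodalPair hα
  refine conj_eq_of_logFactor_eq (hk.eq_of_odd (logFactor_conj U) ?_
    (hU.mass_upperHalf_le.trans (by nlinarith [pi_pos])) z)
  simpa only [logFactor_sub] using hv

end PlaneSolution

end MeanFieldPlane

section Rotation

open Topology Filter Set ComplexConjugate

/-- The intersection of two open half planes bounded by lines through the origin. -/
def wedge (a b : ℂ) : Set ℂ := {z | 0 < (a * z).im} ∩ {z | 0 < (b * z).im}

theorem continuous_mul_im (a : ℂ) : Continuous fun z : ℂ => (a * z).im := by fun_prop

theorem isOpen_wedge (a b : ℂ) : IsOpen (wedge a b) :=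
  (isOpen_lt continuous_const (continuous_mul_im a)).inter
    (isOpen_lt continuous_const (continuous_mul_im b))

theorem convex_wedge (a b : ℂ) : Convex ℝ (wedge a b) := by
  have h : ∀ a : ℂ, IsLinearMap ℝ fun z : ℂ => (a * z).im := fun a =>
    (Complex.imLm ∘ₗ LinearMap.mulLeft ℝ a).isLinear
  exact (convex_halfSpace_gt (h a) 0).inter (convex_halfSpace_gt (h b) 0)

theorem frontier_wedge_subset {a b z : ℂ} (hz : z ∈ frontier (wedge a b)) :
    (a * z).im = 0 ∨ (b * z).im = 0 := by
  rcases frontier_inter_subset _ _ hz with h | h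
  · exact Or.inl (frontier_lt_subset_eq continuous_const (continuous_mul_im a) h.1).symm
  · exact Or.inr (frontier_lt_subset_eq continuous_const (continuous_mul_im b) h.2).symm

theorem NodalPair.exists_mass_gt_in_wedge {v₁ v₂ : ℂ → ℝ} {k : ℝ} (h : NodalPair v₁ v₂ k) {a b : ℂ}
    (ha : ∀ z, (a * z).im = 0 → v₁ z = v₂ z) (hb : ∀ z, (b * z).im = 0 → v₁ z = v₂ z) {z : ℂ}
    (hz : z ∈ wedge a b) (hne : v₁ z ≠ v₂ z) : ∃ D, IsOpen D ∧ D ⊆ wedge a b ∧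
      4 * π < ∫ x in D, (rexp (2 * v₁ x) + rexp (2 * v₂ x)) := by
  have ho := isOpen_wedge a b
  have hfr : ∀ x ∈ frontier (wedge a b), v₁ x = v₂ x := fun x hx =>
    (frontier_wedge_subset hx).elim (ha x) (hb x)
  obtain ⟨D, hD, hF, -⟩ := h.exists_full_component ho (full_of_convex (convex_wedge a b) ho) hfr
    (C := connectedComponentIn (diffSet (wedge a b) v₁ v₂) z) ⟨z, ⟨hz, hne⟩, rfl⟩
  exact ⟨D, hD.isOpen (h.isOpen_diffSet ho), hD.subset.trans fun x hx => hx.1,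
    h.mass_gt ho hfr hD hF⟩

namespace PlaneSolution

variable {U : ℂ → ℝ} {α : ℝ}

theorem symm_of_rotation (hU : PlaneSolution U α) (hα : 1 < α) (hα3 : α ≤ 3) {ζ : ℂ}
    (hζ : ζ ^ 2 + ζ + 1 = 0) (hrot : ∀ z, U (ζ * z) = U z) (z : ℂ) : U (conj z) = U z := by
  obtain ⟨k, hk⟩ := hU.nodalPair hα
  have hcube : ζ ^ 3 = 1 := by linear_combination (ζ - 1) * hζ
  have hnorm : ‖ζ‖ = 1 := by
    have : ‖ζ‖ ^ 3 = 1 := by rw [← norm_pow, hcube, norm_one]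
    exact (pow_eq_one_iff_of_nonneg (norm_nonneg _) (by norm_num)).1 this
  have hconj : conj ζ = ζ ^ 2 := by
    have h1 : ζ * conj ζ = 1 := by rw [Complex.mul_conj, Complex.normSq_eq_norm_sq, hnorm]; simp
    linear_combination ζ ^ 2 * h1 - conj ζ * hcube
  have hrot2 : ∀ z, U (ζ ^ 2 * z) = U z := fun z => by rw [pow_two, mul_assoc, hrot, hrot]
  have hsum : ∀ z : ℂ, z.im + (ζ * z).im + (ζ ^ 2 * z).im = 0 := fun z => by
    rw [← Complex.add_im, ← Complex.add_im,
      show z + ζ * z + ζ ^ 2 * z = (ζ ^ 2 + ζ + 1) * z by ring, hζ, zero_mul, Complex.zero_im]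
  have hc0 : ∀ z : ℂ, (conj z).im = -z.im := Complex.conj_im
  have hc1 : ∀ z, (ζ * conj z).im = -(ζ ^ 2 * z).im := fun z => by
    rw [← Complex.conj_im, map_mul, map_pow, hconj, ← pow_mul]
    congr 2
    linear_combination (-ζ) * hcube
  have hc2 : ∀ z, (ζ ^ 2 * conj z).im = -(ζ * z).im := fun z => by
    rw [← Complex.conj_im, map_mul, hconj]
  have hrefl : ∀ z : ℂ, U z ≠ U (conj z) → U (conj z) ≠ U (conj (conj z)) := fun z h => by
    rw [Complex.conj_conj]; exact h.symm
  have hne1 : ∀ z : ℂ, U z ≠ U (conj z) → U (ζ * z) ≠ U (conj (ζ * z)) := fun z h => by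
    rwa [map_mul, hconj, hrot, hrot2]
  have hne2 : ∀ z : ℂ, U z ≠ U (conj z) → U (ζ ^ 2 * z) ≠ U (conj (ζ ^ 2 * z)) := fun z h => by
    rw [pow_two, mul_assoc]; exact hne1 _ (hne1 _ h)
  have hline0 : ∀ z : ℂ, z.im = 0 → U z = U (conj z) := fun z hz => by
    rw [Complex.conj_eq_iff_im.2 hz]
  have hline1 : ∀ z : ℂ, (ζ * z).im = 0 → U z = U (conj z) := fun z hz => by
    by_contra h
    exact hne1 z h (hline0 _ hz)
  have hline2 : ∀ z : ℂ, (ζ ^ 2 * z).im = 0 → U z = U (conj z) := fun z hz => by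
    by_contra h
    exact hne2 z h (hline0 _ hz)
  have hneg : ∀ a z : ℂ, (-a * z).im = -(a * z).im := fun a z => by rw [neg_mul, Complex.neg_im]
  have hlf : ∀ z : ℂ, logFactor U z = logFactor (fun x => U (conj x)) z ↔ U z = U (conj z) :=
    fun z => by rw [← sub_eq_zero, logFactor_sub, sub_eq_zero]
  by_contra hz
  obtain ⟨y, hy, hy1, hy2⟩ : ∃ y : ℂ, U y ≠ U (conj y) ∧ 0 < (ζ * y).im ∧ 0 < (ζ ^ 2 * y).im := by
    have key : ∀ x : ℂ, U x ≠ U (conj x) → 0 < x.im → 0 < (ζ * x).im →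
        ∃ y : ℂ, U y ≠ U (conj y) ∧ 0 < (ζ * y).im ∧ 0 < (ζ ^ 2 * y).im := fun x hx h0 h1 => by
      refine ⟨ζ ^ 2 * x, hne2 x hx, ?_, ?_⟩
      · rwa [show ζ * (ζ ^ 2 * x) = x by linear_combination x * hcube]
      · rwa [show ζ ^ 2 * (ζ ^ 2 * x) = ζ * x by linear_combination ζ * x * hcube]
    have two : ∀ x : ℂ, U x ≠ U (conj x) →
        (0 < x.im ∧ 0 < (ζ * x).im) ∨ (0 < x.im ∧ 0 < (ζ ^ 2 * x).im) ∨
          (0 < (ζ * x).im ∧ 0 < (ζ ^ 2 * x).im) →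
        ∃ y : ℂ, U y ≠ U (conj y) ∧ 0 < (ζ * y).im ∧ 0 < (ζ ^ 2 * y).im := by
      rintro x hx (h | h | h)
      · exact key x hx h.1 h.2
      · refine key _ (hne2 x hx) h.2 ?_
        rw [show ζ * (ζ ^ 2 * x) = x by linear_combination x * hcube]
        exact h.1
      · exact ⟨x, hx, h⟩
    have hz' : U z ≠ U (conj z) := Ne.symm hz
    have n0 : z.im ≠ 0 := fun h => hz' (hline0 z h)
    have n1 : (ζ * z).im ≠ 0 := fun h => hz' (hline1 z h)
    have n2 : (ζ ^ 2 * z).im ≠ 0 := fun h => hz' (hline2 z h)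
    have d0 := hc0 z
    have d1 := hc1 z
    have d2 := hc2 z
    rcases n0.lt_or_gt with s0 | s0 <;> rcases n1.lt_or_gt with s1 | s1 <;>
      rcases n2.lt_or_gt with s2 | s2
    · exact two _ (hrefl z hz') (Or.inl ⟨by linarith, by linarith⟩)
    · exact two _ (hrefl z hz') (Or.inr (Or.inl ⟨by linarith, by linarith⟩))
    · exact two _ (hrefl z hz') (Or.inl ⟨by linarith, by linarith⟩)
    · exact two z hz' (Or.inr (Or.inr ⟨s1, s2⟩))
    · exact two _ (hrefl z hz') (Or.inr (Or.inr ⟨by linarith, by linarith⟩))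
    · exact two z hz' (Or.inr (Or.inl ⟨s0, s2⟩))
    · exact two z hz' (Or.inl ⟨s0, s1⟩)
    · exact two z hz' (Or.inl ⟨s0, s1⟩)
  have m1 := hk.exists_mass_gt_in_wedge (a := 1) (b := ζ) (z := ζ * y)
    (fun z hz => (hlf z).2 (hline0 z (by simpa using hz))) (fun z hz => (hlf z).2 (hline1 z hz))
    ⟨by simpa using hy1, by simpa [pow_two, mul_assoc] using hy2⟩ (fun h => hne1 y hy ((hlf _).1 h))
  have m2 := hk.exists_mass_gt_in_wedge (a := -ζ) (b := -ζ ^ 2) (z := conj y)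
    (fun z hz => (hlf z).2 (hline1 z (neg_eq_zero.1 (hneg ζ z ▸ hz))))
    (fun z hz => (hlf z).2 (hline2 z (neg_eq_zero.1 (hneg (ζ ^ 2) z ▸ hz))))
    ⟨by simpa only [mem_ofPred_eq, hneg, hc1, neg_neg] using hy2,
      by simpa only [mem_ofPred_eq, hneg, hc2, neg_neg] using hy1⟩ (fun h => hrefl y hy ((hlf _).1 h))
  have m3 := hk.exists_mass_gt_in_wedge (a := 1) (b := ζ ^ 2) (z := ζ ^ 2 * y)
    (fun z hz => (hlf z).2 (hline0 z (by simpa using hz))) (fun z hz => (hlf z).2 (hline2 z hz))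
    ⟨by simpa using hy2, by
      have : ζ ^ 2 * (ζ ^ 2 * y) = ζ * y := by linear_combination ζ * y * hcube
      simpa only [mem_ofPred_eq, this] using hy1⟩ (fun h => hne2 y hy ((hlf _).1 h))
  obtain ⟨D₁, o₁, s₁, m₁⟩ := m1
  obtain ⟨D₂, o₂, s₂, m₂⟩ := m2
  obtain ⟨D₃, o₃, s₃, m₃⟩ := m3
  have w1 : ∀ x ∈ wedge 1 ζ, 0 < x.im ∧ 0 < (ζ * x).im := fun x hx => ⟨by simpa using hx.1, hx.2⟩
  have w2 : ∀ x ∈ wedge (-ζ) (-ζ ^ 2), (ζ * x).im < 0 ∧ (ζ ^ 2 * x).im < 0 := fun x hx =>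
    ⟨neg_pos.1 (hneg ζ x ▸ hx.1), neg_pos.1 (hneg (ζ ^ 2) x ▸ hx.2)⟩
  have w3 : ∀ x ∈ wedge 1 (ζ ^ 2), 0 < x.im ∧ 0 < (ζ ^ 2 * x).im := fun x hx =>
    ⟨by simpa using hx.1, hx.2⟩
  have hm := hk.mass_gt_of_disjoint (H := {z : ℂ | 0 < z.im}) o₂ o₃
    (fun x hx => (w1 x (s₁ hx)).1)
    (fun x hx => by
      have := w2 x (s₂ hx)
      have h0 := hsum x
      show 0 < x.im
      linarith [this.1, this.2])
    (fun x hx => (w3 x (s₃ hx)).1)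
    (Set.disjoint_left.2 fun x h1 h2 => lt_asymm (w1 x (s₁ h1)).2 (w2 x (s₂ h2)).1)
    (Set.disjoint_left.2 fun x h1 h2 => by
      have h0 := hsum x
      linarith [w1 x (s₁ h1), w3 x (s₃ h2)])
    (Set.disjoint_left.2 fun x h1 h2 => lt_asymm (w3 x (s₃ h2)).2 (w2 x (s₂ h1)).2) m₁ m₂ m₃
  exact absurd (hU.mass_upperHalf_le.trans (by nlinarith [pi_pos])) (not_le.2 hm)

end PlaneSolution

end Rotation

section Radial

open Topology Filter Set ComplexConjugate

theorem contDiff_sphereDensity : ContDiff ℝ ∞ sphereDensity :=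
  contDiff_const.div ((contDiff_const.add contDiff_normSq).pow 2) fun z => by
    have := Complex.normSq_nonneg z
    positivity

theorem dir_sphereDensity_zero (e : ℂ) : dir e sphereDensity 0 = 0 := by
  have h : IsLocalMax sphereDensity 0 :=
    Eventually.of_forall fun z => (sphereDensity_le z).trans (by simp [sphereDensity])
  simp [dir, h.fderiv_eq_zero]

/-- A critical point at which the Hessian is a multiple of the metric. -/
structure IsUmbilical (U : ℂ → ℝ) : Prop where
  dir_eq_zero : ∀ e, dir e U 0 = 0
  dir_dir : ∃ κ, ∀ e, dir e (dir e U) 0 = κ * Complex.normSq e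

theorem vanish_three_of_diagonal {w : ℂ → ℝ} (hw : ContDiff ℝ ∞ w) (h0 : w 0 = 0)
    (h1 : ∀ e, dir e w 0 = 0) (h2 : ∀ e, dir e (dir e w) 0 = 0) : Vanish 3 w := by
  have hmix : dir 1 (dir Complex.I w) 0 = 0 := by
    have h3 := h2 (1 + Complex.I)
    have e1 : dir (1 + Complex.I) w = fun z => dir 1 w z + dir Complex.I w z := by
      rw [dir_eq_add]; ext z; simp
    rw [e1, dir_add _ _ ((hw.dir _).diffAt 0) ((hw.dir _).diffAt 0)] at h3
    have e2 : ∀ f : ℂ → ℝ, dir (1 + Complex.I) f 0 = dir 1 f 0 + dir Complex.I f 0 := fun f => by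
      have := congrFun (dir_eq_add (f := f) (1 + Complex.I)) 0
      simpa using this
    rw [e2, e2, h2, h2, dir_comm hw Complex.I 1] at h3
    linarith
  exact ⟨h0, ⟨h1 _, ⟨h2 _, trivial, trivial⟩, (dir_comm hw Complex.I 1 0).trans hmix, trivial, trivial⟩,
    h1 _, ⟨hmix, trivial, trivial⟩, h2 _, trivial, trivial⟩

namespace PlaneSolution

variable {U : ℂ → ℝ} {α : ℝ}

theorem exists_cubic (hU : PlaneSolution U α) (hum : IsUmbilical U) : ∃ (a : ℂ) (c₀ : ℝ),
    Vanish 4 fun z => U z - U 0 - c₀ * Complex.normSq z - (a * z ^ 3).re := by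
  obtain ⟨κ, hκ⟩ := hum.dir_dir
  have hcn : ContDiff ℝ ∞ fun z : ℂ => κ / 2 * Complex.normSq z := contDiff_const.mul contDiff_normSq
  have hU0 : ContDiff ℝ ∞ fun z => U z - U 0 := hU.smooth.sub contDiff_const
  set w : ℂ → ℝ := fun z => U z - U 0 - κ / 2 * Complex.normSq z with hwdef
  have hw : ContDiff ℝ ∞ w := hU0.sub hcn
  have hd : ∀ e, dir e w = fun z => dir e U z - κ * (z.re * e.re + z.im * e.im) := fun e => by
    ext z
    rw [hwdef, dir_sub _ _ (hU0.diffAt z) (hcn.diffAt z),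
      dir_sub _ _ (hU.smooth.diffAt z) (by fun_prop), dir_const,
      dir_mul _ _ (by fun_prop) (contDiff_normSq.diffAt z), dir_const, dir_normSq]
    ring
  have hlin : ∀ e z : ℂ, HasFDerivAt (fun z : ℂ => κ * (z.re * e.re + z.im * e.im))
      (κ • (e.re • Complex.reCLM + e.im • Complex.imCLM)) z := fun e z => by
    have := (κ • (e.re • Complex.reCLM + e.im • Complex.imCLM)).hasFDerivAt (x := z)
    refine this.congr_of_eventuallyEq (Eventually.of_forall fun x => ?_)
    simp
    ring
  have hdd : ∀ e, dir e (dir e w) 0 = 0 := fun e => by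
    rw [hd, dir_sub _ _ ((hU.smooth.dir e).diffAt 0) (hlin e 0).differentiableAt, hκ]
    simp [dir, (hlin e 0).fderiv, Complex.normSq_apply]
    ring
  have hd0 : ∀ e, dir e w 0 = 0 := fun e => by simp [hd, hum.dir_eq_zero]
  have h3 : Vanish 3 w := vanish_three_of_diagonal hw (by simp [hwdef]) hd0 hdd
  have hflat : flatLap w = fun z => sphereDensity z * (α - rexp (2 * U z)) - 2 * κ := by
    ext z
    have h4 : flatLap (fun z : ℂ => κ / 2 * Complex.normSq z) z = 2 * κ := by
      have h5 : ∀ e, dir e (fun z : ℂ => κ / 2 * Complex.normSq z) =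
          fun z => κ * (z.re * e.re + z.im * e.im) := fun e => by
        ext z
        rw [dir_mul _ _ (by fun_prop) (contDiff_normSq.diffAt z), dir_const, dir_normSq]
        ring
      have h6 : ∀ e z, dir e (fun z : ℂ => κ * (z.re * e.re + z.im * e.im)) z =
          κ * Complex.normSq e := fun e z => by
        simp [dir, (hlin e z).fderiv, Complex.normSq_apply]
        ring
      show dir 1 (dir 1 _) z + dir Complex.I (dir Complex.I _) z = _
      rw [h5, h5, h6, h6]
      simp
      ring
    rw [hwdef, flatLap_sub hU0 hcn, flatLap_sub hU.smooth contDiff_const, flatLap_const,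
      hU.flatLap_eq, h4, sub_zero]
  have hg : ContDiff ℝ ∞ fun z => α - rexp (2 * U z) :=
    contDiff_const.sub (Real.contDiff_exp.comp (contDiff_const.mul hU.smooth))
  have hdflat : ∀ e, dir e (flatLap w) 0 = 0 := fun e => by
    have he : dir e (fun z => α - rexp (2 * U z)) 0 = 0 := by
      rw [dir_comp (j := fun t => α - rexp (2 * t)) e 0 (by fun_prop) (hU.smooth.diffAt 0),
        hum.dir_eq_zero, mul_zero]
    have hp := contDiff_sphereDensity.mul hg
    rw [hflat, dir_sub _ _ (hp.diffAt 0) (by fun_prop), dir_const,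
      dir_mul _ _ (contDiff_sphereDensity.diffAt 0) (hg.diffAt 0), he, dir_sphereDensity_zero]
    ring
  have hv2 : Vanish 2 (flatLap w) := by
    refine ⟨?_, ⟨hdflat _, trivial, trivial⟩, hdflat _, trivial, trivial⟩
    show dir 1 (dir 1 w) 0 + dir Complex.I (dir Complex.I w) 0 = 0
    rw [hdd, hdd, add_zero]
  obtain ⟨a, ha⟩ := h3.exists_leading hw hv2
  exact ⟨a, κ / 2, ha⟩

theorem symm_of_cubic_real (hU : PlaneSolution U α) (hα : 1 < α) (hα3 : α ≤ 3) {a : ℂ} {c₀ : ℝ}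
    (hv : Vanish 4 fun z => U z - U 0 - c₀ * Complex.normSq z - (a * z ^ 3).re) {c : ℂ}
    (hc : ‖c‖ = 1) (hac : (a * c ^ 3).im = 0) (z : ℂ) : U (c * conj z) = U (c * z) := by
  refine (hU.comp_mul hc).symm_of_vanish hα hα3 ?_ z
  have hsm : ContDiff ℝ ∞ fun z => U z - U 0 - c₀ * Complex.normSq z - (a * z ^ 3).re :=
    ((hU.smooth.sub contDiff_const).sub (contDiff_const.mul contDiff_normSq)).sub
      (contDiff_re_pow a 3)
  let L : ℂ →L[ℝ] ℂ := ContinuousLinearMap.mul ℝ ℂ c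
  let M : ℂ →L[ℝ] ℂ := L ∘L (Complex.conjCLE : ℂ →L[ℝ] ℂ)
  have h1 := hv.comp_linear L hsm
  have h2 := hv.comp_linear M hsm
  have h3 := h1.sub (hsm.comp L.contDiff) (hsm.comp M.contDiff) h2
  convert h3 using 2 with z
  have hL : L z = c * z := rfl
  have hM : M z = c * conj z := rfl
  have hcub : (a * (c * conj z) ^ 3).re = (a * (c * z) ^ 3).re := by
    have hr : conj (a * c ^ 3) = a * c ^ 3 := Complex.conj_eq_iff_im.2 hac
    rw [← Complex.conj_re, show a * (c * conj z) ^ 3 = a * c ^ 3 * conj z ^ 3 by ring, map_mul, hr,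
      map_pow, Complex.conj_conj, mul_assoc, mul_pow]
  rw [Function.comp_apply, Function.comp_apply, hL, hM, hcub, Complex.normSq_mul,
    Complex.normSq_mul, Complex.normSq_conj]
  ring

theorem exists_unit_cube_real (a : ℂ) : ∃ c : ℂ, ‖c‖ = 1 ∧ (a * c ^ 3).im = 0 := by
  refine ⟨Complex.exp (((-a.arg / 3 : ℝ) : ℂ) * Complex.I), Complex.norm_exp_ofReal_mul_I _, ?_⟩
  rw [← Complex.exp_nat_mul]
  nth_rewrite 1 [← Complex.norm_mul_exp_arg_mul_I a]
  rw [mul_assoc, ← Complex.exp_add]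
  have : (a.arg : ℂ) * Complex.I + ((3 : ℕ) : ℂ) * (((-a.arg / 3 : ℝ) : ℂ) * Complex.I) = 0 := by
    push_cast; ring
  rw [this, Complex.exp_zero, mul_one, Complex.ofReal_im]

theorem radial (hU : PlaneSolution U α) (hα : 1 < α) (hα3 : α ≤ 3) (hum : IsUmbilical U)
    {z z' : ℂ} (h : ‖z‖ = ‖z'‖) : U z = U z' := by
  obtain ⟨a, c₀, hv⟩ := hU.exists_cubic hum
  obtain ⟨c, hc, hac⟩ := exists_unit_cube_real a
  obtain ⟨η, hη⟩ : ∃ η : ℂ, η ^ 2 - η + 1 = 0 := by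
    obtain ⟨s, hs⟩ := IsAlgClosed.exists_pow_nat_eq (-3 : ℂ) (n := 2) two_pos
    exact ⟨(1 + s) / 2, by linear_combination hs / 4⟩
  have hη3 : η ^ 3 = -1 := by linear_combination (η + 1) * hη
  have hηn : ‖η‖ = 1 := by
    have : ‖η‖ ^ 3 = 1 := by rw [← norm_pow, hη3, norm_neg, norm_one]
    exact (pow_eq_one_iff_of_nonneg (norm_nonneg _) (by norm_num)).1 this
  have hηc : η * conj η = 1 := by rw [Complex.mul_conj, Complex.normSq_eq_norm_sq, hηn]; simp
  have hcc : c * conj c = 1 := by rw [Complex.mul_conj, Complex.normSq_eq_norm_sq, hc]; simp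
  have s1 := hU.symm_of_cubic_real hα hα3 hv hc hac
  have s2 := hU.symm_of_cubic_real hα hα3 hv (c := c * η) (by rw [norm_mul, hc, hηn, one_mul])
    (by rw [mul_pow, hη3, mul_neg_one, mul_neg, Complex.neg_im, hac, neg_zero])
  have hrot : ∀ z, U (η ^ 2 * z) = U z := fun z => by
    have e1 := s1 (conj (conj c * z))
    have e2 := s2 (conj (conj (c * η) * (η ^ 2 * z)))
    have f1 : c * (conj c * z) = z := by linear_combination z * hcc
    have f2 : c * η * (conj (c * η) * (η ^ 2 * z)) = η ^ 2 * z := by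
      rw [map_mul]; linear_combination (η * conj η * η ^ 2 * z) * hcc + η ^ 2 * z * hηc
    rw [Complex.conj_conj] at e1 e2
    rw [f1] at e1
    rw [f2] at e2
    rw [e1, e2]
    congr 1
    simp only [map_mul, Complex.conj_conj, map_pow]
    linear_combination (c * c * conj z) * (η * conj η + 1) * hηc
  have hsymm : ∀ c : ℂ, ‖c‖ = 1 → ∀ z, U (c * conj z) = U (c * z) := fun c hc z =>
    (hU.comp_mul hc).symm_of_rotation hα hα3 (ζ := η ^ 2)
      (by linear_combination (η ^ 2 + η + 1) * hη)
      (fun z => by rw [mul_left_comm, hrot]) z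
  rcases eq_or_ne z 0 with rfl | hz
  · rw [norm_zero, eq_comm, norm_eq_zero] at h
    rw [h]
  · obtain ⟨c, hc⟩ := IsAlgClosed.exists_pow_nat_eq (z' / conj z) (n := 2) two_pos
    have hcz : conj z ≠ 0 := by simpa using hz
    have hcn : ‖c‖ = 1 := by
      have : ‖c‖ ^ 2 = 1 := by
        rw [← norm_pow, hc, norm_div, Complex.norm_conj, h, div_self]
        exact h ▸ norm_ne_zero_iff.2 hz
      exact (pow_eq_one_iff_of_nonneg (norm_nonneg _) (by norm_num)).1 this
    have hcc : c * conj c = 1 := by rw [Complex.mul_conj, Complex.normSq_eq_norm_sq, hcn]; simp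
    have e1 := hsymm c hcn (conj c * z)
    rw [map_mul, Complex.conj_conj, show c * (conj c * z) = z by linear_combination z * hcc,
      ← mul_assoc, ← pow_two, hc, div_mul_cancel₀ _ hcz] at e1
    exact e1.symm

end PlaneSolution

end Radial

section Homogeneous

open Topology Filter Set

variable {u : E3 → ℝ}

theorem Hom0.fderiv_smul (hu : Hom0 u) {r : ℝ} (hr : 0 < r) (x : E3) :
    fderiv ℝ u x = r • fderiv ℝ u (r • x) := by
  rw [← fderiv_comp_smul]
  congr 1
  ext y
  exact (hu y r hr).symm

theorem Hom0.fderiv_fderiv_smul (hu : Hom0 u) {r : ℝ} (hr : 0 < r) (x : E3) :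
    fderiv ℝ (fderiv ℝ u) x = r ^ 2 • fderiv ℝ (fderiv ℝ u) (r • x) := by
  have h : fderiv ℝ u = r • fun y => fderiv ℝ u (r • y) := funext fun y => hu.fderiv_smul hr y
  have h2 : fderiv ℝ (fun y => fderiv ℝ u (r • y)) x = r • fderiv ℝ (fderiv ℝ u) (r • x) :=
    fderiv_comp_smul (f := fderiv ℝ u) r
  have h3 : fderiv ℝ (r • fun y => fderiv ℝ u (r • y)) x =
      r • fderiv ℝ (fun y => fderiv ℝ u (r • y)) x :=
    congrFun (fderiv_const_smul_field (𝕜 := ℝ) (f := fun y => fderiv ℝ u (r • y)) r) x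
  conv_lhs => rw [h]
  rw [h3, h2, smul_smul, pow_two]

theorem lap_eq_sum (u : E3 → ℝ) (x : E3) (b : OrthonormalBasis (Fin 3) ℝ E3) :
    lap u x = ∑ i, fderiv ℝ (fderiv ℝ u) x (b i) (b i) := by
  have h1 := congrFun (InnerProductSpace.laplacian_eq_iteratedFDeriv_orthonormalBasis u
    (EuclideanSpace.basisFun (Fin 3) ℝ)) x
  rw [InnerProductSpace.laplacian_eq_iteratedFDeriv_orthonormalBasis u b] at h1
  simp only [EuclideanSpace.basisFun_apply] at h1
  rw [lap, ← h1]
  simp [iteratedFDeriv_two_apply]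

theorem Hom0.lap_smul (hu : Hom0 u) {r : ℝ} (hr : 0 < r) (x : E3) :
    lap u x = r ^ 2 * lap u (r • x) := by
  rw [lap_eq_sum u x (EuclideanSpace.basisFun (Fin 3) ℝ),
    lap_eq_sum u (r • x) (EuclideanSpace.basisFun (Fin 3) ℝ), hu.fderiv_fderiv_smul hr,
    Finset.mul_sum]
  rfl

theorem contDiffAt_of_compl_zero (hs : ContDiffOn ℝ ∞ u {(0 : E3)}ᶜ) {x : E3} (hx : x ≠ 0) :
    ContDiffAt ℝ ∞ u x :=
  hs.contDiffAt (isOpen_compl_singleton.mem_nhds hx)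

theorem differentiableAt_fderiv_of_compl_zero (hs : ContDiffOn ℝ ∞ u {(0 : E3)}ᶜ) {x : E3}
    (hx : x ≠ 0) : DifferentiableAt ℝ (fderiv ℝ u) x :=
  ((contDiffAt_of_compl_zero hs hx).fderiv_right (m := 1)
    (by simpa [one_add_one_eq_two] using ENat.LEInfty.out)).differentiableAt (by simp)

theorem Hom0.fderiv_self (hu : Hom0 u) (hs : ContDiffOn ℝ ∞ u {(0 : E3)}ᶜ) {x : E3}
    (hx : x ≠ 0) : fderiv ℝ u x x = 0 := by
  have hd := (contDiffAt_of_compl_zero hs hx).differentiableAt (by simp)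
  have h1 : HasDerivAt (fun r : ℝ => r • x) x 1 := by
    simpa using (hasDerivAt_id (1 : ℝ)).smul_const x
  have h2 : HasFDerivAt u (fderiv ℝ u x) ((1 : ℝ) • x) := by rw [one_smul]; exact hd.hasFDerivAt
  have h3 := h2.comp_hasDerivAt (1 : ℝ) h1
  have h4 : HasDerivAt (u ∘ fun r : ℝ => r • x) 0 1 :=
    (hasDerivAt_const (1 : ℝ) (u x)).congr_of_eventuallyEq <| by
      filter_upwards [lt_mem_nhds one_pos] with r hr using hu x r hr
  exact h3.unique h4

theorem Hom0.fderiv_fderiv_self (hu : Hom0 u) (hs : ContDiffOn ℝ ∞ u {(0 : E3)}ᶜ) {x : E3}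
    (hx : x ≠ 0) (v : E3) : fderiv ℝ (fderiv ℝ u) x v x = -fderiv ℝ u x v := by
  have h1 := (differentiableAt_fderiv_of_compl_zero hs hx).hasFDerivAt.clm_apply (hasFDerivAt_id x)
  have h2 : HasFDerivAt (fun y => fderiv ℝ u y (id y)) (0 : E3 →L[ℝ] ℝ) x :=
    (hasFDerivAt_const (0 : ℝ) x).congr_of_eventuallyEq <| by
      filter_upwards [isOpen_compl_singleton.mem_nhds hx] with y hy using hu.fderiv_self hs hy
  have h3 := congrArg (fun L : E3 →L[ℝ] ℝ => L v) (h1.unique h2)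
  simp at h3
  linarith

end Homogeneous

section Stereographic

open Topology Filter Set

/-- Inverse stereographic projection from `-b 2`, scaled by `1 + |z|²`. -/
noncomputable def stereo (b : OrthonormalBasis (Fin 3) ℝ E3) (z : ℂ) : E3 :=
  (2 * z.re) • b 0 + (2 * z.im) • b 1 + (1 - Complex.normSq z) • b 2

/-- The derivative of `stereo b`. -/
noncomputable def stereoDeriv (b : OrthonormalBasis (Fin 3) ℝ E3) (z : ℂ) : ℂ →L[ℝ] E3 :=
  ((2 : ℝ) • Complex.reCLM).smulRight (b 0) + ((2 : ℝ) • Complex.imCLM).smulRight (b 1) -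
    ((2 : ℝ) • (z.re • Complex.reCLM + z.im • Complex.imCLM)).smulRight (b 2)

variable (b : OrthonormalBasis (Fin 3) ℝ E3) {u : E3 → ℝ} {α : ℝ}

theorem norm_sq_combination (x y t : ℝ) :
    ‖x • b 0 + y • b 1 + t • b 2‖ ^ 2 = x ^ 2 + y ^ 2 + t ^ 2 := by
  have h := b.sum_sq_norm_inner_right (x • b 0 + y • b 1 + t • b 2)
  rw [← h, Fin.sum_univ_three]
  have ho := b.orthonormal
  simp [inner_add_right, inner_smul_right, b.inner_eq_ite]

theorem stereoDeriv_apply (z e : ℂ) : stereoDeriv b z e =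
    (2 * e.re) • b 0 + (2 * e.im) • b 1 - (2 * (z.re * e.re + z.im * e.im)) • b 2 := by
  simp only [stereoDeriv, sub_apply, add_apply, ContinuousLinearMap.smulRight_apply, smul_apply,
    Complex.reCLM_apply, Complex.imCLM_apply, smul_eq_mul]

theorem contDiff_stereo : ContDiff ℝ ∞ (stereo b) := by
  have h1 : ContDiff ℝ ∞ fun z : ℂ => z.re := Complex.reCLM.contDiff
  have h2 : ContDiff ℝ ∞ fun z : ℂ => z.im := Complex.imCLM.contDiff
  have h3 := contDiff_normSq
  unfold stereo
  fun_prop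

theorem hasFDerivAt_normSq (z : ℂ) : HasFDerivAt (fun z : ℂ => Complex.normSq z)
    ((2 : ℝ) • (z.re • Complex.reCLM + z.im • Complex.imCLM)) z := by
  have h := (contDiff_normSq.diffAt z).hasFDerivAt
  refine h.congr_fderiv (ContinuousLinearMap.ext fun e => (dir_normSq e z).trans ?_)
  simp only [smul_apply, add_apply, Complex.reCLM_apply, Complex.imCLM_apply, smul_eq_mul]

theorem hasFDerivAt_stereo (z : ℂ) : HasFDerivAt (stereo b) (stereoDeriv b z) z := by
  have h1 : HasFDerivAt (fun z : ℂ => 2 * z.re) ((2 : ℝ) • Complex.reCLM) z :=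
    Complex.reCLM.hasFDerivAt.const_mul 2
  have h2 : HasFDerivAt (fun z : ℂ => 2 * z.im) ((2 : ℝ) • Complex.imCLM) z :=
    Complex.imCLM.hasFDerivAt.const_mul 2
  have h3 := (hasFDerivAt_normSq z).const_sub 1
  refine (((h1.smul_const (b 0)).add (h2.smul_const (b 1))).add
    (h3.smul_const (b 2))).congr_fderiv ?_
  ext e : 1
  simp only [stereoDeriv, sub_eq_add_neg, add_apply, neg_apply, ContinuousLinearMap.smulRight_apply,
    neg_smul]

theorem hasFDerivAt_stereoDeriv (z e : ℂ) : HasFDerivAt (fun z => stereoDeriv b z e)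
    (-((2 : ℝ) • (e.re • Complex.reCLM + e.im • Complex.imCLM)).smulRight (b 2)) z := by
  have h : HasFDerivAt (fun z : ℂ => 2 * (z.re * e.re + z.im * e.im))
      ((2 : ℝ) • (e.re • Complex.reCLM + e.im • Complex.imCLM)) z := by
    refine ((2 : ℝ) • (e.re • Complex.reCLM + e.im • Complex.imCLM)).hasFDerivAt.congr_of_eventuallyEq
      (Eventually.of_forall fun x => ?_)
    simp
    ring
  simp only [stereoDeriv_apply]
  exact (h.smul_const (b 2)).const_sub _

theorem norm_stereo (z : ℂ) : ‖stereo b z‖ = 1 + Complex.normSq z := by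
  have h0 := Complex.normSq_nonneg z
  refine (sq_eq_sq₀ (norm_nonneg _) (by positivity)).1 ?_
  rw [stereo, norm_sq_combination, Complex.normSq_apply]
  ring

theorem stereo_ne_zero (z : ℂ) : stereo b z ≠ 0 := by
  have h0 := Complex.normSq_nonneg z
  rw [← norm_pos_iff, norm_stereo]
  positivity

theorem dir_comp_stereo (hs : ContDiffOn ℝ ∞ u {(0 : E3)}ᶜ) (e : ℂ) :
    dir e (fun z => u (stereo b z)) = fun z => fderiv ℝ u (stereo b z) (stereoDeriv b z e) := by
  ext z
  have hd := (contDiffAt_of_compl_zero hs (stereo_ne_zero b z)).differentiableAt (by simp)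
  have := (hd.hasFDerivAt.comp z (hasFDerivAt_stereo b z)).fderiv
  simp only [dir]
  erw [this]
  rfl

theorem dir_dir_comp_stereo (hs : ContDiffOn ℝ ∞ u {(0 : E3)}ᶜ) (e z : ℂ) :
    dir e (dir e fun z => u (stereo b z)) z =
      fderiv ℝ (fderiv ℝ u) (stereo b z) (stereoDeriv b z e) (stereoDeriv b z e) -
        2 * Complex.normSq e * fderiv ℝ u (stereo b z) (b 2) := by
  rw [dir_comp_stereo b hs]
  have hd := (differentiableAt_fderiv_of_compl_zero hs (stereo_ne_zero b z)).hasFDerivAt.comp z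
    (hasFDerivAt_stereo b z)
  have := (hd.clm_apply (hasFDerivAt_stereoDeriv b z e)).fderiv
  simp only [dir]
  erw [this]
  simp [Complex.normSq_apply]
  ring

theorem flatLap_comp_stereo (hs : ContDiffOn ℝ ∞ u {(0 : E3)}ᶜ) (hu : Hom0 u) (z : ℂ) :
    flatLap (fun z => u (stereo b z)) z = 4 * lap u (stereo b z) := by
  have hne := stereo_ne_zero b z
  have hsymm := (contDiffAt_of_compl_zero hs hne).isSymmSndFDerivAt
    (by simpa using ENat.LEInfty.out)
  have h1 := hu.fderiv_fderiv_self hs hne (b 2)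
  show dir 1 (dir 1 _) z + dir Complex.I (dir Complex.I _) z = _
  rw [dir_dir_comp_stereo b hs, dir_dir_comp_stereo b hs, lap_eq_sum u _ b, Fin.sum_univ_three,
    stereoDeriv_apply, stereoDeriv_apply]
  generalize hB : fderiv ℝ (fderiv ℝ u) (stereo b z) = B at *
  generalize fderiv ℝ u (stereo b z) = D at *
  have s0 : B (b 0) (b 2) = B (b 2) (b 0) := hB ▸ hsymm (b 0) (b 2)
  have s1 : B (b 1) (b 2) = B (b 2) (b 1) := hB ▸ hsymm (b 1) (b 2)
  rw [stereo] at h1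
  simp only [map_add, map_sub, map_smul, add_apply, sub_apply, smul_apply, smul_eq_mul,
    Complex.normSq_apply, Complex.one_re,
    Complex.one_im, Complex.I_re, Complex.I_im] at h1 ⊢
  rw [s0, s1]
  linear_combination (-4) * h1

theorem comp_stereo_eq (hu : Hom0 u) (z : ℂ) :
    u (stereo b z) = u ((1 + Complex.normSq z)⁻¹ • stereo b z) := by
  have h0 := Complex.normSq_nonneg z
  exact (hu _ _ (by positivity)).symm

theorem tendsto_normalized_stereo :
    Tendsto (fun z => (1 + Complex.normSq z)⁻¹ • stereo b z) (cocompact ℂ) (𝓝 (-b 2)) := by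
  have hn : Tendsto (fun z : ℂ => 1 + Complex.normSq z) (cocompact ℂ) atTop := by
    simp only [Complex.normSq_eq_norm_sq]
    exact tendsto_atTop_add_const_left _ _ ((tendsto_pow_atTop two_ne_zero).comp
      (tendsto_norm_cocompact_atTop))
  have h4 : Tendsto (fun z : ℂ => √(4 * (1 + Complex.normSq z)⁻¹)) (cocompact ℂ) (𝓝 0) := by
    have := (hn.inv_tendsto_atTop.const_mul 4).sqrt
    simpa using this
  refine tendsto_iff_norm_sub_tendsto_zero.2 (h4.congr fun z => ?_)
  have h0 := Complex.normSq_nonneg z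
  rw [← Real.sqrt_sq (norm_nonneg _)]
  congr 1
  have hv : (1 + Complex.normSq z)⁻¹ • stereo b z - -b 2 =
      ((1 + Complex.normSq z)⁻¹ * (2 * z.re)) • b 0 + ((1 + Complex.normSq z)⁻¹ * (2 * z.im)) • b 1 +
        ((1 + Complex.normSq z)⁻¹ * (1 - Complex.normSq z) + 1) • b 2 := by
    rw [stereo]
    module
  rw [hv, norm_sq_combination]
  have hn := Complex.normSq_apply z
  field_simp
  linear_combination 4 * hn

theorem planeSolution_comp_stereo (h : MFE u α) : PlaneSolution (fun z => u (stereo b z)) α := by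
  obtain ⟨hs, hu, heq⟩ := h
  refine ⟨?_, fun z => ?_, u (-b 2), ?_⟩
  · exact contDiff_iff_contDiffAt.2 fun z =>
      (contDiffAt_of_compl_zero hs (stereo_ne_zero b z)).comp z (contDiff_stereo b).contDiffAt
  · have h0 := Complex.normSq_nonneg z
    have hr : 0 < (1 + Complex.normSq z)⁻¹ := by positivity
    have hmem : (1 + Complex.normSq z)⁻¹ • stereo b z ∈ S2 := by
      rw [S2, mem_sphere_zero_iff_norm, norm_smul, norm_stereo, Real.norm_of_nonneg hr.le,
        inv_mul_cancel₀ (by positivity)]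
    have := heq _ hmem
    rw [hu _ _ hr] at this
    rw [flatLap_comp_stereo b hs hu, hu.lap_smul hr, ← this, sphereDensity]
    field_simp
    ring
  · have hne : -b 2 ≠ 0 := neg_ne_zero.2 (b.orthonormal.ne_zero 2)
    refine ((contDiffAt_of_compl_zero hs hne).continuousAt.tendsto.comp
      (tendsto_normalized_stereo b)).congr fun z => (comp_stereo_eq b hu z).symm

theorem isUmbilical_comp_stereo (hs : ContDiffOn ℝ ∞ u {(0 : E3)}ᶜ)
    (h : UmbilicalCritical u (b 2)) : IsUmbilical fun z => u (stereo b z) := by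
  obtain ⟨h1, c, hc⟩ := h
  have h0 : stereo b 0 = b 2 := by simp [stereo]
  refine ⟨fun e => ?_, 4 * c, fun e => ?_⟩
  · rw [dir_comp_stereo b hs]
    beta_reduce
    rw [h0, h1]
    rfl
  · have hd : stereoDeriv b 0 e = (2 * e.re) • b 0 + (2 * e.im) • b 1 + (0 : ℝ) • b 2 := by
      simp [stereoDeriv_apply]
    have hv := hc (stereoDeriv b 0 e) (by
      rw [hd]; simp [inner_add_left, inner_smul_left, b.inner_eq_ite])
    rw [iteratedFDeriv_two_apply] at hv
    simp only [Matrix.cons_val_zero, Matrix.cons_val_one] at hv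
    rw [dir_dir_comp_stereo b hs, h0, h1, hv, hd, norm_sq_combination, Complex.normSq_apply]
    simp
    ring

theorem exists_stereo_eq {x : E3} (hx : x ∈ S2) (hne : ⟪x, b 2⟫ ≠ -1) : ∃ z : ℂ, ∃ r : ℝ, 0 < r ∧
    stereo b z = r • x ∧ ‖z‖ ^ 2 = (1 - ⟪x, b 2⟫) / (1 + ⟪x, b 2⟫) := by
  have hsum := b.sum_repr x
  rw [Fin.sum_univ_three] at hsum
  have ht : b.repr x 2 = ⟪x, b 2⟫ := by rw [b.repr_apply_apply, real_inner_comm]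
  rw [← ht] at hne ⊢
  have hxn : ‖x‖ ^ 2 = 1 := by rw [mem_sphere_zero_iff_norm.1 hx, one_pow]
  generalize b.repr x 0 = x₀ at *
  generalize b.repr x 1 = x₁ at *
  generalize b.repr x 2 = t at *
  have hsq : x₀ ^ 2 + x₁ ^ 2 + t ^ 2 = 1 := by rw [← norm_sq_combination b, hsum, hxn]
  have ht1 : 0 < 1 + t := by
    have : -1 ≤ t := by nlinarith [sq_nonneg x₀, sq_nonneg x₁]
    have := lt_of_le_of_ne this (Ne.symm hne)
    linarith
  have hn : Complex.normSq ⟨x₀ / (1 + t), x₁ / (1 + t)⟩ = (1 - t) / (1 + t) := by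
    rw [Complex.normSq_mk]
    field_simp
    linarith
  refine ⟨⟨x₀ / (1 + t), x₁ / (1 + t)⟩, 2 / (1 + t), by positivity, ?_, ?_⟩
  · rw [stereo, hn, ← hsum, smul_add, smul_add, smul_smul, smul_smul, smul_smul]
    congr 3
    · ring
    · ring
    · field_simp
      ring
  · rw [← Complex.normSq_eq_norm_sq, hn]

end Stereographic

theorem eq_neg_of_inner_eq_neg_one {x p : E3} (hx : x ∈ S2) (hp : p ∈ S2) (h : ⟪x, p⟫ = -1) :
    x = -p := by
  have h1 : ‖x‖ = 1 := mem_sphere_zero_iff_norm.1 hx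
  have h2 : ‖p‖ = 1 := mem_sphere_zero_iff_norm.1 hp
  have h3 := norm_add_sq_real x p
  rw [h, h1, h2] at h3
  have h4 : ‖x + p‖ = 0 := by nlinarith
  exact eq_neg_of_add_eq_zero_left (norm_eq_zero.1 h4)

theorem exists_orthonormalBasis_two_eq {p : E3} (hp : p ∈ S2) :
    ∃ b : OrthonormalBasis (Fin 3) ℝ E3, b 2 = p := by
  have hv : Orthonormal ℝ (({2} : Set (Fin 3)).domRestrict fun _ => p) := by
    refine ⟨fun _ => mem_sphere_zero_iff_norm.1 hp, fun i j hij => (hij ?_).elim⟩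
    exact Subsingleton.elim i j
  obtain ⟨b, hb⟩ := hv.exists_orthonormalBasis_extension_of_card_eq (by simp)
  exact ⟨b, hb 2 rfl⟩

theorem stmt0 (α : ℝ) (hα1 : 2 < α) (hα2 : α ≤ 3) (u : E3 → ℝ) (hu : MFE u α)
    (p : E3) (hp : p ∈ S2) (hump : UmbilicalCritical u p) :
    AxiallySymmetric u p := by
  obtain ⟨b, rfl⟩ := exists_orthonormalBasis_two_eq hp
  intro x hx y hy hxy
  by_cases h : ⟪x, b 2⟫ = -1
  · rw [eq_neg_of_inner_eq_neg_one hx hp h, eq_neg_of_inner_eq_neg_one hy hp (hxy ▸ h)]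
  · obtain ⟨z, r, hr, hz, hzn⟩ := exists_stereo_eq b hx h
    obtain ⟨z', r', hr', hz', hzn'⟩ := exists_stereo_eq b hy (hxy ▸ h)
    have hn : ‖z‖ = ‖z'‖ :=
      (sq_eq_sq₀ (norm_nonneg _) (norm_nonneg _)).1 (by rw [hzn, hzn', hxy])
    have key := (planeSolution_comp_stereo b hu).radial (by linarith) hα2
      (isUmbilical_comp_stereo b hu.1 hump) hn
    rwa [hz, hz', hu.2.1 _ _ hr, hu.2.1 _ _ hr'] at key
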